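/- Fix an integer d ≥ 2. For c = (c₀, …, c_{d−2}) ∈ ℂ^{d−1} let p_c(z) = z^d + Σ_{j=0}^{d−2} c_j z^j, and for a ∈ ℂ \ {0} let f_{a,c} : ℂ² → ℂ² be the Hénon map f_{a,c}(z,w) = (a·w + p_c(z), z). Then there exists an open set U ⊆ ℂ × ℂ^{d−1} containing {0} × ℂ^{d−1} such that for every (a,c) ∈ U with a ≠ 0 and every subfield L of ℂ that is finite-dimensional over ℚ (a number field), there exist a saddle periodic point of f_{a,c} whose unstable multiplier does not belong to L, and a saddle periodic point of f_{a,c} whose stable multiplier does not belong to L. -/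

import Mathlib

open Function Set Filter Topology

noncomputable section

/-- A polynomial map of `ℂ²`. -/
def IsPolyMap (F : ℂ × ℂ → ℂ × ℂ) : Prop :=
  ∃ P Q : MvPolynomial (Fin 2) ℂ, ∀ z : ℂ × ℂ,
    F z = (MvPolynomial.eval ![z.1, z.2] P, MvPolynomial.eval ![z.1, z.2] Q)

/-- A polynomial automorphism of `ℂ²`. -/
def IsPolyAuto (F : ℂ × ℂ → ℂ × ℂ) : Prop :=
  IsPolyMap F ∧ ∃ G : ℂ × ℂ → ℂ × ℂ, IsPolyMap G ∧
    (∀ z, G (F z) = z) ∧ (∀ z, F (G z) = z)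

/-- A generalized Hénon map. -/
def IsHenon (h : ℂ × ℂ → ℂ × ℂ) : Prop :=
  ∃ (p : Polynomial ℂ) (a : ℂ), a ≠ 0 ∧ 2 ≤ p.natDegree ∧
    ∀ z : ℂ × ℂ, h z = (Polynomial.eval z.1 p - a * z.2, z.1)

/-- A loxodromic automorphism of `ℂ²`. -/
def IsLoxodromic (f : ℂ × ℂ → ℂ × ℂ) : Prop :=
  IsPolyAuto f ∧
  ∃ (u uinv : ℂ × ℂ → ℂ × ℂ) (hs : List (ℂ × ℂ → ℂ × ℂ)),
    IsPolyAuto u ∧ (∀ z, uinv (u z) = z) ∧ (∀ z, u (uinv z) = z) ∧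
    hs ≠ [] ∧ (∀ h ∈ hs, IsHenon h) ∧
    ∀ z, f z = uinv (hs.foldr (fun h acc => h ∘ acc) id (u z))

/-- The set of points with bounded forward orbit. -/
def Kplus (f : ℂ × ℂ → ℂ × ℂ) : Set (ℂ × ℂ) :=
  {z | ∃ C : ℝ, ∀ n : ℕ, ‖f^[n] z‖ ≤ C}

/-- `lam` is an eigenvalue of the continuous linear map `T`. -/
def IsEigenvalue (T : (ℂ × ℂ) →L[ℂ] ℂ × ℂ) (lam : ℂ) : Prop :=
  ∃ v : ℂ × ℂ, v ≠ 0 ∧ T v = lam • v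

/-- `p` is a saddle periodic point of period `n` with stable multiplier `ls`
and unstable multiplier `lu`. -/
def IsSaddle (f : ℂ × ℂ → ℂ × ℂ) (p : ℂ × ℂ) (n : ℕ) (ls lu : ℂ) : Prop :=
  1 ≤ n ∧ f^[n] p = p ∧
  IsEigenvalue (fderiv ℂ (f^[n]) p) ls ∧ IsEigenvalue (fderiv ℂ (f^[n]) p) lu ∧
  ‖ls‖ < 1 ∧ 1 < ‖lu‖

/-- Coordinatewise complex conjugation `σ(x,y) = (x̄, ȳ)`. -/
def conjMap (z : ℂ × ℂ) : ℂ × ℂ := (starRingEnd ℂ z.1, starRingEnd ℂ z.2)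

/-- The open unit disk in `ℂ`. -/
def unitDisk : Set ℂ := Metric.ball 0 1

/-- `γ` is a transversal to `J⁺`. -/
def IsTransversal (f : ℂ × ℂ → ℂ × ℂ) (γ : ℂ → ℂ × ℂ) : Prop :=
  Set.InjOn γ unitDisk ∧ DifferentiableOn ℂ γ unitDisk ∧
  (∃ z ∈ unitDisk, γ z ∈ Kplus f) ∧ ¬ (∀ z ∈ unitDisk, γ z ∈ Kplus f)

/-- The Julia slice associated to a transversal. -/
def juliaSlice (f : ℂ × ℂ → ℂ × ℂ) (γ : ℂ → ℂ × ℂ) : Set ℂ :=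
  unitDisk ∩ frontier {z | z ∈ unitDisk ∧ γ z ∈ Kplus f}

/-- An unstable parametrization of a saddle periodic point. -/
def IsUnstableParam (f : ℂ × ℂ → ℂ × ℂ) (n : ℕ) (lu : ℂ) (p : ℂ × ℂ) (ψ : ℂ → ℂ × ℂ) : Prop :=
  Function.Injective ψ ∧ Differentiable ℂ ψ ∧ ψ 0 = p ∧
  ∀ ζ : ℂ, f^[n] (ψ ζ) = ψ (lu * ζ)

/-- `S` is contained in a proper real-analytic subvariety of `ℂ²`. -/
def ContainedInProperRealAnalyticSubvariety (S : Set (ℂ × ℂ)) : Prop :=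
  ∃ V : Set (ℂ × ℂ), IsClosed V ∧ V ≠ Set.univ ∧ S ⊆ V ∧
    ∀ x ∈ V, ∃ (U : Set (ℂ × ℂ)) (g : ℂ × ℂ → ℝ),
      IsOpen U ∧ x ∈ U ∧ (∀ y ∈ U, AnalyticAt ℝ g y) ∧
      (∃ y ∈ U, g y ≠ 0) ∧ ∀ y ∈ V ∩ U, g y = 0

/-- The polynomial `p_c(z) = z^d + Σ_{j=0}^{d-2} c_j z^j`. -/
def henonPoly (d : ℕ) (c : Fin (d - 1) → ℂ) (z : ℂ) : ℂ :=
  z ^ d + ∑ j : Fin (d - 1), c j * z ^ (j : ℕ)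

/-- The Hénon map `f_{a,c}(z,w) = (a·w + p_c(z), z)`. -/
def henonMap (d : ℕ) (a : ℂ) (c : Fin (d - 1) → ℂ) (zw : ℂ × ℂ) : ℂ × ℂ :=
  (a * zw.2 + henonPoly d c zw.1, zw.1)

section
namespace HenonML

/-- Height-type predicate: `x` is a nonzero `D`-unit of size at most `H`. -/
def HtP (K : Type) [Field K] (D : ℕ) (B : ℝ) (H : ℕ) (x : K) : Prop :=
  x ≠ 0 ∧ IsIntegral ℤ ((D : K) ^ H * x) ∧ IsIntegral ℤ ((D : K) ^ H * x⁻¹) ∧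
    ∀ σ : K →+* ℂ, ‖σ x‖ ≤ B ^ H ∧ ‖σ x⁻¹‖ ≤ B ^ H

section HtP
variable {K : Type} [Field K] {D : ℕ} {B : ℝ}

lemma HtP.inv {H : ℕ} {x : K} (h : HtP K D B H x) : HtP K D B H x⁻¹ := by
  obtain ⟨h0, h1, h2, h3⟩ := h
  refine ⟨inv_ne_zero h0, h2, by simpa using h1, fun σ => ⟨(h3 σ).2, by simpa using (h3 σ).1⟩⟩

lemma HtP.mul {H1 H2 : ℕ} {x y : K} (hB : 0 ≤ B) (h : HtP K D B H1 x) (h' : HtP K D B H2 y) :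
    HtP K D B (H1 + H2) (x * y) := by
  obtain ⟨h0, h1, h2, h3⟩ := h
  obtain ⟨h0', h1', h2', h3'⟩ := h'
  refine ⟨mul_ne_zero h0 h0', ?_, ?_, fun σ => ⟨?_, ?_⟩⟩
  · have := h1.mul h1'
    rwa [pow_add, mul_mul_mul_comm]
  · have := h2.mul h2'
    rwa [pow_add, mul_inv, mul_mul_mul_comm]
  · rw [map_mul, norm_mul, pow_add]
    exact mul_le_mul (h3 σ).1 (h3' σ).1 (norm_nonneg _) (by positivity)
  · rw [mul_inv, map_mul, norm_mul, pow_add]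
    exact mul_le_mul (h3 σ).2 (h3' σ).2 (norm_nonneg _) (by positivity)

lemma HtP.mono {H1 H2 : ℕ} {x : K} (hB : 1 ≤ B) (hH : H1 ≤ H2) (h : HtP K D B H1 x) :
    HtP K D B H2 x := by
  obtain ⟨h0, h1, h2, h3⟩ := h
  have hD : IsIntegral ℤ ((D : K) ^ (H2 - H1)) := by
    have : IsIntegral ℤ (D : K) := by simpa using (isIntegral_algebraMap (R := ℤ) (A := K) (x := (D : ℤ)))
    exact this.pow _
  have e : (D : K) ^ H2 = (D : K) ^ (H2 - H1) * (D : K) ^ H1 := by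
    rw [← pow_add]; congr 1; omega
  refine ⟨h0, ?_, ?_, fun σ => ⟨(h3 σ).1.trans (pow_le_pow_right₀ hB hH), (h3 σ).2.trans (pow_le_pow_right₀ hB hH)⟩⟩
  · rw [e, mul_assoc]; exact hD.mul h1
  · rw [e, mul_assoc]; exact hD.mul h2

lemma HtP.prod {ι : Type*} (hB : 1 ≤ B) (s : Finset ι) (x : ι → K) (H : ι → ℕ)
    (h : ∀ i ∈ s, HtP K D B (H i) (x i)) : HtP K D B (∑ i ∈ s, H i) (∏ i ∈ s, x i) := by
  classical
  induction s using Finset.induction_on with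
  | empty =>
    simp only [Finset.sum_empty, Finset.prod_empty]
    refine ⟨one_ne_zero, by simpa using isIntegral_one, by simpa using isIntegral_one, fun σ => by simp⟩
  | insert i s hi ih =>
    rw [Finset.sum_insert hi, Finset.prod_insert hi]
    exact (h i (by simp)).mul (by linarith) (ih fun j hj => h j (by simp [hj]))

end HtP

open NumberField in
/-- number of divisors of a power of an ideal -/
lemma divisors_count (K : Type) [Field K] [NumberField K] (I : Ideal (𝓞 K)) (hI : I ≠ ⊥) :
    ∃ (k : ℕ) (e : ℕ → Ideal (𝓞 K) → (Fin k → ℕ)), ∃ C : ℕ, ∀ n : ℕ,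
      Set.InjOn (e n) {J | J ∣ I ^ n} ∧ ∀ J, J ∣ I ^ n → ∀ i, e n J i ≤ C * n := by
  classical
  let s := UniqueFactorizationMonoid.normalizedFactors I
  let t := s.toFinset
  refine ⟨t.card, fun n J i => (UniqueFactorizationMonoid.normalizedFactors J).count (t.equivFin.symm i : Ideal (𝓞 K)),
    Multiset.card s, fun n => ⟨?_, ?_⟩⟩
  · intro J hJ J' hJ' h
    have hIn : I ^ n ≠ 0 := pow_ne_zero _ hI
    have key : ∀ J, J ∣ I ^ n → ∀ P, P ∉ t → (UniqueFactorizationMonoid.normalizedFactors J).count P = 0 := by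
      intro J hJ P hP
      rw [Multiset.count_eq_zero]
      intro hPJ
      have h1 := (UniqueFactorizationMonoid.dvd_iff_normalizedFactors_le_normalizedFactors
        (ne_zero_of_dvd_ne_zero hIn hJ) hIn).1 hJ
      have h2 := Multiset.mem_of_le h1 hPJ
      rw [UniqueFactorizationMonoid.normalizedFactors_pow] at h2
      exact hP (Multiset.mem_toFinset.2 (Multiset.mem_of_mem_nsmul h2))
    have e : UniqueFactorizationMonoid.normalizedFactors J = UniqueFactorizationMonoid.normalizedFactors J' := by
      ext P
      by_cases hP : P ∈ t
      · have := congrFun h (t.equivFin ⟨P, hP⟩)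
        simpa using this
      · rw [key J hJ P hP, key J' hJ' P hP]
    have h3 := (UniqueFactorizationMonoid.associated_iff_normalizedFactors_eq_normalizedFactors
      (ne_zero_of_dvd_ne_zero hIn hJ) (ne_zero_of_dvd_ne_zero hIn hJ')).2 e
    exact associated_iff_eq.1 h3
  · intro J hJ i
    have hIn : I ^ n ≠ 0 := pow_ne_zero _ hI
    have h1 := (UniqueFactorizationMonoid.dvd_iff_normalizedFactors_le_normalizedFactors
        (ne_zero_of_dvd_ne_zero hIn hJ) hIn).1 hJ
    refine (Multiset.count_le_of_le _ h1).trans ?_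
    rw [UniqueFactorizationMonoid.normalizedFactors_pow, Multiset.count_nsmul, mul_comm]
    exact Nat.mul_le_mul_right _ (Multiset.count_le_card _ _)

open NumberField in
/-- package an integral element -/
def mkO {K : Type} [Field K] (x : K) (h : IsIntegral ℤ x) : 𝓞 K := ⟨x, h⟩

open NumberField in
lemma mkO_coe {K : Type} [Field K] (x : K) (h : IsIntegral ℤ x) :
    algebraMap (𝓞 K) K (mkO x h) = x := rfl

open NumberField in
theorem count_HtP (K : Type) [Field K] [NumberField K] (D : ℕ) (hD : 1 ≤ D) (B : ℝ) (hB : 1 ≤ B) :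
    ∃ C k : ℕ, ∀ H : ℕ, ∀ s : Finset K, (∀ x ∈ s, HtP K D B H x) → s.card ≤ C * (H + 1) ^ k := by
  classical
  have hDK : (D : K) ≠ 0 := by exact_mod_cast (by omega : D ≠ 0)
  let I : Ideal (𝓞 K) := Ideal.span {(D : 𝓞 K) ^ 2}
  have hDO : (D : 𝓞 K) ≠ 0 := by exact_mod_cast (by omega : D ≠ 0)
  have hI : I ≠ ⊥ := by
    simp only [I, ne_eq, Ideal.span_singleton_eq_bot]; exact pow_ne_zero _ hDO
  obtain ⟨k, e, C1, he⟩ := divisors_count K I hI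
  obtain ⟨b, hb⟩ := exists_nat_ge (Real.log B)
  have hlB : 0 ≤ Real.log B := Real.log_nonneg hB
  have hfin := NumberField.Embeddings.finite_of_norm_le K ℂ (Real.exp 1)
  set C0 := hfin.toFinset.card with hC0
  -- the key map
  let J : ℕ → K → Ideal (𝓞 K) := fun H x =>
    if h : IsIntegral ℤ ((D : K) ^ H * x) then Ideal.span {mkO _ h} else ⊥
  let F : ℕ → K → (Fin k → ℕ) × ((K →+* ℂ) → ℤ) := fun H x =>
    (e H (J H x), fun σ => ⌊Real.log ‖σ x‖⌋)
  have hJdvd : ∀ H x, HtP K D B H x → J H x ∣ I ^ H := by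
    intro H x ⟨h0, h1, h2, h3⟩
    simp only [J, dif_pos h1, I, Ideal.span_singleton_pow, Ideal.dvd_iff_le, Ideal.span_singleton_le_span_singleton]
    refine ⟨mkO _ h2, ?_⟩
    ext
    simp only [map_mul, map_pow, mkO_coe]
    have : (algebraMap (𝓞 K) K) (D : 𝓞 K) = (D : K) := by simp
    rw [this]
    field_simp
    ring
  let T : ℕ → Finset ((Fin k → ℕ) × ((K →+* ℂ) → ℤ)) := fun H =>
    (Fintype.piFinset fun _ => Finset.range (C1 * H + 1)) ×ˢ
      (Fintype.piFinset fun _ => Finset.Icc (-(b * H : ℤ)) (b * H))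
  have hmaps : ∀ H x, HtP K D B H x → F H x ∈ T H := by
    intro H x hx
    have h4 := (he H).2 _ (hJdvd H x hx)
    obtain ⟨h0, h1, h2, h3⟩ := hx
    simp only [T, F, Finset.mem_product, Fintype.mem_piFinset, Finset.mem_range, Finset.mem_Icc]
    refine ⟨fun i => by have := h4 i; omega, fun σ => ?_⟩
    have hpos : 0 < ‖σ x‖ := by simpa using h0
    have h5 : Real.log ‖σ x‖ ≤ H * Real.log B := by
      rw [← Real.log_pow]; exact Real.log_le_log hpos (h3 σ).1
    have h6 : - Real.log ‖σ x‖ ≤ H * Real.log B := by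
      rw [← Real.log_pow, ← Real.log_inv]
      have := (h3 σ).2
      rw [map_inv₀, norm_inv] at this
      exact Real.log_le_log (inv_pos.2 hpos) this
    have h7 : (H : ℝ) * Real.log B ≤ b * H := by
      rw [mul_comm]; exact mul_le_mul_of_nonneg_right hb (by positivity)
    constructor
    · rw [Int.le_floor]; push_cast; linarith
    · have : (⌊Real.log ‖σ x‖⌋ : ℝ) ≤ ((b * H : ℤ) : ℝ) := by
        push_cast; exact (Int.floor_le _).trans (by linarith)
      exact_mod_cast this
  have hfib : ∀ H x y, HtP K D B H x → HtP K D B H y → F H x = F H y →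
      y / x ∈ hfin.toFinset := by
    intro H x y hx hy hxy
    have hJ : J H x = J H y := (he H).1 (hJdvd H x hx) (hJdvd H y hy) (congrArg Prod.fst hxy)
    have hl := fun σ => congrFun (congrArg Prod.snd hxy) σ
    obtain ⟨h0, h1, h2, h3⟩ := hx
    obtain ⟨h0', h1', h2', h3'⟩ := hy
    simp only [J, dif_pos h1, dif_pos h1'] at hJ
    rw [Ideal.span_singleton_eq_span_singleton] at hJ
    obtain ⟨u, hu⟩ := hJ
    have hu' : (D : K) ^ H * x * (u : 𝓞 K) = (D : K) ^ H * y := by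
      have := congrArg (algebraMap (𝓞 K) K) hu
      simpa [mkO_coe] using this
    have hyx : y / x = ((u : 𝓞 K) : K) := by
      have hDH : (D : K) ^ H ≠ 0 := pow_ne_zero _ hDK
      rw [div_eq_iff h0]
      apply mul_left_cancel₀ hDH
      rw [← hu']; ring
    rw [Set.Finite.mem_toFinset]
    refine ⟨by rw [hyx]; exact RingOfIntegers.isIntegral_coe _, fun σ => ?_⟩
    have hpos : 0 < ‖σ x‖ := by simpa using h0
    have hpos' : 0 < ‖σ y‖ := by simpa using h0'
    have h8 := hl σ
    simp only [F] at h8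
    have h9 : Real.log ‖σ y‖ < ⌊Real.log ‖σ x‖⌋ + 1 := by rw [h8]; exact Int.lt_floor_add_one _
    have h10 := Int.floor_le (Real.log ‖σ x‖)
    rw [map_div₀, norm_div, ← Real.log_le_iff_le_exp (by positivity), Real.log_div hpos'.ne' hpos.ne']
    linarith
  refine ⟨C0 * ((C1 + 1) ^ k * (2 * b + 1) ^ (Fintype.card (K →+* ℂ))), k + Fintype.card (K →+* ℂ), fun H s hs => ?_⟩
  have h1 : s.card ≤ C0 * (T H).card := by
    apply Finset.card_le_mul_card_image_of_maps_to (f := F H) (fun x hx => hmaps H x (hs x hx))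
    intro y hy
    rcases (s.filter fun x => F H x = y).eq_empty_or_nonempty with h | ⟨x, hx⟩
    · rw [h]; simp
    · rw [Finset.mem_filter] at hx
      apply Finset.card_le_card_of_injOn (fun z => z / x)
      · intro z hz
        rw [Finset.mem_coe, Finset.mem_filter] at hz
        exact hfib H x z (hs x hx.1) (hs z hz.1) (by rw [hx.2, hz.2])
      · intro z _ z' _ h
        exact (div_left_inj' (hs x hx.1).1).1 h
  refine h1.trans ?_
  rw [mul_assoc]
  apply Nat.mul_le_mul_left
  simp only [T, Finset.card_product, Fintype.card_piFinset, Finset.card_range, Int.card_Icc,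
    Finset.prod_const, Finset.card_univ, Fintype.card_fin]
  rw [pow_add, mul_mul_mul_comm, ← mul_pow, ← mul_pow]
  apply Nat.mul_le_mul
  · apply Nat.pow_le_pow_left; nlinarith
  · apply Nat.pow_le_pow_left
    have : ((b : ℤ) * H + 1 - -(b * H)).toNat = 2 * (b * H) + 1 := by
      have : ((b : ℤ) * H + 1 - -(b * H)) = ((2 * (b * H) + 1 : ℕ) : ℤ) := by push_cast; ring
      rw [this, Int.toNat_natCast]
    rw [this]; nlinarith

end HenonML
end

section
namespace HenonML

/-- tails of dominated products are close to one -/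
lemma tail_prod_bound (x : ℕ → ℂ) (hx : ∀ j, ‖x (j + 1)‖ ≤ ‖x j‖ / 10) (h0 : ‖x 0‖ ≤ 1 / 10)
    (j0 : ℕ) (s : Finset ℕ) (hs : ∀ j ∈ s, j0 < j) :
    ‖∏ j ∈ s, (1 + x j) - 1‖ ≤ ‖x j0‖ / 4 := by
  have hle : ∀ j i, ‖x (j + i)‖ ≤ ‖x j‖ * (1 / 10) ^ i := by
    intro j i
    induction i with
    | zero => simp
    | succ i ih =>
      have := hx (j + i)
      rw [← add_assoc, pow_succ]; nlinarith
  have hb : ‖x j0‖ ≤ 1 / 10 := by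
    have := hle 0 j0
    simp only [zero_add] at this
    have h1 : (1 / 10 : ℝ) ^ j0 ≤ 1 := pow_le_one₀ (by norm_num) (by norm_num)
    nlinarith [norm_nonneg (x 0)]
  have hsum : ∑ j ∈ s, ‖x j‖ ≤ ‖x j0‖ / 9 := by
    have h1 : ∀ j ∈ s, ‖x j‖ ≤ ‖x j0‖ / 10 * (1 / 10) ^ (j - (j0 + 1)) := by
      intro j hj
      have := hle j0 (j - j0)
      have hj' := hs j hj
      rw [show j0 + (j - j0) = j by omega] at this
      rw [show j - j0 = (j - (j0 + 1)) + 1 by omega, pow_succ] at this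
      linarith
    refine (Finset.sum_le_sum h1).trans ?_
    rw [← Finset.mul_sum]
    have h2 : ∑ j ∈ s, (1 / 10 : ℝ) ^ (j - (j0 + 1)) = ∑ i ∈ s.image (fun j => j - (j0 + 1)), (1 / 10 : ℝ) ^ i := by
      rw [Finset.sum_image]
      intro a ha b hb h
      have := hs a ha
      have := hs b hb
      simp only at h
      omega
    have h3 : ∑ i ∈ s.image (fun j => j - (j0 + 1)), (1 / 10 : ℝ) ^ i ≤ (1 - 1 / 10)⁻¹ := by
      rw [← tsum_geometric_of_lt_one (by norm_num) (by norm_num)]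
      exact (summable_geometric_of_lt_one (by norm_num) (by norm_num)).sum_le_tsum _ (fun _ _ => by positivity)
    rw [h2]
    have := mul_le_mul_of_nonneg_left h3 (by positivity : 0 ≤ ‖x j0‖ / 10)
    refine this.trans (le_of_eq ?_)
    norm_num; ring
  have h4 := Finset.norm_prod_one_add_sub_one_le s x
  refine h4.trans ?_
  set t := ∑ j ∈ s, ‖x j‖
  have ht : 0 ≤ t := Finset.sum_nonneg fun _ _ => norm_nonneg _
  have h5 : Real.exp t ≤ 1 + 2 * t := by
    have := Real.abs_exp_sub_one_le (x := t) (by rw [abs_of_nonneg ht]; linarith)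
    rw [abs_of_nonneg ht] at this
    have := (abs_le.1 this).2
    linarith
  linarith

lemma dominated_prod_injective (x : ℕ → ℂ) (hx : ∀ j, ‖x (j + 1)‖ ≤ ‖x j‖ / 10)
    (h0 : ‖x 0‖ ≤ 1 / 10) (hne : ∀ j, x j ≠ 0) :
    Function.Injective (fun s : Finset ℕ => ∏ j ∈ s, (1 + x j)) := by
  classical
  have hb : ∀ j, ‖x j‖ ≤ 1 / 10 := by
    intro j
    induction j with
    | zero => exact h0
    | succ j ih => have := hx j; linarith [norm_nonneg (x j)]
  have hne1 : ∀ j, 1 + x j ≠ 0 := by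
    intro j h
    have : x j = -1 := by linear_combination h
    have h2 := hb j
    rw [this] at h2; norm_num at h2
  -- main asymmetric claim
  have key : ∀ (s t : Finset ℕ) (j0 : ℕ), j0 ∈ s → j0 ∉ t →
      (∀ j < j0, (j ∈ s ↔ j ∈ t)) → ∏ j ∈ s, (1 + x j) ≠ ∏ j ∈ t, (1 + x j) := by
    intro s t j0 hs ht hlt h
    have es : ∏ j ∈ s, (1 + x j) = (∏ j ∈ s.filter (· < j0), (1 + x j)) * ((1 + x j0) * ∏ j ∈ s.filter (j0 < ·), (1 + x j)) := by
      rw [← Finset.prod_filter_mul_prod_filter_not s (· < j0)]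
      congr 1
      have : s.filter (fun j => ¬ j < j0) = insert j0 (s.filter (j0 < ·)) := by
        ext j; simp only [Finset.mem_filter, Finset.mem_insert]
        constructor
        · rintro ⟨h1, h2⟩
          rcases Nat.lt_or_ge j0 j with h | h
          · exact Or.inr ⟨h1, h⟩
          · left; omega
        · rintro (rfl | ⟨h1, h2⟩)
          · exact ⟨hs, lt_irrefl _⟩
          · exact ⟨h1, by omega⟩
      rw [this, Finset.prod_insert (by simp)]
    have et : ∏ j ∈ t, (1 + x j) = (∏ j ∈ s.filter (· < j0), (1 + x j)) * ∏ j ∈ t.filter (j0 < ·), (1 + x j) := by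
      rw [← Finset.prod_filter_mul_prod_filter_not t (· < j0)]
      congr 1
      · apply Finset.prod_congr _ fun _ _ => rfl
        ext j; simp only [Finset.mem_filter]
        constructor
        · rintro ⟨h1, h2⟩; exact ⟨(hlt j h2).2 h1, h2⟩
        · rintro ⟨h1, h2⟩; exact ⟨(hlt j h2).1 h1, h2⟩
      · apply Finset.prod_congr _ fun _ _ => rfl
        ext j; simp only [Finset.mem_filter]
        constructor
        · rintro ⟨h1, h2⟩
          refine ⟨h1, ?_⟩
          rcases Nat.lt_or_ge j0 j with h | h
          · exact h
          · exfalso; have : j = j0 := by omega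
            exact ht (this ▸ h1)
        · rintro ⟨h1, h2⟩; exact ⟨h1, by omega⟩
    rw [es, et] at h
    have hP : (∏ j ∈ s.filter (· < j0), (1 + x j)) ≠ 0 := Finset.prod_ne_zero_iff.2 fun j _ => hne1 j
    have h1 := mul_left_cancel₀ hP h
    have b1 := tail_prod_bound x hx h0 j0 (s.filter (j0 < ·)) (by simp)
    have b2 := tail_prod_bound x hx h0 j0 (t.filter (j0 < ·)) (by simp)
    set S := ∏ j ∈ s.filter (j0 < ·), (1 + x j)
    set T := ∏ j ∈ t.filter (j0 < ·), (1 + x j)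
    have h2 : x j0 = (T - 1) - (S - 1) - x j0 * (S - 1) := by linear_combination h1
    have h3 : ‖x j0‖ ≤ ‖T - 1‖ + ‖S - 1‖ + ‖x j0‖ * ‖S - 1‖ := by
      calc ‖x j0‖ = ‖(T - 1) - (S - 1) - x j0 * (S - 1)‖ := by rw [← h2]
        _ ≤ ‖(T - 1) - (S - 1)‖ + ‖x j0 * (S - 1)‖ := norm_sub_le _ _
        _ ≤ _ := by rw [norm_mul]; gcongr; exact norm_sub_le _ _
    have h4 : 0 < ‖x j0‖ := norm_pos_iff.2 (hne j0)
    have h5 := hb j0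
    nlinarith
  intro s t hst
  by_contra hne'
  have hd : (symmDiff s t).Nonempty := by
    rw [Finset.nonempty_iff_ne_empty]
    intro h
    exact hne' (symmDiff_eq_bot.1 h)
  set j0 := (symmDiff s t).min' hd
  have hj0 := Finset.min'_mem _ hd
  have hlt : ∀ j < j0, (j ∈ s ↔ j ∈ t) := by
    intro j hj
    have : j ∉ symmDiff s t := fun h => absurd (Finset.min'_le _ _ h) (by omega)
    rw [Finset.mem_symmDiff] at this
    tauto
  rw [Finset.mem_symmDiff] at hj0
  rcases hj0 with ⟨h1, h2⟩ | ⟨h1, h2⟩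
  · exact key s t j0 h1 h2 hlt hst
  · exact key t s j0 h1 h2 (fun j hj => (hlt j hj).symm) hst.symm

lemma pow_beats (C k c : ℕ) : ∃ J0 : ℕ, ∀ J ≥ J0, C * (c * (J + 1) ^ 2 + 1) ^ k < 2 ^ J := by
  have h : Tendsto (fun J : ℕ => ((C * (c + 1) ^ k * 4 ^ k : ℕ) : ℝ) * ((J : ℝ) ^ (2 * k) / 2 ^ J)) atTop (𝓝 0) := by
    have := tendsto_pow_const_div_const_pow_of_one_lt (2 * k) (by norm_num : (1 : ℝ) < 2)
    simpa using this.const_mul ((C * (c + 1) ^ k * 4 ^ k : ℕ) : ℝ)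
  obtain ⟨J0, hJ0⟩ := eventually_atTop.1 (h.eventually_lt_const (by norm_num : (0 : ℝ) < 1))
  refine ⟨J0 + 1, fun J hJ => ?_⟩
  have h1 := hJ0 J (by omega)
  rw [← mul_div_assoc, div_lt_one (by positivity)] at h1
  have h2 : C * (c + 1) ^ k * 4 ^ k * J ^ (2 * k) < 2 ^ J := by exact_mod_cast h1
  refine lt_of_le_of_lt ?_ h2
  rw [mul_assoc, mul_assoc]
  apply Nat.mul_le_mul_left
  rw [pow_mul, ← mul_pow, ← mul_pow]
  apply Nat.pow_le_pow_left
  have hJ1 : 1 ≤ J := by omega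
  nlinarith [Nat.mul_le_mul_left c (show (J+1)^2 ≤ 4 * J^2 by nlinarith)]

theorem no_geom (K : Type) [Field K] [NumberField K] (i : K →+* ℂ) (D : ℕ) (hD : 1 ≤ D) (B : ℝ)
    (hB : 1 ≤ B) (S : ℕ → K) (l0 : ℕ) (hS : ∀ l ≥ l0, HtP K D B l (S l)) (γ κ θ : ℂ)
    (hγ : γ ≠ 0) (hκ : κ ≠ 0) (hθ : θ ≠ 0) (hθ1 : ‖θ‖ < 1)
    (hlim : Tendsto (fun l => (i (S l) / γ - 1) / θ ^ l) atTop (𝓝 κ)) : False := by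
  classical
  obtain ⟨M, hM⟩ := exists_pow_lt_of_lt_one (by norm_num : (0 : ℝ) < 1 / 20) hθ1
  have hM0 : 0 < M := by
    rcases Nat.eq_zero_or_pos M with h | h
    · rw [h] at hM; norm_num at hM
    · exact h
  obtain ⟨y, hy⟩ : ∃ y : ℕ → ℂ, ∀ l, y l = i (S l) / γ - 1 := ⟨_, fun _ => rfl⟩
  simp_rw [← hy] at hlim
  have hSy : ∀ l, i (S l) = γ * (1 + y l) := fun l => by rw [hy]; field_simp; ring
  have hyz : Tendsto y atTop (𝓝 0) := by
    have h1 := hlim.mul (tendsto_pow_atTop_nhds_zero_of_norm_lt_one hθ1)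
    rw [mul_zero] at h1
    refine h1.congr fun l => ?_
    rw [div_mul_cancel₀ _ (pow_ne_zero _ hθ)]
  -- the ratios
  let ρ : ℕ → K := fun l => S (M * (l + 1)) * (S (M * l))⁻¹
  have hMl : Tendsto (fun l : ℕ => M * l) atTop atTop := tendsto_id.const_mul_atTop' hM0
  have hMl1 : Tendsto (fun l : ℕ => M * (l + 1)) atTop atTop := hMl.comp (tendsto_add_atTop_nat 1)
  let x : ℕ → ℂ := fun l => (y (M * (l + 1)) - y (M * l)) / (1 + y (M * l))
  have hθM : θ ^ M ≠ 1 := by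
    intro h
    have : ‖θ‖ ^ M = 1 := by rw [← norm_pow, h, norm_one]
    linarith
  have hxl : Tendsto (fun l => x l / (θ ^ M) ^ l) atTop (𝓝 (κ * (θ ^ M - 1))) := by
    have h1 := hlim.comp hMl1
    have h2 := hlim.comp hMl
    have h3 := ((hyz.comp hMl).const_add 1)
    have h4 := ((h1.mul_const (θ ^ M)).sub h2).div h3 (by norm_num)
    have : (κ * θ ^ M - κ) / (1 + 0) = κ * (θ ^ M - 1) := by ring
    rw [this] at h4
    refine h4.congr fun l => ?_
    simp only [Function.comp, x, Pi.div_apply, Pi.sub_apply]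
    have e1 : θ ^ (M * (l + 1)) = (θ ^ M) ^ l * θ ^ M := by rw [mul_add, pow_add, pow_mul, mul_one]
    have e2 : θ ^ (M * l) = (θ ^ M) ^ l := pow_mul _ _ _
    rw [e1, e2]
    have h5 : (θ ^ M) ^ l ≠ 0 := pow_ne_zero _ (pow_ne_zero _ hθ)
    have h6 : θ ^ M ≠ 0 := pow_ne_zero _ hθ
    rw [div_mul_eq_mul_div, mul_div_mul_right _ _ h6, ← sub_div, div_div, div_div, mul_comm ((θ ^ M) ^ l)]
  have hk : κ * (θ ^ M - 1) ≠ 0 := mul_ne_zero hκ (sub_ne_zero.2 hθM)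
  have hxne : ∀ᶠ l in atTop, x l ≠ 0 := by
    filter_upwards [hxl.eventually_ne hk] with l hl h
    rw [h, zero_div] at hl; exact hl rfl
  have hxr : Tendsto (fun l => x (l + 1) / x l) atTop (𝓝 (θ ^ M)) := by
    have h1 := ((hxl.comp (tendsto_add_atTop_nat 1)).div hxl hk).mul_const (θ ^ M)
    rw [div_self hk, one_mul] at h1
    refine h1.congr' ?_
    filter_upwards [hxne] with l hl
    simp only [Function.comp, Pi.div_apply]
    have h5 : (θ ^ M) ^ l ≠ 0 := pow_ne_zero _ (pow_ne_zero _ hθ)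
    have h6 : θ ^ M ≠ 0 := pow_ne_zero _ hθ
    rw [pow_succ]
    field_simp
  have hxz : Tendsto x atTop (𝓝 0) := by
    have h3 := ((hyz.comp hMl).const_add 1)
    have := ((hyz.comp hMl1).sub (hyz.comp hMl)).div h3 (by norm_num)
    simp only [sub_zero, zero_div] at this
    exact this.congr fun l => rfl
  have e1 : ∀ᶠ l in atTop, ‖x (l + 1)‖ ≤ ‖x l‖ / 10 := by
    have h1 : ∀ᶠ l in atTop, ‖x (l + 1) / x l‖ < 1 / 20 :=
      hxr.norm.eventually_lt_const (by rw [norm_pow]; exact hM)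
    filter_upwards [h1, hxne] with l hl hne
    rw [norm_div, div_lt_iff₀ (norm_pos_iff.2 hne)] at hl
    linarith [norm_nonneg (x l)]
  have e2 : ∀ᶠ l in atTop, ‖x l‖ ≤ 1 / 10 := by
    have := hxz.norm.eventually_lt_const (show ‖(0 : ℂ)‖ < 1 / 10 by norm_num)
    filter_upwards [this] with l hl using hl.le
  have e3 : ∀ᶠ l in atTop, ‖y (M * l)‖ < 1 :=
    (hyz.comp hMl).norm.eventually_lt_const (by norm_num)
  obtain ⟨l1, hl1⟩ := eventually_atTop.1 (((e1.and e2).and (e3.and hxne)).and (hMl.eventually_ge_atTop l0))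
  -- count
  obtain ⟨C, k, hC⟩ := count_HtP K D hD B hB
  obtain ⟨J0, hJ0⟩ := pow_beats C k (M * (2 * (l1 + 1)))
  set J := max J0 1
  have hρ : ∀ j, HtP K D B (M * (2 * (l1 + 1) * (j + 1))) (ρ (l1 + j)) := by
    intro j
    have h1 := hS (M * (l1 + j)) (hl1 _ (by omega)).2
    have h2 := hS (M * (l1 + j + 1)) (hl1 (l1 + j + 1) (by omega)).2
    refine (h2.mul (by linarith) h1.inv).mono hB ?_
    rw [← mul_add]; apply Nat.mul_le_mul_left; nlinarith
  have hiρ : ∀ j, i (ρ (l1 + j)) = 1 + x (l1 + j) := by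
    intro j
    have h1 : 1 + y (M * (l1 + j)) ≠ 0 := by
      intro h
      have h2 := (hl1 (l1 + j) (by omega)).1.2.1
      rw [show y (M * (l1 + j)) = -1 by linear_combination h] at h2
      norm_num at h2
    simp only [ρ, x, map_mul, map_inv₀, hSy]
    field_simp
    ring
  have hinj := dominated_prod_injective (fun j => x (l1 + j)) (fun j => (hl1 (l1 + j) (by omega)).1.1.1)
    (hl1 (l1 + 0) (by omega)).1.1.2 (fun j => (hl1 (l1 + j) (by omega)).1.2.2)
  have hinj' : Function.Injective (fun s : Finset ℕ => ∏ j ∈ s, ρ (l1 + j)) := by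
    intro s t hst
    apply hinj
    have := congrArg i hst
    simpa only [map_prod, hiρ] using this
  have h1 := hC (M * (2 * (l1 + 1)) * (J + 1) ^ 2) ((Finset.range J).powerset.image (fun s : Finset ℕ => ∏ j ∈ s, ρ (l1 + j))) (by
    intro z hz
    obtain ⟨s, hs, rfl⟩ := Finset.mem_image.1 hz
    refine (HtP.prod hB s _ _ (fun j _ => hρ j)).mono hB ?_
    have hs' := Finset.mem_powerset.1 hs
    calc ∑ j ∈ s, M * (2 * (l1 + 1) * (j + 1)) ≤ ∑ j ∈ Finset.range J, M * (2 * (l1 + 1) * (j + 1)) :=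
          Finset.sum_le_sum_of_subset hs'
      _ ≤ ∑ j ∈ Finset.range J, M * (2 * (l1 + 1) * (J + 1)) := by
          apply Finset.sum_le_sum; intro j hj
          have := Finset.mem_range.1 hj
          gcongr
      _ = J * (M * (2 * (l1 + 1) * (J + 1))) := by simp
      _ ≤ M * (2 * (l1 + 1)) * (J + 1) ^ 2 := by
          have : M * (2 * (l1 + 1)) * (J + 1) ^ 2 = (J + 1) * (M * (2 * (l1 + 1) * (J + 1))) := by ring
          rw [this]; exact Nat.mul_le_mul_right _ (by omega))
  rw [Finset.card_image_of_injective _ hinj', Finset.card_powerset, Finset.card_range] at h1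
  have h2 := hJ0 J (le_max_left _ _)
  omega

end HenonML
end

section
namespace HenonML

/-- derivative of `henonPoly` -/
def hpD (d : ℕ) (c : Fin (d - 1) → ℂ) (z : ℂ) : ℂ :=
  d * z ^ (d - 1) + ∑ j : Fin (d - 1), c j * (((j : ℕ) : ℂ) * z ^ ((j : ℕ) - 1))

/-- algebraic description of the multipliers -/
def MultChain (d : ℕ) (a : ℂ) (c : Fin (d - 1) → ℂ) (n : ℕ) (μ : ℂ) : Prop :=
  1 ≤ n ∧ ∃ z w : ℕ → ℂ, (∀ i, z (i + 2) = a * z i + henonPoly d c (z (i + 1))) ∧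
    (∀ i, z (i + n) = z i) ∧ (∀ i, w (i + 2) = a * w i + hpD d c (z (i + 1)) * w (i + 1)) ∧
    (∀ i, w (i + n) = μ * w i) ∧ (w 0 ≠ 0 ∨ w 1 ≠ 0)

lemma MultChain.map {d : ℕ} {a : ℂ} {c : Fin (d - 1) → ℂ} {n : ℕ} {μ : ℂ} (h : MultChain d a c n μ)
    (τ : ℂ →+* ℂ) : MultChain d (τ a) (fun j => τ (c j)) n (τ μ) := by
  obtain ⟨hn, z, w, h1, h2, h3, h4, h5⟩ := h
  refine ⟨hn, fun i => τ (z i), fun i => τ (w i), fun i => ?_, fun i => ?_, fun i => ?_, fun i => ?_, ?_⟩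
  · simp only [h1 i, henonPoly, map_add, map_mul, map_pow, map_sum]
  · simp only [h2 i]
  · simp only [h3 i, hpD, map_add, map_mul, map_pow, map_sum, map_natCast]
  · simp only [h4 i, map_mul]
  · simpa using h5

section val
variable {Γ₀ : Type*} [LinearOrderedCommGroupWithZero Γ₀] (v : Valuation ℂ Γ₀)

lemma val_natCast_le (n : ℕ) : v (n : ℂ) ≤ 1 := by
  have h : (n : ℂ) ∈ v.integer := by
    exact natCast_mem v.integer n
  exact h

lemma MultChain.val_le {d : ℕ} (hd : 2 ≤ d) {a : ℂ} {c : Fin (d - 1) → ℂ} {n : ℕ} {μ : ℂ}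
    (h : MultChain d a c n μ) (ha : a ≠ 0) {A : Γ₀} (hA : 1 ≤ A) (h1 : v a ≤ A) (h2 : v a⁻¹ ≤ A)
    (h3 : ∀ j, v (c j) ≤ A) : v μ ≤ A ^ (d * n) ∧ v μ⁻¹ ≤ A ^ (d * n) := by
  obtain ⟨hn, z, w, hz, hzn, hw, hwn, hw0⟩ := h
  have hpow : ∀ {i j : ℕ}, i ≤ j → A ^ i ≤ A ^ j := fun h => pow_le_pow_right₀ hA h
  -- bound on z
  have hzmax : ∀ i, v (z i) ≤ A := by
    obtain ⟨i0, hi0, hmax⟩ := Finset.exists_max_image (Finset.range n) (fun i => v (z i)) ⟨0, by simp; omega⟩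
    have hper : ∀ i, z i = z (i % n) := by
      intro i
      induction i using Nat.strong_induction_on with
      | _ i ih =>
        rcases Nat.lt_or_ge i n with h | h
        · rw [Nat.mod_eq_of_lt h]
        · have h1 := hzn (i - n)
          rw [Nat.sub_add_cancel h] at h1
          rw [h1, ih (i - n) (by omega), Nat.mod_eq_sub_mod h]
    have hmax' : ∀ i, v (z i) ≤ v (z i0) := fun i => by
      rw [hper i]; exact hmax _ (Finset.mem_range.2 (Nat.mod_lt _ (by omega)))
    suffices v (z i0) ≤ A from fun i => (hmax' i).trans this
    by_contra hcon
    push Not at hcon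
    set m := v (z i0) with hm
    have hm1 : 1 ≤ m := hA.trans hcon.le
    -- use index i0 + n
    have e1 := hz (i0 + n - 1)
    rw [show i0 + n - 1 + 1 = i0 + n by omega, hzn i0] at e1
    have e2 : z i0 ^ d = z (i0 + n - 1 + 2) - a * z (i0 + n - 1) - ∑ j : Fin (d - 1), c j * z i0 ^ (j : ℕ) := by
      rw [e1, henonPoly]; ring
    have hmp : ∀ {i j : ℕ}, i ≤ j → m ^ i ≤ m ^ j := fun h => pow_le_pow_right₀ hm1 h
    have hmd : m ≤ m ^ (d - 1) := by
      calc m = m ^ 1 := (pow_one m).symm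
        _ ≤ m ^ (d - 1) := hmp (by omega)
    have e3 : v (z i0 ^ d) ≤ A * m ^ (d - 1) := by
      rw [e2]
      refine (v.map_sub _ _).trans (max_le ((v.map_sub _ _).trans (max_le ?_ ?_)) ?_)
      · calc v (z (i0 + n - 1 + 2)) ≤ m := hmax' _
          _ ≤ m ^ (d - 1) := hmd
          _ ≤ A * m ^ (d - 1) := le_mul_of_one_le_left' hA
      · rw [map_mul]; exact mul_le_mul' h1 ((hmax' _).trans hmd)
      · apply v.map_sum_le
        intro j _
        rw [map_mul, map_pow]
        exact mul_le_mul' (h3 j) (hmp (by omega))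
    rw [map_pow, ← hm, show d = d - 1 + 1 by omega, pow_succ, Nat.add_sub_cancel, mul_comm] at e3
    have hpos : 0 < m ^ (d - 1) := pow_pos (lt_of_lt_of_le zero_lt_one hm1) _
    exact absurd (le_of_mul_le_mul_right e3 hpos) (not_le.2 hcon)
  have hD : ∀ i, v (hpD d c (z i)) ≤ A ^ (d - 1) := by
    intro i
    rw [hpD]
    refine (v.map_add _ _).trans (max_le ?_ ?_)
    · rw [map_mul, map_pow]
      calc v (d : ℂ) * v (z i) ^ (d - 1) ≤ 1 * A ^ (d - 1) :=
            mul_le_mul' (val_natCast_le v d) (pow_le_pow_left' (hzmax i) _)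
        _ = _ := one_mul _
    · apply v.map_sum_le
      intro j _
      rw [map_mul, map_mul, map_pow]
      calc v (c j) * (v ((j : ℕ) : ℂ) * v (z i) ^ ((j : ℕ) - 1)) ≤ A * (1 * A ^ ((j : ℕ) - 1)) :=
            mul_le_mul' (h3 j) (mul_le_mul' (val_natCast_le v j) (pow_le_pow_left' (hzmax i) _))
        _ = A ^ ((j : ℕ) - 1 + 1) := by rw [one_mul, pow_succ, mul_comm]
        _ ≤ _ := hpow (by omega)
  set W : ℕ → Γ₀ := fun i => max (v (w i)) (v (w (i + 1))) with hWdef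
  have hAd : (1 : Γ₀) ≤ A ^ d := one_le_pow_of_one_le' hA _
  have hup : ∀ i, W (i + 1) ≤ A ^ d * W i := by
    intro i
    refine max_le ?_ ?_
    · exact (le_max_right _ _).trans (le_mul_of_one_le_left' hAd)
    · rw [show i + 1 + 1 = i + 2 by rfl, hw i]
      refine (v.map_add _ _).trans (max_le ?_ ?_)
      · rw [map_mul]
        exact mul_le_mul' (h1.trans (by simpa using hpow (show 1 ≤ d by omega))) (le_max_left _ _)
      · rw [map_mul]
        exact mul_le_mul' ((hD _).trans (hpow (by omega))) (le_max_right _ _)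
  have hdown : ∀ i, W i ≤ A ^ d * W (i + 1) := by
    intro i
    refine max_le ?_ ?_
    · have e : w i = a⁻¹ * (w (i + 2) - hpD d c (z (i + 1)) * w (i + 1)) := by
        rw [hw i]; field_simp; ring
      have hAA : A ^ d = A * A ^ (d - 1) := by rw [← pow_succ']; congr 1; omega
      rw [e, map_mul, hAA, mul_assoc]
      refine mul_le_mul' h2 ((v.map_sub _ _).trans (max_le ?_ ?_))
      · exact (le_max_right _ _).trans (le_mul_of_one_le_left' (one_le_pow_of_one_le' hA _))
      · rw [map_mul]; exact mul_le_mul' (hD _) (le_max_left _ _)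
    · exact (le_max_left _ _).trans (le_mul_of_one_le_left' hAd)
  have hup' : ∀ i, W i ≤ (A ^ d) ^ i * W 0 := by
    intro i
    induction i with
    | zero => simp
    | succ i ih => rw [pow_succ', mul_assoc]; exact (hup i).trans (mul_le_mul_right ih _)
  have hdown' : ∀ i, W 0 ≤ (A ^ d) ^ i * W i := by
    intro i
    induction i with
    | zero => simp
    | succ i ih =>
      rw [pow_succ, mul_assoc]; exact ih.trans (mul_le_mul_right (hdown i) _)
  have hW0 : 0 < W 0 := by
    rcases hw0 with h | h
    · exact lt_of_lt_of_le (zero_lt_iff.2 ((v.ne_zero_iff).2 h)) (le_max_left _ _)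
    · exact lt_of_lt_of_le (zero_lt_iff.2 ((v.ne_zero_iff).2 h)) (le_max_right _ _)
  have hWn : W n = v μ * W 0 := by
    have e1 := hwn 0
    have e2 := hwn 1
    simp only [hWdef]
    rw [show n + 1 = 1 + n by ring, e2, show w n = μ * w 0 by simpa using e1, map_mul, map_mul, mul_max]
  have b1 := hup' n
  have b2 := hdown' n
  rw [hWn] at b1 b2
  have c1 : v μ ≤ (A ^ d) ^ n := le_of_mul_le_mul_right b1 hW0
  have c2 : 1 ≤ (A ^ d) ^ n * v μ := by
    rw [← mul_assoc] at b2
    exact le_of_mul_le_mul_right (by simpa using b2) hW0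
  rw [← pow_mul] at c1 c2
  refine ⟨c1, ?_⟩
  rw [map_inv₀]
  have hμ : v μ ≠ 0 := by
    intro h; rw [h, mul_zero] at c2; exact absurd c2 (not_le.2 zero_lt_one)
  calc (v μ)⁻¹ = 1 * (v μ)⁻¹ := (one_mul _).symm
    _ ≤ A ^ (d * n) * v μ * (v μ)⁻¹ := by gcongr
    _ = A ^ (d * n) := by rw [mul_assoc, mul_inv_cancel₀ hμ, mul_one]

end val

lemma hp_large {d : ℕ} (hd : 2 ≤ d) {A : ℝ} (hA : 0 ≤ A) {c : Fin (d - 1) → ℂ} (hc : ∀ j, ‖c j‖ ≤ A)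
    {z : ℂ} (hz : 2 + A + A * d < ‖z‖) : (1 + A) * ‖z‖ < ‖henonPoly d c z‖ := by
  have hz2 : 2 < ‖z‖ := by nlinarith [Nat.cast_nonneg (α := ℝ) d]
  have hz1 : 1 ≤ ‖z‖ := by linarith
  have h1 : ‖∑ j : Fin (d - 1), c j * z ^ (j : ℕ)‖ ≤ (d : ℝ) * (A * ‖z‖ ^ (d - 2)) := by
    calc ‖∑ j : Fin (d - 1), c j * z ^ (j : ℕ)‖ ≤ ∑ j : Fin (d - 1), A * ‖z‖ ^ (d - 2) := by
          refine (norm_sum_le _ _).trans (Finset.sum_le_sum fun j _ => ?_)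
          rw [norm_mul, norm_pow]
          exact mul_le_mul (hc j) (pow_le_pow_right₀ hz1 (by omega)) (by positivity) hA
      _ = ((d - 1 : ℕ) : ℝ) * (A * ‖z‖ ^ (d - 2)) := by simp
      _ ≤ _ := by gcongr; omega
  have h2 : ‖z‖ ^ d = ‖z‖ ^ (d - 2) * ‖z‖ ^ 2 := by rw [← pow_add]; congr 1; omega
  have h3 : ‖z‖ ^ d - (d : ℝ) * (A * ‖z‖ ^ (d - 2)) ≤ ‖henonPoly d c z‖ := by
    rw [henonPoly]
    have := norm_sub_le_norm_add (z ^ d) (∑ j : Fin (d - 1), c j * z ^ (j : ℕ))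
    rw [norm_pow] at this
    linarith
  have h4 : 1 ≤ ‖z‖ ^ (d - 2) := one_le_pow₀ hz1
  have hd0 : (0 : ℝ) ≤ d := Nat.cast_nonneg d
  have h5 : (1 + A) * ‖z‖ < ‖z‖ ^ 2 - d * A := by nlinarith [mul_nonneg hA hd0]
  have h6 : 0 < (1 + A) * ‖z‖ := by positivity
  nlinarith

/-- a finite orbit segment with bounded endpoints is bounded -/
lemma seg_bounded {d : ℕ} (hd : 2 ≤ d) {A : ℝ} (hA : 0 ≤ A) {a : ℂ} (ha : ‖a‖ ≤ A)
    {c : Fin (d - 1) → ℂ} (hc : ∀ j, ‖c j‖ ≤ A) {z : ℕ → ℂ} {m : ℕ}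
    (hz : ∀ i, i + 2 ≤ m → z (i + 2) = a * z i + henonPoly d c (z (i + 1))) {ρ : ℝ}
    (hρ : 2 + A + A * d ≤ ρ) (h0 : ‖z 0‖ ≤ ρ) (hm : ‖z m‖ ≤ ρ) : ∀ i ≤ m, ‖z i‖ ≤ ρ := by
  by_contra hcon
  push Not at hcon
  have hex : ∃ i, i ≤ m ∧ ρ < ‖z i‖ := hcon
  classical
  obtain ⟨h1, h2⟩ := Nat.find_spec hex
  set i := Nat.find hex
  have hi0 : i ≠ 0 := by intro h; rw [h] at h2; linarith
  have hprev : ‖z (i - 1)‖ ≤ ρ := by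
    by_contra h
    exact Nat.find_min hex (m := i - 1) (by omega) ⟨by omega, by push Not at h; exact h⟩
  have hstep : ∀ j, i + j ≤ m → ρ < ‖z (i + j)‖ ∧ ‖z (i + j - 1)‖ ≤ ‖z (i + j)‖ := by
    intro j
    induction j with
    | zero => intro _; exact ⟨h2, hprev.trans h2.le⟩
    | succ j ih =>
      intro hj
      obtain ⟨b1, b2⟩ := ih (by omega)
      have e := hz (i + j - 1) (by omega)
      rw [show i + j - 1 + 2 = i + (j + 1) by omega, show i + j - 1 + 1 = i + j by omega] at e
      have b3 := hp_large hd hA hc (lt_of_le_of_lt hρ b1)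
      have b4 : ‖henonPoly d c (z (i + j))‖ ≤ ‖z (i + (j + 1))‖ + ‖a‖ * ‖z (i + j - 1)‖ := by
        rw [← norm_mul]
        have : henonPoly d c (z (i + j)) = z (i + (j + 1)) - a * z (i + j - 1) := by rw [e]; ring
        rw [this]; exact norm_sub_le _ _
      have b5 : ‖a‖ * ‖z (i + j - 1)‖ ≤ A * ‖z (i + j)‖ := mul_le_mul ha b2 (norm_nonneg _) hA
      have b6 : ‖z (i + j)‖ ≤ ‖z (i + (j + 1))‖ := by linarith
      refine ⟨by linarith, by rw [show i + (j + 1) - 1 = i + j by omega]; exact b6⟩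
  have := (hstep (m - i) (by omega)).1
  rw [show i + (m - i) = m by omega] at this
  linarith

lemma periodic_bounded {d : ℕ} (hd : 2 ≤ d) {A : ℝ} (hA : 0 ≤ A) {a : ℂ} (ha : ‖a‖ ≤ A)
    {c : Fin (d - 1) → ℂ} (hc : ∀ j, ‖c j‖ ≤ A) {z : ℕ → ℂ} {n : ℕ} (hn : 1 ≤ n)
    (hz : ∀ i, z (i + 2) = a * z i + henonPoly d c (z (i + 1))) (hzn : ∀ i, z (i + n) = z i) :
    ∀ i, ‖z i‖ ≤ 2 + A + A * d := by
  set R := 2 + A + A * d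
  have hper : ∀ i k, z (i + k * n) = z i := by
    intro i k
    induction k with
    | zero => simp
    | succ k ih => rw [Nat.succ_mul, ← add_assoc, hzn, ih]
  have key : ∀ i i0, ‖z i‖ ≤ max R ‖z i0‖ := by
    intro i i0
    have h := seg_bounded hd hA ha hc (z := fun j => z (i0 + j)) (m := (i + i0) * n + 0) (fun j _ => hz (i0 + j))
      (ρ := max R ‖z i0‖) (le_max_left _ _) (le_max_right _ _) (by
        show ‖z (i0 + _)‖ ≤ _
        rw [add_zero, hper]; exact le_max_right _ _)
    -- index congruent to i
    have hle : i0 ≤ i + i0 * n := by nlinarith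
    have h2 := h (i + i0 * n - i0) (by have : i ≤ i * n := Nat.le_mul_of_pos_right i hn
                                       nlinarith [Nat.sub_le (i + i0 * n) i0])
    rwa [show i0 + (i + i0 * n - i0) = i + i0 * n by omega, hper] at h2
  intro i
  by_contra hcon
  push Not at hcon
  have hall : ∀ j, ‖z i‖ ≤ ‖z j‖ := by
    intro j
    rcases le_max_iff.1 (key i j) with h | h
    · linarith
    · exact h
  have hall' : ∀ j, ‖z j‖ ≤ ‖z i‖ := by
    intro j
    rcases le_max_iff.1 (key j i) with h | h
    · linarith
    · exact h
  have e := hz i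
  have b3 := hp_large hd hA hc (lt_of_lt_of_le hcon (hall (i + 1)))
  have b4 : ‖henonPoly d c (z (i + 1))‖ ≤ ‖z (i + 2)‖ + ‖a‖ * ‖z i‖ := by
    rw [← norm_mul]
    have : henonPoly d c (z (i + 1)) = z (i + 2) - a * z i := by rw [e]; ring
    rw [this]; exact norm_sub_le _ _
  have b5 : ‖a‖ * ‖z i‖ ≤ A * ‖z (i + 1)‖ := mul_le_mul ha (hall _) (norm_nonneg _) hA
  linarith [hall' (i + 2), hall (i + 1)]

/-- crude bound on `hpD` -/
lemma hpD_bound {d : ℕ} {A R : ℝ} (hA : 1 ≤ A) (hR : 1 ≤ R) {c : Fin (d - 1) → ℂ} (hc : ∀ j, ‖c j‖ ≤ A)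
    {z : ℂ} (hz : ‖z‖ ≤ R) : ‖hpD d c z‖ ≤ (d + d ^ 2) * A * R ^ d := by
  have hz0 := norm_nonneg z
  have hRd : ∀ {i : ℕ}, i ≤ d → ‖z‖ ^ i ≤ R ^ d := fun h =>
    (pow_le_pow_left₀ hz0 hz _).trans (pow_le_pow_right₀ hR h)
  rw [hpD]
  have h1 : ‖(d : ℂ) * z ^ (d - 1)‖ ≤ d * (A * R ^ d) := by
    rw [norm_mul, norm_pow, Complex.norm_natCast]
    gcongr
    have := hRd (i := d - 1) (by omega)
    have h0 : 0 ≤ R ^ d := by positivity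
    nlinarith
  have h2 : ‖∑ j : Fin (d - 1), c j * (((j : ℕ) : ℂ) * z ^ ((j : ℕ) - 1))‖ ≤ d * (A * (d * R ^ d)) := by
    calc _ ≤ ∑ j : Fin (d - 1), A * (d * R ^ d) := by
          refine (norm_sum_le _ _).trans (Finset.sum_le_sum fun j _ => ?_)
          rw [norm_mul, norm_mul, norm_pow, Complex.norm_natCast]
          have := hRd (i := (j : ℕ) - 1) (by omega)
          have h3 : ((j : ℕ) : ℝ) ≤ d := by exact_mod_cast (by omega)
          have := hc j
          gcongr
      _ = ((d - 1 : ℕ) : ℝ) * (A * (d * R ^ d)) := by simp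
      _ ≤ _ := by gcongr; omega
  calc _ ≤ d * (A * R ^ d) + d * (A * (d * R ^ d)) := (norm_add_le _ _).trans (add_le_add h1 h2)
    _ = _ := by ring

lemma MultChain.norm_le {d : ℕ} (hd : 2 ≤ d) (a : ℂ) (ha : a ≠ 0) (c : Fin (d - 1) → ℂ) :
    ∃ C : ℝ, 1 ≤ C ∧ ∀ n μ, MultChain d a c n μ → ‖μ‖ ≤ C ^ n ∧ ‖μ⁻¹‖ ≤ C ^ n := by
  obtain ⟨A, hA1, haA, hcA, hiA⟩ : ∃ A : ℝ, 1 ≤ A ∧ ‖a‖ ≤ A ∧ (∀ j, ‖c j‖ ≤ A) ∧ ‖a⁻¹‖ ≤ A := by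
    refine ⟨1 + ‖a‖ + ‖c‖ + ‖a⁻¹‖, ?_, ?_, fun j => ?_, ?_⟩
    · linarith [norm_nonneg c, norm_nonneg a, norm_nonneg a⁻¹]
    · linarith [norm_nonneg c, norm_nonneg a⁻¹]
    · linarith [norm_le_pi_norm c j, norm_nonneg a, norm_nonneg a⁻¹]
    · linarith [norm_nonneg c, norm_nonneg a]
  set R := 2 + A + A * d
  have hR : 1 ≤ R := by have : (0:ℝ) ≤ A * d := by positivity
                        simp only [R]; linarith
  set Q := (d + d ^ 2) * A * R ^ d
  have hQ : 0 ≤ Q := by positivity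
  set C := A * (1 + A + Q)
  have hC1 : 1 + A + Q ≤ C := le_mul_of_one_le_left (by positivity) hA1
  refine ⟨C, by linarith, fun n μ h => ?_⟩
  obtain ⟨hn, z, w, hz, hzn, hw, hwn, hw0⟩ := h
  have hzb := periodic_bounded hd (by linarith) haA hcA hn hz hzn
  have hD : ∀ i, ‖hpD d c (z i)‖ ≤ Q := fun i => hpD_bound hA1 hR hcA (hzb i)
  set W : ℕ → ℝ := fun i => max (‖w i‖) (‖w (i + 1)‖) with hWdef
  have hWl : ∀ i, ‖w i‖ ≤ W i := fun i => le_max_left _ _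
  have hWr : ∀ i, ‖w (i + 1)‖ ≤ W i := fun i => le_max_right _ _
  have hWn0 : ∀ i, 0 ≤ W i := fun i => (norm_nonneg _).trans (hWl i)
  have hup : ∀ i, W (i + 1) ≤ C * W i := by
    intro i
    refine max_le ?_ ?_
    · nlinarith [hWr i, hWn0 i]
    · rw [show i + 1 + 1 = i + 2 by rfl, hw i]
      refine (norm_add_le _ _).trans ?_
      rw [norm_mul, norm_mul]
      have e1 := mul_le_mul haA (hWl i) (norm_nonneg _) (by linarith)
      have e2 := mul_le_mul (hD (i + 1)) (hWr i) (norm_nonneg _) hQ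
      nlinarith [hWn0 i]
  have hdown : ∀ i, W i ≤ C * W (i + 1) := by
    intro i
    refine max_le ?_ ?_
    · have e : w i = a⁻¹ * (w (i + 2) - hpD d c (z (i + 1)) * w (i + 1)) := by
        rw [hw i]; field_simp; ring
      rw [e, norm_mul]
      have e1 : ‖w (i + 2) - hpD d c (z (i + 1)) * w (i + 1)‖ ≤ (1 + A + Q) * W (i + 1) := by
        refine (norm_sub_le _ _).trans ?_
        rw [norm_mul]
        have e2 := mul_le_mul (hD (i + 1)) (hWl (i + 1)) (norm_nonneg _) hQ
        nlinarith [hWn0 (i + 1), hWr (i + 1)]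
      rw [mul_assoc]
      exact mul_le_mul hiA e1 (norm_nonneg _) (by linarith)
    · nlinarith [hWl (i + 1), hWn0 (i + 1)]
  have hC0 : 0 ≤ C := by linarith
  have hup' : ∀ i, W i ≤ C ^ i * W 0 := by
    intro i
    induction i with
    | zero => simp
    | succ i ih => rw [pow_succ', mul_assoc]; exact (hup i).trans (mul_le_mul_of_nonneg_left ih hC0)
  have hdown' : ∀ i, W 0 ≤ C ^ i * W i := by
    intro i
    induction i with
    | zero => simp
    | succ i ih =>
      rw [pow_succ, mul_assoc]; exact ih.trans (mul_le_mul_of_nonneg_left (hdown i) (by positivity))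
  have hW0 : 0 < W 0 := by
    rcases hw0 with h | h
    · exact lt_of_lt_of_le (norm_pos_iff.2 h) (le_max_left _ _)
    · exact lt_of_lt_of_le (norm_pos_iff.2 h) (le_max_right _ _)
  have hWn : W n = ‖μ‖ * W 0 := by
    have e1 := hwn 0
    have e2 := hwn 1
    simp only [hWdef]
    rw [show n + 1 = 1 + n by ring, e2, show w n = μ * w 0 by simpa using e1, norm_mul, norm_mul,
      mul_max_of_nonneg _ _ (norm_nonneg _)]
  have b1 := hup' n
  have b2 := hdown' n
  rw [hWn] at b1 b2
  have c1 : ‖μ‖ ≤ C ^ n := le_of_mul_le_mul_right b1 hW0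
  have c2 : 1 ≤ C ^ n * ‖μ‖ := by
    rw [← mul_assoc] at b2
    exact le_of_mul_le_mul_right (by simpa using b2) hW0
  refine ⟨c1, ?_⟩
  have hμ : 0 < ‖μ‖ := by
    rcases (norm_nonneg μ).eq_or_lt with h | h
    · rw [← h] at c2; norm_num at c2
    · exact h
  rw [norm_inv, inv_le_iff_one_le_mul₀ hμ]; exact c2

end HenonML
end

section
namespace HenonML

/-- Integrality of multipliers over the ring generated by the parameters. -/
lemma MultChain.integral {d : ℕ} (hd : 2 ≤ d) {a : ℂ} {c : Fin (d - 1) → ℂ} {n : ℕ} {μ : ℂ}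
    (h : MultChain d a c n μ) (ha : a ≠ 0) (D : ℕ) (hD : 1 ≤ D) (s : Set ℂ)
    (h1 : (D : ℂ) * a ∈ s) (h2 : (D : ℂ) * a⁻¹ ∈ s) (h3 : ∀ j, (D : ℂ) * c j ∈ s) :
    IsIntegral (Subring.closure s) ((D : ℂ) ^ (d * n) * μ) ∧
      IsIntegral (Subring.closure s) ((D : ℂ) ^ (d * n) * μ⁻¹) := by
  have key : ∀ V : {V : ValuationSubring ℂ // s ⊆ V.toSubring},
      (D : ℂ) ^ (d * n) * μ ∈ V.1.toSubring ∧ (D : ℂ) ^ (d * n) * μ⁻¹ ∈ V.1.toSubring := by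
    rintro ⟨V, hV⟩
    have hD0 : (D : ℂ) ≠ 0 := by exact_mod_cast (by omega : D ≠ 0)
    have hvD : V.valuation (D : ℂ) ≠ 0 := (Valuation.ne_zero_iff _).2 hD0
    have hvD' : 0 < V.valuation (D : ℂ) := zero_lt_iff.2 hvD
    have mem : ∀ x : ℂ, x ∈ s → V.valuation x ≤ 1 := fun x hx =>
      (V.valuation_le_one_iff x).2 (hV hx)
    have aux : ∀ x : ℂ, (D : ℂ) * x ∈ s → V.valuation x ≤ (V.valuation (D : ℂ))⁻¹ := by
      intro x hx
      have := mem _ hx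
      rw [map_mul] at this
      rw [← one_div, le_div_iff₀ hvD']
      rwa [mul_comm]
    have hA : 1 ≤ (V.valuation (D : ℂ))⁻¹ := by
      rw [one_le_inv₀ hvD']
      exact val_natCast_le V.valuation D
    obtain ⟨b1, b2⟩ := h.val_le V.valuation hd ha hA (aux _ h1) (aux _ h2) (fun j => aux _ (h3 j))
    have fin : ∀ x : ℂ, V.valuation x ≤ (V.valuation (D : ℂ))⁻¹ ^ (d * n) →
        (D : ℂ) ^ (d * n) * x ∈ V.toSubring := by
      intro x hx
      change _ ∈ V
      rw [← V.valuation_le_one_iff, map_mul, map_pow]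
      calc V.valuation (D : ℂ) ^ (d * n) * V.valuation x
          ≤ V.valuation (D : ℂ) ^ (d * n) * (V.valuation (D : ℂ))⁻¹ ^ (d * n) := by gcongr
        _ = 1 := by rw [← mul_pow, mul_inv_cancel₀ hvD, one_pow]
    exact ⟨fin _ b1, fin _ b2⟩
  have e := iInf_valuationSubring_superset (K := ℂ) (s := s)
  have conv : ∀ x : ℂ, (∀ V : {V : ValuationSubring ℂ // s ⊆ V.toSubring}, x ∈ V.1.toSubring) →
      IsIntegral (Subring.closure s) x := by
    intro x hx
    have : x ∈ (integralClosure (Subring.closure s) ℂ).toSubring := by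
      rw [← e, Subring.mem_iInf]; exact hx
    exact this
  exact ⟨conv _ fun V => (key V).1, conv _ fun V => (key V).2⟩

lemma exists_finite_quotient (L B : Type) [Field L] [CommRing B] [Nontrivial B] [Algebra L B]
    (h : Algebra.FiniteType L B) : ∃ (F : Type) (_ : Field F) (_ : Algebra L F),
      Module.Finite L F ∧ Nonempty (B →ₐ[L] F) := by
  obtain ⟨m, hm⟩ := Ideal.exists_maximal B
  let _ : Field (B ⧸ m) := Ideal.Quotient.field m
  have : Algebra.FiniteType L (B ⧸ m) := Algebra.FiniteType.of_surjective (Ideal.Quotient.mkₐ L m)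
    (Ideal.Quotient.mkₐ_surjective L m)
  have hfin : Module.Finite L (B ⧸ m) := finite_of_finite_type_of_isJacobsonRing L (B ⧸ m)
  exact ⟨B ⧸ m, inferInstance, inferInstance, hfin, ⟨Ideal.Quotient.mkₐ L m⟩⟩

/-- Specialization: choose `D` such that integrality over the ring generated by `D t`, `t ∈ T`
descends to `L`. -/
lemma specialize_integral (L : Subfield ℂ) [FiniteDimensional ℚ L] (T : Finset ℂ) :
    ∃ D : ℕ, 1 ≤ D ∧ ∀ x : L, IsIntegral (Subring.closure ((fun t => (D : ℂ) * t) '' (T : Set ℂ))) (x : ℂ) →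
      IsIntegral ℤ x := by
  classical
  let B := Algebra.adjoin L (T : Set ℂ)
  have hBft : Algebra.FiniteType L B := B.fg_iff_finiteType.1 ⟨T, rfl⟩
  obtain ⟨F, iF, iA, hfin, ⟨π⟩⟩ := exists_finite_quotient L B hBft
  have : CharZero F := charZero_of_injective_algebraMap (algebraMap L F).injective
  have : Algebra.IsAlgebraic ℤ L := by
    have : Algebra.IsAlgebraic ℚ L := Algebra.IsAlgebraic.of_finite ℚ L
    have : Algebra.IsAlgebraic ℤ ℚ := IsLocalization.isAlgebraic ℚ (nonZeroDivisors ℤ)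
    exact Algebra.IsAlgebraic.trans ℤ ℚ L
  have : Algebra.IsAlgebraic ℤ F := by
    have : Algebra.IsAlgebraic L F := Algebra.IsAlgebraic.of_finite L _
    exact Algebra.IsAlgebraic.trans ℤ L F
  have hTB : ∀ t ∈ T, t ∈ B := fun t ht => Algebra.subset_adjoin ht
  obtain ⟨y, hy0, hy⟩ := Algebra.IsAlgebraic.exists_integral_multiples ℤ
    (T.attach.image fun t : {x // x ∈ T} => π ⟨t.1, hTB t.1 t.2⟩)
  refine ⟨y.natAbs, by omega, fun x hx => ?_⟩
  set D := y.natAbs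
  have hinteg : ∀ t (ht : t ∈ T), IsIntegral ℤ ((D : F) * π ⟨t, hTB t ht⟩) := by
    intro t ht
    have h1 := hy (π ⟨t, hTB t ht⟩) (Finset.mem_image.2 ⟨⟨t, ht⟩, Finset.mem_attach _ _, rfl⟩)
    rw [zsmul_eq_mul] at h1
    rcases Int.natAbs_eq y with h | h
    · have e : ((y : ℤ) : F) = (D : F) := by rw [h, Int.cast_natCast]
      rwa [e] at h1
    · have e : ((y : ℤ) : F) = -(D : F) := by rw [h, Int.cast_neg, Int.cast_natCast]
      rw [e] at h1; simpa using h1.neg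
  set R := Subring.closure ((fun t => (D : ℂ) * t) '' (T : Set ℂ))
  have hRB : R ≤ B.toSubring := by
    rw [Subring.closure_le]
    rintro _ ⟨t, ht, rfl⟩
    exact B.mul_mem (natCast_mem B D) (hTB t ht)
  let inc : R →+* B := Subring.inclusion hRB
  let f : R →+* F := (π : B →+* F).comp inc
  have hfint : ∀ r : R, IsIntegral ℤ (f r) := by
    have : R ≤ Subring.map (B.subtype : B →+* ℂ) (Subring.comap (π : B →+* F) (integralClosure ℤ (F)).toSubring) := by
      rw [Subring.closure_le]
      rintro _ ⟨t, ht, rfl⟩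
      refine ⟨(D : B) * ⟨t, hTB t ht⟩, ?_, by simp⟩
      change π _ ∈ integralClosure ℤ (F)
      rw [map_mul, map_natCast]
      exact hinteg t ht
    intro r
    obtain ⟨b, hb, hb'⟩ := this r.2
    have : inc r = b := Subtype.ext hb'.symm
    change IsIntegral ℤ (π (inc r))
    rw [this]; exact hb
  obtain ⟨P, hP, hP0⟩ := hx
  have hxB : algebraMap L B x = ⟨(x : ℂ), B.algebraMap_mem x⟩ := rfl
  have e1 : Polynomial.eval₂ inc (algebraMap L B x) P = 0 := by
    apply Subtype.val_injective
    have := Polynomial.hom_eval₂ P inc (B.subtype : B →+* ℂ) (algebraMap L B x)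
    change (B.subtype : B →+* ℂ) _ = 0
    rw [this]
    exact hP0
  have e2 : Polynomial.eval₂ f (algebraMap L (F) x) P = 0 := by
    have := Polynomial.hom_eval₂ P inc (π : B →+* F) (algebraMap L B x)
    rw [e1, map_zero] at this
    rw [this]
    congr 1
    exact (π.commutes x).symm
  let g : R →+* integralClosure ℤ (F) := f.codRestrict (integralClosure ℤ (F)) hfint
  have e3 : IsIntegral (integralClosure ℤ (F)) (algebraMap L (F) x) := by
    refine ⟨P.map g, hP.map g, ?_⟩
    rw [Polynomial.eval₂_map]
    exact e2
  have e4 : IsIntegral ℤ (algebraMap L (F) x) := isIntegral_trans _ e3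
  exact (isIntegral_algebraMap_iff (algebraMap L (F)).injective).1 e4

lemma exists_extension (L K F : Type) [Field L] [Countable L] [Field K] [Field F] [Algebra L K] [Algebra L F]
    [IsAlgClosed K] [IsAlgClosed F] (hK : Cardinal.aleph0 < Cardinal.mk K)
    (hKF : Cardinal.mk K = Cardinal.mk F) : Nonempty (K →ₐ[L] F) := by
  obtain ⟨s, hs⟩ := exists_isTranscendenceBasis L K
  obtain ⟨t, ht⟩ := exists_isTranscendenceBasis L F
  have cL : Cardinal.mk L ≤ Cardinal.aleph0 := Cardinal.mk_le_aleph0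
  have c1 := IsAlgClosed.cardinal_eq_cardinal_transcendence_basis_of_aleph0_lt' _ hs cL hK
  have c2 := IsAlgClosed.cardinal_eq_cardinal_transcendence_basis_of_aleph0_lt' _ ht cL (hKF ▸ hK)
  have e : Nonempty (s ≃ t) := Cardinal.eq.1 (by rw [← c1, ← c2, hKF])
  obtain ⟨e⟩ := e
  let A := Algebra.adjoin L (Set.range (Subtype.val : s → K))
  haveI : Algebra.IsAlgebraic A K := hs.isAlgebraic
  let j : A →ₐ[L] F := (MvPolynomial.aeval (fun i : s => ((e i : t) : F))).comp
    (hs.1.aevalEquiv.symm : A →ₐ[L] MvPolynomial s L)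
  have hj : Function.Injective j := by
    have h2 : Function.Injective (MvPolynomial.aeval (R := L) (fun i : s => ((e i : t) : F))) := by
      have : AlgebraicIndependent L (fun i : s => ((e i : t) : F)) := ht.1.comp e e.injective
      exact this
    exact h2.comp hs.1.aevalEquiv.symm.injective
  letI : Algebra A F := j.toRingHom.toAlgebra
  haveI : IsScalarTower L A F := IsScalarTower.of_algebraMap_eq fun x => (j.commutes x).symm
  haveI : FaithfulSMul A F := (faithfulSMul_iff_algebraMap_injective A F).2 hj
  haveI : Module.IsTorsionFree A F := inferInstance
  exact ⟨(IsAlgClosed.lift : K →ₐ[A] F).restrictScalars L⟩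

lemma exists_extend_embedding (L : Subfield ℂ) [FiniteDimensional ℚ L] (σ : L →+* ℂ) :
    ∃ τ : ℂ →+* ℂ, ∀ x : L, τ x = σ x := by
  haveI : Countable L := by
    have : Cardinal.mk L ≤ Cardinal.aleph0 := by
      have h := Algebra.IsAlgebraic.cardinalMk_le_max ℚ L
      simpa using h
    exact Cardinal.mk_le_aleph0_iff.1 this
  have hc : Cardinal.aleph0 < Cardinal.mk ℂ := by
    rw [Cardinal.mk_complex]; exact Cardinal.aleph0_lt_continuum
  obtain ⟨τ⟩ := @exists_extension L ℂ ℂ _ _ _ _ _ σ.toAlgebra _ _ hc rfl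
  exact ⟨@AlgHom.toRingHom _ _ _ _ _ _ _ σ.toAlgebra τ, fun x => @AlgHom.commutes _ _ _ _ _ _ _ σ.toAlgebra τ x⟩

lemma IsIntegral.congr_val {R : Type*} [CommRing R] [Algebra R ℂ] {x y : ℂ} (h : IsIntegral R x) (e : y = x) :
    IsIntegral R y := e ▸ h

/-- The arithmetic obstruction. -/
theorem arith_main {d : ℕ} (hd : 2 ≤ d) {a : ℂ} (ha : a ≠ 0) (c : Fin (d - 1) → ℂ)
    (L : Subfield ℂ) (hL : FiniteDimensional ℚ L) (N : ℕ) (lam : ℂ) (hlam : MultChain d a c N lam)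
    (μ : ℕ → ℂ) (l0 : ℕ) (hμ : ∀ l ≥ l0, MultChain d a c (l * N) (μ l))
    (hS : ∀ l ≥ l0, lam ^ l / μ l ∈ L) (γ κ θ : ℂ)
    (hγ : γ ≠ 0) (hκ : κ ≠ 0) (hθ : θ ≠ 0) (hθ1 : ‖θ‖ < 1)
    (hlim : Tendsto (fun l => (lam ^ l / μ l / γ - 1) / θ ^ l) atTop (𝓝 κ)) : False := by
  classical
  have : NumberField L := ⟨⟩
  let T : Finset ℂ := {a, a⁻¹} ∪ Finset.univ.image c
  obtain ⟨D, hD, hDint⟩ := specialize_integral L T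
  have hD0 : (D : ℂ) ≠ 0 := by exact_mod_cast (by omega : D ≠ 0)
  set s : Set ℂ := (fun t => (D : ℂ) * t) '' (T : Set ℂ) with hs
  have hinteg : ∀ n ν, MultChain d a c n ν → IsIntegral (Subring.closure s) ((D : ℂ) ^ (d * n) * ν) ∧
      IsIntegral (Subring.closure s) ((D : ℂ) ^ (d * n) * ν⁻¹) := fun n ν h =>
    h.integral hd ha D hD s ⟨a, by simp [T], rfl⟩ ⟨a⁻¹, by simp [T], rfl⟩
      (fun j => ⟨c j, by simp [T], rfl⟩)
  have hnorm : ∀ σ : L →+* ℂ, ∃ C : ℝ, 1 ≤ C ∧ ∀ l ≥ l0, ∀ x : L, (x : ℂ) = lam ^ l / μ l →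
      ‖σ x‖ ≤ C ^ l ∧ ‖σ x⁻¹‖ ≤ C ^ l := by
    intro σ
    obtain ⟨τ, hτ⟩ := exists_extend_embedding L σ
    obtain ⟨C, hC, hb⟩ := MultChain.norm_le hd (τ a) ((map_ne_zero τ).2 ha) (fun j => τ (c j))
    refine ⟨C ^ N * C ^ N, ?_, ?_⟩
    · have := one_le_pow₀ hC (n := N); nlinarith
    intro l hl x hx
    have b1 := hb _ _ (hlam.map τ)
    have b2 := hb _ _ ((hμ l hl).map τ)
    have e1 : σ x = (τ lam) ^ l * (τ (μ l))⁻¹ := by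
      rw [← hτ, hx, map_div₀, map_pow, div_eq_mul_inv]
    have e2 : σ x⁻¹ = ((τ lam)⁻¹) ^ l * (τ (μ l)) := by
      rw [map_inv₀, e1, mul_inv, inv_inv, inv_pow]
    have hC0 : (0 : ℝ) ≤ C := by linarith
    have hpw : C ^ (l * N) = (C ^ N) ^ l := by rw [← pow_mul, mul_comm]
    rw [hpw] at b2
    rw [e1, e2, mul_pow, norm_mul, norm_mul, norm_pow, norm_pow]
    exact ⟨mul_le_mul (pow_le_pow_left₀ (norm_nonneg _) b1.1 _) b2.2 (norm_nonneg _) (by positivity),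
      mul_le_mul (pow_le_pow_left₀ (norm_nonneg _) b1.2 _) b2.1 (norm_nonneg _) (by positivity)⟩
  choose C hC1 hCb using hnorm
  set B : ℝ := ∑ σ : L →+* ℂ, C σ with hB
  have hCB : ∀ σ, C σ ≤ B := fun σ =>
    Finset.single_le_sum (f := C) (fun τ _ => zero_le_one.trans (hC1 τ)) (Finset.mem_univ σ)
  have hB1 : 1 ≤ B := (hC1 L.subtype).trans (hCB _)
  let S : ℕ → L := fun l => if h : l0 ≤ l then ⟨_, hS l h⟩ else 1
  have hSe : ∀ l ≥ l0, ((S l : L) : ℂ) = lam ^ l / μ l := by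
    intro l hl; simp only [S]; rw [dif_pos hl]
  have ne0 : ∀ n ν, MultChain d a c n ν → ν ≠ 0 := by
    rintro n ν ⟨hn, z, w, h1, h2, h3, h4, h5⟩ h0
    have hw : ∀ i, n ≤ i → w i = 0 := by
      intro i hi
      have := h4 (i - n)
      rw [Nat.sub_add_cancel hi, h0, zero_mul] at this
      exact this
    have hback : ∀ k i, n ≤ i + k → w i = 0 := by
      intro k
      induction k with
      | zero => exact fun i hi => hw i hi
      | succ k ih =>
        intro i hi
        have e := h3 i
        rw [ih (i + 1) (by omega), ih (i + 2) (by omega), mul_zero, add_zero] at e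
        exact (mul_eq_zero.1 e.symm).resolve_left ha
    rcases h5 with h | h
    · exact h (hback n 0 (by omega))
    · exact h (hback n 1 (by omega))
  refine no_geom L L.subtype (D ^ (2 * (d * N))) (Nat.one_le_pow _ _ hD) B hB1 S l0 ?_ γ κ θ hγ hκ hθ hθ1 ?_
  · intro l hl
    have hmn := ne0 _ _ (hμ l hl)
    have hln := ne0 _ _ hlam
    have hSl := hSe l hl
    have hx : (S l : ℂ) ≠ 0 := by rw [hSl]; exact div_ne_zero (pow_ne_zero _ hln) hmn
    obtain ⟨i1, i2⟩ := hinteg _ _ hlam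
    obtain ⟨j1, j2⟩ := hinteg _ _ (hμ l hl)
    refine ⟨fun h => hx (by rw [h]; rfl), ?_, ?_, fun σ => ?_⟩
    · apply hDint
      refine HenonML.IsIntegral.congr_val ((i1.pow l).mul j2) ?_
      push_cast
      rw [hSl]; rw [mul_pow, ← pow_mul, ← pow_mul]; 
      rw [show 2 * (d * N) * l = d * N * l + d * (l * N) by ring, pow_add]; ring
    · apply hDint
      refine HenonML.IsIntegral.congr_val ((i2.pow l).mul j1) ?_
      push_cast
      rw [hSl]; rw [mul_pow, ← pow_mul, ← pow_mul]; 
      rw [show 2 * (d * N) * l = d * N * l + d * (l * N) by ring, pow_add, inv_div]; ring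
    · have b := hCb σ l hl (S l) hSl
      have := pow_le_pow_left₀ (zero_le_one.trans (hC1 σ)) (hCB σ) l
      exact ⟨b.1.trans this, b.2.trans this⟩
  · refine hlim.congr' ?_
    filter_upwards [eventually_ge_atTop l0] with l hl
    rw [← hSe l hl]; rfl

end HenonML
end

section
namespace HenonML

/-- the derivative of the Hénon map -/
def hD (d : ℕ) (a : ℂ) (c : Fin (d - 1) → ℂ) (y : ℂ × ℂ) : (ℂ × ℂ) →L[ℂ] ℂ × ℂ :=
  ((a • ContinuousLinearMap.snd ℂ ℂ ℂ) + hpD d c y.1 • ContinuousLinearMap.fst ℂ ℂ ℂ).prod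
    (ContinuousLinearMap.fst ℂ ℂ ℂ)

lemma hD_apply (d : ℕ) (a : ℂ) (c : Fin (d - 1) → ℂ) (y h : ℂ × ℂ) :
    hD d a c y h = (a * h.2 + hpD d c y.1 * h.1, h.1) := by
  simp [hD]

lemma henonPoly_hasDerivAt (d : ℕ) (c : Fin (d - 1) → ℂ) (z : ℂ) :
    HasDerivAt (henonPoly d c) (hpD d c z) z := by
  unfold henonPoly hpD
  refine (hasDerivAt_pow d z).add ?_
  exact HasDerivAt.fun_sum fun j _ => (hasDerivAt_pow (j : ℕ) z).const_mul (c j)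

lemma henonMap_hasFDerivAt (d : ℕ) (a : ℂ) (c : Fin (d - 1) → ℂ) (y : ℂ × ℂ) :
    HasFDerivAt (henonMap d a c) (hD d a c y) y := by
  have h1 : HasFDerivAt (fun y : ℂ × ℂ => henonPoly d c y.1) (hpD d c y.1 • ContinuousLinearMap.fst ℂ ℂ ℂ) y :=
    (henonPoly_hasDerivAt d c y.1).comp_hasFDerivAt y hasFDerivAt_fst
  have h2 : HasFDerivAt (fun y : ℂ × ℂ => a * y.2) (a • ContinuousLinearMap.snd ℂ ℂ ℂ) y :=
    (hasFDerivAt_snd (𝕜 := ℂ) (E := ℂ) (F := ℂ) (p := y)).const_mul a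
  exact (h2.add h1).prodMk hasFDerivAt_fst

lemma henonMap_differentiable (d : ℕ) (a : ℂ) (c : Fin (d - 1) → ℂ) : Differentiable ℂ (henonMap d a c) :=
  fun y => (henonMap_hasFDerivAt d a c y).differentiableAt

lemma henonMap_iter_differentiable (d : ℕ) (a : ℂ) (c : Fin (d - 1) → ℂ) (n : ℕ) :
    Differentiable ℂ ((henonMap d a c)^[n]) :=
  (henonMap_differentiable d a c).iterate n

lemma fderiv_iter_add (d : ℕ) (a : ℂ) (c : Fin (d - 1) → ℂ) (m n : ℕ) (y : ℂ × ℂ) :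
    fderiv ℂ ((henonMap d a c)^[m + n]) y =
      (fderiv ℂ ((henonMap d a c)^[m]) ((henonMap d a c)^[n] y)).comp (fderiv ℂ ((henonMap d a c)^[n]) y) := by
  rw [Function.iterate_add]
  exact fderiv_comp y (henonMap_iter_differentiable d a c m _) (henonMap_iter_differentiable d a c n _)

lemma fderiv_iter_succ (d : ℕ) (a : ℂ) (c : Fin (d - 1) → ℂ) (n : ℕ) (y : ℂ × ℂ) :
    fderiv ℂ ((henonMap d a c)^[n + 1]) y =
      (hD d a c ((henonMap d a c)^[n] y)).comp (fderiv ℂ ((henonMap d a c)^[n]) y) := by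
  rw [add_comm n 1, fderiv_iter_add, Function.iterate_one, (henonMap_hasFDerivAt d a c _).fderiv]

/-- two by two determinant -/
def det2 (T : (ℂ × ℂ) →L[ℂ] ℂ × ℂ) : ℂ :=
  (T (1, 0)).1 * (T (0, 1)).2 - (T (0, 1)).1 * (T (1, 0)).2

/-- two by two trace -/
def tr2 (T : (ℂ × ℂ) →L[ℂ] ℂ × ℂ) : ℂ := (T (1, 0)).1 + (T (0, 1)).2

lemma clm2_apply (T : (ℂ × ℂ) →L[ℂ] ℂ × ℂ) (v : ℂ × ℂ) :
    T v = (v.1 * (T (1, 0)).1 + v.2 * (T (0, 1)).1, v.1 * (T (1, 0)).2 + v.2 * (T (0, 1)).2) := by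
  have : v = v.1 • ((1 : ℂ), (0 : ℂ)) + v.2 • ((0 : ℂ), (1 : ℂ)) := by ext <;> simp
  conv_lhs => rw [this, map_add, map_smul, map_smul]
  ext <;> simp

lemma det2_comp (S T : (ℂ × ℂ) →L[ℂ] ℂ × ℂ) : det2 (S.comp T) = det2 S * det2 T := by
  simp only [det2, ContinuousLinearMap.comp_apply]
  rw [clm2_apply S (T (1, 0)), clm2_apply S (T (0, 1))]
  ring

lemma det2_iter (d : ℕ) (a : ℂ) (c : Fin (d - 1) → ℂ) (n : ℕ) (y : ℂ × ℂ) :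
    det2 (fderiv ℂ ((henonMap d a c)^[n]) y) = (-a) ^ n := by
  induction n with
  | zero => simp [det2]
  | succ n ih =>
    rw [fderiv_iter_succ, det2_comp, ih, pow_succ']
    congr 1
    simp [det2, hD_apply]

lemma char_of_eigen (T : (ℂ × ℂ) →L[ℂ] ℂ × ℂ) (μ : ℂ) (h : IsEigenvalue T μ) :
    μ ^ 2 - tr2 T * μ + det2 T = 0 := by
  obtain ⟨v, hv, e⟩ := h
  rw [clm2_apply] at e
  have e1 := congrArg Prod.fst e
  have e2 := congrArg Prod.snd e
  simp only [Prod.smul_fst, Prod.smul_snd, smul_eq_mul] at e1 e2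
  unfold tr2 det2
  by_cases h1 : v.1 = 0
  · have h2 : v.2 ≠ 0 := fun h2 => hv (Prod.ext h1 h2)
    apply mul_left_cancel₀ h2
    linear_combination (μ - (T (1, 0)).1) * (-e2) - (T (1,0)).2 * e1
  · apply mul_left_cancel₀ h1
    linear_combination (μ - (T (0, 1)).2) * (-e1) - (T (0,1)).1 * e2

lemma eigen_of_char (T : (ℂ × ℂ) →L[ℂ] ℂ × ℂ) (μ : ℂ) (h : μ ^ 2 - tr2 T * μ + det2 T = 0) :
    IsEigenvalue T μ := by
  unfold tr2 det2 at h
  by_cases h1 : ((T (0, 1)).1, μ - (T (1, 0)).1) = ((0 : ℂ), (0 : ℂ))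
  · by_cases h2 : (μ - (T (0, 1)).2, (T (1, 0)).2) = ((0 : ℂ), (0 : ℂ))
    · simp only [Prod.mk.injEq] at h1 h2
      refine ⟨(1, 0), by simp, ?_⟩
      rw [clm2_apply]
      ext
      · simp; linear_combination -h1.2
      · simp [h2.2]
    · refine ⟨_, h2, ?_⟩
      rw [clm2_apply]
      ext
      · simp; linear_combination -h
      · simp; ring
  · refine ⟨_, h1, ?_⟩
    rw [clm2_apply]
    ext
    · simp; ring
    · simp; linear_combination -h

lemma iter_snd_succ (d : ℕ) (a : ℂ) (c : Fin (d - 1) → ℂ) (n : ℕ) (y : ℂ × ℂ) :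
    ((henonMap d a c)^[n + 1] y).2 = ((henonMap d a c)^[n] y).1 := by
  rw [Function.iterate_succ_apply']; rfl

lemma iter_fst_succ (d : ℕ) (a : ℂ) (c : Fin (d - 1) → ℂ) (n : ℕ) (y : ℂ × ℂ) :
    ((henonMap d a c)^[n + 1] y).1 = a * ((henonMap d a c)^[n] y).2 + henonPoly d c ((henonMap d a c)^[n] y).1 := by
  rw [Function.iterate_succ_apply']; rfl

lemma MultChain.of_fixed {d : ℕ} {a : ℂ} {c : Fin (d - 1) → ℂ} {n : ℕ} (hn : 1 ≤ n) {q : ℂ × ℂ}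
    (hq : (henonMap d a c)^[n] q = q) {μ : ℂ} (h : IsEigenvalue (fderiv ℂ ((henonMap d a c)^[n]) q) μ) :
    MultChain d a c n μ := by
  obtain ⟨v, hv, e⟩ := h
  have ws : ∀ i, (fderiv ℂ ((henonMap d a c)^[i + 1]) q v).2 = (fderiv ℂ ((henonMap d a c)^[i]) q v).1 := by
    intro i; rw [fderiv_iter_succ, ContinuousLinearMap.comp_apply, hD_apply]
  refine ⟨hn, fun i => ((henonMap d a c)^[i] q).2, fun i => (fderiv ℂ ((henonMap d a c)^[i]) q v).2,
    fun i => ?_, fun i => ?_, fun i => ?_, fun i => ?_, ?_⟩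
  · simp only [iter_snd_succ, show i + 2 = (i + 1) + 1 from rfl, iter_fst_succ]
  · simp only [Function.iterate_add_apply, hq]
  · simp only [show i + 2 = (i + 1) + 1 from rfl, ws, iter_snd_succ]
    rw [fderiv_iter_succ, ContinuousLinearMap.comp_apply, hD_apply]
  · simp only [fderiv_iter_add, hq, ContinuousLinearMap.comp_apply, e, map_smul]
    simp
  · by_contra hcon
    push Not at hcon
    obtain ⟨h1, h2⟩ := hcon
    rw [show (1 : ℕ) = 0 + 1 from rfl, ws] at h2
    simp at h1 h2
    exact hv (Prod.ext h2 h1)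

lemma MultChain.saddle {d : ℕ} {a : ℂ} {c : Fin (d - 1) → ℂ} {n : ℕ} {μ : ℂ} (h : MultChain d a c n μ)
    (ha0 : a ≠ 0) (ha : ‖a‖ < 1) (hμ : 1 < ‖μ‖) :
    ∃ p, IsSaddle (henonMap d a c) p n ((-a) ^ n / μ) μ := by
  obtain ⟨hn, z, w, h1, h2, h3, h4, h5⟩ := h
  have hz : ∀ i, (henonMap d a c)^[i] (z 1, z 0) = (z (i + 1), z i) := by
    intro i
    induction i with
    | zero => rfl
    | succ i ih => rw [Function.iterate_succ_apply', ih, henonMap, h1 i]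
  have hw : ∀ i, fderiv ℂ ((henonMap d a c)^[i]) (z 1, z 0) (w 1, w 0) = (w (i + 1), w i) := by
    intro i
    induction i with
    | zero => simp
    | succ i ih => rw [fderiv_iter_succ, ContinuousLinearMap.comp_apply, ih, hD_apply, hz, h3 i]
  have e1 : IsEigenvalue (fderiv ℂ ((henonMap d a c)^[n]) (z 1, z 0)) μ := by
    refine ⟨(w 1, w 0), ?_, ?_⟩
    · intro h
      simp only [Prod.mk_eq_zero] at h
      rcases h5 with h5 | h5
      · exact h5 h.2
      · exact h5 h.1
    · rw [hw]
      have := h4 0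
      have := h4 1
      ext
      · simp [add_comm n 1, h4 1]
      · have := h4 0
        simp only [zero_add] at this
        simp [this]
  have hμ0 : μ ≠ 0 := by rintro rfl; simp at hμ; linarith
  refine ⟨(z 1, z 0), hn, ?_, ?_, e1, ?_, hμ⟩
  · rw [hz]
    have := h2 0
    simp only [zero_add] at this
    rw [add_comm n 1, h2 1, this]
  · apply eigen_of_char
    have h := char_of_eigen _ _ e1
    rw [det2_iter] at h ⊢
    generalize tr2 (fderiv ℂ ((henonMap d a c)^[n]) (z 1, z 0)) = t at h ⊢
    have h2 : ((-a)^n/μ)^2 - t*((-a)^n/μ) + (-a)^n = ((-a)^n/μ^2) * (μ^2 - t*μ + (-a)^n) := by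
      field_simp
      ring
    rw [h2, h, mul_zero]
  · rw [norm_div, norm_pow, norm_neg, div_lt_one (by linarith)]
    exact (pow_le_one₀ (norm_nonneg _) ha.le).trans_lt hμ

end HenonML
end

section
namespace HenonML

lemma pow_sub_bound {R : ℝ} (hR : 1 ≤ R) (x y : ℂ) (hx : ‖x‖ ≤ R) (hy : ‖y‖ ≤ R) (k : ℕ) :
    ‖x ^ k - y ^ k‖ ≤ k * R ^ k * ‖x - y‖ := by
  induction k with
  | zero => simp
  | succ k ih =>
    have e : x ^ (k+1) - y ^ (k+1) = x * (x ^ k - y ^ k) + (x - y) * y ^ k := by ring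
    have h1 : ‖y ^ k‖ ≤ R ^ k := by rw [norm_pow]; exact pow_le_pow_left₀ (norm_nonneg _) hy k
    have h2 : R ^ k ≤ R ^ (k+1) := pow_le_pow_right₀ hR (Nat.le_succ k)
    calc ‖x ^ (k+1) - y ^ (k+1)‖ ≤ ‖x‖ * ‖x ^ k - y ^ k‖ + ‖x - y‖ * ‖y ^ k‖ := by
          rw [e]; exact (norm_add_le _ _).trans (by rw [norm_mul, norm_mul])
      _ ≤ R * (k * R ^ k * ‖x - y‖) + ‖x - y‖ * R ^ (k+1) := by
          gcongr; exact h1.trans h2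
      _ = _ := by push_cast; ring

lemma hpD_lip (d : ℕ) {A R : ℝ} (hA : 0 ≤ A) (hR : 1 ≤ R) (c : Fin (d - 1) → ℂ) (hc : ∀ j, ‖c j‖ ≤ A)
    (x y : ℂ) (hx : ‖x‖ ≤ R) (hy : ‖y‖ ≤ R) :
    ‖hpD d c x - hpD d c y‖ ≤ (d * (d * R ^ d) + d * (A * (d * (d * R ^ d)))) * ‖x - y‖ := by
  have key : ∀ k : ℕ, k ≤ d → ‖x ^ (k-1) - y ^ (k-1)‖ ≤ d * R ^ d * ‖x - y‖ := by
    intro k hk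
    refine (pow_sub_bound hR x y hx hy _).trans ?_
    have : ((k - 1 : ℕ) : ℝ) ≤ d := by exact_mod_cast (Nat.sub_le k 1).trans hk
    gcongr
    omega
  unfold hpD
  have e : (d * x ^ (d - 1) + ∑ j : Fin (d - 1), c j * ((j : ℕ) * x ^ ((j : ℕ) - 1))) -
      (d * y ^ (d - 1) + ∑ j : Fin (d - 1), c j * ((j : ℕ) * y ^ ((j : ℕ) - 1))) =
      d * (x ^ (d-1) - y ^ (d-1)) + ∑ j : Fin (d - 1), c j * ((j : ℕ) * (x ^ ((j : ℕ) - 1) - y ^ ((j : ℕ) - 1))) := by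
    rw [add_sub_add_comm, ← Finset.sum_sub_distrib, ← mul_sub]
    congr 1
    exact Finset.sum_congr rfl fun j _ => by ring
  rw [e]
  refine (norm_add_le _ _).trans ?_
  rw [add_mul]
  gcongr
  · rw [norm_mul, Complex.norm_natCast]
    have := key d le_rfl
    rw [mul_assoc]; gcongr
  · refine (norm_sum_le _ _).trans ?_
    have : ∀ j ∈ (Finset.univ : Finset (Fin (d-1))), ‖c j * ((j : ℕ) * (x ^ ((j : ℕ) - 1) - y ^ ((j : ℕ) - 1)))‖ ≤
        A * (d * (d * R ^ d * ‖x - y‖)) := by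
      intro j _
      have hj : ((j : ℕ) : ℝ) ≤ d := by exact_mod_cast (by omega : (j : ℕ) ≤ d)
      rw [norm_mul, norm_mul, Complex.norm_natCast]
      have := key j (by omega)
      have := hc j
      gcongr
    refine (Finset.sum_le_card_nsmul _ _ _ this).trans ?_
    rw [nsmul_eq_mul, Finset.card_univ, Fintype.card_fin]
    have h1 : ((d - 1 : ℕ) : ℝ) ≤ d := by exact_mod_cast Nat.sub_le d 1
    calc ((d - 1 : ℕ) : ℝ) * (A * (d * (d * R ^ d * ‖x - y‖))) ≤ d * (A * (d * (d * R ^ d * ‖x - y‖))) := by gcongr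
      _ = _ := by ring

/-- contraction principle on a closed ball -/
lemma ball_fixed {E : Type*} [NormedAddCommGroup E] [CompleteSpace E] (Φ : E → E) (P : E) (r : ℝ) (hr : 0 ≤ r)
    (hΦ : ∀ x ∈ Metric.closedBall P r, ∀ y ∈ Metric.closedBall P r, ‖Φ x - Φ y‖ ≤ 1/2 * ‖x - y‖)
    (hP : ‖Φ P - P‖ ≤ r / 2) : ∃ q ∈ Metric.closedBall P r, Φ q = q := by
  have hPm : P ∈ Metric.closedBall P r := Metric.mem_closedBall_self hr
  have hmaps : MapsTo Φ (Metric.closedBall P r) (Metric.closedBall P r) := by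
    intro x hx
    rw [mem_closedBall_iff_norm]
    have h1 := hΦ x hx P hPm
    have h2 : ‖x - P‖ ≤ r := mem_closedBall_iff_norm.1 hx
    calc ‖Φ x - P‖ = ‖(Φ x - Φ P) + (Φ P - P)‖ := by congr 1; abel
      _ ≤ 1/2 * r + r/2 := (norm_add_le _ _).trans (by gcongr; exact h1.trans (by gcongr))
      _ = r := by ring
  have hc : ContractingWith (1/2) (hmaps.restrict Φ _ _) := by
    constructor
    · rw [← NNReal.coe_lt_coe]; norm_num
    · apply LipschitzWith.of_dist_le_mul
      intro x y
      have := hΦ x x.2 y y.2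
      rw [Subtype.dist_eq, Subtype.dist_eq, dist_eq_norm, dist_eq_norm]
      simpa using this
  obtain ⟨y, hy, hfix, -⟩ := ContractingWith.exists_fixedPoint' (Metric.isClosed_closedBall.isComplete) hmaps hc hPm
    (edist_ne_top _ _)
  exact ⟨y, hy, hfix⟩

lemma iter_bounds {d : ℕ} {a : ℂ} {c : Fin (d - 1) → ℂ} {K R' : ℝ} (hK : 2 ≤ K)
    (hB : ∀ y : ℂ × ℂ, ‖y‖ ≤ R' → ‖hD d a c y‖ ≤ K)
    (hL : ∀ y y' : ℂ × ℂ, ‖y‖ ≤ R' → ‖y'‖ ≤ R' → ‖hD d a c y - hD d a c y'‖ ≤ K * ‖y - y'‖)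
    (P : ℂ × ℂ) (T : ℕ) (hP : ∀ i ≤ T, ‖(henonMap d a c)^[i] P‖ ≤ R' - 1) :
    ∀ n ≤ T, (∀ y ∈ Metric.closedBall P (K^T)⁻¹, ‖fderiv ℂ ((henonMap d a c)^[n]) y‖ ≤ K ^ n) ∧
      (∀ y ∈ Metric.closedBall P (K^T)⁻¹, ∀ y' ∈ Metric.closedBall P (K^T)⁻¹,
        ‖fderiv ℂ ((henonMap d a c)^[n]) y - fderiv ℂ ((henonMap d a c)^[n]) y'‖ ≤ K ^ (3 * n) * ‖y - y'‖) := by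
  have hK1 : 1 ≤ K := by linarith
  have hPm : P ∈ Metric.closedBall P (K^T)⁻¹ := Metric.mem_closedBall_self (by positivity)
  intro n
  induction n with
  | zero =>
    intro _
    have : ∀ y : ℂ × ℂ, fderiv ℂ ((henonMap d a c)^[0]) y = ContinuousLinearMap.id ℂ (ℂ × ℂ) := by
      intro y; simp
    constructor
    · intro y _; rw [this]; simpa using ContinuousLinearMap.norm_id_le
    · intro y _ y' _; rw [this, this]; simp
  | succ n ih =>
    intro hn
    obtain ⟨i1, i2⟩ := ih (by omega)
    have lip : ∀ y ∈ Metric.closedBall P (K^T)⁻¹, ∀ y' ∈ Metric.closedBall P (K^T)⁻¹,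
        ‖(henonMap d a c)^[n] y - (henonMap d a c)^[n] y'‖ ≤ K ^ n * ‖y - y'‖ := by
      intro y hy y' hy'
      exact (convex_closedBall P _).norm_image_sub_le_of_norm_fderiv_le
        (fun x _ => henonMap_iter_differentiable d a c n x) i1 hy' hy
    have inR : ∀ y ∈ Metric.closedBall P (K^T)⁻¹, ‖(henonMap d a c)^[n] y‖ ≤ R' := by
      intro y hy
      have h1 := lip y hy P hPm
      have h2 : ‖y - P‖ ≤ (K^T)⁻¹ := mem_closedBall_iff_norm.1 hy
      have h3 : K ^ n * ‖y - P‖ ≤ 1 := by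
        calc K ^ n * ‖y - P‖ ≤ K ^ T * (K^T)⁻¹ := by gcongr; omega
          _ = 1 := mul_inv_cancel₀ (by positivity)
      have h4 := hP n (by omega)
      have h5 := norm_le_norm_add_norm_sub' ((henonMap d a c)^[n] y) ((henonMap d a c)^[n] P)
      linarith
    constructor
    · intro y hy
      rw [fderiv_iter_succ, pow_succ']
      exact (ContinuousLinearMap.opNorm_comp_le _ _).trans
        (mul_le_mul (hB _ (inR y hy)) (i1 y hy) (norm_nonneg _) (by positivity))
    · intro y hy y' hy'
      rw [fderiv_iter_succ, fderiv_iter_succ]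
      set f := henonMap d a c
      have e : (hD d a c (f^[n] y)).comp (fderiv ℂ (f^[n]) y) - (hD d a c (f^[n] y')).comp (fderiv ℂ (f^[n]) y') =
        (hD d a c (f^[n] y)).comp (fderiv ℂ (f^[n]) y - fderiv ℂ (f^[n]) y') +
        (hD d a c (f^[n] y) - hD d a c (f^[n] y')).comp (fderiv ℂ (f^[n]) y') := by
        ext <;> simp
      rw [e]
      have hK0 : 0 ≤ K := by linarith
      have b1 : ‖(hD d a c (f^[n] y)).comp (fderiv ℂ (f^[n]) y - fderiv ℂ (f^[n]) y')‖ ≤ K * (K ^ (3*n) * ‖y - y'‖) :=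
        (ContinuousLinearMap.opNorm_comp_le _ _).trans
          (mul_le_mul (hB _ (inR y hy)) (i2 y hy y' hy') (norm_nonneg _) hK0)
      have b2 : ‖(hD d a c (f^[n] y) - hD d a c (f^[n] y')).comp (fderiv ℂ (f^[n]) y')‖ ≤ K * (K ^ n * ‖y - y'‖) * K ^ n :=
        (ContinuousLinearMap.opNorm_comp_le _ _).trans
          (mul_le_mul ((hL _ _ (inR y hy) (inR y' hy')).trans (by gcongr; exact lip y hy y' hy')) (i1 y' hy')
            (norm_nonneg _) (by positivity))
      refine (norm_add_le _ _).trans ((add_le_add b1 b2).trans ?_)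
      have h1 : K ^ (2 * n) ≤ K ^ (3 * n) := pow_le_pow_right₀ hK1 (by omega)
      have h2 : K * K ^ (3*n) * 2 ≤ K ^ (3 * (n+1)) := by
        have : K ^ (3 * (n+1)) = K * K ^ (3*n) * (K * K) := by ring
        rw [this]; gcongr; nlinarith
      calc K * (K ^ (3*n) * ‖y - y'‖) + K * (K ^ n * ‖y - y'‖) * K ^ n
          = (K * K ^ (3*n) + K * K ^ (2*n)) * ‖y - y'‖ := by ring
        _ ≤ (K * K ^ (3*n) * 2) * ‖y - y'‖ := by
            gcongr
            nlinarith
        _ ≤ _ := by gcongr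

end HenonML
end

section
namespace HenonML

lemma hD_sub (d : ℕ) (a : ℂ) (c : Fin (d - 1) → ℂ) (y y' : ℂ × ℂ) :
    ‖hD d a c y - hD d a c y'‖ ≤ ‖hpD d c y.1 - hpD d c y'.1‖ := by
  refine ContinuousLinearMap.opNorm_le_bound _ (norm_nonneg _) fun h => ?_
  rw [ContinuousLinearMap.sub_apply, hD_apply, hD_apply]
  have : ((a * h.2 + hpD d c y.1 * h.1, h.1) : ℂ × ℂ) - (a * h.2 + hpD d c y'.1 * h.1, h.1) =
    ((hpD d c y.1 - hpD d c y'.1) * h.1, 0) := by ext <;> simp; ring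
  rw [this, Prod.norm_def]
  simp only [norm_zero, norm_mul]
  rw [max_eq_left (by positivity)]
  gcongr
  exact norm_fst_le h

lemma hD_norm (d : ℕ) (a : ℂ) (c : Fin (d - 1) → ℂ) (y : ℂ × ℂ) :
    ‖hD d a c y‖ ≤ 1 + ‖a‖ + ‖hpD d c y.1‖ := by
  refine ContinuousLinearMap.opNorm_le_bound _ (by positivity) fun h => ?_
  rw [hD_apply, Prod.norm_def]
  have h1 := norm_fst_le h
  have h2 := norm_snd_le h
  have h0 := norm_nonneg h
  apply max_le
  · calc ‖a * h.2 + hpD d c y.1 * h.1‖ ≤ ‖a‖ * ‖h.2‖ + ‖hpD d c y.1‖ * ‖h.1‖ :=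
        (norm_add_le _ _).trans (by rw [norm_mul, norm_mul])
      _ ≤ ‖a‖ * ‖h‖ + ‖hpD d c y.1‖ * ‖h‖ := by gcongr
      _ ≤ (1 + ‖a‖ + ‖hpD d c y.1‖) * ‖h‖ := by nlinarith
  · have : 0 ≤ (‖a‖ + ‖hpD d c y.1‖) * ‖h‖ := by positivity
    simp only
    nlinarith

lemma inv2_bound (M : (ℂ × ℂ) →L[ℂ] ℂ × ℂ) (k : ℝ) (hk : 2 ≤ k) (hM : ‖M‖ ≤ k)
    (h : 1 ≤ ‖1 - tr2 M + det2 M‖) :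
    ∃ S : (ℂ × ℂ) →L[ℂ] ℂ × ℂ, (∀ v, S (M v - v) = v) ∧ (∀ v, M (S v) - S v = v) ∧ ‖S‖ ≤ 4 * k := by
  set A := (M (1, 0)).1
  set B := (M (0, 1)).1
  set C := (M (1, 0)).2
  set D := (M (0, 1)).2
  have hd0 : 1 - tr2 M + det2 M ≠ 0 := by intro h0; rw [h0, norm_zero] at h; linarith
  have e10 : ‖((1 : ℂ), (0 : ℂ))‖ = 1 := by simp [Prod.norm_def]
  have e01 : ‖((0 : ℂ), (1 : ℂ))‖ = 1 := by simp [Prod.norm_def]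
  have hm1 : ‖M (1, 0)‖ ≤ k := by have := M.le_opNorm (1, 0); rw [e10] at this; linarith
  have hm2 : ‖M (0, 1)‖ ≤ k := by have := M.le_opNorm (0, 1); rw [e01] at this; linarith
  have hA : ‖A‖ ≤ k := (norm_fst_le _).trans hm1
  have hB : ‖B‖ ≤ k := (norm_fst_le _).trans hm2
  have hC : ‖C‖ ≤ k := (norm_snd_le _).trans hm1
  have hD : ‖D‖ ≤ k := (norm_snd_le _).trans hm2
  set δ := 1 - tr2 M + det2 M with hδ
  have hδ' : δ = (A - 1) * (D - 1) - B * C := by rw [hδ, tr2, det2]; ring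
  let S : (ℂ × ℂ) →L[ℂ] ℂ × ℂ := δ⁻¹ •
    (((D - 1) • ContinuousLinearMap.fst ℂ ℂ ℂ - B • ContinuousLinearMap.snd ℂ ℂ ℂ).prod
     ((A - 1) • ContinuousLinearMap.snd ℂ ℂ ℂ - C • ContinuousLinearMap.fst ℂ ℂ ℂ))
  have hS : ∀ v, S v = (δ⁻¹ * ((D - 1) * v.1 - B * v.2), δ⁻¹ * ((A - 1) * v.2 - C * v.1)) := by
    intro v; simp [S]
  have hMv : ∀ v, M v = (v.1 * A + v.2 * B, v.1 * C + v.2 * D) := clm2_apply M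
  refine ⟨S, fun v => ?_, fun v => ?_, ?_⟩
  · rw [hS, hMv]
    ext
    · simp only [Prod.fst_sub, Prod.snd_sub]
      rw [inv_mul_eq_iff_eq_mul₀ hd0, hδ']; ring
    · simp only [Prod.fst_sub, Prod.snd_sub]
      rw [inv_mul_eq_iff_eq_mul₀ hd0, hδ']; ring
  · rw [hMv, hS]
    ext
    · simp only [Prod.fst_sub]
      apply mul_left_cancel₀ hd0
      calc _ = (δ * δ⁻¹) * (((D - 1) * v.1 - B * v.2) * A + ((A - 1) * v.2 - C * v.1) * B - ((D - 1) * v.1 - B * v.2)) := by ring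
        _ = _ := by rw [mul_inv_cancel₀ hd0, hδ']; ring
    · simp only [Prod.snd_sub]
      apply mul_left_cancel₀ hd0
      calc _ = (δ * δ⁻¹) * (((D - 1) * v.1 - B * v.2) * C + ((A - 1) * v.2 - C * v.1) * D - ((A - 1) * v.2 - C * v.1)) := by ring
        _ = _ := by rw [mul_inv_cancel₀ hd0, hδ']; ring
  · refine ContinuousLinearMap.opNorm_le_bound _ (by positivity) fun v => ?_
    have hi : ‖δ⁻¹‖ ≤ 1 := by rw [norm_inv]; exact inv_le_one_of_one_le₀ h
    have h1 := norm_fst_le v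
    have h2 := norm_snd_le v
    have hA1 : ‖A - 1‖ ≤ k + 1 := (norm_sub_le _ _).trans (by simpa using hA)
    have hD1 : ‖D - 1‖ ≤ k + 1 := (norm_sub_le _ _).trans (by simpa using hD)
    have h0 := norm_nonneg v
    rw [hS, Prod.norm_def]
    apply max_le
    · calc ‖δ⁻¹ * ((D - 1) * v.1 - B * v.2)‖ ≤ 1 * ((k + 1) * ‖v‖ + k * ‖v‖) := by
            rw [norm_mul]; gcongr
            refine (norm_sub_le _ _).trans ?_
            rw [norm_mul, norm_mul]; gcongr
        _ ≤ _ := by nlinarith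
    · calc ‖δ⁻¹ * ((A - 1) * v.2 - C * v.1)‖ ≤ 1 * ((k + 1) * ‖v‖ + k * ‖v‖) := by
            rw [norm_mul]; gcongr
            refine (norm_sub_le _ _).trans ?_
            rw [norm_mul, norm_mul]; gcongr
        _ ≤ _ := by nlinarith

lemma exists_close_root (t D x : ℂ) : ∃ μ : ℂ, μ ^ 2 - t * μ + D = 0 ∧ ‖μ - x‖ ^ 2 ≤ ‖x ^ 2 - t * x + D‖ := by
  obtain ⟨r, hr⟩ := IsAlgClosed.exists_pow_nat_eq (t ^ 2 - 4 * D) (n := 2) (by norm_num)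
  have f : x ^ 2 - t * x + D = ((t + r) / 2 - x) * ((t - r) / 2 - x) := by linear_combination (1/4) * hr
  have e1 : ((t + r) / 2) ^ 2 - t * ((t + r) / 2) + D = 0 := by linear_combination (1/4) * hr
  have e2 : ((t - r) / 2) ^ 2 - t * ((t - r) / 2) + D = 0 := by linear_combination (1/4) * hr
  rw [f, norm_mul]
  have g1 := norm_nonneg ((t + r) / 2 - x)
  have g2 := norm_nonneg ((t - r) / 2 - x)
  rcases le_total ‖(t + r) / 2 - x‖ ‖(t - r) / 2 - x‖ with h | h
  · exact ⟨_, e1, by nlinarith⟩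
  · exact ⟨_, e2, by nlinarith⟩

lemma exists_fixed {F : ℂ × ℂ → ℂ × ℂ} (hF : Differentiable ℂ F) (P : ℂ × ℂ) (k kk δ : ℝ) (hk : 2 ≤ k) (hkk : 0 ≤ kk)
    (hM : ‖fderiv ℂ F P‖ ≤ k)
    (hL : ∀ y ∈ Metric.closedBall P δ, ‖fderiv ℂ F y - fderiv ℂ F P‖ ≤ kk * ‖y - P‖)
    (h : 1 ≤ ‖1 - tr2 (fderiv ℂ F P) + det2 (fderiv ℂ F P)‖)
    (h1 : 8 * k * ‖F P - P‖ ≤ δ) (h2 : 64 * k ^ 2 * kk * ‖F P - P‖ ≤ 1) :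
    ∃ q, ‖q - P‖ ≤ 8 * k * ‖F P - P‖ ∧ F q = q := by
  obtain ⟨S, s1, s2, s3⟩ := inv2_bound _ k hk hM h
  set M := fderiv ℂ F P
  set r := 8 * k * ‖F P - P‖ with hr
  have hr0 : 0 ≤ r := by positivity
  have hsub : Metric.closedBall P r ⊆ Metric.closedBall P δ := Metric.closedBall_subset_closedBall h1
  have hLip : ∀ x ∈ Metric.closedBall P r, ∀ y ∈ Metric.closedBall P r,
      ‖(F x - M x) - (F y - M y)‖ ≤ (kk * r) * ‖x - y‖ := by
    intro x hx y hy
    refine (convex_closedBall P r).norm_image_sub_le_of_norm_hasFDerivWithin_le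
      (f := fun z => F z - M z) (f' := fun z => fderiv ℂ F z - M)
      (fun z _ => ((hF z).hasFDerivAt.sub M.hasFDerivAt).hasFDerivWithinAt) (fun z hz => ?_) hy hx
    refine (hL z (hsub hz)).trans ?_
    gcongr
    exact mem_closedBall_iff_norm.1 hz
  have c1 : ∀ x ∈ Metric.closedBall P r, ∀ y ∈ Metric.closedBall P r,
      ‖(x - S (F x - x)) - (y - S (F y - y))‖ ≤ 1/2 * ‖x - y‖ := by
    intro x hx y hy
    have e : (x - S (F x - x)) - (y - S (F y - y)) = - S ((F x - M x) - (F y - M y)) := by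
      have := s1 (x - y)
      simp only [map_sub] at this ⊢
      rw [← sub_eq_zero] at this ⊢
      rw [← neg_eq_zero, ← this]
      abel
    rw [e, norm_neg]
    refine (S.le_opNorm _).trans ?_
    have := hLip x hx y hy
    calc ‖S‖ * ‖(F x - M x) - (F y - M y)‖ ≤ (4 * k) * ((kk * r) * ‖x - y‖) := by gcongr
      _ = (64 * k ^ 2 * kk * ‖F P - P‖) / 2 * ‖x - y‖ := by rw [hr]; ring
      _ ≤ 1 / 2 * ‖x - y‖ := by gcongr
  have c2 : ‖(P - S (F P - P)) - P‖ ≤ r / 2 := by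
    simp only [sub_sub_cancel_left, norm_neg]
    refine (S.le_opNorm _).trans ?_
    calc ‖S‖ * ‖F P - P‖ ≤ 4 * k * ‖F P - P‖ := by gcongr
      _ = r / 2 := by rw [hr]; ring
  obtain ⟨q, hq, hfix⟩ := ball_fixed (fun y => y - S (F y - y)) P r hr0 c1 c2
  refine ⟨q, mem_closedBall_iff_norm.1 hq, ?_⟩
  have : S (F q - q) = 0 := by simpa using hfix
  have h3 := s2 (F q - q)
  rw [this] at h3
  simp only [map_zero, sub_zero] at h3
  exact (sub_eq_zero.1 h3.symm)

end HenonML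
end

section
namespace HenonML

lemma tr2_sub_le (M M' : (ℂ × ℂ) →L[ℂ] ℂ × ℂ) : ‖tr2 M - tr2 M'‖ ≤ 2 * ‖M - M'‖ := by
  have e10 : ‖((1 : ℂ), (0 : ℂ))‖ = 1 := by simp [Prod.norm_def]
  have e01 : ‖((0 : ℂ), (1 : ℂ))‖ = 1 := by simp [Prod.norm_def]
  have h1 := (M - M').le_opNorm (1, 0)
  have h2 := (M - M').le_opNorm (0, 1)
  rw [e10, mul_one] at h1
  rw [e01, mul_one] at h2
  have e : tr2 M - tr2 M' = ((M - M') (1, 0)).1 + ((M - M') (0, 1)).2 := by simp [tr2]; ring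
  rw [e]
  refine (norm_add_le _ _).trans ?_
  linarith [(norm_fst_le ((M - M') (1, 0))).trans h1, (norm_snd_le ((M - M') (0, 1))).trans h2]

/-- closing lemma -/
lemma close_lemma (d : ℕ) (A ρ₀ : ℝ) : ∃ K : ℝ, 2 ≤ K ∧ ∀ (a : ℂ) (c : Fin (d - 1) → ℂ), ‖a‖ ≤ 1 →
    (∀ j, ‖c j‖ ≤ A) → ∀ (T : ℕ), 1 ≤ T → ∀ (z w : ℕ → ℂ) (mh : ℂ),
    (∀ i < T, z (i + 2) = a * z i + henonPoly d c (z (i + 1))) →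
    (∀ i < T, w (i + 2) = a * w i + hpD d c (z (i + 1)) * w (i + 1)) →
    (∀ i ≤ T + 1, ‖z i‖ ≤ ρ₀) → z (T + 1) = z 1 → w (T + 1) = mh * w 1 → w 1 ≠ 0 → 5 ≤ ‖mh‖ →
    K ^ (5 * T) * ‖z T - z 0‖ ≤ 1 → K ^ (5 * T) * (‖w T - mh * w 0‖ / ‖w 1‖) ≤ ‖mh‖ →
    ∃ μ, MultChain d a c T μ ∧
      ‖μ - mh‖ ^ 2 ≤ K ^ (5 * T) * (‖w T - mh * w 0‖ / ‖w 1‖ + ‖mh‖ * ‖z T - z 0‖) := by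
  set R' := max ρ₀ 0 + 1 with hR'
  have hR1 : 1 ≤ R' := by rw [hR']; linarith [le_max_right ρ₀ 0]
  set A' := max A 0 + 1
  have hA1 : 1 ≤ A' := by linarith [le_max_right A 0]
  have hA0 : 0 ≤ A' := by linarith
  have hAA : A ≤ A' := by linarith [le_max_left A 0]
  set Q1 : ℝ := (d + d ^ 2) * A' * R' ^ d
  set Q2 : ℝ := (d * (d * R' ^ d) + d * (A' * (d * (d * R' ^ d))))
  have hQ1 : 0 ≤ Q1 := by positivity
  have hQ2 : 0 ≤ Q2 := by positivity
  set K₀ : ℝ := 2 + Q1 + Q2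
  have hK₀ : 2 ≤ K₀ := by linarith
  refine ⟨4 * K₀, by linarith, ?_⟩
  intro a c ha hc' T hT z w mh hz hw hzb hzT hwT hw1 hmh hs1 hs2
  have hc : ∀ j, ‖c j‖ ≤ A' := fun j => (hc' j).trans hAA
  have hB : ∀ y : ℂ × ℂ, ‖y‖ ≤ R' → ‖hD d a c y‖ ≤ K₀ := by
    intro y hy
    have := hpD_bound hA1 hR1 hc ((norm_fst_le y).trans hy)
    exact (hD_norm d a c y).trans (by linarith)
  have hL : ∀ y y' : ℂ × ℂ, ‖y‖ ≤ R' → ‖y'‖ ≤ R' → ‖hD d a c y - hD d a c y'‖ ≤ K₀ * ‖y - y'‖ := by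
    intro y y' hy hy'
    refine (hD_sub d a c y y').trans ((hpD_lip d hA0 hR1 c hc _ _ ((norm_fst_le y).trans hy) ((norm_fst_le y').trans hy')).trans ?_)
    have h1 : ‖y.1 - y'.1‖ ≤ ‖y - y'‖ := norm_fst_le (y - y')
    calc Q2 * ‖y.1 - y'.1‖ ≤ Q2 * ‖y - y'‖ := by gcongr
      _ ≤ K₀ * ‖y - y'‖ := by gcongr; linarith
  set P : ℂ × ℂ := (z 1, z 0) with hPdef
  have hit : ∀ i ≤ T, (henonMap d a c)^[i] P = (z (i + 1), z i) := by
    intro i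
    induction i with
    | zero => intro _; simp [hPdef]
    | succ i ih =>
      intro hi
      rw [Function.iterate_succ_apply', ih (by omega), henonMap]
      simp only
      rw [← hz i (by omega)]
  have hwt : ∀ i ≤ T, fderiv ℂ ((henonMap d a c)^[i]) P (w 1, w 0) = (w (i + 1), w i) := by
    intro i
    induction i with
    | zero => intro _; simp
    | succ i ih =>
      intro hi
      rw [fderiv_iter_succ, ContinuousLinearMap.comp_apply, ih (by omega), hit i (by omega), hD_apply]
      simp only
      rw [← hw i (by omega)]
  have hPb : ∀ i ≤ T, ‖(henonMap d a c)^[i] P‖ ≤ R' - 1 := by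
    intro i hi
    rw [hit i hi, Prod.norm_def]
    have h3 := le_max_left ρ₀ 0
    exact max_le (by linarith [hzb (i+1) (by omega)]) (by linarith [hzb i (by omega)])
  obtain ⟨b1, b2⟩ := iter_bounds hK₀ hB hL P T hPb T le_rfl
  set F := (henonMap d a c)^[T] with hF
  have hPm : P ∈ Metric.closedBall P (K₀^T)⁻¹ := Metric.mem_closedBall_self (by positivity)
  have hM := b1 P hPm
  set M := fderiv ℂ F P with hMdef
  set ε := ‖w T - mh * w 0‖ / ‖w 1‖ with hε
  set Δ := ‖z T - z 0‖ with hΔ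
  have hε0 : 0 ≤ ε := by positivity
  have hΔ0 : 0 ≤ Δ := norm_nonneg _
  have hFP : ‖F P - P‖ = Δ := by
    rw [hF, hit T le_rfl, hPdef, Prod.norm_def, hzT]
    simp [hΔ]
  have hdet : det2 M = (-a) ^ T := det2_iter d a c T P
  have hdet1 : ‖det2 M‖ ≤ 1 := by
    rw [hdet, norm_pow, norm_neg]; exact pow_le_one₀ (norm_nonneg _) ha
  have hk2 : 2 ≤ K₀ ^ T := hK₀.trans (le_self_pow₀ (by linarith) (by omega))
  have hpow : ∀ (j : ℕ), j ≤ 5 → 1024 * K₀ ^ (j * T) ≤ (4 * K₀) ^ (5 * T) := by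
    intro j hj
    rw [mul_pow]
    have h1 : (1024 : ℝ) ≤ 4 ^ (5 * T) := by
      calc (1024 : ℝ) = 4 ^ 5 := by norm_num
        _ ≤ 4 ^ (5 * T) := pow_le_pow_right₀ (by norm_num) (by omega)
    have h2 : K₀ ^ (j * T) ≤ K₀ ^ (5 * T) := pow_le_pow_right₀ (by linarith) (by gcongr)
    gcongr
  -- characteristic polynomial at mh
  have hchar : (mh ^ 2 - tr2 M * mh + det2 M) * w 1 = - (M (0, 1)).1 * (w T - mh * w 0) := by
    have h1 := hwt T le_rfl
    rw [hwT, ← hF, ← hMdef, clm2_apply] at h1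
    have e1 := congrArg Prod.fst h1
    have e2 := congrArg Prod.snd h1
    simp only at e1 e2
    rw [← e2, tr2, det2]
    linear_combination (mh - (M (0,1)).2) * (-e1)
  have hM12 : ‖(M (0, 1)).1‖ ≤ K₀ ^ T := by
    have e01 : ‖((0 : ℂ), (1 : ℂ))‖ = 1 := by simp [Prod.norm_def]
    have := M.le_opNorm (0, 1)
    rw [e01, mul_one] at this
    exact (norm_fst_le _).trans (this.trans hM)
  have hw1' : 0 < ‖w 1‖ := norm_pos_iff.2 hw1
  have hcb : ‖mh ^ 2 - tr2 M * mh + det2 M‖ ≤ K₀ ^ T * ε := by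
    have := congrArg norm hchar
    rw [norm_mul, norm_mul, norm_neg] at this
    rw [hε, ← mul_div_assoc, le_div_iff₀ hw1', this]
    gcongr
  have hcb' : K₀ ^ T * ε ≤ ‖mh‖ := by
    refine le_trans ?_ hs2
    gcongr
    have := hpow 1 (by norm_num)
    rw [one_mul] at this
    have : 0 ≤ K₀ ^ T := by positivity
    linarith
  have htr : ‖mh‖ - 2 ≤ ‖tr2 M‖ := by
    have h1 : ‖mh‖ * ‖mh‖ ≤ ‖tr2 M‖ * ‖mh‖ + 1 + ‖mh‖ := by
      have e : mh * mh = tr2 M * mh - det2 M + (mh ^ 2 - tr2 M * mh + det2 M) := by ring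
      have := congrArg norm e
      rw [norm_mul] at this
      rw [this, ← norm_mul (tr2 M)]
      refine (norm_add_le _ _).trans ?_
      refine add_le_add ((norm_sub_le _ _).trans ?_) (hcb.trans hcb')
      gcongr
    by_contra hcon
    push Not at hcon
    nlinarith
  have hone : 1 ≤ ‖1 - tr2 M + det2 M‖ := by
    have e : tr2 M = 1 + det2 M - (1 - tr2 M + det2 M) := by ring
    have h1 : ‖tr2 M‖ ≤ 1 + 1 + ‖1 - tr2 M + det2 M‖ := by
      conv_lhs => rw [e]
      refine (norm_sub_le _ _).trans ?_
      gcongr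
      refine (norm_add_le _ _).trans ?_
      rw [norm_one]; gcongr
    linarith
  have hk0 : (0 : ℝ) < K₀ ^ T := by positivity
  obtain ⟨q, hq1, hq2⟩ := exists_fixed (henonMap_iter_differentiable d a c T) P (K₀ ^ T) (K₀ ^ (3 * T)) (K₀ ^ T)⁻¹
    hk2 (by positivity) hM (fun y hy => b2 y hy P hPm) hone
    (by
      rw [← hF, hFP, ← one_div, le_div_iff₀ hk0]
      refine le_trans ?_ hs1
      have := hpow 2 (by norm_num)
      have h2 : K₀ ^ (2 * T) = K₀ ^ T * K₀ ^ T := by ring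
      calc 8 * K₀ ^ T * Δ * K₀ ^ T = (8 * K₀ ^ (2 * T)) * Δ := by rw [h2]; ring
        _ ≤ (4 * K₀) ^ (5 * T) * Δ := by
          gcongr; have : 0 ≤ K₀ ^ (2 * T) := by positivity
          linarith)
    (by
      rw [← hF, hFP]
      refine le_trans ?_ hs1
      have := hpow 5 (by norm_num)
      calc 64 * (K₀ ^ T) ^ 2 * K₀ ^ (3 * T) * Δ = (64 * K₀ ^ (5 * T)) * Δ := by ring
        _ ≤ (4 * K₀) ^ (5 * T) * Δ := by
          gcongr; have : 0 ≤ K₀ ^ (5 * T) := by positivity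
          linarith)
  rw [← hF, hFP] at hq1
  have hqm : q ∈ Metric.closedBall P (K₀^T)⁻¹ := by
    rw [mem_closedBall_iff_norm]
    refine hq1.trans ?_
    rw [← one_div, le_div_iff₀ hk0]
    refine le_trans ?_ hs1
    have := hpow 2 (by norm_num)
    have h2 : K₀ ^ (2 * T) = K₀ ^ T * K₀ ^ T := by ring
    calc 8 * K₀ ^ T * Δ * K₀ ^ T = (8 * K₀ ^ (2 * T)) * Δ := by rw [h2]; ring
      _ ≤ (4 * K₀) ^ (5 * T) * Δ := by
        gcongr; have : 0 ≤ K₀ ^ (2 * T) := by positivity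
        linarith
  set M' := fderiv ℂ F q with hM'def
  have hdet' : det2 M' = det2 M := by rw [hdet]; exact det2_iter d a c T q
  obtain ⟨μ, hμ1, hμ2⟩ := exists_close_root (tr2 M') (det2 M') mh
  refine ⟨μ, MultChain.of_fixed hT hq2 (eigen_of_char _ _ hμ1), hμ2.trans ?_⟩
  have htd : ‖tr2 M - tr2 M'‖ ≤ 16 * K₀ ^ (4 * T) * Δ := by
    refine (tr2_sub_le M M').trans ?_
    rw [norm_sub_rev]
    calc 2 * ‖M' - M‖ ≤ 2 * (K₀ ^ (3 * T) * (8 * K₀ ^ T * Δ)) := by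
          gcongr; exact (b2 q hqm P hPm).trans (by gcongr)
      _ = _ := by ring
  have e : mh ^ 2 - tr2 M' * mh + det2 M' = (mh ^ 2 - tr2 M * mh + det2 M) + (tr2 M - tr2 M') * mh := by
    rw [hdet']; ring
  rw [e]
  calc ‖(mh ^ 2 - tr2 M * mh + det2 M) + (tr2 M - tr2 M') * mh‖
      ≤ K₀ ^ T * ε + (16 * K₀ ^ (4 * T) * Δ) * ‖mh‖ := by
        refine (norm_add_le _ _).trans ?_
        rw [norm_mul]; gcongr
    _ ≤ (4 * K₀) ^ (5 * T) * ε + ((4 * K₀) ^ (5 * T) * Δ) * ‖mh‖ := by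
        have h1 := hpow 1 (by norm_num)
        have h4 := hpow 4 (by norm_num)
        rw [one_mul] at h1
        have : 0 ≤ K₀ ^ (4 * T) := by positivity
        gcongr
        · linarith
        · linarith
    _ = _ := by ring

end HenonML
end

section
namespace HenonML

/-- Taylor coefficient at 0 -/
def tc (f : ℂ → ℂ) (i : ℕ) : ℂ := (i.factorial : ℂ)⁻¹ * iteratedDeriv i f 0

lemma tc_bound {f : ℂ → ℂ} {R M : ℝ} (hR : 0 < R) (hf : DifferentiableOn ℂ f (Metric.ball 0 R))
    (hM : ∀ s ∈ Metric.ball (0:ℂ) R, ‖f s‖ ≤ M) (i : ℕ) : ‖tc f i‖ ≤ M / R ^ i := by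
  have key : ∀ r ∈ Ioo 0 R, ‖tc f i‖ ≤ M / r ^ i := by
    intro r hr
    have hsub : Metric.closedBall (0:ℂ) r ⊆ Metric.ball 0 R := Metric.closedBall_subset_ball hr.2
    have hd : DiffContOnCl ℂ f (Metric.ball 0 r) := (hf.mono hsub).diffContOnCl_ball subset_rfl
    have h := Complex.norm_iteratedDeriv_le_of_forall_mem_sphere_norm_le i hr.1 hd
      (fun z hz => hM z (hsub (Metric.sphere_subset_closedBall hz)))
    rw [tc, norm_mul, norm_inv, Complex.norm_natCast]
    have hfac : (0:ℝ) < i.factorial := by exact_mod_cast i.factorial_pos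
    rw [inv_mul_le_iff₀ hfac, ← mul_div_assoc]
    exact h
  have h2 : Tendsto (fun r : ℝ => M / r ^ i) (𝓝[<] R) (𝓝 (M / R ^ i)) := by
    apply Tendsto.mono_left _ nhdsWithin_le_nhds
    have : ContinuousAt (fun r : ℝ => M / r ^ i) R := by
      apply ContinuousAt.div continuousAt_const (continuousAt_id.pow i) (pow_ne_zero _ hR.ne')
    exact this
  refine ge_of_tendsto h2 ?_
  filter_upwards [Ioo_mem_nhdsLT hR] with r hr using key r hr

lemma tc_hasSum {f : ℂ → ℂ} {R : ℝ} (hf : DifferentiableOn ℂ f (Metric.ball 0 R)) {s : ℂ} (hs : s ∈ Metric.ball (0:ℂ) R) :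
    HasSum (fun i => tc f i * s ^ i) (f s) := by
  have := Complex.hasSum_taylorSeries_on_ball hf hs
  refine this.congr_fun ?_ |> fun h => h
  intro i
  simp only [tc, sub_zero, smul_eq_mul]; ring

lemma tl_bound {f : ℂ → ℂ} {R M : ℝ} (hR : 0 < R) (hf : DifferentiableOn ℂ f (Metric.ball 0 R))
    (hM : ∀ s ∈ Metric.ball (0:ℂ) R, ‖f s‖ ≤ M) (q : ℕ) {s : ℂ} (hs : ‖s‖ ≤ R / 2) :
    ‖f s - ∑ i ∈ Finset.range q, tc f i * s ^ i‖ ≤ 2 * M * (‖s‖ / R) ^ q := by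
  have hsb : s ∈ Metric.ball (0:ℂ) R := by rw [mem_ball_zero_iff]; linarith
  have hM0 : 0 ≤ M := (norm_nonneg _).trans (hM 0 (Metric.mem_ball_self hR))
  have h := tc_hasSum hf hsb
  have h1 := h.summable.sum_add_tsum_nat_add q
  rw [h.tsum_eq] at h1
  have e : f s - ∑ i ∈ Finset.range q, tc f i * s ^ i = ∑' i, tc f (i + q) * s ^ (i + q) := by
    rw [← h1]; ring
  rw [e]
  set x := ‖s‖ / R with hx
  have hx0 : 0 ≤ x := by positivity
  have hx1 : x ≤ 1/2 := by rw [hx, div_le_iff₀ hR]; linarith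
  have hb : ∀ i, ‖tc f (i + q) * s ^ (i + q)‖ ≤ (M * x ^ q) * (1/2) ^ i := by
    intro i
    rw [norm_mul, norm_pow]
    calc ‖tc f (i+q)‖ * ‖s‖ ^ (i+q) ≤ M / R ^ (i+q) * ‖s‖ ^ (i+q) := by
          gcongr; exact tc_bound hR hf hM _
      _ = M * x ^ q * x ^ i := by rw [hx, div_pow, div_pow]; field_simp; ring
      _ ≤ _ := by gcongr
  have hg : HasSum (fun i : ℕ => (M * x ^ q) * (1/2 : ℝ) ^ i) ((M * x ^ q) * 2) := hasSum_geometric_two.mul_left _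
  refine (tsum_of_norm_bounded hg hb).trans (le_of_eq (by ring))

/-- limiting jets -/
def jetLim (H : ℕ → ℂ → ℂ) (i : ℕ) : ℂ := tc (H 0) i + ∑' j, tc (fun s => H (j+1) s - H j s) i

section jet
variable {H : ℕ → ℂ → ℂ} {r κ M η : ℝ} {q : ℕ}

lemma jet_tail (hr : 0 < r) (hκ : 1 < κ) (hη : 0 < η)
    (hH : ∀ n, DifferentiableOn ℂ (H n) (Metric.ball 0 (r / κ ^ n)))
    (hD : ∀ n, ∀ s ∈ Metric.ball (0:ℂ) (r / κ ^ (n+1)), ‖H (n+1) s - H n s‖ ≤ M * η ^ (n+1))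
    (i : ℕ) (hq : η * κ ^ i ≤ 1/2) :
    Summable (fun j => tc (fun s => H (j+1) s - H j s) i) ∧
    ∀ n, ‖∑' j, tc (fun s => H (j+n+1) s - H (j+n) s) i‖ ≤ M * η ^ n * (κ ^ n / r) ^ i * (2 * (η * κ ^ i)) := by
  have hM0 : 0 ≤ M := by
    have h := (norm_nonneg _).trans (hD 0 0 (Metric.mem_ball_self (by positivity)))
    simp only [zero_add, pow_one] at h
    exact nonneg_of_mul_nonneg_left h hη
  have hb : ∀ j, ‖tc (fun s => H (j+1) s - H j s) i‖ ≤ M * η ^ (j+1) / (r / κ ^ (j+1)) ^ i := by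
    intro j
    apply tc_bound (by positivity)
    · refine (hH (j+1)).sub ((hH j).mono (Metric.ball_subset_ball ?_))
      gcongr
      · exact hκ.le
      · omega
    · exact hD j
  have hb' : ∀ n j, ‖tc (fun s => H (j+n+1) s - H (j+n) s) i‖ ≤
      (M * η ^ n * (κ ^ n / r) ^ i * (η * κ ^ i)) * (1/2) ^ j := by
    intro n j
    refine (hb (j+n)).trans ?_
    have e : M * η ^ (j+n+1) / (r / κ ^ (j+n+1)) ^ i = (M * η ^ n * (κ ^ n / r) ^ i * (η * κ ^ i)) * (η * κ ^ i) ^ j := by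
      rw [div_pow, div_pow]; field_simp; ring
    rw [e]
    gcongr
  have hg : ∀ C : ℝ, HasSum (fun j : ℕ => C * (1/2 : ℝ) ^ j) (C * 2) := fun C => hasSum_geometric_two.mul_left _
  constructor
  · have := hb' 0
    simp only [add_zero] at this
    exact Summable.of_norm_bounded (hg _).summable this
  · intro n
    exact (tsum_of_norm_bounded (hg _) (hb' n)).trans (le_of_eq (by ring))

lemma jet_zero (hr : 0 < r) (hκ : 1 < κ) (hη : 0 < η)
    (hH : ∀ n, DifferentiableOn ℂ (H n) (Metric.ball 0 (r / κ ^ n)))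
    (hD : ∀ n, ∀ s ∈ Metric.ball (0:ℂ) (r / κ ^ (n+1)), ‖H (n+1) s - H n s‖ ≤ M * η ^ (n+1))
    (i : ℕ) (hq : η * κ ^ i ≤ 1/2) :
    ‖jetLim H i - tc (H 0) i‖ ≤ 2 * M * η * (κ / r) ^ i := by
  have h := (jet_tail hr hκ hη hH hD i hq).2 0
  simp only [add_zero] at h
  rw [jetLim, add_sub_cancel_left]
  refine h.trans (le_of_eq ?_)
  simp only [pow_zero, div_pow, one_pow]; ring

lemma jet_main (hr : 0 < r) (hκ : 1 < κ) (hη : 0 < η)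
    (hH : ∀ n, DifferentiableOn ℂ (H n) (Metric.ball 0 (r / κ ^ n)))
    (h0 : ∀ s ∈ Metric.ball (0:ℂ) r, ‖H 0 s‖ ≤ M)
    (hD : ∀ n, ∀ s ∈ Metric.ball (0:ℂ) (r / κ ^ (n+1)), ‖H (n+1) s - H n s‖ ≤ M * η ^ (n+1))
    (hq : η * κ ^ q ≤ 1/2) (n : ℕ) (s : ℂ) (hs : ‖s‖ ≤ r / κ ^ n / 2) :
    ‖H n s - ∑ i ∈ Finset.range q, jetLim H i * s ^ i‖ ≤ M * (4 * (‖s‖ / r) ^ q + 2 * η ^ n) := by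
  have hM0 : 0 ≤ M := (norm_nonneg _).trans (h0 0 (Metric.mem_ball_self hr))
  set D : ℕ → ℂ → ℂ := fun j s => H (j+1) s - H j s with hDdef
  have hκ0 : 0 < κ := by linarith
  have hi : ∀ i ∈ Finset.range q, η * κ ^ i ≤ 1/2 := by
    intro i hi
    refine le_trans ?_ hq
    gcongr
    · exact hκ.le
    · exact (Finset.mem_range.1 hi).le
  have htel : H n s = H 0 s + ∑ j ∈ Finset.range n, D j s := by
    rw [Finset.sum_range_sub (fun j => H j s)]; ring
  have hjl : ∀ i ∈ Finset.range q, jetLim H i = tc (H 0) i + ∑ j ∈ Finset.range n, tc (D j) i +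
      ∑' j, tc (fun s => H (j+n+1) s - H (j+n) s) i := by
    intro i hi'
    have := ((jet_tail hr hκ hη hH hD i (hi i hi')).1).sum_add_tsum_nat_add n
    rw [jetLim, ← this]; ring
  have e : H n s - ∑ i ∈ Finset.range q, jetLim H i * s ^ i =
      (H 0 s - ∑ i ∈ Finset.range q, tc (H 0) i * s ^ i) +
      ∑ j ∈ Finset.range n, (D j s - ∑ i ∈ Finset.range q, tc (D j) i * s ^ i) -
      ∑ i ∈ Finset.range q, (∑' j, tc (fun s => H (j+n+1) s - H (j+n) s) i) * s ^ i := by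
    have h1 : ∑ i ∈ Finset.range q, jetLim H i * s ^ i = ∑ i ∈ Finset.range q, tc (H 0) i * s ^ i +
        ∑ j ∈ Finset.range n, ∑ i ∈ Finset.range q, tc (D j) i * s ^ i +
        ∑ i ∈ Finset.range q, (∑' j, tc (fun s => H (j+n+1) s - H (j+n) s) i) * s ^ i := by
      rw [Finset.sum_comm, ← Finset.sum_add_distrib, ← Finset.sum_add_distrib]
      refine Finset.sum_congr rfl fun i hi' => ?_
      rw [hjl i hi', add_mul, add_mul, Finset.sum_mul]
    have h2 : ∑ j ∈ Finset.range n, (D j s - ∑ i ∈ Finset.range q, tc (D j) i * s ^ i) =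
        ∑ j ∈ Finset.range n, D j s - ∑ j ∈ Finset.range n, ∑ i ∈ Finset.range q, tc (D j) i * s ^ i :=
      Finset.sum_sub_distrib _ _
    rw [h1, htel, h2]
    generalize ∑ j ∈ Finset.range n, D j s = X1
    generalize ∑ j ∈ Finset.range n, ∑ i ∈ Finset.range q, tc (D j) i * s ^ i = X2
    generalize ∑ i ∈ Finset.range q, (∑' j, tc (fun s => H (j+n+1) s - H (j+n) s) i) * s ^ i = X3
    ring
  rw [e]
  have hκn : ∀ j ≤ n, κ ^ j ≤ κ ^ n := fun j hj => pow_le_pow_right₀ hκ.le hj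
  have b1 : ‖H 0 s - ∑ i ∈ Finset.range q, tc (H 0) i * s ^ i‖ ≤ 2 * M * (‖s‖ / r) ^ q := by
    apply tl_bound hr (by simpa using hH 0) h0
    refine hs.trans ?_
    gcongr
    exact div_le_self hr.le (one_le_pow₀ hκ.le)
  have b2 : ∀ j ∈ Finset.range n, ‖D j s - ∑ i ∈ Finset.range q, tc (D j) i * s ^ i‖ ≤
      (M * (‖s‖ / r) ^ q) * (1/2) ^ j := by
    intro j hj
    have h := tl_bound (f := D j) (R := r / κ ^ (j+1)) (M := M * η ^ (j+1)) (by positivity)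
      ((hH (j+1)).sub ((hH j).mono (Metric.ball_subset_ball (by gcongr; exact hκ.le; omega)))) (hD j) q (s := s)
      (hs.trans (by gcongr; exact hκ.le; exact Finset.mem_range.1 hj))
    refine h.trans ?_
    have e2 : 2 * (M * η ^ (j+1)) * (‖s‖ / (r / κ ^ (j+1))) ^ q = (M * (‖s‖ / r) ^ q) * (2 * (η * κ ^ q) * (η * κ ^ q) ^ j) := by
      rw [div_pow, div_pow, div_pow]; field_simp; ring
    rw [e2]
    gcongr
    calc 2 * (η * κ ^ q) * (η * κ ^ q) ^ j ≤ 1 * (1/2) ^ j := by gcongr; linarith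
      _ = _ := one_mul _
  have b2' : ‖∑ j ∈ Finset.range n, (D j s - ∑ i ∈ Finset.range q, tc (D j) i * s ^ i)‖ ≤ 2 * M * (‖s‖ / r) ^ q := by
    refine (norm_sum_le_of_le _ b2).trans ?_
    rw [← Finset.mul_sum]
    have : ∑ j ∈ Finset.range n, (1/2 : ℝ) ^ j ≤ 2 := by
      have := summable_geometric_two.sum_le_tsum (Finset.range n) (fun i _ => by positivity)
      rwa [tsum_geometric_two] at this
    calc (M * (‖s‖ / r) ^ q) * ∑ j ∈ Finset.range n, (1/2 : ℝ) ^ j ≤ (M * (‖s‖ / r) ^ q) * 2 := by gcongr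
      _ = _ := by ring
  have b3 : ∀ i ∈ Finset.range q, ‖(∑' j, tc (fun s => H (j+n+1) s - H (j+n) s) i) * s ^ i‖ ≤
      (M * η ^ n) * (1/2) ^ i := by
    intro i hi'
    rw [norm_mul, norm_pow]
    calc _ ≤ (M * η ^ n * (κ ^ n / r) ^ i * 1) * (r / κ ^ n / 2) ^ i := by
          gcongr
          refine ((jet_tail hr hκ hη hH hD i (hi i hi')).2 n).trans ?_
          have := hi i hi'
          gcongr
          linarith
      _ = _ := by rw [mul_one, mul_assoc, ← mul_pow]; congr 2; field_simp
  have b3' : ‖∑ i ∈ Finset.range q, (∑' j, tc (fun s => H (j+n+1) s - H (j+n) s) i) * s ^ i‖ ≤ M * (2 * η ^ n) := by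
    refine (norm_sum_le_of_le _ b3).trans ?_
    rw [← Finset.mul_sum]
    have : ∑ j ∈ Finset.range q, (1/2 : ℝ) ^ j ≤ 2 := by
      have := summable_geometric_two.sum_le_tsum (Finset.range q) (fun i _ => by positivity)
      rwa [tsum_geometric_two] at this
    calc (M * η ^ n) * ∑ j ∈ Finset.range q, (1/2 : ℝ) ^ j ≤ (M * η ^ n) * 2 := by gcongr
      _ = _ := by ring
  refine (norm_sub_le _ _).trans ((add_le_add ((norm_add_le _ _).trans (add_le_add b1 b2')) b3').trans (le_of_eq ?_))
  ring

end jet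

end HenonML
end

section
namespace HenonML

lemma near_linear_bound {Φ : ℂ → ℂ} {Ω : Set ℂ} (hΩ : IsOpen Ω) (hc : Convex ℝ Ω) (hΦ : DifferentiableOn ℂ Φ Ω) {α : ℂ} {k : ℝ}
    (hα : ∀ z ∈ Ω, ‖deriv Φ z - α‖ ≤ k) {x y : ℂ} (hx : x ∈ Ω) (hy : y ∈ Ω) :
    ‖(Φ x - Φ y) - α * (x - y)‖ ≤ k * ‖x - y‖ := by
  have := hc.norm_image_sub_le_of_norm_hasDerivWithin_le (f := fun z => Φ z - α * z) (f' := fun z => deriv Φ z - α)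
    (fun z hz => ((((hΦ.differentiableAt (hΩ.mem_nhds hz)).hasDerivAt).sub
      (by simpa using (hasDerivAt_id z).const_mul α)).hasDerivWithinAt)) hα hy hx
  calc _ = ‖(Φ x - α * x) - (Φ y - α * y)‖ := by congr 1; ring
    _ ≤ _ := this

lemma near_linear_inj {Φ : ℂ → ℂ} {Ω : Set ℂ} (hΩ : IsOpen Ω) (hc : Convex ℝ Ω) (hΦ : DifferentiableOn ℂ Φ Ω) {α : ℂ} (hα0 : α ≠ 0)
    (hα : ∀ z ∈ Ω, ‖deriv Φ z - α‖ ≤ ‖α‖ / 2) : InjOn Φ Ω := by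
  intro x hx y hy h
  have := near_linear_bound hΩ hc hΦ hα hx hy
  rw [h, sub_self, zero_sub, norm_neg, norm_mul] at this
  have ha := norm_pos_iff.2 hα0
  have : ‖x - y‖ ≤ 0 := by
    by_contra hcon
    push Not at hcon
    nlinarith
  exact sub_eq_zero.1 (norm_le_zero_iff.1 this)

lemma inv_lemma {Φ h : ℂ → ℂ} {Ω V : Set ℂ} (hΩ : IsOpen Ω) (hc : Convex ℝ Ω) (hV : IsOpen V)
    (hΦ : DifferentiableOn ℂ Φ Ω) (hh : DifferentiableOn ℂ h V) {α : ℂ} (hα0 : α ≠ 0)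
    (hα : ∀ z ∈ Ω, ‖deriv Φ z - α‖ ≤ ‖α‖ / 2) (b : ℂ → ℂ) (ρ : ℂ → ℝ) (hρ : ∀ s ∈ V, 0 ≤ ρ s)
    (hsub : ∀ s ∈ V, Metric.closedBall (b s) (ρ s) ⊆ Ω) (hb : ∀ s ∈ V, ‖h s - Φ (b s)‖ ≤ ‖α‖ * ρ s / 2) :
    ∃ G : ℂ → ℂ, DifferentiableOn ℂ G V ∧ (∀ s ∈ V, G s ∈ Metric.closedBall (b s) (ρ s)) ∧ ∀ s ∈ V, Φ (G s) = h s := by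
  have ha := norm_pos_iff.2 hα0
  have ex : ∀ s : ℂ, ∃ y : ℂ, s ∈ V → y ∈ Metric.closedBall (b s) (ρ s) ∧ Φ y = h s := by
    intro s
    by_cases hs : s ∈ V
    swap
    · exact ⟨0, fun h => absurd h hs⟩
    obtain ⟨y, hy, hfix⟩ := ball_fixed (fun y => y - α⁻¹ * (Φ y - h s)) (b s) (ρ s) (hρ s hs) (by
      intro x hx y hy
      have := near_linear_bound hΩ hc hΦ hα (hsub s hs hx) (hsub s hs hy)
      have e : (x - α⁻¹ * (Φ x - h s)) - (y - α⁻¹ * (Φ y - h s)) = - (α⁻¹ * ((Φ x - Φ y) - α * (x - y))) := by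
        field_simp; ring
      rw [e, norm_neg, norm_mul, norm_inv, inv_mul_le_iff₀ ha]
      linarith) (by
      have := hb s hs
      simp only [sub_sub_cancel_left, norm_neg]
      rw [norm_mul, norm_inv, inv_mul_le_iff₀ ha, norm_sub_rev]
      linarith)
    refine ⟨y, fun _ => ⟨hy, ?_⟩⟩
    have h1 : α⁻¹ * (Φ y - h s) = 0 := by simpa using hfix
    rcases mul_eq_zero.1 h1 with h2 | h2
    · exact absurd h2 (inv_ne_zero hα0)
    · exact sub_eq_zero.1 h2
  choose G hG using ex
  refine ⟨G, ?_, fun s hs => (hG s hs).1, fun s hs => (hG s hs).2⟩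
  intro s0 hs0
  have hy0 : G s0 ∈ Ω := hsub s0 hs0 (hG s0 hs0).1
  have hd0 : deriv Φ (G s0) ≠ 0 := by
    intro h0
    have := hα _ hy0
    rw [h0, zero_sub, norm_neg] at this
    linarith
  have hst : HasStrictDerivAt Φ (deriv Φ (G s0)) (G s0) :=
    ((hΦ.analyticAt (hΩ.mem_nhds hy0)).hasStrictDerivAt)
  set g := hst.localInverse Φ _ _ hd0 with hg
  have hgd : HasStrictDerivAt g (deriv Φ (G s0))⁻¹ (Φ (G s0)) := hst.to_localInverse hd0
  have hgr : ∀ᶠ w in 𝓝 (Φ (G s0)), Φ (g w) = w :=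
    (hst.hasStrictFDerivAt_equiv hd0).eventually_right_inverse
  have hg0 : g (Φ (G s0)) = G s0 := (hst.hasStrictFDerivAt_equiv hd0).localInverse_apply_image
  rw [(hG s0 hs0).2] at hgd hgr hg0
  have hhd : DifferentiableAt ℂ h s0 := hh.differentiableAt (hV.mem_nhds hs0)
  have hcomp : DifferentiableAt ℂ (fun s => g (h s)) s0 := hgd.hasDerivAt.differentiableAt.comp s0 hhd
  have hev : G =ᶠ[𝓝 s0] fun s => g (h s) := by
    have h1 : ∀ᶠ s in 𝓝 s0, Φ (g (h s)) = h s := hhd.continuousAt.eventually hgr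
    have h2 : ∀ᶠ s in 𝓝 s0, g (h s) ∈ Ω :=
      hcomp.continuousAt.eventually (hΩ.mem_nhds (by show g (h s0) ∈ Ω; rw [hg0]; exact hy0))
    filter_upwards [h1, h2, hV.mem_nhds hs0] with s h1 h2 hs
    apply near_linear_inj hΩ hc hΦ hα0 hα (hsub s hs (hG s hs).1) h2
    rw [h1, (hG s hs).2]
  exact (hev.differentiableAt_iff.2 hcomp).differentiableWithinAt

lemma cauchy_deriv {f : ℂ → ℂ} {R r M : ℝ} (hrR : r < R) (hf : DifferentiableOn ℂ f (Metric.ball 0 R))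
    (hM : ∀ s ∈ Metric.ball (0:ℂ) R, ‖f s‖ ≤ M) {y : ℂ} (hy : y ∈ Metric.ball (0:ℂ) r) :
    ‖deriv f y‖ ≤ M / (R - r) := by
  have hsub : Metric.closedBall y (R - r) ⊆ Metric.ball 0 R := by
    intro z hz
    rw [mem_ball_zero_iff] at hy ⊢
    have := mem_closedBall_iff_norm.1 hz
    calc ‖z‖ = ‖y + (z - y)‖ := by congr 1; ring
      _ ≤ ‖y‖ + ‖z - y‖ := norm_add_le _ _
      _ < R := by linarith
  exact Complex.norm_deriv_le_of_forall_mem_sphere_norm_le (by linarith)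
    ((hf.mono hsub).diffContOnCl_ball subset_rfl) (fun z hz => hM z (hsub (Metric.sphere_subset_closedBall hz)))

lemma p5_step {a : ℂ} {P : ℂ → ℂ} {Z₀ Z₁ Z₂ : ℂ → ℂ} {r r' B U D v : ℝ} (hr' : 0 < r') (hr : r' < r) (hB : 1 ≤ B) (hv : 0 < v)
    (hd0 : Differentiable ℂ Z₀) (hd1 : Differentiable ℂ Z₁) (hd2 : Differentiable ℂ Z₂)
    (hrec : ∀ u, Z₂ u = a * Z₀ u + P (Z₁ u))
    (h1 : ∀ s, ‖s‖ < r → ‖deriv Z₁ s‖ ≤ 2 * B * v)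
    (h2 : ∀ s, ‖s‖ < r → ‖deriv Z₂ s - deriv Z₂ 0‖ ≤ ‖deriv Z₂ 0‖ / 4)
    (h2' : v / B ≤ ‖deriv Z₂ 0‖)
    {G : ℂ → ℂ} (hG : DifferentiableOn ℂ G (Metric.ball 0 r)) (hGZ : ∀ s ∈ Metric.ball (0:ℂ) r, Z₁ (G s) = Z₁ s)
    (hGU : ∀ s ∈ Metric.ball (0:ℂ) r, ‖G s‖ ≤ U) (hGD : ∀ s ∈ Metric.ball (0:ℂ) r, ‖Z₀ (G s) - Z₀ s‖ ≤ D)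
    (hsm : 8 * B * ‖a‖ * D ≤ v * (r - r')) :
    ∃ G' : ℂ → ℂ, DifferentiableOn ℂ G' (Metric.ball 0 r') ∧ (∀ s ∈ Metric.ball (0:ℂ) r', Z₂ (G' s) = Z₂ s) ∧
      (∀ s ∈ Metric.ball (0:ℂ) r', ‖G' s‖ ≤ U) ∧ (∀ s ∈ Metric.ball (0:ℂ) r', ‖Z₁ (G' s) - Z₁ s‖ ≤ 4 * B ^ 2 * ‖a‖ * D) ∧
      ∀ s ∈ Metric.ball (0:ℂ) r', ‖G' s - G s‖ ≤ 4 * U * B / (v * (r - r')) * ‖a‖ * D := by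
  have hD0 : 0 ≤ D := (norm_nonneg _).trans (hGD 0 (Metric.mem_ball_self (by linarith)))
  have hU0 : 0 ≤ U := (norm_nonneg _).trans (hGU 0 (Metric.mem_ball_self (by linarith)))
  set α := deriv Z₂ 0 with hα
  have hαp : 0 < ‖α‖ := lt_of_lt_of_le (by positivity) h2'
  have hα0 : α ≠ 0 := norm_pos_iff.1 hαp
  set m := (r + r') / 2 with hm
  have hmr : m < r := by linarith
  have hsubm : Metric.ball (0:ℂ) m ⊆ Metric.ball 0 r := Metric.ball_subset_ball hmr.le
  set Δ : ℂ → ℂ := fun s => Z₀ (G s) - Z₀ s with hΔ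
  have hΔd : DifferentiableOn ℂ Δ (Metric.ball 0 r) :=
    (hd0.comp_differentiableOn hG).sub hd0.differentiableOn
  set ρ : ℝ := 2 * ‖a‖ * D / ‖α‖ with hρ
  have hρ0 : 0 ≤ ρ := by positivity
  have hρb : ρ ≤ 2 * B * ‖a‖ * D / v := by
    rw [hρ, div_le_div_iff₀ hαp hv]
    rw [div_le_iff₀ (by linarith)] at h2'
    have : 0 ≤ 2 * ‖a‖ * D := by positivity
    nlinarith
  have hρm : ρ ≤ (r - r') / 4 := by
    refine hρb.trans ?_
    rw [div_le_iff₀ hv]; linarith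
  obtain ⟨τ, t1, t2, t3⟩ := inv_lemma (Φ := fun y => Z₂ y + a * Δ y) (h := Z₂) (Ω := Metric.ball 0 m) (V := Metric.ball 0 r')
    Metric.isOpen_ball (convex_ball _ _) Metric.isOpen_ball
    (hd2.differentiableOn.add ((hΔd.mono hsubm).const_mul a)) hd2.differentiableOn hα0 (by
      intro z hz
      have hda : DifferentiableAt ℂ Δ z := hΔd.differentiableAt (Metric.isOpen_ball.mem_nhds (hsubm hz))
      have e : deriv (fun y => Z₂ y + a * Δ y) z = deriv Z₂ z + a * deriv Δ z := by
        rw [deriv_fun_add hd2.differentiableAt (hda.const_mul a), deriv_const_mul_field]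
      have c1 := h2 z (by simpa using hsubm hz)
      have c2 := cauchy_deriv hmr hΔd hGD hz
      have c3 : ‖a * deriv Δ z‖ ≤ ‖α‖ / 4 := by
        rw [norm_mul]
        calc ‖a‖ * ‖deriv Δ z‖ ≤ ‖a‖ * (D / (r - m)) := by gcongr
          _ ≤ v / B / 4 := by
            have : r - m = (r - r') / 2 := by rw [hm]; ring
            rw [this, div_div, ← mul_div_assoc, div_le_div_iff₀ (by linarith) (by linarith)]
            linarith
          _ ≤ _ := by gcongr
      rw [e]
      calc ‖deriv Z₂ z + a * deriv Δ z - α‖ = ‖(deriv Z₂ z - α) + a * deriv Δ z‖ := by congr 1; ring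
        _ ≤ ‖α‖ / 4 + ‖α‖ / 4 := (norm_add_le _ _).trans (add_le_add c1 c3)
        _ = _ := by ring)
    (fun s => s) (fun _ => ρ) (fun _ _ => hρ0) (by
      intro s hs z hz
      rw [mem_ball_zero_iff] at hs ⊢
      have := mem_closedBall_iff_norm.1 hz
      calc ‖z‖ = ‖s + (z - s)‖ := by congr 1; ring
        _ ≤ ‖s‖ + ‖z - s‖ := norm_add_le _ _
        _ < m := by rw [hm]; linarith) (by
      intro s hs
      have := hGD s (Metric.ball_subset_ball hr.le hs)
      simp only [sub_add_cancel_left, norm_neg, norm_mul]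
      have e : ‖α‖ * ρ / 2 = ‖a‖ * D := by rw [hρ]; field_simp
      rw [e]; gcongr)
  have hτm : ∀ s ∈ Metric.ball (0:ℂ) r', τ s ∈ Metric.ball (0:ℂ) m := by
    intro s hs
    have := mem_closedBall_iff_norm.1 (t2 s hs)
    rw [mem_ball_zero_iff] at hs ⊢
    calc ‖τ s‖ = ‖s + (τ s - s)‖ := by congr 1; ring
      _ ≤ ‖s‖ + ‖τ s - s‖ := norm_add_le _ _
      _ < m := by rw [hm]; linarith
  have hsm' : ∀ s ∈ Metric.ball (0:ℂ) r', s ∈ Metric.ball (0:ℂ) m := 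
    fun s hs => Metric.ball_subset_ball (by rw [hm]; linarith) hs
  refine ⟨G ∘ τ, ?_, ?_, ?_, ?_, ?_⟩
  · exact hG.comp t1 (fun s hs => hsubm (hτm s hs))
  · intro s hs
    have := t3 s hs
    rw [← this]
    simp only [comp_apply, hΔ]
    rw [hrec (G (τ s)), hrec (τ s), hGZ _ (hsubm (hτm s hs))]; ring
  · intro s hs; exact hGU _ (hsubm (hτm s hs))
  · intro s hs
    simp only [comp_apply]
    rw [hGZ _ (hsubm (hτm s hs))]
    have := (convex_ball (0:ℂ) m).norm_image_sub_le_of_norm_deriv_le (f := Z₁) (C := 2 * B * v)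
      (fun x _ => hd1.differentiableAt) (fun x hx => h1 x (by simpa using hsubm hx)) (hsm' s hs) (hτm s hs)
    refine this.trans ?_
    have h5 := (mem_closedBall_iff_norm.1 (t2 s hs)).trans hρb
    calc 2 * B * v * ‖τ s - s‖ ≤ 2 * B * v * (2 * B * ‖a‖ * D / v) := by gcongr
      _ = _ := by field_simp; ring
  · intro s hs
    simp only [comp_apply]
    have := (convex_ball (0:ℂ) m).norm_image_sub_le_of_norm_deriv_le (f := G) (C := U / (r - m))
      (fun x hx => hG.differentiableAt (Metric.isOpen_ball.mem_nhds (hsubm hx))) 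
      (fun x hx => cauchy_deriv hmr hG hGU hx) (hsm' s hs) (hτm s hs)
    refine this.trans ?_
    have h5 := (mem_closedBall_iff_norm.1 (t2 s hs)).trans hρb
    have h6 : r - m = (r - r') / 2 := by rw [hm]; ring
    have h7 : 0 < r - r' := by linarith
    calc U / (r - m) * ‖τ s - s‖ ≤ U / (r - m) * (2 * B * ‖a‖ * D / v) := by
          gcongr
      _ = _ := by rw [h6]; field_simp; ring

end HenonML
end

section
namespace HenonML

theorem p5 {κ0 B R U D0 : ℝ} (hκ0 : 1 < κ0) (hB : 1 ≤ B) (hR : 0 < R) (hU : 0 ≤ U) (hD0 : 0 ≤ D0) :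
    ∃ K : ℝ, 1 ≤ K ∧ ∀ (a : ℂ), K * ‖a‖ ≤ 1 → ∀ (P : ℂ → ℂ) (Z : ℕ → ℂ → ℂ) (κ : ℝ), κ0 ≤ κ →
      (∀ n, Differentiable ℂ (Z n)) → (∀ n s, Z (n+2) s = a * Z n s + P (Z (n+1) s)) →
      (∀ n s, ‖s‖ ≤ R / κ ^ n → ‖deriv (Z (n+1)) s - deriv (Z (n+1)) 0‖ ≤ ‖deriv (Z (n+1)) 0‖ / 4) →
      (∀ n, κ ^ n / B ≤ ‖deriv (Z n) 0‖) → (∀ n, ‖deriv (Z n) 0‖ ≤ B * κ ^ n) →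
      ∀ H0 : ℂ → ℂ, DifferentiableOn ℂ H0 (Metric.ball 0 (R / κ)) →
      (∀ s ∈ Metric.ball (0:ℂ) (R / κ), Z 1 (H0 s) = Z 1 s) →
      (∀ s ∈ Metric.ball (0:ℂ) (R / κ), ‖H0 s‖ ≤ U) →
      (∀ s ∈ Metric.ball (0:ℂ) (R / κ), ‖Z 0 (H0 s) - Z 0 s‖ ≤ D0) →
      ∃ H : ℕ → ℂ → ℂ, H 0 = H0 ∧ (∀ n, DifferentiableOn ℂ (H n) (Metric.ball 0 (R / κ ^ (n+1)))) ∧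
        (∀ n, ∀ s ∈ Metric.ball (0:ℂ) (R / κ ^ (n+1)), Z (n+1) (H n s) = Z (n+1) s) ∧
        (∀ n, ∀ s ∈ Metric.ball (0:ℂ) (R / κ ^ (n+1)), ‖H n s‖ ≤ U) ∧
        (∀ n, ∀ s ∈ Metric.ball (0:ℂ) (R / κ ^ (n+1)), ‖Z n (H n s) - Z n s‖ ≤ D0 * (K * ‖a‖) ^ n) ∧
        (∀ n, ∀ s ∈ Metric.ball (0:ℂ) (R / κ ^ (n+2)), ‖H (n+1) s - H n s‖ ≤ (K * ‖a‖) ^ (n+1)) := by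
  set δ := R * (1 - 1 / κ0) with hδ
  have hδ0 : 0 < δ := by
    apply mul_pos hR
    rw [sub_pos, div_lt_one (by linarith)]; exact hκ0
  set K : ℝ := 1 + 4 * B ^ 2 + 4 * U * B * D0 / δ + 8 * B * D0 / δ with hK
  have q1 : 0 ≤ 4 * U * B * D0 / δ := by positivity
  have q2 : 0 ≤ 8 * B * D0 / δ := by positivity
  have q3 : 0 ≤ 4 * B ^ 2 := by positivity
  refine ⟨K, by linarith, ?_⟩
  intro a ha P Z κ hκ hZ hrec h1 h2 h3 H0 g1 g2 g3 g4
  have hκp : 0 < κ := by linarith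
  have hκ1 : 1 < κ := by linarith
  set η := K * ‖a‖ with hη
  have hη0 : 0 ≤ η := mul_nonneg (by linarith) (norm_nonneg _)
  have step : ∀ n (G : ℂ → ℂ), (DifferentiableOn ℂ G (Metric.ball 0 (R / κ ^ (n+1))) ∧
        (∀ s ∈ Metric.ball (0:ℂ) (R / κ ^ (n+1)), Z (n+1) (G s) = Z (n+1) s) ∧
        (∀ s ∈ Metric.ball (0:ℂ) (R / κ ^ (n+1)), ‖G s‖ ≤ U) ∧
        (∀ s ∈ Metric.ball (0:ℂ) (R / κ ^ (n+1)), ‖Z n (G s) - Z n s‖ ≤ D0 * η ^ n)) →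
      ∃ G' : ℂ → ℂ, (DifferentiableOn ℂ G' (Metric.ball 0 (R / κ ^ (n+1+1))) ∧
        (∀ s ∈ Metric.ball (0:ℂ) (R / κ ^ (n+1+1)), Z (n+1+1) (G' s) = Z (n+1+1) s) ∧
        (∀ s ∈ Metric.ball (0:ℂ) (R / κ ^ (n+1+1)), ‖G' s‖ ≤ U) ∧
        (∀ s ∈ Metric.ball (0:ℂ) (R / κ ^ (n+1+1)), ‖Z (n+1) (G' s) - Z (n+1) s‖ ≤ D0 * η ^ (n+1))) ∧
        (∀ s ∈ Metric.ball (0:ℂ) (R / κ ^ (n+2)), ‖G' s - G s‖ ≤ η ^ (n+1)) := by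
    rintro n G ⟨b1, b2, b3, b4⟩
    have hv : 0 < κ ^ (n+1) := by positivity
    have hlt : R / κ ^ (n+1+1) < R / κ ^ (n+1) := by
      apply div_lt_div_of_pos_left hR hv
      exact pow_lt_pow_right₀ hκ1 (by omega)
    have hvr : δ ≤ κ ^ (n+1) * (R / κ ^ (n+1) - R / κ ^ (n+1+1)) := by
      have e : κ ^ (n+1) * (R / κ ^ (n+1) - R / κ ^ (n+1+1)) = R * (1 - 1 / κ) := by
        rw [pow_succ κ (n+1)]; field_simp
      rw [e, hδ]
      gcongr
    have hηn : η ^ n ≤ 1 := pow_le_one₀ hη0 ha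
    have hηn0 : 0 ≤ η ^ n := pow_nonneg hη0 n
    obtain ⟨G', c1, c2, c3, c4, c5⟩ := p5_step (a := a) (P := P) (Z₀ := Z n) (Z₁ := Z (n+1)) (Z₂ := Z (n+2))
      (r := R / κ ^ (n+1)) (r' := R / κ ^ (n+1+1)) (B := B) (U := U) (D := D0 * η ^ n) (v := κ ^ (n+1)) (by positivity) hlt hB hv
      (hZ _) (hZ _) (hZ _) (hrec n) (by
        intro s hs
        have hs' : ‖s‖ < R / κ ^ (n+1) := by simpa using hs
        have e1 := h1 n s (hs'.le.trans (by
          apply div_le_div_of_nonneg_left hR.le (by positivity)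
          exact pow_le_pow_right₀ hκ1.le (by omega)))
        have e2 := h3 (n+1)
        have e3 : ‖deriv (Z (n+1)) s‖ ≤ ‖deriv (Z (n+1)) s - deriv (Z (n+1)) 0‖ + ‖deriv (Z (n+1)) 0‖ := by
          simpa using norm_add_le (deriv (Z (n+1)) s - deriv (Z (n+1)) 0) (deriv (Z (n+1)) 0)
        have : 0 ≤ B * κ ^ (n+1) := by positivity
        linarith) (by
        intro s hs
        have hs' : ‖s‖ < R / κ ^ (n+1) := by simpa using hs
        exact h1 (n+1) s hs'.le) ((by gcongr <;> first | exact hκ1.le | omega : κ ^ (n+1) / B ≤ κ ^ (n+2) / B).trans (h2 (n+2)))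
      b1 b2 b3 b4 (by
        refine le_trans ?_ hvr
        have : 8 * B * D0 / δ ≤ K := by linarith
        rw [div_le_iff₀ hδ0] at this
        calc 8 * B * ‖a‖ * (D0 * η ^ n) = (8 * B * D0) * ‖a‖ * η ^ n := by ring
          _ ≤ (K * δ) * ‖a‖ * 1 := by gcongr
          _ = δ * (K * ‖a‖) := by ring
          _ ≤ δ * 1 := by gcongr
          _ = δ := mul_one _)
    refine ⟨G', ⟨c1, c2, c3, ?_⟩, ?_⟩
    · intro s hs
      refine (c4 s hs).trans ?_
      calc 4 * B ^ 2 * ‖a‖ * (D0 * η ^ n) ≤ K * ‖a‖ * (D0 * η ^ n) := by gcongr; linarith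
        _ = D0 * η ^ (n+1) := by rw [pow_succ, ← hη]; ring
    · intro s hs
      refine (c5 s hs).trans ?_
      have : 4 * U * B * D0 / δ ≤ K := by linarith
      calc 4 * U * B / (κ ^ (n+1) * (R / κ ^ (n+1) - R / κ ^ (n+1+1))) * ‖a‖ * (D0 * η ^ n)
          ≤ 4 * U * B / δ * ‖a‖ * (D0 * η ^ n) := by gcongr
        _ = (4 * U * B * D0 / δ) * ‖a‖ * η ^ n := by ring
        _ ≤ K * ‖a‖ * η ^ n := by gcongr
        _ = η ^ (n+1) := by rw [pow_succ, ← hη]; ring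
  choose! f hf using step
  let H : ℕ → ℂ → ℂ := fun n => Nat.rec H0 (fun n G => f n G) n
  have hH : ∀ n, (DifferentiableOn ℂ (H n) (Metric.ball 0 (R / κ ^ (n+1))) ∧
        (∀ s ∈ Metric.ball (0:ℂ) (R / κ ^ (n+1)), Z (n+1) (H n s) = Z (n+1) s) ∧
        (∀ s ∈ Metric.ball (0:ℂ) (R / κ ^ (n+1)), ‖H n s‖ ≤ U) ∧
        (∀ s ∈ Metric.ball (0:ℂ) (R / κ ^ (n+1)), ‖Z n (H n s) - Z n s‖ ≤ D0 * η ^ n)) := by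
    intro n
    induction n with
    | zero =>
      have e0 : H 0 = H0 := rfl
      rw [e0]
      refine ⟨by simpa using g1, by simpa using g2, by simpa using g3, by simpa using g4⟩
    | succ n ih => exact (hf n (H n) ih).1
  exact ⟨H, rfl, fun n => (hH n).1, fun n => (hH n).2.1, fun n => (hH n).2.2.1, fun n => (hH n).2.2.2,
    fun n => (hf n (H n) (hH n)).2⟩

end HenonML
end

section
namespace HenonML

structure HData (H : ℕ → ℂ → ℂ) (r κ M η : ℝ) : Prop where
  hr : 0 < r
  hκ : 1 < κ
  hη : 0 < η
  hη1 : η ≤ 1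
  hM : 1 ≤ M
  Hd : ∀ n, DifferentiableOn ℂ (H n) (Metric.ball 0 (r / κ ^ n))
  HU : ∀ n, ∀ s ∈ Metric.ball (0:ℂ) (r / κ ^ n), ‖H n s‖ ≤ M
  HD : ∀ n, ∀ s ∈ Metric.ball (0:ℂ) (r / κ ^ (n+1)), ‖H (n+1) s - H n s‖ ≤ M * η ^ (n+1)

lemma pow_mul_tendsto {κ : ℝ} (hκ : 1 < κ) {N : ℕ} (hN : 1 ≤ N) : Tendsto (fun l : ℕ => κ ^ (l * N)) atTop atTop := by
  have h1 : Tendsto (fun l : ℕ => l * N) atTop atTop :=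
    tendsto_atTop_mono (fun l => Nat.le_mul_of_pos_right l hN) tendsto_id
  exact (tendsto_pow_atTop_atTop_of_one_lt hκ).comp h1

lemma pow_mul_tendsto_zero {x : ℝ} (hx0 : 0 ≤ x) (hx : x < 1) {N : ℕ} (hN : 1 ≤ N) : Tendsto (fun l : ℕ => x ^ (l * N)) atTop (𝓝 0) := by
  have h1 : Tendsto (fun l : ℕ => l * N) atTop atTop :=
    tendsto_atTop_mono (fun l => Nat.le_mul_of_pos_right l hN) tendsto_id
  exact (tendsto_pow_atTop_nhds_zero_of_lt_one hx0 hx).comp h1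

lemma HData.fixed {H : ℕ → ℂ → ℂ} {r κ M η : ℝ} (h : HData H r κ M η) {N : ℕ} (hN : 1 ≤ N) {lam : ℂ}
    (hlam : ‖lam‖ = κ ^ (2 * N)) : ∃ s : ℕ → ℂ, ∀ᶠ l in atTop,
      ‖s l‖ ≤ 2 * M / κ ^ (2 * (l * N)) ∧ ‖s l‖ ≤ r / κ ^ (l * N) / 8 ∧ lam ^ l * s l = H (l * N) (s l) := by
  have hκ0 : 0 < κ := by linarith [h.hκ]
  have hr := h.hr
  have hM := h.hM
  have hl0 : lam ≠ 0 := by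
    rw [← norm_pos_iff, hlam]; positivity
  have key : ∀ᶠ l : ℕ in atTop, ∃ s : ℂ, ‖s‖ ≤ 2 * M / κ ^ (2 * (l * N)) ∧ ‖s‖ ≤ r / κ ^ (l * N) / 8 ∧ lam ^ l * s = H (l * N) s := by
    filter_upwards [(pow_mul_tendsto h.hκ hN).eventually_ge_atTop (16 * M / r)] with l hl
    set n := l * N with hn
    set x := κ ^ n with hx
    have hx0 : 0 < x := by positivity
    have hx2 : κ ^ (2 * n) = x ^ 2 := by rw [hx, ← pow_mul, mul_comm]
    have hL : ‖lam ^ l‖ = x ^ 2 := by rw [norm_pow, hlam, ← hx2, ← pow_mul]; congr 1; rw [hn]; ring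
    have hl' : 16 * M ≤ x * r := by rwa [div_le_iff₀ hr] at hl
    set t : ℝ := 2 * M / x ^ 2 with ht
    have ht0 : 0 ≤ t := by positivity
    have ht8 : t ≤ r / x / 8 := by
      rw [ht, div_div, div_le_div_iff₀ (by positivity) (by positivity)]
      nlinarith
    have hsub : Metric.closedBall (0:ℂ) t ⊆ Metric.ball 0 (r / x / 2) := by
      apply Metric.closedBall_subset_ball
      have : 0 < r / x := by positivity
      linarith
    have hlt : r / x / 2 < r / x := by
      have : 0 < r / x := by positivity
      linarith
    obtain ⟨s, hs, hfix⟩ := ball_fixed (fun s => (lam ^ l)⁻¹ * H n s) (0:ℂ) t ht0 (by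
      intro y hy z hz
      have hb := (convex_ball (0:ℂ) (r / x / 2)).norm_image_sub_le_of_norm_deriv_le (f := H n) (C := M / (r / x - r / x / 2))
        (fun y hy => (h.Hd n).differentiableAt (Metric.isOpen_ball.mem_nhds (Metric.ball_subset_ball hlt.le hy)))
        (fun y hy => cauchy_deriv hlt (h.Hd n) (h.HU n) hy) (hsub hz) (hsub hy)
      rw [← mul_sub, norm_mul, norm_inv, hL, inv_mul_le_iff₀ (by positivity)]
      refine hb.trans ?_
      have e : M / (r / x - r / x / 2) = 2 * M * x / r := by field_simp; ring
      rw [e]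
      have : 2 * M * x / r ≤ x ^ 2 * (1/2) := by
        rw [div_le_iff₀ hr]; nlinarith
      calc _ ≤ x ^ 2 * (1/2) * ‖y - z‖ := by gcongr
        _ = _ := by ring) (by
      rw [sub_zero, norm_mul, norm_inv, hL, inv_mul_le_iff₀ (by positivity)]
      refine (h.HU n 0 (Metric.mem_ball_self (by positivity))).trans (le_of_eq ?_)
      rw [ht]; field_simp)
    have hs' : ‖s‖ ≤ t := by simpa using hs
    refine ⟨s, by rw [hx2]; exact hs', hs'.trans ht8, ?_⟩
    have : (lam ^ l)⁻¹ * H n s = s := hfix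
    rw [← this, ← mul_assoc, mul_inv_cancel₀ (pow_ne_zero _ hl0), one_mul, this]
  obtain ⟨l0, hl0⟩ := eventually_atTop.1 key
  choose! s hs using hl0
  exact ⟨s, eventually_atTop.2 ⟨l0, hs⟩⟩

lemma HData.limit {H : ℕ → ℂ → ℂ} {r κ M η : ℝ} (h : HData H r κ M η) {N : ℕ} (hN : 1 ≤ N) {lam : ℂ}
    (hlam : ‖lam‖ = κ ^ (2 * N)) {s : ℕ → ℂ} (hs : ∀ᶠ l in atTop,
      ‖s l‖ ≤ 2 * M / κ ^ (2 * (l * N)) ∧ ‖s l‖ ≤ r / κ ^ (l * N) / 8 ∧ lam ^ l * s l = H (l * N) (s l))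
    {k : ℕ} (hk : 2 ≤ k) (hq : η * κ ^ (4 * k) ≤ 1 / 2) (hz : ∀ j, 2 ≤ j → j < k → jetLim H j = 0)
    (h0 : jetLim H 0 ≠ 0) :
    Tendsto (fun l => (deriv (H (l * N)) (s l) - jetLim H 1) / ((lam ^ (k - 1))⁻¹) ^ l) atTop
      (𝓝 (k * jetLim H k * jetLim H 0 ^ (k - 1))) := by
  have hκ0 : 0 < κ := by linarith [h.hκ]
  have hr := h.hr
  have hM := h.hM
  have hη := h.hη
  have hl0 : lam ≠ 0 := by
    rw [← norm_pos_iff, hlam]; positivity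
  set q := k + 1 with hqdef
  have hq' : η * κ ^ q ≤ 1 / 2 := by
    refine le_trans ?_ hq
    gcongr
    · exact h.hκ.le
    · omega
  set A : ℂ → ℂ := fun s => ∑ i ∈ Finset.range q, jetLim H i * s ^ i with hA
  have hjm := jet_main (H := H) hr h.hκ hη h.Hd (M := M) (fun s hs => h.HU 0 s (by simpa using hs)) h.HD hq'
  have hAe : ∀ s, A s = jetLim H 0 + jetLim H 1 * s + jetLim H k * s ^ k := by
    intro s
    obtain ⟨m, rfl⟩ : ∃ m, k = m + 2 := ⟨k - 2, by omega⟩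
    have : ∑ i ∈ Finset.range m, jetLim H (i + 1 + 1) * s ^ (i + 1 + 1) = 0 := by
      apply Finset.sum_eq_zero
      intro i hi
      have := Finset.mem_range.1 hi
      rw [hz _ (by omega) (by omega), zero_mul]
    rw [hA]; simp only
    rw [hqdef, Finset.sum_range_succ, Finset.sum_range_succ', Finset.sum_range_succ', this]
    simp; ring
  have hx1 : Tendsto (fun l : ℕ => κ ^ (l * N)) atTop atTop := pow_mul_tendsto h.hκ hN
  have hs0 : Tendsto s atTop (𝓝 0) := by
    rw [tendsto_zero_iff_norm_tendsto_zero]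
    have : Tendsto (fun l : ℕ => r / κ ^ (l * N)) atTop (𝓝 0) := hx1.const_div_atTop r
    refine squeeze_zero' (Eventually.of_forall fun _ => norm_nonneg _) (hs.mono fun l hl => ?_) (by simpa using this.div_const 8)
    exact hl.2.1
  have hη1 : η < 1 := by
    have : (1:ℝ) ≤ κ ^ (4 * k) := one_le_pow₀ h.hκ.le
    nlinarith
  have hsball : ∀ᶠ l in atTop, ‖s l‖ ≤ r / κ ^ (l * N) / 2 := hs.mono fun l hl => hl.2.1.trans (by
    have : 0 < r / κ ^ (l * N) := by positivity
    linarith)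
  have hHn : Tendsto (fun l => lam ^ l * s l) atTop (𝓝 (jetLim H 0)) := by
    have e1 : Tendsto (fun l => A (s l)) atTop (𝓝 (jetLim H 0)) := by
      have hAc : Continuous A := by rw [hA]; fun_prop
      have := (hAc.tendsto 0).comp hs0
      have e : A 0 = jetLim H 0 := by rw [hAe]; simp [show k ≠ 0 by omega]
      rwa [e] at this
    have e2 : Tendsto (fun l => H (l * N) (s l) - A (s l)) atTop (𝓝 0) := by
      apply squeeze_zero_norm' (hsball.mono fun l hl => hjm (l * N) (s l) hl)
      have t1 : Tendsto (fun l => (‖s l‖ / r) ^ q) atTop (𝓝 0) := by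
        have := ((tendsto_zero_iff_norm_tendsto_zero.1 hs0).div_const r).pow q
        simpa [hqdef] using this
      have t2 := pow_mul_tendsto_zero hη.le hη1 hN
      have := ((t1.const_mul 4).add (t2.const_mul 2)).const_mul M
      simpa using this
    have := e2.add e1
    simp only [sub_add_cancel, zero_add] at this
    exact this.congr' (hs.mono fun l hl => hl.2.2.symm)
  have hlow : ∀ᶠ l in atTop, ‖jetLim H 0‖ / 2 ≤ ‖lam ^ l * s l‖ := by
    have := hHn.norm.eventually (lt_mem_nhds (half_lt_self (norm_pos_iff.2 h0)))
    exact this.mono fun l hl => hl.le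
  set g := ‖jetLim H 0‖ with hg
  have hg0 : 0 < g := norm_pos_iff.2 h0
  -- error term
  have herr : Tendsto (fun l => (deriv (H (l * N)) (s l) - jetLim H 1 - k * jetLim H k * (s l) ^ (k - 1)) / ((lam ^ (k - 1))⁻¹) ^ l) atTop (𝓝 0) := by
    have hb : ∀ᶠ l in atTop, ‖(deriv (H (l * N)) (s l) - jetLim H 1 - k * jetLim H k * (s l) ^ (k - 1)) / ((lam ^ (k - 1))⁻¹) ^ l‖
        ≤ M * (4 * (2 / r) ^ q * (2 * M) ^ k * (κ ^ (l * N))⁻¹ + 4 / g * (1/2) ^ (l * N)) := by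
      filter_upwards [hs, hlow] with l ⟨hs1, hs2, hs3⟩ hlow
      set n := l * N with hn
      set x := κ ^ n with hx
      have hx0 : 0 < x := by positivity
      have hx1 : 1 ≤ x := one_le_pow₀ h.hκ.le
      have hx2 : κ ^ (2 * n) = x ^ 2 := by rw [hx, ← pow_mul, mul_comm]
      have hL : ‖lam ^ l‖ = x ^ 2 := by rw [norm_pow, hlam, ← hx2, ← pow_mul]; congr 1; rw [hn]; ring
      rw [hx2] at hs1
      rw [norm_mul, hL] at hlow
      have hsp : 0 < ‖s l‖ := by
        by_contra hc
        have : ‖s l‖ = 0 := le_antisymm (not_lt.1 hc) (norm_nonneg _)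
        rw [this] at hlow; linarith
      have hrx : 0 < r / x := by positivity
      have hAd : Differentiable ℂ A := by rw [hA]; fun_prop
      have hder : deriv A (s l) = jetLim H 1 + k * jetLim H k * (s l) ^ (k - 1) := by
        have : HasDerivAt A (jetLim H 1 + jetLim H k * (k * (s l) ^ (k - 1))) (s l) := by
          have e : A = fun s => jetLim H 0 + jetLim H 1 * s + jetLim H k * s ^ k := funext hAe
          rw [e]
          have := (((hasDerivAt_id (s l)).const_mul (jetLim H 1)).const_add (jetLim H 0)).add
            ((hasDerivAt_pow k (s l)).const_mul (jetLim H k))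
          simp only [mul_one] at this
          exact this
        rw [this.deriv]; ring
      have hball : Metric.closedBall (s l) ‖s l‖ ⊆ Metric.ball (0:ℂ) (r / x) := by
        intro y hy
        have : ‖y - s l‖ ≤ ‖s l‖ := mem_closedBall_iff_norm.1 hy
        have h2 : ‖y‖ ≤ ‖y - s l‖ + ‖s l‖ := by simpa using norm_add_le (y - s l) (s l)
        simp only [mem_ball_zero_iff]; linarith
      have hFd : DifferentiableOn ℂ (fun y => H n y - A y) (Metric.ball (0:ℂ) (r / x)) :=
        (h.Hd n).sub hAd.differentiableOn
      have hc := Complex.norm_deriv_le_of_forall_mem_sphere_norm_le (c := s l) (R := ‖s l‖)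
        (C := M * (4 * (2 * ‖s l‖ / r) ^ q + 2 * η ^ n)) (f := fun y => H n y - A y) hsp
        ((hFd.mono hball).diffContOnCl_ball subset_rfl) (by
          intro y hy
          have : ‖y - s l‖ = ‖s l‖ := mem_sphere_iff_norm.1 hy
          have h2 : ‖y‖ ≤ ‖y - s l‖ + ‖s l‖ := by simpa using norm_add_le (y - s l) (s l)
          refine (hjm n y (by linarith)).trans ?_
          gcongr
          linarith)
      have hsm : s l ∈ Metric.ball (0:ℂ) (r / x) := hball (Metric.mem_closedBall_self hsp.le)
      have hde : deriv (fun y => H n y - A y) (s l) = deriv (H n) (s l) - jetLim H 1 - k * jetLim H k * (s l) ^ (k - 1) := by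
        rw [deriv_fun_sub ((h.Hd n).differentiableAt (Metric.isOpen_ball.mem_nhds hsm)) hAd.differentiableAt, hder]; ring
      rw [hde] at hc
      have hpw : ‖((lam ^ (k - 1))⁻¹) ^ l‖ = ((x ^ 2) ^ (k - 1))⁻¹ := by
        rw [inv_pow, norm_inv, ← pow_mul, mul_comm, pow_mul, norm_pow, hL]
      rw [norm_div, hpw, div_inv_eq_mul]
      have hηx : η ^ n * (x ^ 2) ^ k ≤ (1/2) ^ n := by
        have : η ^ n * (x ^ 2) ^ k = (η * κ ^ (2 * k)) ^ n := by
          rw [hx, mul_pow]; congr 1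
          simp only [← pow_mul]; congr 1; ring
        rw [this]
        refine pow_le_pow_left₀ (by positivity) (le_trans ?_ hq) n
        gcongr
        · exact h.hκ.le
        · omega
      have hk1 : (x ^ 2) ^ k = (x ^ 2) ^ (k - 1) * x ^ 2 := by
        rw [← pow_succ]; congr 1; omega
      calc ‖deriv (H n) (s l) - jetLim H 1 - k * jetLim H k * (s l) ^ (k - 1)‖ * (x ^ 2) ^ (k - 1)
          ≤ (M * (4 * (2 * ‖s l‖ / r) ^ q + 2 * η ^ n) / ‖s l‖) * (x ^ 2) ^ (k - 1) := by gcongr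
        _ = M * (4 * (2 / r) ^ q * (‖s l‖ ^ k * (x ^ 2) ^ (k - 1)) + 2 * (η ^ n * (x ^ 2) ^ k) / (x ^ 2 * ‖s l‖)) := by
            rw [hk1, hqdef, mul_div_right_comm 2 ‖s l‖ r, mul_pow, pow_succ ‖s l‖ k]
            field_simp
        _ ≤ M * (4 * (2 / r) ^ q * ((2 * M / x ^ 2) ^ k * (x ^ 2) ^ (k - 1)) + 2 * ((1/2) ^ n) / (g / 2)) := by
            gcongr
        _ = M * (4 * (2 / r) ^ q * (2 * M) ^ k * (x ^ 2)⁻¹ + 4 / g * (1/2) ^ n) := by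
            rw [div_pow (2 * M), hk1]; field_simp; ring
        _ ≤ _ := by
            gcongr
            nlinarith
    apply squeeze_zero_norm' hb
    have t1 := (pow_mul_tendsto h.hκ hN).inv_tendsto_atTop
    have t2 := pow_mul_tendsto_zero (x := 1/2) (by norm_num) (by norm_num) hN
    have := ((t1.const_mul (4 * (2 / r) ^ q * (2 * M) ^ k)).add (t2.const_mul (4 / g))).const_mul M
    simpa using this
  have hmain := herr.add ((hHn.pow (k - 1)).const_mul (k * jetLim H k))
  rw [zero_add] at hmain
  refine hmain.congr fun l => ?_
  have e : ((lam ^ (k - 1))⁻¹) ^ l = ((lam ^ l) ^ (k - 1))⁻¹ := by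
    rw [inv_pow, ← pow_mul, ← pow_mul, mul_comm]
  rw [e, mul_pow]
  have := pow_ne_zero (k - 1) (pow_ne_zero l hl0)
  field_simp
  ring

end HenonML
end

section
namespace HenonML

structure UD (d : ℕ) (a : ℂ) (c : Fin (d - 1) → ℂ) (N : ℕ) (lam : ℂ) (Z : ℕ → ℂ → ℂ) (R κ B : ℝ) : Prop where
  hN : 1 ≤ N
  hR : 0 < R
  hκ : 1 < κ
  hB : 1 ≤ B
  hlam : ‖lam‖ = κ ^ (2 * N)
  Zd : ∀ n, Differentiable ℂ (Z n)
  Zrec : ∀ n s, Z (n+2) s = a * Z n s + henonPoly d c (Z (n+1) s)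
  Zper : ∀ n s, Z (n + 2 * N) s = Z n (lam * s)
  h1 : ∀ n s, ‖s‖ ≤ R / κ ^ n → ‖deriv (Z (n+1)) s - deriv (Z (n+1)) 0‖ ≤ ‖deriv (Z (n+1)) 0‖ / 4
  h2 : ∀ n, κ ^ n / B ≤ ‖deriv (Z n) 0‖
  h3 : ∀ n, ‖deriv (Z n) 0‖ ≤ B * κ ^ n

namespace UD
variable {d : ℕ} {a : ℂ} {c : Fin (d - 1) → ℂ} {N : ℕ} {lam : ℂ} {Z : ℕ → ℂ → ℂ} {R κ B : ℝ}

lemma lam_ne (h : UD d a c N lam Z R κ B) : lam ≠ 0 := by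
  have := h.hκ
  rw [← norm_pos_iff, h.hlam]; positivity

lemma derivRec (h : UD d a c N lam Z R κ B) (n : ℕ) (s : ℂ) :
    deriv (Z (n+2)) s = a * deriv (Z n) s + hpD d c (Z (n+1) s) * deriv (Z (n+1)) s := by
  have e : Z (n+2) = fun s => a * Z n s + henonPoly d c (Z (n+1) s) := funext (h.Zrec n)
  rw [e]
  have := ((h.Zd n s).hasDerivAt.const_mul a).add ((henonPoly_hasDerivAt d c (Z (n+1) s)).comp s (h.Zd (n+1) s).hasDerivAt)
  exact this.deriv

lemma Zper_iter (h : UD d a c N lam Z R κ B) (n l : ℕ) (s : ℂ) : Z (n + l * (2 * N)) s = Z n (lam ^ l * s) := by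
  induction l generalizing s with
  | zero => simp
  | succ l ih =>
    rw [show n + (l+1) * (2*N) = (n + l * (2 * N)) + 2 * N by ring, h.Zper, ih]
    congr 1; ring

lemma derivPer (h : UD d a c N lam Z R κ B) (n l : ℕ) (s : ℂ) :
    deriv (Z (n + l * (2 * N))) s = lam ^ l * deriv (Z n) (lam ^ l * s) := by
  have e : Z (n + l * (2 * N)) = fun s => Z n (lam ^ l * s) := funext (h.Zper_iter n l)
  rw [e]
  have h0 : HasDerivAt (fun s : ℂ => lam ^ l * s) (lam ^ l) s := by simpa using (hasDerivAt_id s).const_mul (lam ^ l)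
  have := (h.Zd n (lam ^ l * s)).hasDerivAt.comp s h0
  rw [mul_comm]
  exact this.deriv

lemma multChain (h : UD d a c N lam Z R κ B) : MultChain d a c (2 * N) lam := by
  refine ⟨by have := h.hN; omega, fun i => Z i 0, fun i => deriv (Z i) 0, fun i => h.Zrec i 0, fun i => ?_, fun i => h.derivRec i 0, fun i => ?_, Or.inl ?_⟩
  · simpa using h.Zper i 0
  · simpa using h.derivPer i 1 0
  · have := h.h2 0
    have hB := h.hB
    rw [← norm_pos_iff]
    refine lt_of_lt_of_le ?_ this
    positivity

lemma Zbound (h : UD d a c N lam Z R κ B) (hd : 2 ≤ d) {A : ℝ} (hA : 1 ≤ A) (ha : ‖a‖ ≤ 1) (hc : ∀ j, ‖c j‖ ≤ A)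
    (n : ℕ) (s : ℂ) (hs : ‖s‖ ≤ R / κ ^ (n+1)) : ‖Z (n+1) s‖ ≤ 2 + A + A * d + 2 * B * R := by
  have hκ0 : 0 < κ := by linarith [h.hκ]
  have hR := h.hR
  have hB := h.hB
  have e1 := periodic_bounded hd (by linarith) (ha.trans hA) hc (z := fun i => Z i 0) (n := 2 * N) (by have := h.hN; omega)
    (fun i => h.Zrec i 0) (fun i => by simpa using h.Zper i 0) (n+1)
  have hb : ∀ y ∈ Metric.closedBall (0:ℂ) (R / κ ^ (n+1)), ‖deriv (Z (n+1)) y‖ ≤ 2 * B * κ ^ (n+1) := by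
    intro y hy
    have hy' : ‖y‖ ≤ R / κ ^ (n+1) := by simpa using hy
    have e1 := h.h1 n y (hy'.trans (by
          apply div_le_div_of_nonneg_left hR.le (by positivity)
          exact pow_le_pow_right₀ h.hκ.le (by omega)))
    have e2 := h.h3 (n+1)
    have e3 : ‖deriv (Z (n+1)) y‖ ≤ ‖deriv (Z (n+1)) y - deriv (Z (n+1)) 0‖ + ‖deriv (Z (n+1)) 0‖ := by
      simpa using norm_add_le (deriv (Z (n+1)) y - deriv (Z (n+1)) 0) (deriv (Z (n+1)) 0)
    have : 0 ≤ B * κ ^ (n+1) := by positivity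
    linarith
  have := (convex_closedBall (0:ℂ) (R / κ ^ (n+1))).norm_image_sub_le_of_norm_deriv_le (f := Z (n+1))
    (fun y _ => h.Zd (n+1) y) hb (Metric.mem_closedBall_self (by positivity)) (show s ∈ _ by simpa using hs)
  have e4 : ‖Z (n+1) s‖ ≤ ‖Z (n+1) s - Z (n+1) 0‖ + ‖Z (n+1) 0‖ := by
    simpa using norm_add_le (Z (n+1) s - Z (n+1) 0) (Z (n+1) 0)
  have e5 : 2 * B * κ ^ (n+1) * ‖s - 0‖ ≤ 2 * B * R := by
    rw [sub_zero]
    calc 2 * B * κ ^ (n+1) * ‖s‖ ≤ 2 * B * κ ^ (n+1) * (R / κ ^ (n+1)) := by gcongr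
      _ = _ := by field_simp
  have e1' : ‖Z (n+1) 0‖ ≤ 2 + A + A * d := e1
  linarith

end UD

set_option maxHeartbeats 1000000 in
lemma close_app {d : ℕ} (hd : 2 ≤ d) {A : ℝ} (hA : 1 ≤ A) (B R : ℝ) : ∃ K : ℝ, 2 ≤ K ∧
    ∀ (a : ℂ) (c : Fin (d - 1) → ℂ) (N : ℕ) (lam : ℂ) (Z : ℕ → ℂ → ℂ) (κ : ℝ), UD d a c N lam Z R κ B → ‖a‖ ≤ 1 →
    (∀ j, ‖c j‖ ≤ A) → ∀ (H : ℕ → ℂ → ℂ) (M η D0 : ℝ), HData H (R / κ) κ M η → 0 ≤ D0 →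
    (∀ n, ∀ s ∈ Metric.ball (0:ℂ) (R / κ / κ ^ n), Z (n+1) (H n s) = Z (n+1) s) →
    (∀ n, ∀ s ∈ Metric.ball (0:ℂ) (R / κ / κ ^ n), ‖Z n (H n s) - Z n s‖ ≤ D0 * η ^ n) →
    ∀ s : ℕ → ℂ, (∀ᶠ l in atTop,
      ‖s l‖ ≤ 2 * M / κ ^ (2 * (l * N)) ∧ ‖s l‖ ≤ R / κ / κ ^ (l * N) / 8 ∧ lam ^ l * s l = H (l * N) (s l)) →
    ∀ γ : ℂ, γ ≠ 0 → Tendsto (fun l => deriv (H (l * N)) (s l)) atTop (𝓝 γ) → η * K ^ 10 * κ < 1 →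
    ∃ C : ℝ, 0 ≤ C ∧ ∀ᶠ l : ℕ in atTop, ∃ μ : ℂ, MultChain d a c (l * (2 * N)) μ ∧ 1 < ‖μ‖ ∧
      ‖lam ^ l / μ - deriv (H (l * N)) (s l)‖ ^ 2 ≤ C * (η * K ^ 10 * κ) ^ (l * N) := by
  obtain ⟨K, hK, hcl⟩ := close_lemma d A (2 + A + A * d + 2 * B * R)
  refine ⟨K, hK, ?_⟩
  intro a c N lam Z κ h ha hc H M η D0 hH hD0 hHZ hHD s hs γ hγ hγt hx1
  have hκ0 : 0 < κ := by linarith [h.hκ]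
  have hR := h.hR
  have hB := h.hB
  have hN := h.hN
  have hη := hH.hη
  set x := η * K ^ 10 * κ with hx
  have hx0 : 0 ≤ x := by positivity
  set C3 : ℝ := 4 * B * D0 / (R / κ) + D0 with hC3
  have hC30 : 0 ≤ C3 := by positivity
  refine ⟨(4 * ‖γ‖) ^ 2 * C3, by positivity, ?_⟩
  have hγp := norm_pos_iff.2 hγ
  have hE0 : Tendsto (fun l : ℕ => C3 * x ^ (l * N)) atTop (𝓝 0) := by
    simpa using (pow_mul_tendsto_zero hx0 hx1 hN).const_mul C3
  have ev1 := hE0.eventually (gt_mem_nhds (show (0:ℝ) < 1/4 by norm_num))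
  have ev2 := hγt.norm.eventually (lt_mem_nhds (half_lt_self hγp))
  have ev3 := hγt.norm.eventually (gt_mem_nhds (show ‖γ‖ < 2 * ‖γ‖ by linarith))
  have ev4 := (pow_mul_tendsto h.hκ hN).eventually_ge_atTop (10 * ‖γ‖ + 1)
  filter_upwards [hs, ev1, ev2, ev3, ev4, eventually_ge_atTop 1] with l ⟨hs1, hs2, hs3⟩ ev1 ev2 ev3 ev4 hl1
  set n := l * N with hn
  have hn1 : 1 ≤ n := Nat.mul_pos hl1 hN
  set y := κ ^ n with hy
  have hy0 : 0 < y := by positivity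
  have hT : l * (2 * N) = 2 * n := by rw [hn]; ring
  have hL : ‖lam ^ l‖ = y ^ 2 := by
    rw [norm_pow, h.hlam, ← pow_mul, hy, ← pow_mul]; congr 1; rw [hn]; ring
  set r := R / κ with hr
  have hr0 : 0 < r := by positivity
  have hry : 0 < r / y := by positivity
  have hsm : s l ∈ Metric.ball (0:ℂ) (r / y) := by simp only [mem_ball_zero_iff]; linarith
  have hsm2 : s l ∈ Metric.ball (0:ℂ) (r / y / 2) := by simp only [mem_ball_zero_iff]; linarith
  set h' := deriv (H n) (s l) with hh'
  have hh'p : 0 < ‖h'‖ := lt_trans (half_pos hγp) ev2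
  have hh'0 : h' ≠ 0 := norm_pos_iff.1 hh'p
  have hHda : HasDerivAt (H n) h' (s l) := ((hH.Hd n).differentiableAt (Metric.isOpen_ball.mem_nhds hsm)).hasDerivAt
  -- derivative identities
  have hdZ1 : deriv (Z (n+1)) (H n (s l)) * h' = deriv (Z (n+1)) (s l) := by
    have e1 : HasDerivAt (fun u => Z (n+1) (H n u)) (deriv (Z (n+1)) (H n (s l)) * h') (s l) :=
      (h.Zd (n+1) _).hasDerivAt.comp (s l) hHda
    have e2 : (fun u => Z (n+1) (H n u)) =ᶠ[𝓝 (s l)] Z (n+1) := by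
      filter_upwards [Metric.isOpen_ball.mem_nhds hsm] with u hu using hHZ n u hu
    rw [← e1.deriv, e2.deriv_eq]
  set Δ : ℂ → ℂ := fun u => Z n (H n u) - Z n u with hΔ
  have hΔd : DifferentiableOn ℂ Δ (Metric.ball 0 (r / y)) :=
    ((h.Zd n).comp_differentiableOn (hH.Hd n)).sub (h.Zd n).differentiableOn
  have hdZ0 : deriv (Z n) (H n (s l)) * h' = deriv (Z n) (s l) + deriv Δ (s l) := by
    have e1 : HasDerivAt (fun u => Z n (H n u)) (deriv (Z n) (H n (s l)) * h') (s l) :=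
      (h.Zd n _).hasDerivAt.comp (s l) hHda
    have := (e1.sub (h.Zd n (s l)).hasDerivAt).deriv
    have e3 : deriv Δ (s l) = deriv (Z n) (H n (s l)) * h' - deriv (Z n) (s l) := this
    rw [e3]; ring
  have hΔ' : ‖deriv Δ (s l)‖ ≤ 2 * D0 / r * (η ^ n * y) := by
    have := cauchy_deriv (by linarith : r / y / 2 < r / y) hΔd (hHD n) hsm2
    refine this.trans (le_of_eq ?_)
    field_simp; ring
  have hw1 : 1 / (2 * B) ≤ ‖deriv (Z (n+1)) (s l)‖ := by
    have e1 := h.h1 n (s l) (by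
      have : r / y ≤ R / κ ^ n := by
        rw [hr, ← hy]; gcongr; exact div_le_self hR.le h.hκ.le
      linarith)
    have e2 := h.h2 (n+1)
    have e3 : ‖deriv (Z (n+1)) 0‖ ≤ ‖deriv (Z (n+1)) (s l) - deriv (Z (n+1)) 0‖ + ‖deriv (Z (n+1)) (s l)‖ := by
      have := norm_sub_le (deriv (Z (n+1)) (s l)) (deriv (Z (n+1)) (s l) - deriv (Z (n+1)) 0)
      simp only [sub_sub_cancel] at this; linarith
    have e4 : 1 / B ≤ κ ^ (n+1) / B := by gcongr; exact one_le_pow₀ h.hκ.le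
    have e5 : 1 / (2 * B) = 1 / B / 2 := by field_simp
    have : 0 < 1 / B := by positivity
    linarith
  have hw1p : 0 < ‖deriv (Z (n+1)) (s l)‖ := lt_of_lt_of_le (by positivity) hw1
  set mh := lam ^ l / h' with hmh
  have hl0 := h.lam_ne
  have hmh5 : 5 ≤ ‖mh‖ := by
    rw [hmh, norm_div, hL, le_div_iff₀ hh'p]
    have : (1:ℝ) ≤ y := one_le_pow₀ h.hκ.le
    nlinarith
  have hmhp : 0 < ‖mh‖ := by linarith
  have hzT : Z (n + l * (2 * N)) (s l) - Z n (s l) = Δ (s l) := by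
    rw [h.Zper_iter, hs3]
  have hwT : deriv (Z (n + l * (2 * N))) (s l) - mh * deriv (Z n) (s l) = mh * deriv Δ (s l) := by
    rw [h.derivPer, hs3]
    have : deriv (Z n) (H n (s l)) = (deriv (Z n) (s l) + deriv Δ (s l)) / h' := by
      rw [← hdZ0]; field_simp
    rw [this, hmh]; field_simp; ring
  have hΔs : ‖Δ (s l)‖ ≤ D0 * η ^ n := hHD n (s l) hsm
  have hK10 : K ^ (5 * (l * (2 * N))) = (K ^ 10) ^ n := by
    rw [← pow_mul]; congr 1; rw [hn]; ring
  have hy1 : (1:ℝ) ≤ y := one_le_pow₀ h.hκ.le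
  have hxn : x ^ n = (K ^ 10) ^ n * (η ^ n * y) := by
    rw [hx, hy, mul_pow, mul_pow]; ring
  have hrat : ‖deriv Δ (s l)‖ / ‖deriv (Z (n+1)) (s l)‖ ≤ 4 * B * D0 / r * (η ^ n * y) := by
    rw [div_le_iff₀ hw1p]
    calc ‖deriv Δ (s l)‖ ≤ 2 * D0 / r * (η ^ n * y) := hΔ'
      _ = 4 * B * D0 / r * (η ^ n * y) * (1 / (2 * B)) := by field_simp; ring
      _ ≤ _ := by gcongr
  have hΔs2 : ‖Δ (s l)‖ ≤ D0 * (η ^ n * y) := hΔs.trans (by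
    have : 0 ≤ η ^ n := by positivity
    gcongr; nlinarith)
  have hE : (K ^ 10) ^ n * (‖deriv Δ (s l)‖ / ‖deriv (Z (n+1)) (s l)‖ + ‖Δ (s l)‖) ≤ C3 * x ^ n := by
    rw [hxn]
    calc _ ≤ (K ^ 10) ^ n * (4 * B * D0 / r * (η ^ n * y) + D0 * (η ^ n * y)) := by gcongr
      _ = _ := by rw [hC3]; ring
  have hK0 : 0 ≤ (K ^ 10) ^ n := by positivity
  have hq0 : 0 ≤ ‖deriv Δ (s l)‖ / ‖deriv (Z (n+1)) (s l)‖ := by positivity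
  have hbd : ∀ i ≤ l * (2 * N) + 1, ‖Z (n + i) (s l)‖ ≤ 2 + A + A * d + 2 * B * R := by
    have hrn : r / y = R / κ ^ (n + 1) := by rw [hr, hy, pow_succ]; field_simp
    have b0 : ‖Z (n + 0) (s l)‖ ≤ 2 + A + A * d + 2 * B * R := by
      obtain ⟨m, hm⟩ : ∃ m, n = m + 1 := ⟨n - 1, by omega⟩
      rw [add_zero, hm]
      apply h.Zbound hd hA ha hc
      rw [← hm]
      refine le_trans hs2 ?_
      have : r / y ≤ R / κ ^ n := by
        rw [hr, ← hy]; gcongr; exact div_le_self hR.le h.hκ.le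
      linarith
    have b1 : ‖Z (n + (l * (2 * N) + 1)) (s l)‖ ≤ 2 + A + A * d + 2 * B * R := by
      rw [show n + (l * (2 * N) + 1) = (n+1) + l * (2 * N) by ring, h.Zper_iter, hs3, hHZ n _ hsm]
      apply h.Zbound hd hA ha hc
      rw [← hrn]; linarith
    exact seg_bounded hd (by linarith) (ha.trans hA) hc (z := fun i => Z (n + i) (s l)) (m := l * (2 * N) + 1)
      (fun i _ => h.Zrec (n + i) (s l)) (by have : 0 ≤ 2 * B * R := by positivity
                                            linarith) b0 b1
  obtain ⟨μ, hμ, hμb⟩ := hcl a c ha hc (l * (2 * N)) (by have : 0 < l * (2 * N) := by positivity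
                                                         omega) (fun i => Z (n + i) (s l)) (fun i => deriv (Z (n + i)) (s l)) mh
    (fun i _ => h.Zrec (n + i) (s l)) (fun i _ => h.derivRec (n + i) (s l)) hbd (by
      show Z (n + (l * (2 * N) + 1)) (s l) = Z (n + 1) (s l)
      rw [show n + (l * (2 * N) + 1) = (n+1) + l * (2 * N) by ring, h.Zper_iter, hs3, hHZ n _ hsm]) (by
      show deriv (Z (n + (l * (2 * N) + 1))) (s l) = mh * deriv (Z (n + 1)) (s l)
      rw [show n + (l * (2 * N) + 1) = (n+1) + l * (2 * N) by ring, h.derivPer, hs3, ← hdZ1, hmh]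
      field_simp) (norm_pos_iff.1 hw1p) hmh5 (by
      show _ * ‖Z (n + l * (2 * N)) (s l) - Z n (s l)‖ ≤ 1
      rw [hzT, hK10]
      have : (K ^ 10) ^ n * ‖Δ (s l)‖ ≤ (K ^ 10) ^ n * (‖deriv Δ (s l)‖ / ‖deriv (Z (n+1)) (s l)‖ + ‖Δ (s l)‖) := by
        gcongr; linarith
      linarith) (by
      show _ * (‖deriv (Z (n + l * (2 * N))) (s l) - mh * deriv (Z n) (s l)‖ / ‖deriv (Z (n + 1)) (s l)‖) ≤ _
      rw [hwT, hK10, norm_mul, mul_div_assoc]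
      have : (K ^ 10) ^ n * (‖deriv Δ (s l)‖ / ‖deriv (Z (n+1)) (s l)‖) ≤ (K ^ 10) ^ n * (‖deriv Δ (s l)‖ / ‖deriv (Z (n+1)) (s l)‖ + ‖Δ (s l)‖) := by
        gcongr; linarith [norm_nonneg (Δ (s l))]
      have h1 : (K ^ 10) ^ n * (‖deriv Δ (s l)‖ / ‖deriv (Z (n+1)) (s l)‖) ≤ 1 := by linarith
      calc _ = ‖mh‖ * ((K ^ 10) ^ n * (‖deriv Δ (s l)‖ / ‖deriv (Z (n+1)) (s l)‖)) := by ring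
        _ ≤ ‖mh‖ * 1 := by gcongr
        _ = _ := mul_one _)
  have hμb' : ‖μ - mh‖ ^ 2 ≤ ‖mh‖ * (C3 * x ^ n) := by
    refine hμb.trans ?_
    show _ * (‖deriv (Z (n + l * (2 * N))) (s l) - mh * deriv (Z n) (s l)‖ / ‖deriv (Z (n + 1)) (s l)‖ + ‖mh‖ * ‖Z (n + l * (2 * N)) (s l) - Z n (s l)‖) ≤ _
    rw [hzT, hwT, hK10, norm_mul, mul_div_assoc]
    calc _ = ‖mh‖ * ((K ^ 10) ^ n * (‖deriv Δ (s l)‖ / ‖deriv (Z (n+1)) (s l)‖ + ‖Δ (s l)‖)) := by ring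
      _ ≤ _ := by gcongr
  have hE1 : 0 ≤ C3 * x ^ n := by positivity
  have hdiff : ‖μ - mh‖ ≤ ‖mh‖ / 2 := by
    apply abs_le_of_sq_le_sq' _ (by positivity) |>.2
    nlinarith
  have hμlow : ‖mh‖ / 2 ≤ ‖μ‖ := by
    have := norm_sub_le μ (μ - mh)
    simp only [sub_sub_cancel] at this; linarith
  refine ⟨μ, hμ, by linarith, ?_⟩
  have hμp : 0 < ‖μ‖ := by linarith
  have hμ0 : μ ≠ 0 := norm_pos_iff.1 hμp
  have e : lam ^ l / μ - h' = h' * (-(μ - mh)) / μ := by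
    have : lam ^ l = mh * h' := by rw [hmh]; field_simp
    rw [this]; field_simp; ring
  have : ‖lam ^ l / μ - h'‖ ^ 2 = ‖h'‖ ^ 2 * ‖μ - mh‖ ^ 2 / ‖μ‖ ^ 2 := by
    rw [e, norm_div, norm_mul, norm_neg]; ring
  rw [this, div_le_iff₀ (by positivity)]
  calc ‖h'‖ ^ 2 * ‖μ - mh‖ ^ 2 ≤ (2 * ‖γ‖) ^ 2 * (‖mh‖ * (C3 * x ^ n)) := by gcongr
    _ ≤ (2 * ‖γ‖) ^ 2 * (‖mh‖ ^ 2 * (C3 * x ^ n)) := by gcongr; nlinarith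
    _ = (4 * ‖γ‖) ^ 2 * C3 * x ^ n * (‖mh‖ / 2) ^ 2 := by ring
    _ ≤ _ := by gcongr

end HenonML
end

section
namespace HenonML

def Bad (d : ℕ) (a : ℂ) (c : Fin (d - 1) → ℂ) : Prop :=
  ∃ L : Subfield ℂ, FiniteDimensional ℚ L ∧
    ((∀ p n ls lu, IsSaddle (henonMap d a c) p n ls lu → lu ∈ L) ∨
     (∀ p n ls lu, IsSaddle (henonMap d a c) p n ls lu → ls ∈ L))

lemma Bad.ratio {d : ℕ} {a : ℂ} {c : Fin (d - 1) → ℂ} (h : Bad d a c) (ha0 : a ≠ 0) (ha : ‖a‖ < 1) :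
    ∃ L : Subfield ℂ, FiniteDimensional ℚ L ∧ ∀ N lam l μ, MultChain d a c N lam → 1 < ‖lam‖ → MultChain d a c (l * N) μ →
      1 < ‖μ‖ → lam ^ l / μ ∈ L := by
  obtain ⟨L, hL, hh⟩ := h
  refine ⟨L, hL, ?_⟩
  intro N lam l μ h1 h2 h3 h4
  obtain ⟨p, hp⟩ := h1.saddle ha0 ha h2
  obtain ⟨q, hq⟩ := h3.saddle ha0 ha h4
  rcases hh with hh | hh
  · exact L.div_mem (L.pow_mem (hh _ _ _ _ hp) l) (hh _ _ _ _ hq)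
  · have := L.div_mem (hh _ _ _ _ hq) (L.pow_mem (hh _ _ _ _ hp) l)
    have hl0 : lam ≠ 0 := by intro h; rw [h] at h2; simp at h2; linarith
    have hm0 : μ ≠ 0 := by intro h; rw [h] at h4; simp at h4; linarith
    have e : (-a) ^ (l * N) / μ / ((-a) ^ N / lam) ^ l = lam ^ l / μ := by
      have : (-a) ^ (l * N) ≠ 0 := pow_ne_zero _ (neg_ne_zero.2 ha0)
      rw [div_pow, ← pow_mul, mul_comm N l]
      field_simp
    rwa [e] at this

theorem p6 {d : ℕ} (hd : 2 ≤ d) {A : ℝ} (hA : 1 ≤ A) (B R : ℝ) : ∃ K : ℝ, 2 ≤ K ∧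
    ∀ (a : ℂ) (c : Fin (d - 1) → ℂ) (N : ℕ) (lam : ℂ) (Z : ℕ → ℂ → ℂ) (κ : ℝ), UD d a c N lam Z R κ B → a ≠ 0 → ‖a‖ < 1 →
    (∀ j, ‖c j‖ ≤ A) → Bad d a c → ∀ (H : ℕ → ℂ → ℂ) (M η D0 : ℝ), HData H (R / κ) κ M η → 0 ≤ D0 →
    (∀ n, ∀ s ∈ Metric.ball (0:ℂ) (R / κ / κ ^ n), Z (n+1) (H n s) = Z (n+1) s) →
    (∀ n, ∀ s ∈ Metric.ball (0:ℂ) (R / κ / κ ^ n), ‖Z n (H n s) - Z n s‖ ≤ D0 * η ^ n) →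
    jetLim H 0 ≠ 0 → jetLim H 1 ≠ 0 → ∀ k, 2 ≤ k → η * K ^ 10 * κ ^ (4 * k) ≤ 1 / 2 → jetLim H k = 0 := by
  obtain ⟨K, hK, hcl⟩ := close_app hd hA B R
  refine ⟨K, hK, ?_⟩
  intro a c N lam Z κ h ha0 ha1 hc hbad H M η D0 hH hD0 hHZ hHD hj0 hj1 k
  have hκ0 : 0 < κ := by linarith [h.hκ]
  have hη := hH.hη
  induction k using Nat.strong_induction_on with
  | _ k ih =>
  intro hk2 hq
  by_contra hne
  have hz : ∀ j, 2 ≤ j → j < k → jetLim H j = 0 := by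
    intro j hj hjk
    refine ih j hjk hj (le_trans ?_ hq)
    gcongr
    exact h.hκ.le
  have hK10 : (1:ℝ) ≤ K ^ 10 := one_le_pow₀ (by linarith)
  have hq' : η * κ ^ (4 * k) ≤ 1 / 2 := by
    refine le_trans ?_ hq
    gcongr
    nlinarith
  obtain ⟨s, hs⟩ := hH.fixed h.hN h.hlam
  have hlim := hH.limit h.hN h.hlam hs hk2 hq' hz hj0
  set γ := jetLim H 1 with hγ
  set θ := (lam ^ (k - 1))⁻¹ with hθ
  have hl0 := h.lam_ne
  have hθ0 : θ ≠ 0 := inv_ne_zero (pow_ne_zero _ hl0)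
  have hlam1 : 1 < ‖lam‖ := by rw [h.hlam]; exact one_lt_pow₀ h.hκ (by have := h.hN; omega)
  have hθ1 : ‖θ‖ < 1 := by
    rw [hθ, norm_inv, norm_pow]
    exact inv_lt_one_of_one_lt₀ (one_lt_pow₀ hlam1 (by omega))
  have hγt : Tendsto (fun l => deriv (H (l * N)) (s l)) atTop (𝓝 γ) := by
    have t : Tendsto (fun l : ℕ => θ ^ l) atTop (𝓝 0) := tendsto_pow_atTop_nhds_zero_of_norm_lt_one hθ1
    have := (hlim.mul t).add_const γ
    rw [mul_zero, zero_add] at this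
    refine this.congr fun l => ?_
    rw [div_mul_cancel₀ _ (pow_ne_zero _ hθ0), sub_add_cancel]
  have hx : η * K ^ 10 * κ < 1 := by
    have : κ ≤ κ ^ (4 * k) := le_self_pow₀ h.hκ.le (by omega)
    have : η * K ^ 10 * κ ≤ η * K ^ 10 * κ ^ (4 * k) := by gcongr
    linarith
  obtain ⟨C, hC, hev⟩ := hcl a c N lam Z κ h ha1.le hc H M η D0 hH hD0 hHZ hHD s hs γ hj1 hγt hx
  obtain ⟨l0, hl0'⟩ := eventually_atTop.1 hev
  choose! μ hμ1 hμ2 hμ3 using hl0'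
  obtain ⟨L, hL, hLr⟩ := hbad.ratio ha0 ha1
  have hsmall : Tendsto (fun l => (lam ^ l / μ l - deriv (H (l * N)) (s l)) / θ ^ l) atTop (𝓝 0) := by
    have hsq : Tendsto (fun l => ‖(lam ^ l / μ l - deriv (H (l * N)) (s l)) / θ ^ l‖ ^ 2) atTop (𝓝 0) := by
      have t := (pow_mul_tendsto_zero (x := 1/2) (by norm_num) (by norm_num) h.hN).const_mul C
      rw [mul_zero] at t
      refine squeeze_zero' (Eventually.of_forall fun _ => by positivity) ?_ t
      filter_upwards [eventually_ge_atTop l0] with l hl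
      have hb := hμ3 l hl
      have hθn : ‖θ ^ l‖ = (κ ^ (2 * (k - 1)))⁻¹ ^ (l * N) := by
        rw [hθ, inv_pow, norm_inv, inv_pow, norm_pow, norm_pow, h.hlam]
        simp only [← pow_mul]; congr 2; ring
      rw [norm_div, div_pow, hθn]
      have hp : 0 < (κ ^ (2 * (k - 1)))⁻¹ ^ (l * N) := by positivity
      rw [div_le_iff₀ (by positivity)]
      refine hb.trans ?_
      rw [mul_assoc C]
      refine mul_le_mul_of_nonneg_left ?_ hC
      rw [inv_pow, inv_pow, ← div_eq_mul_inv, le_div_iff₀ (by positivity), ← pow_mul, mul_comm (l * N) 2, pow_mul _ 2, ← mul_pow]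
      refine pow_le_pow_left₀ (by positivity) (le_trans ?_ hq) _
      rw [mul_assoc, ← pow_mul, ← pow_succ']
      gcongr
      · exact h.hκ.le
      · omega
    rw [tendsto_zero_iff_norm_tendsto_zero]
    have := hsq.sqrt
    rw [Real.sqrt_zero] at this
    refine this.congr fun l => ?_
    exact Real.sqrt_sq (norm_nonneg _)
  refine arith_main hd ha0 c L hL (2 * N) lam h.multChain μ l0 hμ1 (fun l hl => hLr _ _ _ _ h.multChain hlam1 (hμ1 l hl) (hμ2 l hl))
    γ ((k * jetLim H k * jetLim H 0 ^ (k - 1)) / γ) θ hj1 ?_ hθ0 hθ1 ?_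
  · refine div_ne_zero (mul_ne_zero (mul_ne_zero ?_ hne) (pow_ne_zero _ hj0)) hj1
    exact_mod_cast (by omega : k ≠ 0)
  · have := (hsmall.add hlim).div_const γ
    rw [zero_add] at this
    refine this.congr fun l => ?_
    have := pow_ne_zero l hθ0
    field_simp
    ring

end HenonML
end

section
namespace HenonML

set_option maxHeartbeats 1000000 in
theorem as_lemma {d : ℕ} (hd : 2 ≤ d) {A κ0 κ1 B R U D0 β Q : ℝ} (hA : 1 ≤ A) (hκ0 : 1 < κ0) (hB : 1 ≤ B) (hR : 0 < R)
    (hU : 1 ≤ U) (hD0 : 0 ≤ D0) (hβ : 0 < β) :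
    ∃ C r a1 : ℝ, 1 ≤ C ∧ 0 < r ∧ 0 < a1 ∧ ∀ (a : ℂ) (c : Fin (d - 1) → ℂ) (N : ℕ) (lam : ℂ) (Z : ℕ → ℂ → ℂ) (κ : ℝ),
      UD d a c N lam Z R κ B → κ0 ≤ κ → κ ≤ κ1 → a ≠ 0 → ‖a‖ < a1 → (∀ j, ‖c j‖ ≤ A) → Bad d a c →
      (∀ u, ‖u‖ ≤ U + 1 → ‖deriv (Z 1) u‖ ≤ Q ∧ ‖deriv (Z 2) u‖ ≤ Q) →
      ∀ H0 : ℂ → ℂ, DifferentiableOn ℂ H0 (Metric.ball 0 (R / κ)) →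
      (∀ s ∈ Metric.ball (0:ℂ) (R / κ), Z 1 (H0 s) = Z 1 s) →
      (∀ s ∈ Metric.ball (0:ℂ) (R / κ), ‖H0 s‖ ≤ U) →
      (∀ s ∈ Metric.ball (0:ℂ) (R / κ), ‖Z 0 (H0 s) - Z 0 s‖ ≤ D0) →
      β ≤ ‖H0 0‖ → β ≤ ‖deriv H0 0‖ →
      ∃ Γ0 Γ1 : ℂ, ‖Γ0 - H0 0‖ ≤ C * ‖a‖ ∧ ‖Γ1 - deriv H0 0‖ ≤ C * ‖a‖ ∧
        ∀ s : ℂ, ‖s‖ ≤ r → ‖Z 1 (Γ0 + Γ1 * s) - Z 1 s‖ ≤ C * ‖a‖ ∧ ‖Z 2 (Γ0 + Γ1 * s) - Z 2 s‖ ≤ C * ‖a‖ ^ 2 := by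
  obtain ⟨K, hK1, hp5⟩ := p5 hκ0 hB hR (by linarith : 0 ≤ U) hD0
  obtain ⟨K2, hK2, hp6⟩ := p6 hd hA B R
  by_cases hκ01 : κ0 ≤ κ1
  swap
  · exact ⟨1, 1, 1, le_rfl, one_pos, one_pos, fun a c N lam Z κ _ h1 h2 => absurd (h1.trans h2) hκ01⟩
  by_cases hQ : 0 ≤ Q
  swap
  · refine ⟨1, 1, 1, le_rfl, one_pos, one_pos, fun a c N lam Z κ _ h1 h2 _ _ _ _ h => ?_⟩
    exact absurd ((norm_nonneg _).trans (h 0 (by simp; linarith)).1) hQ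
  have hκ1 : 1 < κ1 := by linarith
  have hκ1p : 0 < κ1 := by linarith
  -- constants
  set E : ℝ := U * (16 * κ1 ^ 8 * K2 ^ 20 + 2) with hE
  have hE0 : 0 ≤ E := by positivity
  set X : ℝ := 1 + κ1 ^ 2 / R with hX
  have hX1 : 1 ≤ X := by rw [hX]; have : 0 ≤ κ1 ^ 2 / R := by positivity
                         linarith
  set S : ℝ := 2 * K * K2 ^ 10 * κ1 ^ 12 + 2 * U * K * X * (2 / β) + E * K with hS
  have hS0 : 0 < S := by
    have : 0 ≤ 2 * U * K * X * (2 / β) := by positivity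
    have : 0 ≤ E * K := by positivity
    have : 0 < 2 * K * K2 ^ 10 * κ1 ^ 12 := by positivity
    linarith
  refine ⟨1 + 2 * U * K * X + (D0 + Q * E) * (K + K ^ 2), R / κ1 / κ1 ^ 8 / 2, min (1/2) (1 / (2 * S)), ?_, by positivity, by positivity, ?_⟩
  · have : 0 ≤ 2 * U * K * X := by positivity
    have : 0 ≤ (D0 + Q * E) * (K + K ^ 2) := by positivity
    linarith
  intro a c N lam Z κ h hκa hκb ha0 ha1 hc hbad hQb H0 g1 g2 g3 g4 hb0 hb1
  have hap : 0 < ‖a‖ := norm_pos_iff.2 ha0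
  have ha2 : ‖a‖ < 1 / 2 := ha1.trans_le (min_le_left _ _)
  have ha3 : S * ‖a‖ < 1 / 2 := by
    have := ha1.trans_le (min_le_right _ _)
    rw [lt_div_iff₀ (by positivity)] at this
    linarith
  have p1 : 0 ≤ 2 * U * K * X * (2 / β) := by positivity
  have p2 : 0 ≤ E * K := by positivity
  have p3 : 0 < 2 * K * K2 ^ 10 * κ1 ^ 12 := by positivity
  set η := K * ‖a‖ with hη
  have hη0 : 0 < η := by positivity
  have hηS : 2 * η * K2 ^ 10 * κ1 ^ 12 ≤ 1 / 2 := by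
    have : 2 * K * K2 ^ 10 * κ1 ^ 12 * ‖a‖ ≤ S * ‖a‖ := by gcongr; linarith
    rw [hη]; linarith
  have hηX : 2 * U * η * X ≤ β / 2 := by
    have : (2 * U * K * X * (2 / β)) * ‖a‖ ≤ S * ‖a‖ := by gcongr; linarith
    have e : (2 * U * K * X * (2 / β)) * ‖a‖ = (2 * U * η * X) * (2 / β) := by rw [hη]; ring
    have h3 : (2 * U * η * X) * (2 / β) ≤ 1 := by linarith
    rw [← mul_div_assoc, div_le_one hβ] at h3
    linarith
  have hηE : E * η ≤ 1 := by
    have : (E * K) * ‖a‖ ≤ S * ‖a‖ := by gcongr; linarith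
    rw [hη]; linarith
  have hκp : 0 < κ := by linarith
  have hκ1' : 1 < κ := by linarith
  have hK2p : (1:ℝ) ≤ K2 ^ 10 := one_le_pow₀ (by linarith)
  have hη1 : η ≤ 1 := by
    have : (1:ℝ) ≤ κ1 ^ 12 := one_le_pow₀ hκ1.le
    have : (1:ℝ) ≤ K2 ^ 10 * κ1 ^ 12 := one_le_mul_of_one_le_of_one_le hK2p this
    nlinarith
  obtain ⟨H, hH0, Hd, HZ, HU, HD, Hdiff⟩ := hp5 a hη1 _ Z κ hκa h.Zd h.Zrec h.h1 h.h2 h.h3 H0 g1 g2 g3 g4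
  set r := R / κ with hr
  have hr0 : 0 < r := by positivity
  have hrr : ∀ n, R / κ ^ (n+1) = r / κ ^ n := by intro n; rw [hr, pow_succ]; field_simp
  simp only [hrr] at Hd HZ HU HD
  have hHD : HData H r κ U η := ⟨hr0, hκ1', hη0, hη1, hU, Hd, HU, fun n s hs => by
    have := Hdiff n s (by rw [hrr (n+1)]; exact hs)
    refine this.trans ?_
    have : 0 ≤ η ^ (n+1) := by positivity
    nlinarith⟩
  have hηκ : ∀ i ≤ 12, η * κ ^ i ≤ 1/2 := by
    intro i hi
    have e1 : κ ^ i ≤ κ1 ^ 12 := (pow_le_pow_left₀ hκp.le hκb i).trans (pow_le_pow_right₀ hκ1.le hi)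
    calc η * κ ^ i ≤ η * κ1 ^ 12 := by gcongr
      _ ≤ 2 * η * K2 ^ 10 * κ1 ^ 12 := by
          have : 0 ≤ η * κ1 ^ 12 := by positivity
          nlinarith
      _ ≤ _ := hηS
  have j0 := jet_zero hr0 hκ1' hη0 Hd hHD.HD 0 (hηκ 0 (by omega))
  have j1 := jet_zero hr0 hκ1' hη0 Hd hHD.HD 1 (hηκ 1 (by omega))
  have tc0 : tc (H 0) 0 = H0 0 := by simp [tc, hH0]
  have tc1 : tc (H 0) 1 = deriv H0 0 := by simp [tc, hH0]
  rw [tc0, pow_zero, mul_one] at j0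
  rw [tc1, pow_one] at j1
  have hκr : κ / r ≤ X := by
    have : κ / r = κ ^ 2 / R := by rw [hr]; field_simp
    rw [this, hX]
    have : κ ^ 2 / R ≤ κ1 ^ 2 / R := by gcongr
    linarith
  have j0' : ‖jetLim H 0 - H0 0‖ ≤ 2 * U * η * X := j0.trans (le_mul_of_one_le_right (by positivity) hX1)
  have j1' : ‖jetLim H 1 - deriv H0 0‖ ≤ 2 * U * η * X := j1.trans (by gcongr)
  have nz : ∀ x y : ℂ, ‖x - y‖ ≤ 2 * U * η * X → β ≤ ‖y‖ → x ≠ 0 := by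
    intro x y h1 h2 h3
    rw [h3, zero_sub, norm_neg] at h1
    linarith
  have hjv := hp6 a c N lam Z κ h ha0 (by linarith) hc hbad H U η D0 hHD hD0 HZ HD (nz _ _ j0' hb0) (nz _ _ j1' hb1)
  -- choose q
  have hex : ∃ q : ℕ, 1 / 2 < η * K2 ^ 10 * κ ^ (4 * (q + 1)) := by
    have t : Tendsto (fun q : ℕ => κ ^ (q * 4)) atTop atTop := pow_mul_tendsto hκ1' (by norm_num)
    obtain ⟨q, hq⟩ := (t.eventually_gt_atTop (1 / (η * K2 ^ 10))).exists
    refine ⟨q, ?_⟩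
    have hp : 0 < η * K2 ^ 10 := by positivity
    rw [div_lt_iff₀ hp] at hq
    have : κ ^ (q * 4) ≤ κ ^ (4 * (q + 1)) := pow_le_pow_right₀ hκ1'.le (by omega)
    nlinarith
  classical
  set q := Nat.find hex with hq
  have hq1 : 1 / 2 < η * K2 ^ 10 * κ ^ (4 * (q + 1)) := Nat.find_spec hex
  have hq2 : ∀ m < q, η * K2 ^ 10 * κ ^ (4 * (m + 1)) ≤ 1 / 2 := fun m hm => not_lt.1 (Nat.find_min hex hm)
  have hq3 : 3 ≤ q := by
    by_contra hcon
    have e1 : κ ^ (4 * (q + 1)) ≤ κ1 ^ 12 := (pow_le_pow_left₀ hκp.le hκb _).trans (pow_le_pow_right₀ hκ1.le (by omega))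
    have : η * K2 ^ 10 * κ ^ (4 * (q + 1)) ≤ η * K2 ^ 10 * κ1 ^ 12 := by gcongr
    have : 0 ≤ η * K2 ^ 10 * κ1 ^ 12 := by positivity
    linarith
  have hqq : η * K2 ^ 10 * κ ^ (4 * q) ≤ 1 / 2 := by
    have := hq2 (q - 1) (by omega)
    rwa [Nat.sub_add_cancel (by omega)] at this
  have hqj : η * κ ^ q ≤ 1 / 2 := by
    refine le_trans ?_ hqq
    have : κ ^ q ≤ κ ^ (4 * q) := pow_le_pow_right₀ hκ1'.le (by omega)
    calc η * κ ^ q ≤ η * κ ^ (4 * q) := by gcongr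
      _ ≤ _ := by
        have : 0 ≤ η * κ ^ (4 * q) := by positivity
        nlinarith
  have hAe : ∀ s : ℂ, ∑ i ∈ Finset.range q, jetLim H i * s ^ i = jetLim H 0 + jetLim H 1 * s := by
    intro s
    obtain ⟨m, hm⟩ : ∃ m, q = m + 2 := ⟨q - 2, by omega⟩
    have : ∑ i ∈ Finset.range m, jetLim H (i + 1 + 1) * s ^ (i + 1 + 1) = 0 := by
      apply Finset.sum_eq_zero
      intro i hi
      have := Finset.mem_range.1 hi
      have hh := hq2 (i + 1) (by omega)
      rw [hjv (i+1+1) (by omega) hh, zero_mul]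
    rw [hm, Finset.sum_range_succ', Finset.sum_range_succ', this]
    simp; ring
  have hjm := jet_main (H := H) hr0 hκ1' hη0 Hd (M := U) (fun s hs => HU 0 s (by simpa using hs)) hHD.HD hqj
  simp only [hAe] at hjm
  set Af : ℂ → ℂ := fun s => jetLim H 0 + jetLim H 1 * s with hAf
  have happ : ∀ n ≤ 2, 1 ≤ n → ∀ s : ℂ, ‖s‖ ≤ R / κ1 / κ1 ^ 8 / 2 → s ∈ Metric.ball (0:ℂ) (r / κ ^ n) ∧ ‖H n s - Af s‖ ≤ E * η ^ n := by
    intro n hn2 hn1 s hs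
    have hκn : κ ^ n ≤ κ1 ^ 8 := (pow_le_pow_left₀ hκp.le hκb _).trans (pow_le_pow_right₀ hκ1.le (by omega))
    have hs2 : ‖s‖ ≤ r / κ ^ n / 2 := by
      refine hs.trans ?_
      rw [hr]; gcongr
    refine ⟨?_, (hjm n s hs2).trans ?_⟩
    · have : 0 < r / κ ^ n := by positivity
      simp only [mem_ball_zero_iff]; linarith
    have hs3 : ‖s‖ / r ≤ (κ ^ 8)⁻¹ := by
      rw [div_le_iff₀ hr0]
      have e : R / κ1 / κ1 ^ 8 ≤ R / κ / κ ^ 8 := by gcongr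
      have e2 : (κ ^ 8)⁻¹ * r = R / κ / κ ^ 8 := by rw [hr]; field_simp
      rw [e2]
      have : 0 < R / κ1 / κ1 ^ 8 := by positivity
      linarith
    have hs4 : (‖s‖ / r) ^ q ≤ 4 * κ1 ^ 8 * K2 ^ 20 * η ^ 2 := by
      refine (pow_le_pow_left₀ (by positivity) hs3 q).trans ?_
      rw [inv_pow, ← pow_mul, inv_le_iff_one_le_mul₀ (by positivity)]
      have e1 : 1 ≤ (2 * (η * K2 ^ 10 * κ ^ (4 * (q + 1)))) ^ 2 := one_le_pow₀ (by linarith)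
      refine e1.trans ?_
      have e2 : (2 * (η * K2 ^ 10 * κ ^ (4 * (q + 1)))) ^ 2 = 4 * κ ^ 8 * K2 ^ 20 * η ^ 2 * κ ^ (8 * q) := by ring
      rw [e2]
      gcongr
    have hη2 : η ^ 2 ≤ η ^ n := pow_le_pow_of_le_one hη0.le hη1 hn2
    calc U * (4 * (‖s‖ / r) ^ q + 2 * η ^ n) ≤ U * (4 * (4 * κ1 ^ 8 * K2 ^ 20 * η ^ n) + 2 * η ^ n) := by
          gcongr
          refine hs4.trans ?_
          gcongr
      _ = _ := by rw [hE]; ring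
  have hlip : ∀ (F : ℂ → ℂ), Differentiable ℂ F → (∀ u, ‖u‖ ≤ U + 1 → ‖deriv F u‖ ≤ Q) → ∀ x y : ℂ, ‖x‖ ≤ U + 1 → ‖y‖ ≤ U + 1 →
      ‖F x - F y‖ ≤ Q * ‖x - y‖ := by
    intro F hF hb x y hx hy
    exact (convex_closedBall (0:ℂ) (U+1)).norm_image_sub_le_of_norm_deriv_le (f := F) (fun y _ => hF y)
      (fun u hu => hb u (by simpa using hu)) (by simpa using hy) (by simpa using hx)
  have hfin : ∀ n ≤ 2, 1 ≤ n → ∀ s : ℂ, ‖s‖ ≤ R / κ1 / κ1 ^ 8 / 2 → (∀ u, ‖u‖ ≤ U + 1 → ‖deriv (Z n) u‖ ≤ Q) →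
      ‖Z n (Af s) - Z n s‖ ≤ (D0 + Q * E) * η ^ n := by
    intro n hn2 hn1 s hs hb
    obtain ⟨e1, e2⟩ := happ n hn2 hn1 s hs
    have e3 := HU n s e1
    have hηn : η ^ n ≤ η := pow_le_of_le_one hη0.le hη1 (by omega)
    have e4 : ‖Af s‖ ≤ U + 1 := by
      have := norm_sub_le (H n s) (H n s - Af s)
      simp only [sub_sub_cancel] at this
      have : E * η ^ n ≤ 1 := le_trans (by gcongr) hηE
      linarith
    have e5 := hlip (Z n) (h.Zd n) hb (Af s) (H n s) e4 (by linarith)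
    have e6 := HD n s e1
    have e7 : Z n (Af s) - Z n s = (Z n (Af s) - Z n (H n s)) + (Z n (H n s) - Z n s) := by ring
    rw [e7]
    refine (norm_add_le _ _).trans ?_
    rw [norm_sub_rev] at e2
    have : Q * ‖Af s - H n s‖ ≤ Q * (E * η ^ n) := by gcongr
    linarith
  have cc1 : 0 ≤ 2 * U * K * X := by positivity
  have cc2 : 0 ≤ D0 + Q * E := by positivity
  have cK : K ≤ K + K ^ 2 := by nlinarith
  have cK2 : K ^ 2 ≤ K + K ^ 2 := by linarith
  have cc3 : 0 ≤ (D0 + Q * E) * (K + K ^ 2) := by positivity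
  have hCb : 2 * U * η * X ≤ (1 + 2 * U * K * X + (D0 + Q * E) * (K + K ^ 2)) * ‖a‖ := by
    have : 2 * U * η * X = (2 * U * K * X) * ‖a‖ := by rw [hη]; ring
    rw [this]; gcongr; linarith
  refine ⟨jetLim H 0, jetLim H 1, j0'.trans hCb, j1'.trans hCb, fun s hs => ⟨?_, ?_⟩⟩
  · refine (hfin 1 (by omega) le_rfl s hs fun u hu => (hQb u hu).1).trans ?_
    calc (D0 + Q * E) * η ^ 1 = (D0 + Q * E) * K * ‖a‖ := by rw [hη]; ring
      _ ≤ (D0 + Q * E) * (K + K ^ 2) * ‖a‖ := by gcongr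
      _ ≤ _ := by gcongr; linarith
  · refine (hfin 2 le_rfl (by omega) s hs fun u hu => (hQb u hu).2).trans ?_
    calc (D0 + Q * E) * η ^ 2 = (D0 + Q * E) * K ^ 2 * ‖a‖ ^ 2 := by rw [hη]; ring
      _ ≤ (D0 + Q * E) * (K + K ^ 2) * ‖a‖ ^ 2 := by gcongr
      _ ≤ _ := by gcongr; linarith

end HenonML
end

section
namespace HenonML

section
variable {E : Type*} [NormedAddCommGroup E] [NormedSpace ℂ E]

def psiM (F : E → E) (P v : E) (lam : ℂ) (m : ℕ) (u : ℂ) : E := F^[m] (P + (u / lam ^ m) • v)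

lemma psiM_succ (F : E → E) (P v : E) (lam : ℂ) (m : ℕ) (u : ℂ) :
    psiM F P v lam (m+1) u = F (psiM F P v lam m (u / lam)) := by
  unfold psiM
  rw [iterate_succ_apply', pow_succ', div_div]

structure UConst (F : E → E) (P v : E) (lam : ℂ) (Λ K δ V θ r : ℝ) : Prop where
  hr : 0 < r
  hK : 0 ≤ K
  hV : ‖v‖ ≤ V
  hΛ : 0 ≤ Λ
  hθ1 : θ < 1
  hlam : 1 < ‖lam‖
  hθ : Λ ≤ θ * ‖lam‖ ^ 2
  hlip : ∀ y y', ‖y - P‖ ≤ δ → ‖y' - P‖ ≤ δ → ‖F y - F y'‖ ≤ Λ * ‖y - y'‖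
  hquad : ∀ h : ℂ, ‖h‖ ≤ r → ‖F (P + h • v) - P - (lam * h) • v‖ ≤ K * ‖h‖ ^ 2
  hsm : r * V + K * r ^ 2 / (1 - θ) ≤ δ

variable {F : E → E} {P v : E} {lam : ℂ} {Λ K δ V θ r : ℝ}

lemma UConst.hθ0 (h : UConst F P v lam Λ K δ V θ r) : 0 ≤ θ := by
  by_contra hn
  push Not at hn
  have := h.hθ; have := h.hΛ; have := h.hlam
  nlinarith [mul_neg_of_neg_of_pos hn (show 0 < ‖lam‖^2 by positivity)]

lemma UConst.lam0 (h : UConst F P v lam Λ K δ V θ r) : lam ≠ 0 := by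
  rw [← norm_pos_iff]; linarith [h.hlam]

lemma UConst.main (h : UConst F P v lam Λ K δ V θ r) (m : ℕ) : ∀ u : ℂ, ‖u‖ ≤ r →
    ‖psiM F P v lam (m+1) u - psiM F P v lam m u‖ ≤ K * ‖u‖ ^ 2 * θ ^ m ∧
    ‖psiM F P v lam m u - P‖ ≤ ‖u‖ * V + K * ‖u‖ ^ 2 * ∑ i ∈ Finset.range m, θ ^ i ∧ ‖psiM F P v lam m u - P‖ ≤ δ ∧
    ‖psiM F P v lam (m+1) u - P‖ ≤ ‖u‖ * V + K * ‖u‖ ^ 2 * ∑ i ∈ Finset.range (m+1), θ ^ i ∧ ‖psiM F P v lam (m+1) u - P‖ ≤ δ := by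
  have hθ0 := h.hθ0
  have hl := h.hlam
  have hK := h.hK
  have hV0 : 0 ≤ V := (norm_nonneg _).trans h.hV
  have hd : ∀ (n : ℕ) (u : ℂ), ‖u‖ ≤ r → ‖u‖ * V + K * ‖u‖ ^ 2 * ∑ i ∈ Finset.range n, θ ^ i ≤ δ := by
    intro n u hu
    refine le_trans ?_ h.hsm
    have h1 : ∑ i ∈ Finset.range n, θ ^ i ≤ 1 / (1 - θ) := by
      have hs := (hasSum_geometric_of_lt_one hθ0 h.hθ1)
      rw [one_div]
      exact sum_le_hasSum _ (fun i _ => by positivity) hs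
    have : K * r ^ 2 / (1 - θ) = K * r ^ 2 * (1 / (1 - θ)) := by ring
    rw [this]
    have h0 : 0 ≤ ∑ i ∈ Finset.range n, θ ^ i := Finset.sum_nonneg (fun i _ => by positivity)
    gcongr
  have hdiv : ∀ u : ℂ, ‖u / lam‖ ≤ ‖u‖ := by
    intro u
    rw [norm_div]
    exact div_le_self (norm_nonneg _) hl.le
  induction m with
  | zero =>
    intro u hu
    have h1 : ‖psiM F P v lam (0+1) u - psiM F P v lam 0 u‖ ≤ K * ‖u‖ ^ 2 * θ ^ 0 := by
      have := h.hquad (u / lam) ((hdiv u).trans hu)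
      rw [mul_div_cancel₀ _ h.lam0] at this
      simp only [psiM, zero_add, iterate_one, pow_one, iterate_zero, id, pow_zero, div_one, mul_one]
      rw [← sub_sub]
      refine this.trans ?_
      have := hdiv u
      gcongr
    have h2 : ‖psiM F P v lam 0 u - P‖ ≤ ‖u‖ * V + K * ‖u‖ ^ 2 * ∑ i ∈ Finset.range 0, θ ^ i := by
      simp only [psiM, iterate_zero, id, pow_zero, div_one, add_sub_cancel_left, norm_smul, Finset.range_zero, Finset.sum_empty, mul_zero, add_zero]
      have := h.hV
      gcongr
    have h3 : ‖psiM F P v lam (0+1) u - P‖ ≤ ‖u‖ * V + K * ‖u‖ ^ 2 * ∑ i ∈ Finset.range (0+1), θ ^ i := by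
      have := norm_add_le (psiM F P v lam (0+1) u - psiM F P v lam 0 u) (psiM F P v lam 0 u - P)
      rw [sub_add_sub_cancel] at this
      simp at *
      linarith
    exact ⟨h1, h2, h2.trans (hd _ _ hu), h3, h3.trans (hd _ _ hu)⟩
  | succ m ih =>
    intro u hu
    obtain ⟨a1, a2, a3, a4, a5⟩ := ih (u / lam) ((hdiv u).trans hu)
    obtain ⟨b1, b2, b3, b4, b5⟩ := ih u hu
    have h1 : ‖psiM F P v lam (m+1+1) u - psiM F P v lam (m+1) u‖ ≤ K * ‖u‖ ^ 2 * θ ^ (m+1) := by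
      rw [psiM_succ F P v lam (m+1) u, psiM_succ F P v lam m u]
      refine (h.hlip _ _ a5 a3).trans ?_
      refine (mul_le_mul_of_nonneg_left a1 h.hΛ).trans ?_
      have hlp : 0 < ‖lam‖ := by linarith
      calc Λ * (K * ‖u / lam‖ ^ 2 * θ ^ m) ≤ (θ * ‖lam‖^2) * (K * ‖u / lam‖ ^ 2 * θ ^ m) := by
            have := h.hθ
            gcongr
        _ = _ := by
            rw [norm_div]; field_simp; ring
    have h3 : ‖psiM F P v lam (m+1+1) u - P‖ ≤ ‖u‖ * V + K * ‖u‖ ^ 2 * ∑ i ∈ Finset.range (m+1+1), θ ^ i := by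
      have := norm_add_le (psiM F P v lam (m+1+1) u - psiM F P v lam (m+1) u) (psiM F P v lam (m+1) u - P)
      rw [sub_add_sub_cancel] at this
      rw [Finset.sum_range_succ, mul_add]
      linarith
    exact ⟨h1, b4, b5, h3, h3.trans (hd _ _ hu)⟩

lemma UConst.tail [CompleteSpace E] (h : UConst F P v lam Λ K δ V θ r) (u : ℂ) (hu : ‖u‖ ≤ r) :
    ∃ y, Tendsto (fun m => psiM F P v lam m u) atTop (𝓝 y) ∧
      ∀ m, ‖psiM F P v lam m u - y‖ ≤ K * r ^ 2 * θ ^ m / (1 - θ) := by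
  have hK := h.hK
  have hθ0 := h.hθ0
  have hb : ∀ m, dist (psiM F P v lam m u) (psiM F P v lam (m+1) u) ≤ (K * r ^ 2) * θ ^ m := by
    intro m
    rw [dist_comm, dist_eq_norm]
    refine (h.main m u hu).1.trans ?_
    gcongr
  obtain ⟨y, hy⟩ := cauchySeq_tendsto_of_complete (cauchySeq_of_le_geometric _ _ h.hθ1 hb)
  refine ⟨y, hy, fun m => ?_⟩
  rw [← dist_eq_norm]
  exact dist_le_of_le_geometric_of_tendsto _ _ h.hθ1 hb hy m

def psiL (F : E → E) (P v : E) (lam : ℂ) (u : ℂ) : E := limUnder atTop (fun m => psiM F P v lam m u)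

lemma UConst.tail' [CompleteSpace E] (h : UConst F P v lam Λ K δ V θ r) (u : ℂ) (hu : ‖u‖ ≤ r) :
    Tendsto (fun m => psiM F P v lam m u) atTop (𝓝 (psiL F P v lam u)) ∧
      ∀ m, ‖psiM F P v lam m u - psiL F P v lam u‖ ≤ K * r ^ 2 * θ ^ m / (1 - θ) := by
  obtain ⟨y, hy, hm⟩ := h.tail u hu
  have : psiL F P v lam u = y := hy.limUnder_eq
  rw [this]; exact ⟨hy, hm⟩

lemma psiM_add (F : E → E) (P v : E) (lam : ℂ) (l m : ℕ) (u : ℂ) :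
    psiM F P v lam (m+l) u = F^[l] (psiM F P v lam m (u / lam ^ l)) := by
  unfold psiM
  rw [add_comm m l, iterate_add_apply, pow_add, div_div]

lemma UConst.small (h : UConst F P v lam Λ K δ V θ r) (ρ : ℝ) : ∃ l : ℕ, ∀ u : ℂ, ‖u‖ ≤ ρ → ‖u / lam ^ l‖ ≤ r / 2 := by
  have h1 := tendsto_pow_atTop_atTop_of_one_lt h.hlam
  have hr := h.hr
  obtain ⟨l, hl⟩ := (h1.eventually_ge_atTop (ρ / (r / 2))).exists
  refine ⟨l, fun u hu => ?_⟩
  rw [norm_div, norm_pow]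
  have : 0 < ‖lam‖ ^ l := pow_pos (by linarith [h.hlam]) _
  rw [div_le_iff₀ (by positivity)] at hl
  rw [div_le_iff₀ this]
  linarith

lemma UConst.tend [CompleteSpace E] (h : UConst F P v lam Λ K δ V θ r) (hF : Continuous F) (u : ℂ) :
    Tendsto (fun m => psiM F P v lam m u) atTop (𝓝 (psiL F P v lam u)) := by
  obtain ⟨l, hl⟩ := h.small ‖u‖
  have h1 := (h.tail' (u / lam ^ l) ((hl u le_rfl).trans (by linarith [h.hr]))).1
  have h2 := ((hF.iterate l).tendsto _).comp h1
  have h3 : Tendsto (fun m => psiM F P v lam (m+l) u) atTop (𝓝 (F^[l] (psiL F P v lam (u / lam ^ l)))) := by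
    refine h2.congr fun m => ?_
    rw [psiM_add]; rfl
  have h4 := (tendsto_add_atTop_iff_nat (f := fun m => psiM F P v lam m u) l).1 h3
  have : psiL F P v lam u = _ := h4.limUnder_eq
  rw [this]; exact h4

lemma UConst.func [CompleteSpace E] (h : UConst F P v lam Λ K δ V θ r) (hF : Continuous F) (l : ℕ) (u : ℂ) :
    psiL F P v lam u = F^[l] (psiL F P v lam (u / lam ^ l)) := by
  have h2 := ((hF.iterate l).tendsto _).comp (h.tend hF (u / lam ^ l))
  have h3 : Tendsto (fun m => psiM F P v lam (m+l) u) atTop (𝓝 (F^[l] (psiL F P v lam (u / lam ^ l)))) := by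
    refine h2.congr fun m => ?_
    rw [psiM_add]; rfl
  exact tendsto_nhds_unique (h.tend hF u) ((tendsto_add_atTop_iff_nat (f := fun m => psiM F P v lam m u) l).1 h3)

lemma differentiable_iter (hF : Differentiable ℂ F) (l : ℕ) : Differentiable ℂ F^[l] := by
  induction l with
  | zero => exact differentiable_id
  | succ l ih => exact ih.comp hF

lemma psiM_diff (hF : Differentiable ℂ F) (m : ℕ) : Differentiable ℂ (psiM F P v lam m) := by
  unfold psiM
  refine (differentiable_iter hF m).comp ?_
  fun_prop

lemma UConst.unif [CompleteSpace E] (h : UConst F P v lam Λ K δ V θ r) :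
    TendstoUniformlyOn (fun m u => psiM F P v lam m u) (psiL F P v lam) atTop (Metric.ball 0 r) := by
  rw [Metric.tendstoUniformlyOn_iff]
  intro ε hε
  have ht : Tendsto (fun m : ℕ => K * r ^ 2 * θ ^ m / (1 - θ)) atTop (𝓝 0) := by
    have := ((tendsto_pow_atTop_nhds_zero_of_lt_one h.hθ0 h.hθ1).const_mul (K * r^2)).div_const (1 - θ)
    simpa using this
  filter_upwards [ht.eventually_lt_const hε] with m hm u hu
  rw [dist_comm, dist_eq_norm]
  exact ((h.tail' u (by simpa using (Metric.mem_ball.1 hu).le)).2 m).trans_lt hm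

lemma UConst.diff [CompleteSpace E] (h : UConst F P v lam Λ K δ V θ r) (hF : Differentiable ℂ F) :
    Differentiable ℂ (psiL F P v lam) := by
  have h1 : DifferentiableOn ℂ (psiL F P v lam) (Metric.ball 0 r) :=
    (h.unif.tendstoLocallyUniformlyOn).differentiableOn
      (Eventually.of_forall fun m => (psiM_diff hF m).differentiableOn) Metric.isOpen_ball
  intro u
  obtain ⟨l, hl⟩ := h.small ‖u‖
  have e : psiL F P v lam = fun u => F^[l] (psiL F P v lam (u / lam ^ l)) := funext (h.func hF.continuous l)
  rw [e]
  have h2 : DifferentiableAt ℂ (psiL F P v lam) (u / lam ^ l) := by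
    refine h1.differentiableAt (Metric.isOpen_ball.mem_nhds ?_)
    rw [mem_ball_zero_iff]
    linarith [hl u le_rfl, h.hr]
  have h3 : DifferentiableAt ℂ (fun u : ℂ => u / lam ^ l) u := by fun_prop
  have h4 : DifferentiableAt ℂ (psiL F P v lam ∘ (fun u : ℂ => u / lam ^ l)) u := DifferentiableAt.comp u h2 h3
  exact DifferentiableAt.comp u ((differentiable_iter hF l) _) h4

lemma UConst.zero [CompleteSpace E] (h : UConst F P v lam Λ K δ V θ r) (hP : F P = P) : psiL F P v lam 0 = P := by
  have : ∀ m, psiM F P v lam m 0 = P := by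
    intro m
    simp only [psiM, zero_div, zero_smul, add_zero]
    exact iterate_fixed hP m
  have h2 := (h.tail' 0 (by simpa using h.hr.le)).1
  simp only [this] at h2
  exact (tendsto_nhds_unique tendsto_const_nhds h2).symm

lemma UConst.lin [CompleteSpace E] (h : UConst F P v lam Λ K δ V θ r) (u : ℂ) (hu : ‖u‖ ≤ r) :
    ‖psiL F P v lam u - P - u • v‖ ≤ K / (1 - θ) * ‖u‖ ^ 2 := by
  have h2 := (h.tail' u hu).1
  have h3 : ∀ m, ‖psiM F P v lam m u - P - u • v‖ ≤ K * ‖u‖^2 * ∑ i ∈ Finset.range m, θ ^ i := by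
    intro m
    induction m with
    | zero => simp [psiM]
    | succ m ih =>
      have := (h.main m u hu).1
      have h4 := norm_add_le (psiM F P v lam (m+1) u - psiM F P v lam m u) (psiM F P v lam m u - P - u • v)
      rw [Finset.sum_range_succ, mul_add]
      have e : psiM F P v lam (m+1) u - psiM F P v lam m u + (psiM F P v lam m u - P - u • v) = psiM F P v lam (m+1) u - P - u • v := by abel
      rw [e] at h4
      linarith
  have h4 : ∀ m, ‖psiM F P v lam m u - P - u • v‖ ≤ K / (1 - θ) * ‖u‖ ^ 2 := by
    intro m
    have h1 : ∑ i ∈ Finset.range m, θ ^ i ≤ (1 - θ)⁻¹ := 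
      sum_le_hasSum _ (fun i _ => by have := h.hθ0; positivity) (hasSum_geometric_of_lt_one h.hθ0 h.hθ1)
    have := h.hK
    refine (h3 m).trans ?_
    calc _ ≤ K * ‖u‖^2 * (1 - θ)⁻¹ := by gcongr
      _ = _ := by ring
  exact le_of_tendsto ((h2.sub_const P).sub_const (u • v)).norm (Eventually.of_forall h4)

lemma UConst.hasDeriv [CompleteSpace E] (h : UConst F P v lam Λ K δ V θ r) (hP : F P = P) :
    HasDerivAt (psiL F P v lam) v 0 := by
  rw [hasDerivAt_iff_isLittleO]
  have h1 : (fun u : ℂ => psiL F P v lam u - psiL F P v lam 0 - (u - 0) • v) =O[𝓝 0] fun u => ‖u‖^2 := by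
    refine Asymptotics.IsBigO.of_bound (K / (1 - θ)) ?_
    filter_upwards [Metric.closedBall_mem_nhds (0:ℂ) h.hr] with u hu
    rw [h.zero hP, sub_zero]
    simpa using h.lin u (by simpa using hu)
  refine h1.trans_isLittleO ?_
  have := (Asymptotics.isLittleO_pow_id (𝕜 := ℂ) (n := 2) (by norm_num)).norm_left
  simpa using this
end

end HenonML
end

section
namespace HenonML

lemma iter_joint {X : Type*} [TopologicalSpace X] {E : Type*} [TopologicalSpace E] {G : X × E → E} (hG : Continuous G) (m : ℕ) :
    Continuous (fun q : X × E => (fun y => G (q.1, y))^[m] q.2) := by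
  induction m with
  | zero => exact continuous_snd
  | succ m ih =>
    simp only [iterate_succ_apply']
    exact hG.comp (continuous_fst.prodMk ih)

lemma rank1_inv (T : (ℂ × ℂ) →L[ℂ] ℂ × ℂ) {μ ν : ℂ} (hμ : μ ≠ 1) (hT : ∀ h : ℂ × ℂ, T h = (μ * h.1, ν * h.1)) :
    (T - ContinuousLinearMap.id ℂ (ℂ × ℂ)).IsInvertible := by
  have h1 : μ - 1 ≠ 0 := sub_ne_zero.2 hμ
  let S : (ℂ × ℂ) →L[ℂ] ℂ × ℂ := ((μ - 1)⁻¹ • ContinuousLinearMap.fst ℂ ℂ ℂ).prod ((ν * (μ-1)⁻¹) • ContinuousLinearMap.fst ℂ ℂ ℂ - ContinuousLinearMap.snd ℂ ℂ ℂ)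
  have hS : ∀ k, S k = ((μ-1)⁻¹ * k.1, ν * (μ-1)⁻¹ * k.1 - k.2) := fun k => rfl
  refine ⟨ContinuousLinearEquiv.equivOfInverse (T - ContinuousLinearMap.id ℂ (ℂ × ℂ)) S ?_ ?_, ?_⟩
  · intro k
    rw [hS]
    simp only [ContinuousLinearMap.sub_apply, hT, ContinuousLinearMap.id_apply, Prod.fst_sub, Prod.snd_sub]
    ext <;> simp <;> field_simp <;> ring
  · intro k
    simp only [ContinuousLinearMap.sub_apply, hT, ContinuousLinearMap.id_apply, hS]
    ext <;> simp <;> field_simp <;> ring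
  · ext <;> rfl

section
variable {X : Type*} [NormedAddCommGroup X] [NormedSpace ℂ X] [CompleteSpace X]

lemma partial_fderiv {G : X × (ℂ × ℂ) → ℂ × ℂ} (hG : ContDiff ℂ 2 G) (x : X) (y : ℂ × ℂ) :
    HasFDerivAt (fun y => G (x, y)) ((fderiv ℂ G (x, y)).comp (ContinuousLinearMap.inr ℂ X (ℂ × ℂ))) y := by
  have h1 : HasFDerivAt G (fderiv ℂ G (x, y)) (x, y) := (hG.differentiable (by norm_num) _).hasFDerivAt
  have h2 := hasFDerivAt_prodMk_right (𝕜 := ℂ) x y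
  exact h1.comp y h2

lemma unst_P {G : X × (ℂ × ℂ) → ℂ × ℂ} (hG : ContDiff ℂ 2 G) {x0 : X} {P0 : ℂ × ℂ} (hfix : G (x0, P0) = P0)
    {μ ν : ℂ} (hμ : μ ≠ 1) (hT : ∀ h : ℂ × ℂ, fderiv ℂ (fun y => G (x0, y)) P0 h = (μ * h.1, ν * h.1)) :
    ∃ P : X → ℂ × ℂ, P x0 = P0 ∧ ContinuousAt P x0 ∧ ∀ᶠ x in 𝓝 x0, G (x, P x) = P x := by
  have h1 : HasStrictFDerivAt G (fderiv ℂ G (x0, P0)) (x0, P0) := hG.contDiffAt.hasStrictFDerivAt (by norm_num)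
  have h2 : HasStrictFDerivAt (fun q : X × (ℂ × ℂ) => G q - q.2) (fderiv ℂ G (x0, P0) - ContinuousLinearMap.snd ℂ X (ℂ × ℂ)) (x0, P0) :=
    h1.sub hasStrictFDerivAt_snd
  have h3 : ((fderiv ℂ G (x0, P0) - ContinuousLinearMap.snd ℂ X (ℂ × ℂ)) ∘L ContinuousLinearMap.inr ℂ X (ℂ × ℂ)).IsInvertible := by
    have := rank1_inv ((fderiv ℂ G (x0, P0)).comp (ContinuousLinearMap.inr ℂ X (ℂ × ℂ))) (ν := ν) hμ (by
      intro h
      rw [← hT, (partial_fderiv hG x0 P0).fderiv])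
    have e : (fderiv ℂ G (x0, P0) - ContinuousLinearMap.snd ℂ X (ℂ × ℂ)) ∘L ContinuousLinearMap.inr ℂ X (ℂ × ℂ) = (fderiv ℂ G (x0, P0)).comp (ContinuousLinearMap.inr ℂ X (ℂ × ℂ)) - ContinuousLinearMap.id ℂ (ℂ × ℂ) :=
      ContinuousLinearMap.ext fun k => rfl
    rw [e]; exact this
  have h4 : h2.implicitFunctionOfProdDomain h3 x0 = P0 := 
    (h2.eventually_apply_eq_iff_implicitFunctionOfProdDomain h3).self_of_nhds.mp rfl
  refine ⟨h2.implicitFunctionOfProdDomain h3, h4, ?_, ?_⟩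
  · exact (h2.hasStrictFDerivAt_implicitFunctionOfProdDomain h3).continuousAt
  · filter_upwards [h2.eventually_apply_implicitFunctionOfProdDomain h3] with x hx
    simp only [hfix, sub_self] at hx
    exact sub_eq_zero.1 hx

lemma unst_eig {T : X → (ℂ × ℂ) →L[ℂ] ℂ × ℂ} {x0 : X} (hTc : ContinuousAt T x0) {μ ν : ℂ} (hμ : μ ≠ 0)
    (hT : ∀ h : ℂ × ℂ, T x0 h = (μ * h.1, ν * h.1)) :
    ∃ (lam : X → ℂ) (v : X → ℂ × ℂ), ContinuousAt lam x0 ∧ lam x0 = μ ∧ ContinuousAt v x0 ∧ (v x0).1 ≠ 0 ∧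
      ∀ x, T x (v x) = lam x • v x := by
  have c : ∀ k : ℂ × ℂ, ContinuousAt (fun x => T x k) x0 := fun k => hTc.clm_apply continuousAt_const
  have htr : ContinuousAt (fun x => tr2 (T x)) x0 := by
    unfold tr2
    exact (c (1,0)).fst.add (c (0,1)).snd
  have hdet : ContinuousAt (fun x => det2 (T x)) x0 := by
    unfold det2
    have h1 := c (1,0)
    have h2 := c (0,1)
    fun_prop
  have htr0 : tr2 (T x0) = μ := by simp [tr2, hT]
  have hdet0 : det2 (T x0) = 0 := by simp [det2, hT]
  let Q : X → ℂ := fun x => (tr2 (T x) ^ 2 - 4 * det2 (T x)) / μ ^ 2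
  have hQ : ContinuousAt Q x0 := by
    refine ContinuousAt.div_const ?_ _
    fun_prop
  have hQ0 : Q x0 = 1 := by
    simp only [Q, htr0, hdet0]; field_simp; ring
  let sq : X → ℂ := fun x => (Q x) ^ (1 / 2 : ℂ)
  have hsq : ContinuousAt sq x0 := hQ.cpow continuousAt_const (by rw [hQ0]; exact Complex.one_mem_slitPlane)
  have hsq0 : sq x0 = 1 := by simp [sq, hQ0]
  have hsq2 : ∀ x, sq x ^ 2 = Q x := by
    intro x
    simp only [sq]
    rw [← Complex.cpow_nat_mul]; norm_num
  let lam : X → ℂ := fun x => (tr2 (T x) + μ * sq x) / 2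
  have hlam : ContinuousAt lam x0 := by
    refine ContinuousAt.div_const ?_ _
    fun_prop
  have hlam0 : lam x0 = μ := by simp only [lam, htr0, hsq0]; ring
  have hchar : ∀ x, lam x ^ 2 - tr2 (T x) * lam x + det2 (T x) = 0 := by
    intro x
    have h1 : μ ^ 2 * sq x ^ 2 = tr2 (T x) ^ 2 - 4 * det2 (T x) := by
      rw [hsq2]; simp only [Q]; field_simp
    simp only [lam]
    linear_combination (1/4) * h1
  refine ⟨lam, fun x => (lam x - (T x (0,1)).2, (T x (1,0)).2), hlam, hlam0, ?_, ?_, ?_⟩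
  · have h1 := c (1,0)
    have h2 := c (0,1)
    fun_prop
  · simp [hlam0, hT, hμ]
  · intro x
    have h := hchar x
    unfold tr2 det2 at h
    rw [clm2_apply]
    ext
    · simp
      linear_combination -h
    · simp
      ring
end
end HenonML
end

section
namespace HenonML
section
variable {X : Type*} [NormedAddCommGroup X] [NormedSpace ℂ X] [CompleteSpace X]

lemma unst_const {G : X × (ℂ × ℂ) → ℂ × ℂ} (hG : ContDiff ℂ 2 G) {x0 : X} {P0 : ℂ × ℂ} (hfix : G (x0, P0) = P0)
    {μ ν : ℂ} (hμ : 1 < ‖μ‖) (hν : ‖ν‖ < ‖μ‖ ^ 2)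
    (hT : ∀ h : ℂ × ℂ, fderiv ℂ (fun y => G (x0, y)) P0 h = (μ * h.1, ν * h.1)) :
    ∃ (P v : X → ℂ × ℂ) (lam : X → ℂ) (Λ K δ V θ r : ℝ), P x0 = P0 ∧ ContinuousAt P x0 ∧ ContinuousAt v x0 ∧ (v x0).1 ≠ 0 ∧
      ContinuousAt lam x0 ∧ lam x0 = μ ∧ (∀ᶠ x in 𝓝 x0, G (x, P x) = P x) ∧
      ∀ᶠ x in 𝓝 x0, UConst (fun y => G (x, y)) (P x) (v x) (lam x) Λ K δ V θ r := by
  have hμ1 : μ ≠ 1 := by rintro rfl; simp at hμ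
  have hμ0 : μ ≠ 0 := by rintro rfl; simp at hμ; linarith
  obtain ⟨P, hP0, hPc, hPf⟩ := unst_P hG hfix hμ1 hT
  let DG : X × (ℂ × ℂ) → (ℂ × ℂ) →L[ℂ] ℂ × ℂ := fun q => (fderiv ℂ G q).comp (ContinuousLinearMap.inr ℂ X (ℂ × ℂ))
  have hDG : ContDiff ℂ 1 DG := (hG.fderiv_right (m := 1) (by norm_num)).clm_comp contDiff_const
  have hq : ContinuousAt (fun x => (x, P x)) x0 := continuousAt_id.prodMk hPc
  have hT0 : ∀ h : ℂ × ℂ, DG (x0, P0) h = (μ * h.1, ν * h.1) := by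
    intro h
    rw [← hT, (partial_fderiv hG x0 P0).fderiv]
  obtain ⟨lam, v, hlam, hlam0, hv, hv0, heig⟩ := unst_eig (T := fun x => DG (x, P x)) (x0 := x0) (μ := μ) (ν := ν)
    (ContinuousAt.comp (f := fun x => (x, P x)) (g := DG) hDG.continuous.continuousAt hq) hμ0 (by rw [hP0]; exact hT0)
  have hnT : ‖DG (x0, P0)‖ ≤ max ‖μ‖ ‖ν‖ := by
    refine ContinuousLinearMap.opNorm_le_bound _ (by positivity) fun h => ?_
    rw [hT0, Prod.norm_def]
    simp only [norm_mul]
    have := norm_fst_le h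
    refine max_le ?_ ?_
    · exact mul_le_mul (le_max_left _ _) this (norm_nonneg _) (by positivity)
    · exact mul_le_mul (le_max_right _ _) this (norm_nonneg _) (by positivity)
  have hnT2 : ‖DG (x0, P0)‖ < ‖μ‖ ^ 2 := hnT.trans_lt (max_lt (by nlinarith) hν)
  obtain ⟨Λ, hΛ1, hΛ2⟩ := exists_between hnT2
  have hΛ0 : 0 ≤ Λ := (norm_nonneg _).trans hΛ1.le
  obtain ⟨θ, hθ1, hθ2⟩ := exists_between (show Λ / ‖μ‖ ^ 2 < 1 by rwa [div_lt_one (by positivity)])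
  have hθ3 : Λ < θ * ‖μ‖ ^ 2 := by rwa [div_lt_iff₀ (by positivity)] at hθ1
  obtain ⟨K0, t, ht, hK0⟩ := hDG.contDiffAt.exists_lipschitzOnWith (x := (x0, P0))
  have hnb : t ∩ {q | ‖DG q‖ < Λ} ∈ 𝓝 (x0, P0) := inter_mem ht (hDG.continuous.norm.continuousAt.eventually_lt_const hΛ1)
  obtain ⟨ε, hε, hball⟩ := Metric.mem_nhds_iff.1 hnb
  set V := ‖v x0‖ + 1
  have hV0 : 0 < V := by positivity
  set K := (K0 : ℝ) * V ^ 2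
  have hr : ∃ r : ℝ, 0 < r ∧ r * V + K * r ^ 2 / (1 - θ) < ε / 4 := by
    have hc : ContinuousAt (fun r : ℝ => r * V + K * r ^ 2 / (1 - θ)) 0 := by fun_prop
    have h1 : ∀ᶠ r in 𝓝 (0:ℝ), r * V + K * r ^ 2 / (1 - θ) < ε / 4 := hc.eventually_lt_const (by simpa using hε)
    have h2 : ∀ᶠ r in 𝓝[>] (0:ℝ), r * V + K * r ^ 2 / (1 - θ) < ε / 4 := h1.filter_mono nhdsWithin_le_nhds
    obtain ⟨r, h3, h4⟩ := (h2.and self_mem_nhdsWithin).exists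
    exact ⟨r, h4, h3⟩
  obtain ⟨r, hr0, hr1⟩ := hr
  refine ⟨P, v, lam, Λ, K, ε / 4, V, θ, r, hP0, hPc, hv, hv0, hlam, hlam0, hPf, ?_⟩
  have e1 : ∀ᶠ x in 𝓝 x0, ‖v x‖ < V := hv.norm.eventually_lt_const (by simp [V])
  have e2 : ∀ᶠ x in 𝓝 x0, 1 < ‖lam x‖ := hlam.norm.eventually_const_lt (by simpa only [hlam0] using hμ)
  have e3 : ∀ᶠ x in 𝓝 x0, Λ < θ * ‖lam x‖ ^ 2 := by
    have : ContinuousAt (fun x => θ * ‖lam x‖ ^ 2) x0 := by fun_prop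
    exact this.eventually_const_lt (by simpa only [hlam0] using hθ3)
  have e4 : ∀ᶠ x in 𝓝 x0, dist (P x) P0 < ε / 4 := by
    have := hPc (Metric.ball_mem_nhds _ (show 0 < ε / 4 by positivity))
    rw [hP0] at this
    exact this
  have e5 : ∀ᶠ x in 𝓝 x0, dist x x0 < ε := Metric.ball_mem_nhds _ hε
  filter_upwards [hPf, e1, e2, e3, e4, e5] with x hx h1 h2 h3 h4 h5
  have hin : ∀ y, ‖y - P x‖ ≤ ε / 4 → (x, y) ∈ t ∩ {q | ‖DG q‖ < Λ} := by
    intro y hy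
    refine hball ?_
    rw [Metric.mem_ball, Prod.dist_eq]
    refine max_lt h5 ?_
    have := dist_triangle y (P x) P0
    have hyy : dist y (P x) ≤ ε / 4 := by rwa [dist_eq_norm]
    simp only
    linarith
  have hθ0 : 0 < 1 - θ := by linarith
  refine ⟨hr0, by positivity, h1.le, hΛ0, hθ2, h2, h3.le, ?_, ?_, hr1.le⟩
  · intro y y' hy hy'
    refine (convex_closedBall (P x) (ε/4)).norm_image_sub_le_of_norm_hasFDerivWithin_le (f' := fun y => DG (x, y)) (f := fun y => G (x, y))
      (fun z hz => (partial_fderiv hG x z).hasFDerivWithinAt) ?_ (x := y') (y := y) (by rwa [mem_closedBall_iff_norm]) (by rwa [mem_closedBall_iff_norm])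
    intro z hz
    exact (hin z (by rwa [mem_closedBall_iff_norm] at hz)).2.le
  · intro h hh
    set w := h • v x
    have hw : ‖w‖ ≤ ‖h‖ * V := by
      simp only [w, norm_smul]; gcongr
    have hw2 : ‖w‖ ≤ ε / 4 := by
      have : 0 ≤ K * r ^ 2 / (1 - θ) := by positivity
      have : ‖h‖ * V ≤ r * V := by gcongr
      linarith
    have := (convex_closedBall (P x) ‖w‖).norm_image_sub_le_of_norm_hasFDerivWithin_le' (f' := fun y => DG (x, y)) (f := fun y => G (x, y))
      (φ := DG (x, P x)) (C := K0 * ‖w‖) (fun z hz => (partial_fderiv hG x z).hasFDerivWithinAt) ?_ (x := P x) (y := P x + w) (by simp) (by simp)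
    · rw [hx, add_sub_cancel_left] at this
      have e : DG (x, P x) w = (lam x * h) • v x := by
        simp only [w]
        rw [map_smul, heig, smul_smul, mul_comm]
      rw [e] at this
      refine this.trans ?_
      calc K0 * ‖w‖ * ‖w‖ ≤ K0 * (‖h‖ * V) * (‖h‖ * V) := by gcongr
        _ = _ := by simp only [K]; ring
    · intro z hz
      rw [mem_closedBall_iff_norm] at hz
      have := hK0.dist_le_mul (x, z) (hin z (hz.trans hw2)).1 (x, P x) (hin (P x) (by simp; positivity)).1
      rw [dist_eq_norm, Prod.dist_eq] at this
      simp only [dist_self] at this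
      rw [max_eq_right dist_nonneg, dist_eq_norm] at this
      refine this.trans ?_
      gcongr

theorem unst {G : X × (ℂ × ℂ) → ℂ × ℂ} (hG : ContDiff ℂ 2 G) {x0 : X} {P0 : ℂ × ℂ} (hfix : G (x0, P0) = P0)
    {μ ν : ℂ} (hμ : 1 < ‖μ‖) (hν : ‖ν‖ < ‖μ‖ ^ 2)
    (hT : ∀ h : ℂ × ℂ, fderiv ℂ (fun y => G (x0, y)) P0 h = (μ * h.1, ν * h.1)) :
    ∃ (lam : X → ℂ) (ψ : X → ℂ → ℂ × ℂ), (∀ᶠ x in 𝓝 x0, Differentiable ℂ (ψ x) ∧ (∀ s, G (x, ψ x s) = ψ x (lam x * s)) ∧ 1 < ‖lam x‖) ∧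
      ContinuousAt lam x0 ∧ lam x0 = μ ∧ (∀ u, ContinuousAt (fun q : X × ℂ => ψ q.1 q.2) (x0, u)) ∧
      ψ x0 0 = P0 ∧ deriv (fun s => (ψ x0 s).1) 0 ≠ 0 := by
  obtain ⟨P, v, lam, Λ, K, δ, V, θ, r, hP0, hPc, hv, hv0, hlam, hlam0, hPf, hU⟩ := unst_const hG hfix hμ hν hT
  have hGd : ∀ x, Differentiable ℂ (fun y => G (x, y)) := fun x y => (partial_fderiv hG x y).differentiableAt
  have hU0 := hU.self_of_nhds
  have hcs : ∀ u : ℂ, ‖u‖ < r → ContinuousAt (fun q : X × ℂ => psiL (fun y => G (q.1, y)) (P q.1) (v q.1) (lam q.1) q.2) (x0, u) := by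
    intro u hu
    refine continuousAt_of_locally_uniform_approx_of_continuousAt fun W hW => ?_
    obtain ⟨ε, hε, hW⟩ := Metric.mem_uniformity_dist.1 hW
    have ht : Tendsto (fun m : ℕ => K * r ^ 2 * θ ^ m / (1 - θ)) atTop (𝓝 0) := by
      have := ((tendsto_pow_atTop_nhds_zero_of_lt_one hU0.hθ0 hU0.hθ1).const_mul (K * r^2)).div_const (1 - θ)
      simpa using this
    obtain ⟨m, hm⟩ := (ht.eventually_lt_const hε).exists
    have hn : ∀ᶠ q : X × ℂ in 𝓝 (x0, u), UConst (fun y => G (q.1, y)) (P q.1) (v q.1) (lam q.1) Λ K δ V θ r ∧ ‖q.2‖ < r := by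
      refine ((continuousAt_fst (p := (x0, u))).eventually hU).and ?_
      exact (continuous_norm.comp continuous_snd).continuousAt.eventually_lt_const hu
    refine ⟨_, hn, fun q => psiM (fun y => G (q.1, y)) (P q.1) (v q.1) (lam q.1) m q.2, ?_, ?_⟩
    · unfold psiM
      have h1 : ContinuousAt (fun q : X × ℂ => (q.1, P q.1 + (q.2 / lam q.1 ^ m) • v q.1)) (x0, u) := by
        have c1 : ContinuousAt (fun q : X × ℂ => P q.1) (x0, u) := ContinuousAt.comp (f := Prod.fst) (x := (x0, u)) hPc continuousAt_fst
        have c2 : ContinuousAt (fun q : X × ℂ => v q.1) (x0, u) := ContinuousAt.comp (f := Prod.fst) (x := (x0, u)) hv continuousAt_fst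
        have c3 : ContinuousAt (fun q : X × ℂ => lam q.1) (x0, u) := ContinuousAt.comp (f := Prod.fst) (x := (x0, u)) hlam continuousAt_fst
        have h0 : lam x0 ^ m ≠ 0 := pow_ne_zero _ hU0.lam0
        exact continuousAt_fst.prodMk (c1.add ((continuousAt_snd.div (c3.pow m) h0).smul c2))
      exact ContinuousAt.comp (g := fun q : X × (ℂ × ℂ) => (fun y => G (q.1, y))^[m] q.2) (iter_joint hG.continuous m).continuousAt h1
    · intro q hq
      apply hW
      rw [dist_comm, dist_eq_norm]
      exact ((hq.1.tail' q.2 hq.2.le).2 m).trans_lt hm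
  refine ⟨lam, fun x => psiL (fun y => G (x, y)) (P x) (v x) (lam x), ?_, hlam, hlam0, ?_, ?_, ?_⟩
  · filter_upwards [hU] with x hx
    refine ⟨hx.diff (hGd x), fun s => ?_, hx.hlam⟩
    have := hx.func (hGd x).continuous 1 (lam x * s)
    rw [this, iterate_one, pow_one, mul_div_cancel_left₀ _ hx.lam0]
  · intro u
    obtain ⟨l, hl⟩ := hU0.small ‖u‖
    have h1 := hcs (u / lam x0 ^ l) (by linarith [hl u le_rfl, hU0.hr])
    have h2 : ContinuousAt (fun q : X × ℂ => (q.1, q.2 / lam q.1 ^ l)) (x0, u) := by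
      have c3 : ContinuousAt (fun q : X × ℂ => lam q.1) (x0, u) := ContinuousAt.comp (f := Prod.fst) (x := (x0, u)) hlam continuousAt_fst
      have h0 : lam x0 ^ l ≠ 0 := pow_ne_zero _ hU0.lam0
      exact continuousAt_fst.prodMk (continuousAt_snd.div (c3.pow l) h0)
    have h3 := ContinuousAt.comp (f := fun q : X × ℂ => (q.1, q.2 / lam q.1 ^ l)) (x := (x0, u)) h1 h2
    have h4 : ContinuousAt (fun q : X × ℂ => (q.1, psiL (fun y => G (q.1, y)) (P q.1) (v q.1) (lam q.1) (q.2 / lam q.1 ^ l))) (x0, u) :=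
      continuousAt_fst.prodMk h3
    have h5 := ContinuousAt.comp (g := fun q : X × (ℂ × ℂ) => (fun y => G (q.1, y))^[l] q.2) (x := (x0, u)) (iter_joint hG.continuous l).continuousAt h4
    refine h5.congr ?_
    filter_upwards [continuousAt_fst.eventually hU] with q hq
    exact (hq.func (hGd q.1).continuous l q.2).symm
  · have := hU0.zero (by simpa using hPf.self_of_nhds)
    exact this.trans hP0
  · have := hU0.hasDeriv (by simpa using hPf.self_of_nhds)
    have h2 : HasDerivAt (fun s => (psiL (fun y => G (x0, y)) (P x0) (v x0) (lam x0) s).1) (v x0).1 0 := by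
      have := (ContinuousLinearMap.fst ℂ ℂ ℂ).hasFDerivAt.comp_hasDerivAt (0:ℂ) this
      exact this
    exact h2.deriv.trans_ne hv0
end
end HenonML
end

section
namespace HenonML

/-- limit datum -/
structure LD (d : ℕ) (c0 : Fin (d-1) → ℂ) (N : ℕ) (ζ : ℂ) : Prop where
  hN : 1 ≤ N
  per : (henonPoly d c0)^[2 * N] ζ = ζ
  rep : 1 < ‖deriv ((henonPoly d c0)^[2 * N]) ζ‖
  hν : ‖deriv ((henonPoly d c0)^[2 * N - 1]) ζ‖ < ‖deriv ((henonPoly d c0)^[2 * N]) ζ‖ ^ 2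

/-- unstable family -/
structure UF (d : ℕ) (c0 : Fin (d-1) → ℂ) (N : ℕ) (ζ : ℂ) (lam : ℂ × (Fin (d-1) → ℂ) → ℂ)
    (Z : ℂ × (Fin (d-1) → ℂ) → ℕ → ℂ → ℂ) : Prop where
  hN : 1 ≤ N
  ev : ∀ᶠ x in 𝓝 ((0:ℂ), c0), (∀ n, Differentiable ℂ (Z x n)) ∧
    (∀ n s, Z x (n+2) s = x.1 * Z x n s + henonPoly d x.2 (Z x (n+1) s)) ∧
    (∀ n s, Z x (n + 2 * N) s = Z x n (lam x * s)) ∧ 1 < ‖lam x‖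
  lamc : ContinuousAt lam (0, c0)
  lam0 : lam (0, c0) = deriv ((henonPoly d c0)^[2 * N]) ζ
  cont : ∀ n u, ContinuousAt (fun q : (ℂ × (Fin (d-1) → ℂ)) × ℂ => Z q.1 n q.2) ((0, c0), u)
  zero : Z (0, c0) 1 0 = ζ
  der : deriv (Z (0, c0) 1) 0 ≠ 0

lemma henon_joint_contDiff (d : ℕ) (m : ℕ) : ContDiff ℂ 2 (fun q : (ℂ × (Fin (d-1) → ℂ)) × (ℂ × ℂ) => (henonMap d q.1.1 q.1.2)^[m] q.2) := by
  induction m with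
  | zero => exact contDiff_snd
  | succ m ih =>
    simp only [iterate_succ_apply']
    have h0 : ContDiff ℂ 2 (fun q : (ℂ × (Fin (d-1) → ℂ)) × (ℂ × ℂ) => henonMap d q.1.1 q.1.2 q.2) := by
      unfold henonMap henonPoly
      fun_prop
    exact h0.comp (contDiff_fst.prodMk ih)

lemma iter_zero_a (d : ℕ) (c : Fin (d-1) → ℂ) (n : ℕ) (y : ℂ × ℂ) :
    (henonMap d 0 c)^[n+1] y = ((henonPoly d c)^[n+1] y.1, (henonPoly d c)^[n] y.1) := by
  induction n with
  | zero => simp [henonMap]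
  | succ n ih => rw [iterate_succ_apply', ih, henonMap]; simp [iterate_succ_apply']

lemma hp_diff (d : ℕ) (c : Fin (d-1) → ℂ) : Differentiable ℂ (henonPoly d c) := fun z => (henonPoly_hasDerivAt d c z).differentiableAt

theorem p4 {d : ℕ} {c0 : Fin (d-1) → ℂ} {N : ℕ} {ζ : ℂ} (h : LD d c0 N ζ) : ∃ lam Z, UF d c0 N ζ lam Z := by
  have hN := h.hN
  obtain ⟨k, hk⟩ : ∃ k, 2 * N = k + 1 := ⟨2 * N - 1, by omega⟩
  have hrep := h.rep
  have hν := h.hν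
  have hper := h.per
  rw [hk, Nat.add_sub_cancel] at hν
  rw [hk] at hrep hper
  set p := henonPoly d c0 with hp
  have hpd : ∀ n, Differentiable ℂ p^[n] := fun n => differentiable_iter (hp_diff d c0) n
  obtain ⟨lam, ψ, hev, hlam, hlam0, hcont, h0, hder⟩ := unst (henon_joint_contDiff d (2*N)) (x0 := ((0:ℂ), c0)) (P0 := (ζ, p^[k] ζ)) (by
      rw [hk]; simp only; rw [iter_zero_a]; simp only [← hp, hper]) hrep hν (by
      intro v
      have e : (fun y : ℂ × ℂ => (henonMap d (((0:ℂ), c0), y).1.1 (((0:ℂ), c0), y).1.2)^[2*N] (((0:ℂ), c0), y).2) = fun y => (p^[k+1] y.1, p^[k] y.1) := by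
        funext y
        rw [hk]; simp only; rw [iter_zero_a]
      rw [e]
      have h1 : HasFDerivAt (fun y : ℂ × ℂ => (p^[k+1] y.1, p^[k] y.1)) (((deriv p^[k+1] ζ) • ContinuousLinearMap.fst ℂ ℂ ℂ).prod ((deriv p^[k] ζ) • ContinuousLinearMap.fst ℂ ℂ ℂ)) (ζ, p^[k] ζ) := by
        have a1 : HasDerivAt p^[k+1] (deriv p^[k+1] ζ) ((ζ, p^[k] ζ) : ℂ × ℂ).1 := (hpd (k+1) ζ).hasDerivAt
        have a2 : HasDerivAt p^[k] (deriv p^[k] ζ) ((ζ, p^[k] ζ) : ℂ × ℂ).1 := (hpd k ζ).hasDerivAt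
        exact (a1.comp_hasFDerivAt _ hasFDerivAt_fst).prodMk (a2.comp_hasFDerivAt _ hasFDerivAt_fst)
      rw [h1.fderiv]
      simp)
  refine ⟨lam, fun x n s => ((henonMap d x.1 x.2)^[n] (ψ x s)).2, hN, ?_, hlam, by rw [hlam0, hk], ?_, ?_, ?_⟩
  · filter_upwards [hev] with x hx
    refine ⟨fun n => ?_, fun n s => ?_, fun n s => ?_, hx.2.2⟩
    · exact ((henonMap_iter_differentiable d x.1 x.2 n).comp hx.1).snd
    · rw [iter_snd_succ, iter_fst_succ, iter_snd_succ]
    · rw [iterate_add_apply]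
      have := hx.2.1 s
      rw [this]
  · intro n u
    have h1 : ContinuousAt (fun q : (ℂ × (Fin (d-1) → ℂ)) × ℂ => (q.1, ψ q.1 q.2)) ((0, c0), u) := continuousAt_fst.prodMk (hcont u)
    have h2 := ContinuousAt.comp (x := (((0:ℂ), c0), u)) (henon_joint_contDiff d n).continuous.continuousAt h1
    exact h2.snd
  · simp [h0, henonMap]
  · simpa [henonMap] using hder

namespace UF
variable {d : ℕ} {c0 : Fin (d-1) → ℂ} {N : ℕ} {ζ : ℂ} {lam : ℂ × (Fin (d-1) → ℂ) → ℂ}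
    {Z : ℂ × (Fin (d-1) → ℂ) → ℕ → ℂ → ℂ}

lemma locUnif (h : UF d c0 N ζ lam Z) (n : ℕ) : TendstoLocallyUniformlyOn (fun x => Z x n) (Z (0, c0) n) (𝓝 ((0:ℂ), c0)) univ := by
  rw [tendstoLocallyUniformlyOn_iff_forall_isCompact isOpen_univ]
  intro K _ hK
  rw [Metric.tendstoUniformlyOn_iff]
  intro ε hε
  have hd0 : Continuous (Z (0, c0) n) := (h.ev.self_of_nhds.1 n).continuous
  refine hK.eventually_forall_of_forall_eventually (P := fun q u => dist (Z (0, c0) n u) (Z q n u) < ε) fun u _ => ?_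
  have h1 := h.cont n u
  have h2 : ContinuousAt (fun q : (ℂ × (Fin (d-1) → ℂ)) × ℂ => Z (0, c0) n q.2) ((0, c0), u) := (hd0.comp continuous_snd).continuousAt
  exact (h2.dist h1).eventually_lt_const (by simpa using hε)

lemma locUnifD (h : UF d c0 N ζ lam Z) (n : ℕ) : TendstoLocallyUniformlyOn (fun x => deriv (Z x n)) (deriv (Z (0, c0) n)) (𝓝 ((0:ℂ), c0)) univ :=
  (h.locUnif n).deriv (h.ev.mono fun x hx => (hx.1 n).differentiableOn) isOpen_univ

lemma unif (h : UF d c0 N ζ lam Z) (n : ℕ) (r : ℝ) {ε : ℝ} (hε : 0 < ε) : ∀ᶠ x in 𝓝 ((0:ℂ), c0), ∀ u : ℂ, ‖u‖ ≤ r → ‖Z x n u - Z (0, c0) n u‖ < ε := by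
  have := (tendstoLocallyUniformlyOn_iff_forall_isCompact isOpen_univ).1 (h.locUnif n) (Metric.closedBall 0 r) (subset_univ _) (isCompact_closedBall _ _)
  filter_upwards [Metric.tendstoUniformlyOn_iff.1 this ε hε] with x hx u hu
  rw [← dist_eq_norm, dist_comm]
  exact hx u (by simpa using hu)

lemma unifD (h : UF d c0 N ζ lam Z) (n : ℕ) (r : ℝ) {ε : ℝ} (hε : 0 < ε) : ∀ᶠ x in 𝓝 ((0:ℂ), c0), ∀ u : ℂ, ‖u‖ ≤ r → ‖deriv (Z x n) u - deriv (Z (0, c0) n) u‖ < ε := by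
  have := (tendstoLocallyUniformlyOn_iff_forall_isCompact isOpen_univ).1 (h.locUnifD n) (Metric.closedBall 0 r) (subset_univ _) (isCompact_closedBall _ _)
  filter_upwards [Metric.tendstoUniformlyOn_iff.1 this ε hε] with x hx u hu
  rw [← dist_eq_norm, dist_comm]
  exact hx u (by simpa using hu)

lemma lam_gt (h : UF d c0 N ζ lam Z) : 1 < ‖lam (0, c0)‖ := h.ev.self_of_nhds.2.2.2

lemma lam_ne (h : UF d c0 N ζ lam Z) : lam (0, c0) ≠ 0 := by
  rw [← norm_pos_iff]; linarith [h.lam_gt]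

lemma rec0 (h : UF d c0 N ζ lam Z) (n : ℕ) (s : ℂ) : Z (0, c0) (n+1) s = henonPoly d c0 (Z (0, c0) n s) := by
  obtain ⟨_, h2, h3, _⟩ := h.ev.self_of_nhds
  have hN := h.hN
  obtain ⟨k, hk⟩ : ∃ k, n + 2 * N = k + 1 := ⟨n + 2 * N - 1, by omega⟩
  have e := h2 k (s / lam (0, c0))
  simp only [zero_mul, zero_add] at e
  rw [← hk, show k + 2 = (n + 1) + 2 * N by omega, h3, h3, mul_div_cancel₀ _ h.lam_ne] at e
  exact e

lemma derRec0 (h : UF d c0 N ζ lam Z) (n : ℕ) (s : ℂ) : deriv (Z (0, c0) (n+1)) s = hpD d c0 (Z (0, c0) n s) * deriv (Z (0, c0) n) s := by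
  have e : Z (0, c0) (n+1) = fun s => henonPoly d c0 (Z (0, c0) n s) := funext (h.rec0 n)
  rw [e]
  exact ((henonPoly_hasDerivAt d c0 _).comp s (h.ev.self_of_nhds.1 n s).hasDerivAt).deriv

lemma derPerX {x : ℂ × (Fin (d-1) → ℂ)} (h1 : ∀ n, Differentiable ℂ (Z x n)) (h3 : ∀ n s, Z x (n + 2 * N) s = Z x n (lam x * s)) (n l : ℕ) (s : ℂ) :
    deriv (Z x (n + l * (2 * N))) s = lam x ^ l * deriv (Z x n) (lam x ^ l * s) := by
  have e0 : ∀ l s, Z x (n + l * (2 * N)) s = Z x n (lam x ^ l * s) := by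
    intro l
    induction l with
    | zero => simp
    | succ l ih =>
      intro s
      rw [show n + (l+1) * (2*N) = (n + l * (2 * N)) + 2 * N by ring, h3, ih]
      congr 1; ring
  have e : Z x (n + l * (2 * N)) = fun s => Z x n (lam x ^ l * s) := funext (e0 l)
  rw [e]
  have h0 : HasDerivAt (fun s : ℂ => lam x ^ l * s) (lam x ^ l) s := by simpa using (hasDerivAt_id s).const_mul (lam x ^ l)
  have := (h1 n (lam x ^ l * s)).hasDerivAt.comp s h0
  rw [mul_comm]
  exact this.deriv

lemma der0 (h : UF d c0 N ζ lam Z) (n : ℕ) : deriv (Z (0, c0) n) 0 ≠ 0 := by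
  intro hn
  have h1 : ∀ m, deriv (Z (0, c0) (n + m)) 0 = 0 := by
    intro m
    induction m with
    | zero => simpa using hn
    | succ m ih => rw [← add_assoc, h.derRec0, ih, mul_zero]
  obtain ⟨e1, _, e3, _⟩ := h.ev.self_of_nhds
  have h2 := derPerX e1 e3 1 (n+1) 0
  have hN := h.hN
  obtain ⟨m, hm⟩ : ∃ m, 1 + (n+1) * (2 * N) = n + m := ⟨1 + (n+1) * (2 * N) - n, by
    have : n ≤ (n+1) * (2 * N) := by nlinarith
    omega⟩
  rw [hm, h1, mul_zero] at h2
  exact mul_ne_zero (pow_ne_zero _ h.lam_ne) h.der h2.symm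

end UF
end HenonML
end

section
namespace HenonML
namespace UF
variable {d : ℕ} {c0 : Fin (d-1) → ℂ} {N : ℕ} {ζ : ℂ} {lam : ℂ × (Fin (d-1) → ℂ) → ℂ}
    {Z : ℂ × (Fin (d-1) → ℂ) → ℕ → ℂ → ℂ}

lemma ud1 (h : UF d c0 N ζ lam Z) (n : ℕ) : ∃ R B : ℝ, 0 < R ∧ 1 ≤ B ∧ ∀ᶠ x in 𝓝 ((0:ℂ), c0),
    (∀ s : ℂ, ‖s‖ ≤ R → ‖deriv (Z x n) s - deriv (Z x n) 0‖ ≤ ‖deriv (Z x n) 0‖ / 4) ∧ 1 / B ≤ ‖deriv (Z x n) 0‖ ∧ ‖deriv (Z x n) 0‖ ≤ B := by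
  set D := ‖deriv (Z (0, c0) n) 0‖ with hD
  have hD0 : 0 < D := norm_pos_iff.2 (h.der0 n)
  have hc : Continuous (deriv (Z (0, c0) n)) := ((h.ev.self_of_nhds.1 n).contDiff (n := 2)).continuous_deriv (by norm_num)
  obtain ⟨δ, hδ, hR⟩ := Metric.continuousAt_iff.1 (hc.continuousAt (x := 0)) (D / 16) (by positivity)
  refine ⟨δ / 2, max 1 (max (2 / D) (2 * D)), by positivity, le_max_left _ _, ?_⟩
  filter_upwards [h.unifD n (δ/2) (show 0 < D / 32 by positivity)] with x hx
  have h0 := hx 0 (by simp; positivity)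
  have a1 := norm_sub_norm_le (deriv (Z (0, c0) n) 0) (deriv (Z x n) 0)
  have a2 := norm_sub_norm_le (deriv (Z x n) 0) (deriv (Z (0, c0) n) 0)
  rw [norm_sub_rev] at a1
  have hlow : D / 2 ≤ ‖deriv (Z x n) 0‖ := by linarith
  refine ⟨fun s hs => ?_, ?_, ?_⟩
  · have h1 := hx s hs
    have h2 := hR (x := s) (by rw [dist_zero_right]; linarith)
    rw [dist_eq_norm] at h2
    have e : deriv (Z x n) s - deriv (Z x n) 0 = (deriv (Z x n) s - deriv (Z (0, c0) n) s) + (deriv (Z (0, c0) n) s - deriv (Z (0, c0) n) 0) - (deriv (Z x n) 0 - deriv (Z (0, c0) n) 0) := by ring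
    rw [e]
    have h3 := norm_sub_le ((deriv (Z x n) s - deriv (Z (0, c0) n) s) + (deriv (Z (0, c0) n) s - deriv (Z (0, c0) n) 0)) (deriv (Z x n) 0 - deriv (Z (0, c0) n) 0)
    have h4 := norm_add_le (deriv (Z x n) s - deriv (Z (0, c0) n) s) (deriv (Z (0, c0) n) s - deriv (Z (0, c0) n) 0)
    linarith
  · have : 2 / D ≤ max 1 (max (2 / D) (2 * D)) := (le_max_left _ _).trans (le_max_right _ _)
    calc _ ≤ 1 / (2 / D) := one_div_le_one_div_of_le (by positivity) this
      _ = D / 2 := by field_simp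
      _ ≤ _ := hlow
  · refine le_trans ?_ ((le_max_right _ _).trans (le_max_right _ _))
    linarith

lemma ud2 (h : UF d c0 N ζ lam Z) (m : ℕ) : ∃ R B : ℝ, 0 < R ∧ 1 ≤ B ∧ ∀ᶠ x in 𝓝 ((0:ℂ), c0), ∀ n < m,
    (∀ s : ℂ, ‖s‖ ≤ R → ‖deriv (Z x n) s - deriv (Z x n) 0‖ ≤ ‖deriv (Z x n) 0‖ / 4) ∧ 1 / B ≤ ‖deriv (Z x n) 0‖ ∧ ‖deriv (Z x n) 0‖ ≤ B := by
  induction m with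
  | zero => exact ⟨1, 1, one_pos, le_rfl, Eventually.of_forall fun x n hn => absurd hn (Nat.not_lt_zero _)⟩
  | succ m ih =>
    obtain ⟨R, B, hR, hB, h1⟩ := ih
    obtain ⟨R', B', hR', hB', h2⟩ := h.ud1 m
    refine ⟨min R R', max B B', lt_min hR hR', le_trans hB (le_max_left _ _), ?_⟩
    filter_upwards [h1, h2] with x h1 h2 n hn
    rcases Nat.lt_succ_iff_lt_or_eq.1 hn with hn | rfl
    · obtain ⟨a, b, c⟩ := h1 n hn
      exact ⟨fun s hs => a s (hs.trans (min_le_left _ _)), le_trans (one_div_le_one_div_of_le (by positivity) (le_max_left _ _)) b, c.trans (le_max_left _ _)⟩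
    · obtain ⟨a, b, c⟩ := h2
      exact ⟨fun s hs => a s (hs.trans (min_le_right _ _)), le_trans (one_div_le_one_div_of_le (by positivity) (le_max_right _ _)) b, c.trans (le_max_right _ _)⟩

theorem ud (h : UF d c0 N ζ lam Z) : ∃ R B κ0 κ1 : ℝ, 0 < R ∧ 1 ≤ B ∧ 1 < κ0 ∧ ∀ᶠ x in 𝓝 ((0:ℂ), c0),
    ∃ κ, UD d x.1 x.2 N (lam x) (Z x) R κ B ∧ κ0 ≤ κ ∧ κ ≤ κ1 := by
  have hN := h.hN
  obtain ⟨R, B, hR, hB, h1⟩ := h.ud2 (2 * N)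
  let κ : ℂ × (Fin (d-1) → ℂ) → ℝ := fun x => ‖lam x‖ ^ (((2 * N : ℕ) : ℝ)⁻¹)
  have hκp : ∀ x, κ x ^ (2 * N) = ‖lam x‖ := fun x => Real.rpow_inv_natCast_pow (norm_nonneg _) (by omega)
  have hκc : ContinuousAt κ (0, c0) := h.lamc.norm.rpow_const (Or.inr (by positivity))
  have hκ1 : 1 < κ (0, c0) := Real.one_lt_rpow h.lam_gt (by positivity)
  obtain ⟨κ0, hk0, hk1⟩ := exists_between hκ1
  set κ1 := κ (0, c0) + 1
  have hκ1' : 1 ≤ κ1 := by simp only [κ1]; linarith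
  have hκ1p : 1 ≤ κ1 ^ (2 * N) := one_le_pow₀ hκ1'
  refine ⟨R / κ1, B * κ1 ^ (2 * N), κ0, κ1, by positivity, by nlinarith, hk0, ?_⟩
  filter_upwards [h1, h.ev, hκc.eventually_const_lt hk1, hκc.eventually_lt_const (show κ (0, c0) < κ1 by simp [κ1])] with x h1 ⟨e1, e2, e3, e4⟩ h2 h3
  refine ⟨κ x, ?_, h2.le, h3.le⟩
  have hκ : 1 < κ x := hk0.trans h2
  have hκ0 : 0 < κ x := by linarith
  have hdec : ∀ n, ∃ q r, n = r + q * (2 * N) ∧ r < 2 * N := fun n => ⟨n / (2 * N), n % (2 * N), by rw [mul_comm (n / (2 * N))]; exact (Nat.mod_add_div n (2*N)).symm, Nat.mod_lt _ (by omega)⟩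
  have hnl : ∀ q, ‖lam x ^ q‖ = κ x ^ (q * (2 * N)) := by
    intro q
    rw [norm_pow, ← hκp, ← pow_mul, mul_comm]
  refine ⟨hN, by positivity, hκ, by nlinarith, (hκp x).symm, e1, e2, e3, ?_, ?_, ?_⟩
  · intro n s hs
    obtain ⟨q, r, hn, hr⟩ := hdec (n+1)
    rw [hn, derPerX e1 e3, derPerX e1 e3, mul_zero, ← mul_sub, norm_mul, norm_mul, mul_div_assoc]
    refine mul_le_mul_of_nonneg_left ((h1 r hr).1 _ ?_) (norm_nonneg _)
    rw [norm_mul, hnl]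
    calc κ x ^ (q * (2 * N)) * ‖s‖ ≤ κ x ^ (n+1) * (R / κ1 / κ x ^ n) := by
          gcongr
          · exact hκ.le
          · omega
      _ = R * (κ x / κ1) := by rw [pow_succ]; field_simp
      _ ≤ R * 1 := by
          gcongr
          rw [div_le_one (by positivity)]; exact h3.le
      _ = R := mul_one _
  · intro n
    obtain ⟨q, r, hn, hr⟩ := hdec n
    rw [hn, derPerX e1 e3, mul_zero, norm_mul, hnl, pow_add]
    have a := (h1 r hr).2.1
    have b : κ x ^ r ≤ κ1 ^ (2 * N) := (pow_le_pow_left₀ hκ0.le h3.le r).trans (pow_le_pow_right₀ hκ1' hr.le)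
    calc κ x ^ r * κ x ^ (q * (2 * N)) / (B * κ1 ^ (2 * N)) = κ x ^ (q * (2 * N)) * (1 / B) * (κ x ^ r / κ1 ^ (2 * N)) := by field_simp
      _ ≤ κ x ^ (q * (2 * N)) * ‖deriv (Z x r) 0‖ * 1 := by
          gcongr
          rw [div_le_one (by positivity)]; exact b
      _ = _ := mul_one _
  · intro n
    obtain ⟨q, r, hn, hr⟩ := hdec n
    rw [hn, derPerX e1 e3, mul_zero, norm_mul, hnl, pow_add]
    have a := (h1 r hr).2.2
    have b : 1 ≤ κ x ^ r := one_le_pow₀ hκ.le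
    calc κ x ^ (q * (2 * N)) * ‖deriv (Z x r) 0‖ ≤ κ x ^ (q * (2 * N)) * B := by gcongr
      _ = B * 1 * (1 * κ x ^ (q * (2 * N))) := by ring
      _ ≤ _ := by gcongr

end UF
end HenonML
end

section
namespace HenonML

lemma UD.mono {d : ℕ} {a : ℂ} {c : Fin (d - 1) → ℂ} {N : ℕ} {lam : ℂ} {Z : ℕ → ℂ → ℂ} {R R' κ B : ℝ}
    (h : UD d a c N lam Z R κ B) (h0 : 0 < R') (h1 : R' ≤ R) : UD d a c N lam Z R' κ B :=
  { h with
    hR := h0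
    h1 := fun n s hs => h.h1 n s (hs.trans (by
      have := h.hκ
      gcongr)) }

lemma bdd_of_cont {f : ℂ → ℂ} (hf : Continuous f) (r : ℝ) : ∃ M, 0 ≤ M ∧ ∀ u, ‖u‖ ≤ r → ‖f u‖ ≤ M := by
  obtain ⟨M, hM⟩ := (isCompact_closedBall (0:ℂ) r).exists_bound_of_continuousOn hf.continuousOn
  exact ⟨max M 0, le_max_right _ _, fun u hu => (hM u (by simpa using hu)).trans (le_max_left _ _)⟩

namespace UF
variable {d : ℕ} {c0 : Fin (d-1) → ℂ} {N : ℕ} {ζ : ℂ} {lam : ℂ × (Fin (d-1) → ℂ) → ℂ} {Z : ℂ × (Fin (d-1) → ℂ) → ℕ → ℂ → ℂ}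

lemma diff0 (h : UF d c0 N ζ lam Z) (n : ℕ) : Differentiable ℂ (Z (0, c0) n) := h.ev.self_of_nhds.1 n

lemma contD0 (h : UF d c0 N ζ lam Z) (n : ℕ) : Continuous (deriv (Z (0, c0) n)) :=
  ((h.diff0 n).contDiff (n := 1)).continuous_deriv (by simp)

lemma unifB (h : UF d c0 N ζ lam Z) (n : ℕ) (r : ℝ) : ∃ M, 0 ≤ M ∧ ∀ᶠ x in 𝓝 ((0:ℂ), c0), ∀ u : ℂ, ‖u‖ ≤ r → ‖Z x n u‖ ≤ M := by
  obtain ⟨M, hM0, hM⟩ := bdd_of_cont (h.diff0 n).continuous r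
  refine ⟨M + 1, by linarith, ?_⟩
  filter_upwards [h.unif n r one_pos] with x hx u hu
  have := norm_le_norm_add_norm_sub' (Z x n u) (Z (0, c0) n u)
  linarith [hx u hu, hM u hu]

lemma unifDB (h : UF d c0 N ζ lam Z) (n : ℕ) (r : ℝ) : ∃ M, 0 ≤ M ∧ ∀ᶠ x in 𝓝 ((0:ℂ), c0), ∀ u : ℂ, ‖u‖ ≤ r → ‖deriv (Z x n) u‖ ≤ M := by
  obtain ⟨M, hM0, hM⟩ := bdd_of_cont (h.contD0 n) r
  refine ⟨M + 1, by linarith, ?_⟩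
  filter_upwards [h.unifD n r one_pos] with x hx u hu
  have := norm_le_norm_add_norm_sub' (deriv (Z x n) u) (deriv (Z (0, c0) n) u)
  linarith [hx u hu, hM u hu]

lemma H0_ex (h : UF d c0 N ζ lam Z) {uB : ℂ} (hB : Z (0, c0) 1 uB = Z (0, c0) 1 0) (hBd : deriv (Z (0, c0) 1) uB ≠ 0) :
    ∃ R : ℝ, 0 < R ∧ ∃ H : ℂ × (Fin (d-1) → ℂ) → ℂ → ℂ, (∀ᶠ x in 𝓝 ((0:ℂ), c0), DifferentiableOn ℂ (H x) (Metric.ball 0 R) ∧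
      (∀ s ∈ Metric.ball (0:ℂ) R, Z x 1 (H x s) = Z x 1 s) ∧ (∀ s ∈ Metric.ball (0:ℂ) R, ‖H x s‖ ≤ ‖uB‖ + 1)) ∧
      Tendsto (fun x => H x 0) (𝓝 (0, c0)) (𝓝 uB) ∧
      Tendsto (fun x => deriv (H x) 0) (𝓝 (0, c0)) (𝓝 (deriv (Z (0, c0) 1) 0 / deriv (Z (0, c0) 1) uB)) := by
  set α := deriv (Z (0, c0) 1) uB with hα
  have ha : 0 < ‖α‖ := norm_pos_iff.2 hBd
  obtain ⟨ρ', hρ', hρ2⟩ := Metric.continuousAt_iff.1 ((h.contD0 1).continuousAt (x := uB)) (‖α‖/4) (by positivity)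
  set ρ := min ρ' 1 with hρdef
  have hρ0 : 0 < ρ := lt_min hρ' one_pos
  have hρ1 : ρ ≤ 1 := min_le_right _ _
  obtain ⟨R', hR', hR2⟩ := Metric.continuousAt_iff.1 ((h.diff0 1).continuous.continuousAt (x := 0)) (‖α‖*ρ/12) (by positivity)
  set R := min R' 1 with hR
  have hR0 : 0 < R := lt_min hR' one_pos
  have hR1 : R ≤ 1 := min_le_right _ _
  have ev1 : ∀ᶠ x in 𝓝 ((0:ℂ), c0), ∀ z ∈ Metric.ball uB ρ, ‖deriv (Z x 1) z - α‖ ≤ ‖α‖ / 2 := by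
    filter_upwards [h.unifD 1 (‖uB‖ + 1) (show 0 < ‖α‖/4 by positivity)] with x hx z hz
    rw [mem_ball_iff_norm] at hz
    have e1 := hx z (by have := norm_le_norm_add_norm_sub' z uB; linarith)
    have e2 := hρ2 (show dist z uB < ρ' by rw [dist_eq_norm]; exact hz.trans_le (min_le_left _ _))
    rw [dist_eq_norm] at e2
    have := norm_add_le (deriv (Z x 1) z - deriv (Z (0,c0) 1) z) (deriv (Z (0,c0) 1) z - α)
    rw [sub_add_sub_cancel] at this
    linarith
  have ev2 : ∀ᶠ x in 𝓝 ((0:ℂ), c0), ∀ s ∈ Metric.ball (0:ℂ) R, ‖Z x 1 s - Z x 1 uB‖ ≤ ‖α‖ * (ρ / 2) / 2 := by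
    filter_upwards [h.unif 1 (‖uB‖ + 1) (show 0 < ‖α‖*ρ/12 by positivity)] with x hx s hs
    have hs' : ‖s‖ < R := by simpa using hs
    have e1 := hx s (by have := norm_nonneg uB; linarith)
    have e2 := hx uB (by linarith)
    have e3 := hR2 (show dist s 0 < R' by rw [dist_zero_right]; exact hs'.trans_le (min_le_left _ _))
    rw [dist_eq_norm] at e3
    have : Z x 1 s - Z x 1 uB = (Z x 1 s - Z (0,c0) 1 s) + (Z (0,c0) 1 s - Z (0,c0) 1 0) - (Z x 1 uB - Z (0,c0) 1 uB) := by
      rw [hB]; ring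
    rw [this]
    have a1 := norm_sub_le ((Z x 1 s - Z (0,c0) 1 s) + (Z (0,c0) 1 s - Z (0,c0) 1 0)) (Z x 1 uB - Z (0,c0) 1 uB)
    have a2 := norm_add_le (Z x 1 s - Z (0,c0) 1 s) (Z (0,c0) 1 s - Z (0,c0) 1 0)
    linarith
  have hball : Metric.closedBall uB (ρ/2) ⊆ Metric.ball uB ρ := Metric.closedBall_subset_ball (by linarith)
  have ev3 : ∀ᶠ x in 𝓝 ((0:ℂ), c0), ∃ G : ℂ → ℂ, DifferentiableOn ℂ G (Metric.ball 0 R) ∧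
      (∀ s ∈ Metric.ball (0:ℂ) R, G s ∈ Metric.closedBall uB (ρ/2)) ∧ ∀ s ∈ Metric.ball (0:ℂ) R, Z x 1 (G s) = Z x 1 s := by
    filter_upwards [ev1, ev2, h.ev] with x h1 h2 h3
    exact inv_lemma Metric.isOpen_ball (convex_ball uB ρ) Metric.isOpen_ball (h3.1 1).differentiableOn (h3.1 1).differentiableOn hBd
      h1 (fun _ => uB) (fun _ => ρ/2) (fun _ _ => by positivity) (fun _ _ => hball) h2
  have : ∃ H : ℂ × (Fin (d-1) → ℂ) → ℂ → ℂ, ∀ᶠ x in 𝓝 ((0:ℂ), c0), DifferentiableOn ℂ (H x) (Metric.ball 0 R) ∧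
      (∀ s ∈ Metric.ball (0:ℂ) R, H x s ∈ Metric.closedBall uB (ρ/2)) ∧ ∀ s ∈ Metric.ball (0:ℂ) R, Z x 1 (H x s) = Z x 1 s :=
    Filter.Eventually.choice ev3
  obtain ⟨H, hH⟩ := this
  have h0R : (0:ℂ) ∈ Metric.ball (0:ℂ) R := Metric.mem_ball_self hR0
  have z1 : ∀ u, Tendsto (fun x => Z x 1 u) (𝓝 (0, c0)) (𝓝 (Z (0, c0) 1 u)) := by
    intro u
    have := (h.cont 1 u).comp (f := fun x => (x, u)) (by fun_prop)
    exact this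
  have t0 : Tendsto (fun x => H x 0) (𝓝 (0, c0)) (𝓝 uB) := by
    rw [tendsto_iff_norm_sub_tendsto_zero]
    have t1 : Tendsto (fun x => 2 / ‖α‖ * ‖Z x 1 0 - Z x 1 uB‖) (𝓝 (0, c0)) (𝓝 0) := by
      have := ((z1 0).sub (z1 uB)).norm.const_mul (2 / ‖α‖)
      rwa [hB, sub_self, norm_zero, mul_zero] at this
    refine squeeze_zero' (Eventually.of_forall fun _ => norm_nonneg _) ?_ t1
    filter_upwards [ev1, h.ev, hH] with x h1 h3 ⟨g1, g2, g3⟩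
    have e := near_linear_bound Metric.isOpen_ball (convex_ball uB ρ) (h3.1 1).differentiableOn h1 (hball (g2 0 h0R)) (Metric.mem_ball_self hρ0)
    rw [g3 0 h0R] at e
    have e2 := norm_sub_norm_le (α * (H x 0 - uB)) (Z x 1 0 - Z x 1 uB)
    rw [norm_sub_rev (α * (H x 0 - uB)), norm_mul] at e2
    rw [div_mul_eq_mul_div, le_div_iff₀ ha]
    linarith
  have tD : ∀ (g : ℂ × (Fin (d-1) → ℂ) → ℂ) (u : ℂ), Tendsto g (𝓝 (0, c0)) (𝓝 u) →
      Tendsto (fun x => deriv (Z x 1) (g x)) (𝓝 (0, c0)) (𝓝 (deriv (Z (0,c0) 1) u)) := by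
    intro g u hg
    have h1 := (h.locUnifD 1)
    rw [tendstoLocallyUniformlyOn_univ] at h1
    exact h1.tendsto_comp (h.contD0 1).continuousAt hg
  refine ⟨R, hR0, H, ?_, t0, ?_⟩
  · filter_upwards [hH] with x ⟨g1, g2, g3⟩
    refine ⟨g1, g3, fun s hs => ?_⟩
    have := g2 s hs
    rw [mem_closedBall_iff_norm] at this
    have := norm_le_norm_add_norm_sub' (H x s) uB
    linarith
  · have t1 := tD _ _ t0
    have t2 := tD (fun _ => 0) 0 tendsto_const_nhds
    refine (t2.div t1 hBd).congr' ?_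
    filter_upwards [hH, h.ev, t1.eventually_ne hBd] with x ⟨g1, g2, g3⟩ h3 hne
    have hd1 := ((h3.1 1) (H x 0)).hasDerivAt.comp 0 ((g1.differentiableAt (Metric.isOpen_ball.mem_nhds h0R)).hasDerivAt)
    have hd2 : HasDerivAt (Z x 1 ∘ H x) (deriv (Z x 1) 0) 0 :=
      ((h3.1 1) 0).hasDerivAt.congr_of_eventuallyEq (by
        filter_upwards [Metric.isOpen_ball.mem_nhds h0R] with s hs using g3 s hs)
    have := hd1.unique hd2
    simp only [Pi.div_apply]
    rw [div_eq_iff hne, ← this]; ring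

theorem asym (hd : 2 ≤ d) (h : UF d c0 N ζ lam Z) {uB : ℂ} (huB : uB ≠ 0) (hB : Z (0, c0) 1 uB = Z (0, c0) 1 0) (hBd : deriv (Z (0, c0) 1) uB ≠ 0) :
    ∃ C r : ℝ, 1 ≤ C ∧ 0 < r ∧ ∃ Γ0 Γ1 : ℂ × (Fin (d-1) → ℂ) → ℂ,
      Tendsto Γ0 (𝓝 (0, c0)) (𝓝 uB) ∧ Tendsto Γ1 (𝓝 (0, c0)) (𝓝 (deriv (Z (0, c0) 1) 0 / deriv (Z (0, c0) 1) uB)) ∧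
      ∀ᶠ x in 𝓝 ((0:ℂ), c0), x.1 ≠ 0 → Bad d x.1 x.2 → ∀ s : ℂ, ‖s‖ ≤ r →
        ‖Z x 1 (Γ0 x + Γ1 x * s) - Z x 1 s‖ ≤ C * ‖x.1‖ ∧ ‖Z x 2 (Γ0 x + Γ1 x * s) - Z x 2 s‖ ≤ C * ‖x.1‖ ^ 2 := by
  obtain ⟨R1, hR1, H, hH, t0, t1⟩ := h.H0_ex hB hBd
  obtain ⟨R2, B, κ0, κ1, hR2, hB1, hκ0, hud⟩ := h.ud
  set γ := deriv (Z (0, c0) 1) 0 / deriv (Z (0, c0) 1) uB with hγ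
  have hγ0 : γ ≠ 0 := div_ne_zero h.der hBd
  obtain ⟨Q1, hQ1, hq1⟩ := h.unifDB 1 (‖uB‖ + 1 + 1)
  obtain ⟨Q2, hQ2, hq2⟩ := h.unifDB 2 (‖uB‖ + 1 + 1)
  obtain ⟨D1, hD1, hd1⟩ := h.unifB 0 (‖uB‖ + 1 + R1)
  set R := min R1 R2
  have hR : 0 < R := lt_min hR1 hR2
  set β := min ‖uB‖ ‖γ‖ / 2 with hβd
  have hβ0 : 0 < min ‖uB‖ ‖γ‖ := lt_min (norm_pos_iff.2 huB) (norm_pos_iff.2 hγ0)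
  have hβ : 0 < β := by positivity
  have hβ1 : β < ‖uB‖ := by have := min_le_left ‖uB‖ ‖γ‖; linarith
  have hβ2 : β < ‖γ‖ := by have := min_le_right ‖uB‖ ‖γ‖; linarith
  obtain ⟨C, r, a1, hC, hr, ha1, key⟩ := as_lemma hd (A := ‖c0‖ + 1) (κ0 := κ0) (κ1 := κ1) (B := B) (R := R) (U := ‖uB‖ + 1) (D0 := D1 + D1) (β := β)
    (Q := max Q1 Q2) (by linarith [norm_nonneg c0]) hκ0 hB1 hR (by linarith [norm_nonneg uB]) (by linarith) hβ
  have fst0 : Tendsto (fun x : ℂ × (Fin (d-1) → ℂ) => x.1) (𝓝 ((0:ℂ), c0)) (𝓝 0) := continuous_fst.continuousAt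
  have ev : ∀ᶠ x in 𝓝 ((0:ℂ), c0), x.1 ≠ 0 → Bad d x.1 x.2 → ∃ Γ0 Γ1 : ℂ, ‖Γ0 - H x 0‖ ≤ C * ‖x.1‖ ∧ ‖Γ1 - deriv (H x) 0‖ ≤ C * ‖x.1‖ ∧
        ∀ s : ℂ, ‖s‖ ≤ r → ‖Z x 1 (Γ0 + Γ1 * s) - Z x 1 s‖ ≤ C * ‖x.1‖ ∧ ‖Z x 2 (Γ0 + Γ1 * s) - Z x 2 s‖ ≤ C * ‖x.1‖ ^ 2 := by
    have ec : ∀ᶠ x : ℂ × (Fin (d-1) → ℂ) in 𝓝 ((0:ℂ), c0), ‖x.2‖ < ‖c0‖ + 1 :=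
      (continuous_snd.norm.continuousAt (x := ((0:ℂ), c0))).eventually_lt_const (by simp)
    filter_upwards [hH, hud, hq1, hq2, hd1, ec, fst0.norm.eventually_lt_const (show ‖(0:ℂ)‖ < a1 by simpa using ha1), t0.norm.eventually_const_lt hβ1, t1.norm.eventually_const_lt hβ2] with x ⟨g1, g2, g3⟩ ⟨κ, u1, u2, u3⟩ q1 q2 d1 ec ea b1 b2 ha0 hbad
    have hκ : 1 < κ := hκ0.trans_le u2
    have hRk : R / κ ≤ R1 := (div_le_self hR.le hκ.le).trans (min_le_left _ _)
    have hbb : Metric.ball (0:ℂ) (R / κ) ⊆ Metric.ball 0 R1 := Metric.ball_subset_ball hRk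
    refine key x.1 x.2 N (lam x) (Z x) κ (u1.mono hR (min_le_right _ _)) u2 u3 ha0 ea (fun j => (norm_le_pi_norm _ j).trans ec.le) hbad
      (fun u hu => ⟨(q1 u hu).trans (le_max_left _ _), (q2 u hu).trans (le_max_right _ _)⟩) (H x) (g1.mono hbb) (fun s hs => g2 s (hbb hs))
      (fun s hs => g3 s (hbb hs)) (fun s hs => ?_) b1.le b2.le
    have hs' : ‖s‖ < R1 := by simpa using hbb hs
    have := g3 s (hbb hs)
    exact (norm_sub_le _ _).trans (add_le_add (d1 _ (by linarith)) (d1 _ (by linarith [norm_nonneg uB])))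
  have ex : ∀ x, ∃ Γ : ℂ × ℂ, ‖Γ.1 - H x 0‖ ≤ C * ‖x.1‖ ∧ ‖Γ.2 - deriv (H x) 0‖ ≤ C * ‖x.1‖ ∧
      ((∃ Γ0 Γ1 : ℂ, ‖Γ0 - H x 0‖ ≤ C * ‖x.1‖ ∧ ‖Γ1 - deriv (H x) 0‖ ≤ C * ‖x.1‖ ∧
        ∀ s : ℂ, ‖s‖ ≤ r → ‖Z x 1 (Γ0 + Γ1 * s) - Z x 1 s‖ ≤ C * ‖x.1‖ ∧ ‖Z x 2 (Γ0 + Γ1 * s) - Z x 2 s‖ ≤ C * ‖x.1‖ ^ 2) →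
        ∀ s : ℂ, ‖s‖ ≤ r → ‖Z x 1 (Γ.1 + Γ.2 * s) - Z x 1 s‖ ≤ C * ‖x.1‖ ∧ ‖Z x 2 (Γ.1 + Γ.2 * s) - Z x 2 s‖ ≤ C * ‖x.1‖ ^ 2) := by
    intro x
    by_cases hx : (∃ Γ0 Γ1 : ℂ, ‖Γ0 - H x 0‖ ≤ C * ‖x.1‖ ∧ ‖Γ1 - deriv (H x) 0‖ ≤ C * ‖x.1‖ ∧
        ∀ s : ℂ, ‖s‖ ≤ r → ‖Z x 1 (Γ0 + Γ1 * s) - Z x 1 s‖ ≤ C * ‖x.1‖ ∧ ‖Z x 2 (Γ0 + Γ1 * s) - Z x 2 s‖ ≤ C * ‖x.1‖ ^ 2)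
    · obtain ⟨Γ0, Γ1, e1, e2, e3⟩ := hx
      exact ⟨(Γ0, Γ1), e1, e2, fun _ => e3⟩
    · exact ⟨(H x 0, deriv (H x) 0), by simp; positivity, by simp; positivity, fun hh => absurd hh hx⟩
  choose Γ hΓ using ex
  have tC : Tendsto (fun x : ℂ × (Fin (d-1) → ℂ) => C * ‖x.1‖) (𝓝 ((0:ℂ), c0)) (𝓝 0) := by
    simpa using fst0.norm.const_mul C
  have lim : ∀ (F G : ℂ × (Fin (d-1) → ℂ) → ℂ) (l : ℂ), (∀ x, ‖F x - G x‖ ≤ C * ‖x.1‖) → Tendsto G (𝓝 (0, c0)) (𝓝 l) → Tendsto F (𝓝 (0, c0)) (𝓝 l) := by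
    intro F G l h1 h2
    have : Tendsto (fun x => F x - G x) (𝓝 (0, c0)) (𝓝 0) := squeeze_zero_norm h1 tC
    simpa using this.add h2
  refine ⟨C, r, hC, hr, fun x => (Γ x).1, fun x => (Γ x).2, lim _ _ _ (fun x => (hΓ x).1) t0, lim _ _ _ (fun x => (hΓ x).2.1) t1, ?_⟩
  filter_upwards [ev] with x hx ha hb
  exact (hΓ x).2.2 (hx ha hb)

end UF
end HenonML
end

section
namespace HenonML

lemma entire_log {φ : ℂ → ℂ} (hφ : Differentiable ℂ φ) (h0 : ∀ s, φ s ≠ 0) : ∃ h : ℂ → ℂ, Differentiable ℂ h ∧ ∀ s, φ s = Complex.exp (h s) := by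
  have hd : Differentiable ℂ (fun s => deriv φ s / φ s) := by
    have := hφ.deriv
    intro s
    exact (this s).div (hφ s) (h0 s)
  obtain ⟨h, h1, h2⟩ := hd.isExactOn_univ.with_val_at 0 (Complex.log (φ 0))
  have hdh : Differentiable ℂ h := fun s => (h2 s (mem_univ s)).differentiableAt
  refine ⟨h, hdh, ?_⟩
  have hc : ∀ s, φ s * Complex.exp (- h s) = φ 0 * Complex.exp (- h 0) := by
    intro s
    refine is_const_of_deriv_eq_zero (f := fun s => φ s * Complex.exp (- h s)) (by fun_prop) (fun x => ?_) s 0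
    have := (hφ x).hasDerivAt.mul ((h2 x (mem_univ x)).neg.cexp)
    refine this.deriv.trans ?_
    field_simp [h0 x]; ring
  intro s
  have := hc s
  rw [h1, Complex.exp_neg, Complex.exp_neg, Complex.exp_log (h0 0), mul_inv_cancel₀ (h0 0)] at this
  have he := Complex.exp_ne_zero (h s)
  field_simp at this
  exact this

lemma poly_of_growth {h : ℂ → ℂ} (hh : Differentiable ℂ h) {Λ E K : ℝ} (hΛ : 1 < Λ)
    (hb : ∀ (k : ℕ) s, ‖s‖ ≤ Λ ^ k → ‖h s‖ ≤ K * E ^ k) : ∃ H : Polynomial ℂ, ∀ s, h s = H.eval s := by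
  obtain ⟨q, hq⟩ := pow_unbounded_of_one_lt (|E|) hΛ
  have hΛ0 : 0 < Λ := by linarith
  have hz : ∀ n, q ≤ n → iteratedDeriv n h 0 = 0 := by
    intro n hn
    have hlim : Tendsto (fun k : ℕ => (n.factorial * |K|) * (|E| / Λ ^ n) ^ k) atTop (𝓝 0) := by
      have : |E| / Λ ^ n < 1 := by
        rw [div_lt_one (by positivity)]
        exact hq.trans_le (pow_le_pow_right₀ hΛ.le hn)
      simpa using (tendsto_pow_atTop_nhds_zero_of_lt_one (by positivity) this).const_mul (n.factorial * |K|)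
    have : ∀ k : ℕ, ‖iteratedDeriv n h 0‖ ≤ (n.factorial * |K|) * (|E| / Λ ^ n) ^ k := by
      intro k
      have := Complex.norm_iteratedDeriv_le_of_forall_mem_sphere_norm_le (c := 0) (R := Λ ^ k) (C := |K| * |E| ^ k) n (by positivity) hh.diffContOnCl (f := h) (fun z hz => by
        have := hb k z (by simpa using hz.le)
        refine this.trans ((le_abs_self _).trans ?_)
        rw [abs_mul, abs_pow])
      refine this.trans (le_of_eq ?_)
      rw [div_pow, ← pow_mul, ← pow_mul, mul_comm k n]; ring
    exact norm_le_zero_iff.1 (ge_of_tendsto' hlim this)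
  refine ⟨∑ n ∈ Finset.range q, Polynomial.monomial n ((n.factorial : ℂ)⁻¹ * iteratedDeriv n h 0), fun s => ?_⟩
  rw [← Complex.taylorSeries_eq_of_entire' 0 s hh, tsum_eq_sum (s := Finset.range q), Polynomial.eval_finsetSum]
  · simp
  · intro n hn
    rw [hz n (by simpa using hn)]; simp

/-- a Picard type theorem for functions of finite order -/
theorem picard_fin {φ : ℂ → ℂ} (hφ : Differentiable ℂ φ) {lam : ℂ} (hlam : 1 < ‖lam‖) {C : ℝ} {D : ℕ}
    (hg : ∀ s, ‖φ (lam * s)‖ ≤ C * (1 + ‖φ s‖) ^ D) {x1 x2 : ℂ} (hx : x1 ≠ x2) (h1 : ∀ s, φ s ≠ x1) (h2 : ∀ s, φ s ≠ x2) :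
    ∀ s, φ s = φ 0 := by
  set Λ := ‖lam‖ with hΛ
  have hΛ0 : 0 < Λ := by linarith
  have hlam0 : lam ≠ 0 := norm_pos_iff.1 hΛ0
  have hC : 0 ≤ C := by
    have := (norm_nonneg _).trans (hg 0)
    exact nonneg_of_mul_nonneg_left this (by positivity)
  obtain ⟨M0, hM0, hM⟩ := bdd_of_cont hφ.continuous 1
  set E : ℝ := D + 1
  have hE : 1 ≤ E := by simp [E]
  set K : ℝ := max (C * 2 ^ D) M0
  have hK0 : 0 ≤ K := hM0.trans (le_max_right _ _)
  have hgrow : ∀ (k : ℕ) s, ‖s‖ ≤ Λ ^ k → ‖φ s‖ ≤ Real.exp (K * E ^ k) := by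
    intro k
    induction k with
    | zero =>
      intro s hs
      rw [pow_zero, mul_one]
      have := hM s (by simpa using hs)
      linarith [Real.add_one_le_exp K, le_max_right (C * 2 ^ D) M0]
    | succ k ih =>
      intro s hs
      have e := hg (lam⁻¹ * s)
      rw [mul_inv_cancel_left₀ hlam0] at e
      have i := ih (lam⁻¹ * s) (by
        rw [norm_mul, norm_inv, inv_mul_le_iff₀ hΛ0, ← pow_succ']; exact hs)
      have hEk : 1 ≤ E ^ k := one_le_pow₀ hE
      have o : 1 ≤ Real.exp (K * E ^ k) := Real.one_le_exp (by positivity)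
      calc ‖φ s‖ ≤ C * (1 + ‖φ (lam⁻¹ * s)‖) ^ D := e
        _ ≤ C * (2 * Real.exp (K * E ^ k)) ^ D := by
            gcongr; linarith
        _ = C * 2 ^ D * Real.exp (K * E ^ k * D) := by
            rw [mul_pow, ← Real.exp_nat_mul, mul_assoc]; congr 3; ring
        _ ≤ Real.exp (K * E ^ k) * Real.exp (K * E ^ k * D) := by
            gcongr
            have a1 : C * 2 ^ D ≤ K := le_max_left _ _
            have a2 : K ≤ K * E ^ k := by nlinarith
            linarith [Real.add_one_le_exp (K * E ^ k)]
        _ = Real.exp (K * E ^ (k+1)) := by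
            rw [← Real.exp_add]; congr 1; simp only [E]; ring
  obtain ⟨h, hh, he⟩ := entire_log (φ := fun s => φ s - x1) (by fun_prop) (fun s => sub_ne_zero.2 (h1 s))
  have hre : ∀ (k : ℕ) s, ‖s‖ ≤ Λ ^ k → (h s).re ≤ (K + ‖x1‖ + 1) * E ^ k := by
    intro k s hs
    have e := congrArg norm (he s)
    rw [Complex.norm_exp] at e
    have hEk : 1 ≤ E ^ k := one_le_pow₀ hE
    have e1 : ‖φ s - x1‖ ≤ Real.exp ((K + ‖x1‖ + 1) * E ^ k) := by
      have o : 1 ≤ Real.exp (K * E ^ k) := Real.one_le_exp (by positivity)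
      calc ‖φ s - x1‖ ≤ ‖φ s‖ + ‖x1‖ := norm_sub_le _ _
        _ ≤ Real.exp (K * E ^ k) + ‖x1‖ * Real.exp (K * E ^ k) := by
            gcongr
            · exact hgrow k s hs
            · nlinarith [norm_nonneg x1]
        _ = Real.exp (K * E ^ k) * (‖x1‖ + 1) := by ring
        _ ≤ Real.exp (K * E ^ k) * Real.exp ((‖x1‖ + 1) * E ^ k) := by
            gcongr
            have : ‖x1‖ + 1 ≤ (‖x1‖ + 1) * E ^ k := by nlinarith [norm_nonneg x1]
            linarith [Real.add_one_le_exp ((‖x1‖ + 1) * E ^ k)]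
        _ = _ := by rw [← Real.exp_add]; congr 1; ring
    rw [e] at e1
    exact Real.exp_le_exp.1 e1
  set K' := K + ‖x1‖ + 1
  have hK' : 0 < K' := by have := norm_nonneg x1; simp only [K']; positivity
  obtain ⟨H, hH⟩ := poly_of_growth hh hlam (E := E) (K := 2 * K' * E / (Λ - 1) + ‖h 0‖ * (Λ + 1) / (Λ - 1)) (by
    intro k s hs
    have hEk : 1 ≤ E ^ k := one_le_pow₀ hE
    have hr : Λ ^ k < Λ ^ (k+1) := pow_lt_pow_right₀ hlam (by omega)
    have b := Complex.borelCaratheodory (f := h) (M := K' * E ^ (k+1)) (R := Λ ^ (k+1)) (z := s) (by positivity) hh.differentiableOn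
      (fun z hz => hre (k+1) z (by simpa using (mem_ball_zero_iff.1 hz).le)) (by positivity) (by simpa using hs.trans_lt hr)
    have hΛk : 0 < Λ ^ k := by positivity
    have hl1 : 0 < Λ - 1 := by linarith
    have hden : Λ ^ (k+1) - ‖s‖ ≥ Λ ^ k * (Λ - 1) := by rw [pow_succ]; linarith
    refine b.trans ?_
    have t1 : 2 * (K' * E ^ (k+1)) * ‖s‖ / (Λ ^ (k+1) - ‖s‖) ≤ 2 * (K' * E ^ (k+1)) * Λ ^ k / (Λ ^ k * (Λ - 1)) := by
      gcongr
    have t2 : ‖h 0‖ * (Λ ^ (k+1) + ‖s‖) / (Λ ^ (k+1) - ‖s‖) ≤ ‖h 0‖ * (Λ ^ (k+1) + Λ ^ k) / (Λ ^ k * (Λ - 1)) := by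
      gcongr
    have t3 : 2 * (K' * E ^ (k+1)) * Λ ^ k / (Λ ^ k * (Λ - 1)) = 2 * K' * E / (Λ - 1) * E ^ k := by
      rw [pow_succ E]; field_simp
    have t4 : ‖h 0‖ * (Λ ^ (k+1) + Λ ^ k) / (Λ ^ k * (Λ - 1)) = ‖h 0‖ * (Λ + 1) / (Λ - 1) * 1 := by
      rw [pow_succ Λ]; field_simp
    rw [add_mul (2 * K' * E / (Λ - 1))]
    have t5 : ‖h 0‖ * (Λ + 1) / (Λ - 1) * 1 ≤ ‖h 0‖ * (Λ + 1) / (Λ - 1) * E ^ k := by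
      gcongr
    linarith)
  by_cases hdeg : H.natDegree = 0
  · intro s
    have : h s = h 0 := by
      rw [hH, hH, Polynomial.eq_C_of_natDegree_eq_zero hdeg]; simp
    have e1 := he s
    have e2 := he 0
    rw [this, ← e2] at e1
    exact sub_left_injective e1
  · exfalso
    have : (H - Polynomial.C (Complex.log (x2 - x1))).degree ≠ 0 := by
      intro h0
      have := Polynomial.natDegree_eq_of_degree_eq_some h0
      rw [Polynomial.natDegree_sub_C] at this
      exact hdeg this
    obtain ⟨s, hs⟩ := IsAlgClosed.exists_root _ this
    have e : H.eval s = Complex.log (x2 - x1) := by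
      simpa [Polynomial.IsRoot, sub_eq_zero] using hs
    have e1 := he s
    rw [hH, e, Complex.exp_log (sub_ne_zero.2 hx.symm)] at e1
    exact h2 s (sub_left_injective e1)

end HenonML
end

section
namespace HenonML

lemma hp_growth (d : ℕ) (c : Fin (d-1) → ℂ) : ∃ C : ℝ, 1 ≤ C ∧ ∀ z, 1 + ‖henonPoly d c z‖ ≤ C * (1 + ‖z‖) ^ d := by
  refine ⟨2 + ∑ j, ‖c j‖, by have : 0 ≤ ∑ j, ‖c j‖ := Finset.sum_nonneg fun _ _ => norm_nonneg _
                             linarith, fun z => ?_⟩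
  have h1 : (1:ℝ) ≤ 1 + ‖z‖ := by linarith [norm_nonneg z]
  have hp : (1:ℝ) ≤ (1 + ‖z‖) ^ d := one_le_pow₀ h1
  have e1 : ‖z ^ d‖ ≤ (1 + ‖z‖) ^ d := by rw [norm_pow]; gcongr; linarith
  have e2 : ‖∑ j : Fin (d-1), c j * z ^ (j:ℕ)‖ ≤ ∑ j, ‖c j‖ * (1 + ‖z‖) ^ d := by
    refine (norm_sum_le _ _).trans (Finset.sum_le_sum fun j _ => ?_)
    rw [norm_mul, norm_pow]
    gcongr
    calc ‖z‖ ^ (j:ℕ) ≤ (1 + ‖z‖) ^ (j:ℕ) := by gcongr; linarith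
      _ ≤ _ := pow_le_pow_right₀ h1 (by have := j.2; omega)
  rw [← Finset.sum_mul] at e2
  have := norm_add_le (z ^ d) (∑ j : Fin (d-1), c j * z ^ (j:ℕ))
  unfold henonPoly
  linarith

lemma hp_iter_growth (d : ℕ) (c : Fin (d-1) → ℂ) (n : ℕ) : ∃ C : ℝ, ∃ D : ℕ, 1 ≤ C ∧ ∀ z, 1 + ‖(henonPoly d c)^[n] z‖ ≤ C * (1 + ‖z‖) ^ D := by
  obtain ⟨C0, h0, hC0⟩ := hp_growth d c
  induction n with
  | zero => exact ⟨1, 1, le_rfl, fun z => by simp⟩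
  | succ n ih =>
    obtain ⟨C, D, h1, hC⟩ := ih
    refine ⟨C0 * C ^ d, D * d, one_le_mul_of_one_le_of_one_le h0 (one_le_pow₀ h1), fun z => ?_⟩
    rw [iterate_succ_apply']
    refine (hC0 _).trans ?_
    rw [mul_assoc, pow_mul, ← mul_pow]
    gcongr
    exact hC z

lemma three_circ {r K : ℝ} (hr : 0 < r) (hK : r < K) : ∃ K1, K ≤ K1 ∧ ∀ (E : ℂ → ℂ) (m M : ℝ), Differentiable ℂ E → 0 < m → m ≤ M →
    (∀ s, ‖s‖ ≤ r → ‖E s‖ ≤ m) → (∀ s, ‖s‖ ≤ K1 → ‖E s‖ ≤ M) → ∀ s, ‖s‖ ≤ K → ‖E s‖ ≤ m ^ (3/4 : ℝ) * M ^ (1/4 : ℝ) := by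
  set L := Real.log (K / r) with hL
  have hL0 : 0 < L := Real.log_pos (by rwa [one_lt_div hr])
  have hexpL : r * Real.exp L = K := by
    rw [hL, Real.exp_log (div_pos (hr.trans hK) hr)]; field_simp
  refine ⟨r * Real.exp (4 * L), ?_, fun E m M hE hm hmM h1 h2 s hs => ?_⟩
  · rw [← hexpL]
    gcongr
    linarith
  have hM : 0 < M := hm.trans_le hmM
  have key : ∀ t : ℝ, 0 ≤ t → t ≤ 1/4 → m ^ (1 - t) * M ^ t ≤ m ^ (3/4 : ℝ) * M ^ (1/4 : ℝ) := by
    intro t ht0 ht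
    have e1 : m ^ (1 - t) = m ^ (3/4 : ℝ) * m ^ (1/4 - t) := by rw [← Real.rpow_add hm]; congr 1; ring
    have e2 : M ^ (1/4 : ℝ) = M ^ (1/4 - t) * M ^ t := by rw [← Real.rpow_add hM]; congr 1; ring
    rw [e1, e2, mul_assoc]
    gcongr
  by_cases hsr : ‖s‖ ≤ r
  · have := key 0 le_rfl (by norm_num)
    simp only [sub_zero, Real.rpow_one, Real.rpow_zero, mul_one] at this
    exact (h1 s hsr).trans this
  push Not at hsr
  have hs0 : s ≠ 0 := by rintro rfl; simp at hsr; linarith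
  have hs0' : 0 < ‖s‖ := norm_pos_iff.2 hs0
  set w : ℂ := Complex.log (s / r) with hw
  have hrc : (r:ℂ) ≠ 0 := by exact_mod_cast hr.ne'
  have hws : (r:ℂ) * Complex.exp w = s := by
    rw [hw, Complex.exp_log (div_ne_zero hs0 hrc)]; field_simp
  have hnr : ∀ z : ℂ, ‖(r:ℂ) * Complex.exp z‖ = r * Real.exp z.re := by
    intro z; rw [norm_mul, Complex.norm_exp]; simp [abs_of_pos hr]
  have hwr : r * Real.exp w.re = ‖s‖ := by rw [← hnr, hws]
  have hw0 : 0 ≤ w.re := by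
    have : 1 < Real.exp w.re := by
      by_contra hc; push Not at hc; nlinarith
    rw [← Real.exp_zero] at this
    exact (Real.exp_lt_exp.1 this).le
  have hw1 : w.re ≤ L := by
    rw [← hwr, ← hexpL] at hs
    exact Real.exp_le_exp.1 (le_of_mul_le_mul_left hs hr)
  have := Complex.HadamardThreeLines.norm_le_interp_of_mem_verticalClosedStrip' (f := fun z => E (r * Complex.exp z)) (z := w) (a := m) (b := M) (l := 0) (u := 4 * L)
    (by linarith) (by simp only [Complex.HadamardThreeLines.verticalClosedStrip, mem_preimage, mem_Icc]; constructor <;> linarith)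
    (Differentiable.diffContOnCl (by fun_prop)) ⟨M, by
      rintro _ ⟨z, hz, rfl⟩
      simp only [Complex.HadamardThreeLines.verticalClosedStrip, mem_preimage, mem_Icc] at hz
      refine h2 _ ?_
      rw [hnr]; gcongr; exact hz.2⟩
    (fun z hz => h1 _ (by rw [hnr, show z.re = 0 from hz]; simp)) (fun z hz => h2 _ (by rw [hnr, show z.re = 4 * L from hz]))
  simp only [hws, sub_zero] at this
  refine this.trans (key _ (by positivity) ?_)
  rw [div_le_iff₀ (by positivity)]; linarith

/-- the filter of bad parameters -/
def FB (d : ℕ) (c0 : Fin (d-1) → ℂ) : Filter (ℂ × (Fin (d-1) → ℂ)) := 𝓝 ((0:ℂ), c0) ⊓ 𝓟 {x | x.1 ≠ 0 ∧ Bad d x.1 x.2}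

lemma FB_le {d : ℕ} {c0 : Fin (d-1) → ℂ} : FB d c0 ≤ 𝓝 ((0:ℂ), c0) := inf_le_left

lemma FB_ne {d : ℕ} {c0 : Fin (d-1) → ℂ} : ∀ᶠ x in FB d c0, x.1 ≠ 0 := by
  rw [FB, eventually_inf_principal]
  exact Eventually.of_forall fun x hx => hx.1

namespace UF
variable {d : ℕ} {c0 : Fin (d-1) → ℂ} {N : ℕ} {ζ : ℂ} {lam : ℂ × (Fin (d-1) → ℂ) → ℂ} {Z : ℂ × (Fin (d-1) → ℂ) → ℕ → ℂ → ℂ}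

lemma iter0 (h : UF d c0 N ζ lam Z) (n m : ℕ) (s : ℂ) : Z (0, c0) (n+m) s = (henonPoly d c0)^[m] (Z (0, c0) n s) := by
  induction m with
  | zero => rfl
  | succ m ih => rw [iterate_succ_apply', ← ih, ← h.rec0]; rfl

lemma picard (h : UF d c0 N ζ lam Z) (n : ℕ) {x1 x2 : ℂ} (hx : x1 ≠ x2) : (∃ s, Z (0, c0) n s = x1) ∨ ∃ s, Z (0, c0) n s = x2 := by
  by_contra hcon
  push Not at hcon
  obtain ⟨C, D, -, hC⟩ := hp_iter_growth d c0 (2 * N)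
  have := picard_fin (h.diff0 n) h.lam_gt (C := C) (D := D) (fun s => by
    rw [← h.ev.self_of_nhds.2.2.1 n s, h.iter0]
    have := hC (Z (0, c0) n s)
    linarith) hx hcon.1 hcon.2
  refine h.der0 n ?_
  rw [show Z (0, c0) n = fun _ => Z (0, c0) n 0 from funext this]
  simp

/-- asymptotic data -/
structure AD (h : UF d c0 N ζ lam Z) (uB : ℂ) (Γ0 Γ1 : ℂ × (Fin (d-1) → ℂ) → ℂ) (γ : ℂ) : Prop where
  t0 : Tendsto Γ0 (FB d c0) (𝓝 uB)
  t1 : Tendsto Γ1 (FB d c0) (𝓝 γ)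
  hγ : γ ≠ 0
  inv : ∀ s, Z (0, c0) 1 (uB + γ * s) = Z (0, c0) 1 s
  small : ∀ K ε : ℝ, 0 < ε → ∀ᶠ x in FB d c0, ∀ s : ℂ, ‖s‖ ≤ K → ‖Z x 2 (Γ0 x + Γ1 x * s) - Z x 2 s‖ ≤ ε * ‖x.1‖

lemma tend (h : UF d c0 N ζ lam Z) (n : ℕ) {F : Filter (ℂ × (Fin (d-1) → ℂ))} (hF : F ≤ 𝓝 (0, c0)) {g : ℂ × (Fin (d-1) → ℂ) → ℂ} {u : ℂ} (hg : Tendsto g F (𝓝 u)) :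
    Tendsto (fun x => Z x n (g x)) F (𝓝 (Z (0, c0) n u)) := by
  have : Tendsto (fun x => (x, g x)) F (𝓝 ((0, c0), u)) := by
    rw [nhds_prod_eq]
    exact (tendsto_id'.2 hF).prodMk hg
  exact (h.cont n u).tendsto.comp this

theorem ad [NeBot (FB d c0)] (hd : 2 ≤ d) (h : UF d c0 N ζ lam Z) {uB : ℂ} (huB : uB ≠ 0) (hB : Z (0, c0) 1 uB = Z (0, c0) 1 0) (hBd : deriv (Z (0, c0) 1) uB ≠ 0) :
    ∃ Γ0 Γ1 γ, AD h uB Γ0 Γ1 γ := by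
  obtain ⟨C, r, hC, hr, Γ0, Γ1, t0, t1, hev⟩ := h.asym hd huB hB hBd
  set γ := deriv (Z (0, c0) 1) 0 / deriv (Z (0, c0) 1) uB with hγ
  have t0' := t0.mono_left (FB_le (d := d) (c0 := c0))
  have t1' := t1.mono_left (FB_le (d := d) (c0 := c0))
  have hev' : ∀ᶠ x in FB d c0, ∀ s : ℂ, ‖s‖ ≤ r →
        ‖Z x 1 (Γ0 x + Γ1 x * s) - Z x 1 s‖ ≤ C * ‖x.1‖ ∧ ‖Z x 2 (Γ0 x + Γ1 x * s) - Z x 2 s‖ ≤ C * ‖x.1‖ ^ 2 := by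
    rw [FB, eventually_inf_principal]
    filter_upwards [hev] with x hx hx2 using hx hx2.1 hx2.2
  have fst0 : Tendsto (fun x : ℂ × (Fin (d-1) → ℂ) => x.1) (FB d c0) (𝓝 0) := continuous_fst.continuousAt.mono_left FB_le
  refine ⟨Γ0, Γ1, γ, t0', t1', div_ne_zero h.der hBd, ?_, ?_⟩
  · have hloc : ∀ s : ℂ, ‖s‖ ≤ r → Z (0, c0) 1 (uB + γ * s) = Z (0, c0) 1 s := by
      intro s hs
      have l1 := h.tend 1 FB_le (t0'.add (t1'.mul_const s))
      have l2 := h.tend 1 FB_le (tendsto_const_nhds (x := s))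
      have l3 : Tendsto (fun x => Z x 1 (Γ0 x + Γ1 x * s) - Z x 1 s) (FB d c0) (𝓝 0) := by
        have z : Tendsto (fun x : ℂ × (Fin (d-1) → ℂ) => C * ‖x.1‖) (FB d c0) (𝓝 0) := by simpa using fst0.norm.const_mul C
        exact squeeze_zero_norm' (hev'.mono fun x hx => (hx s hs).1) z
      exact sub_eq_zero.1 (tendsto_nhds_unique (l1.sub l2) l3)
    have a1 : AnalyticOnNhd ℂ (fun s => Z (0, c0) 1 (uB + γ * s)) univ := by
      have : Differentiable ℂ (fun s => Z (0, c0) 1 (uB + γ * s)) := by have := h.diff0 1; fun_prop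
      exact this.differentiableOn.analyticOnNhd isOpen_univ
    have a2 : AnalyticOnNhd ℂ (Z (0, c0) 1) univ := (h.diff0 1).differentiableOn.analyticOnNhd isOpen_univ
    have := a1.eq_of_eventuallyEq a2 (z₀ := 0) (by
      filter_upwards [Metric.closedBall_mem_nhds (0:ℂ) hr] with s hs using hloc s (by simpa using hs))
    exact fun s => congrFun this s
  · intro K ε hε
    set K0 := max K (r + 1)
    obtain ⟨K1, hK1, hcirc⟩ := three_circ hr (show r < K0 from (by linarith : r < r + 1).trans_le (le_max_right _ _))
    have hK1p : 0 < K1 := lt_of_lt_of_le (by positivity) ((le_max_right K (r+1)).trans hK1)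
    obtain ⟨M, hM0, hM⟩ := h.unifB 2 (‖uB‖ + 1 + (‖γ‖ + 1) * K1 + K1)
    set M1 := M + M + 1
    have hM1 : 0 < M1 := by positivity
    have tt : Tendsto (fun x : ℂ × (Fin (d-1) → ℂ) => C ^ (3/4:ℝ) * M1 ^ (1/4:ℝ) * ‖x.1‖ ^ (1/2:ℝ)) (FB d c0) (𝓝 0) := by
      have := (fst0.norm.rpow_const (p := 1/2) (Or.inr (by norm_num))).const_mul (C ^ (3/4:ℝ) * M1 ^ (1/4:ℝ))
      simpa using this
    have tm : Tendsto (fun x : ℂ × (Fin (d-1) → ℂ) => C * ‖x.1‖ ^ 2) (FB d c0) (𝓝 0) := by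
      simpa using (fst0.norm.pow 2).const_mul C
    filter_upwards [hev', FB_le h.ev, FB_le hM, FB_ne, tt.eventually_le_const hε, tm.eventually_le_const hM1,
      t0'.norm.eventually_lt_const (show ‖uB‖ < ‖uB‖ + 1 by linarith), t1'.norm.eventually_lt_const (show ‖γ‖ < ‖γ‖ + 1 by linarith)] with x e1 e2 e3 e4 e5 e6 e7 e8 s hs
    have ha : 0 < ‖x.1‖ := norm_pos_iff.2 e4
    have := hcirc (fun s => Z x 2 (Γ0 x + Γ1 x * s) - Z x 2 s) (C * ‖x.1‖ ^ 2) M1 (by have := e2.1 2; fun_prop) (by positivity) e6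
      (fun s hs => (e1 s hs).2) (fun s hs => by
        refine (norm_sub_le _ _).trans ?_
        have b1 : ‖Γ0 x + Γ1 x * s‖ ≤ ‖uB‖ + 1 + (‖γ‖ + 1) * K1 := by
          refine (norm_add_le _ _).trans (add_le_add e7.le ?_)
          rw [norm_mul]; gcongr
        have := e3 _ (show ‖Γ0 x + Γ1 x * s‖ ≤ ‖uB‖ + 1 + (‖γ‖ + 1) * K1 + K1 by linarith)
        have := e3 s (by have : 0 ≤ ‖uB‖ + 1 + (‖γ‖ + 1) * K1 := by positivity
                         linarith)
        simp only [M1]; linarith) s (hs.trans (le_max_left _ _))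
    refine this.trans ?_
    have e9 : (C * ‖x.1‖ ^ 2) ^ (3/4:ℝ) * M1 ^ (1/4:ℝ) = (C ^ (3/4:ℝ) * M1 ^ (1/4:ℝ) * ‖x.1‖ ^ (1/2:ℝ)) * ‖x.1‖ := by
      rw [Real.mul_rpow (by linarith) (by positivity), ← Real.rpow_natCast, ← Real.rpow_mul ha.le]
      have : ‖x.1‖ ^ (((2:ℕ):ℝ) * (3/4)) = ‖x.1‖ ^ (1/2:ℝ) * ‖x.1‖ := by
        rw [← Real.rpow_add_one ha.ne']; norm_num
      rw [this]; ring
    rw [e9]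
    gcongr

end UF
end HenonML
end

section
namespace HenonML

/-- difference quotient of `henonPoly` -/
def hpQ (d : ℕ) (c : Fin (d-1) → ℂ) (u v : ℂ) : ℂ :=
  ∑ i ∈ Finset.range d, u ^ i * v ^ (d - 1 - i) + ∑ j : Fin (d-1), c j * ∑ i ∈ Finset.range (j:ℕ), u ^ i * v ^ ((j:ℕ) - 1 - i)

lemma hpQ_mul (d : ℕ) (c : Fin (d-1) → ℂ) (u v : ℂ) : henonPoly d c u - henonPoly d c v = (u - v) * hpQ d c u v := by
  unfold hpQ henonPoly
  rw [mul_add, (Commute.all u v).mul_geom_sum₂, add_sub_add_comm, ← Finset.sum_sub_distrib, Finset.mul_sum]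
  congr 1
  refine Finset.sum_congr rfl fun j _ => ?_
  rw [mul_left_comm, (Commute.all u v).mul_geom_sum₂]; ring

lemma hpQ_self (d : ℕ) (c : Fin (d-1) → ℂ) (u : ℂ) : hpQ d c u u = hpD d c u := by
  unfold hpQ hpD
  simp only [geom_sum₂_self]

lemma hpQ_cont (d : ℕ) : Continuous (fun q : (Fin (d-1) → ℂ) × ℂ × ℂ => hpQ d q.1 q.2.1 q.2.2) := by
  unfold hpQ; fun_prop

lemma hpQ_contDiff (d : ℕ) (c : Fin (d-1) → ℂ) : ContDiff ℂ 1 (fun q : ℂ × ℂ => hpQ d c q.1 q.2) := by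
  unfold hpQ; fun_prop

lemma hpD_diff (d : ℕ) (c : Fin (d-1) → ℂ) : Differentiable ℂ (hpD d c) := by
  have : hpD d c = fun u => hpQ d c u u := funext fun u => (hpQ_self d c u).symm
  rw [this]; unfold hpQ; fun_prop

lemma unif_of_joint {ι : Type*} {F : Filter ι} {G : ι → ℂ → ℂ} {g : ℂ → ℂ} (hg : Continuous g)
    (hG : ∀ u, Tendsto (fun q : ι × ℂ => G q.1 q.2) (F ×ˢ 𝓝 u) (𝓝 (g u))) (K : ℝ) {ε : ℝ} (hε : 0 < ε) :
    ∀ᶠ x in F, ∀ u : ℂ, ‖u‖ ≤ K → ‖G x u - g u‖ < ε := by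
  have h1 : TendstoLocallyUniformly G g F := by
    rw [tendstoLocallyUniformly_iff_forall_tendsto]
    intro u
    have h2 : Tendsto (fun q : ι × ℂ => g q.2) (F ×ˢ 𝓝 u) (𝓝 (g u)) := (hg.tendsto u).comp tendsto_snd
    exact (h2.prodMk_nhds (hG u)).mono_right (nhds_le_uniformity _)
  have h2 := (tendstoLocallyUniformlyOn_iff_tendstoUniformlyOn_of_compact (isCompact_closedBall (0:ℂ) K)).1 h1.tendstoLocallyUniformlyOn
  filter_upwards [Metric.tendstoUniformlyOn_iff.1 h2 ε hε] with x hx u hu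
  have := hx u (by simpa using hu)
  rwa [dist_comm, dist_eq_norm] at this

lemma eq_zero_of_deriv_le {F : ℂ → ℂ} (hF : Differentiable ℂ F) {s0 : ℂ} (h0 : F s0 = 0) {C : ℝ} (h : ∀ᶠ s in 𝓝 s0, ‖deriv F s‖ ≤ C * ‖F s‖) :
    ∀ s, F s = 0 := by
  obtain ⟨ρ, hρ, hb⟩ := Metric.eventually_nhds_iff.1 h
  set C' := max C 1
  set r := min (ρ / 2) (1 / (2 * C'))
  have hC' : 0 < C' := lt_of_lt_of_le one_pos (le_max_right _ _)
  have hr : 0 < r := by positivity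
  have hrρ : r < ρ := (min_le_left _ _).trans_lt (by linarith)
  have hrC : C' * r ≤ 1/2 := by
    have : r ≤ 1 / (2 * C') := min_le_right _ _
    calc C' * r ≤ C' * (1 / (2 * C')) := by gcongr
      _ = 1/2 := by field_simp
  obtain ⟨m, hm, hmax⟩ := (isCompact_closedBall s0 r).exists_isMaxOn ⟨s0, Metric.mem_closedBall_self hr.le⟩ hF.continuous.norm.continuousOn
  have hd : ∀ y ∈ Metric.closedBall s0 r, ‖deriv F y‖ ≤ C' * ‖F m‖ := by
    intro y hy
    refine (hb (lt_of_le_of_lt hy hrρ)).trans ?_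
    gcongr
    · exact le_max_left _ _
    · exact hmax hy
  have key := (convex_closedBall s0 r).norm_image_sub_le_of_norm_deriv_le (fun y _ => hF y) hd (Metric.mem_closedBall_self hr.le) hm
  rw [h0, sub_zero] at key
  have hm' : ‖m - s0‖ ≤ r := by simpa [dist_eq_norm] using hm
  have : ‖F m‖ ≤ 1/2 * ‖F m‖ := by
    calc ‖F m‖ ≤ C' * ‖F m‖ * r := key.trans (by gcongr)
      _ = (C' * r) * ‖F m‖ := by ring
      _ ≤ _ := by gcongr
  have hm0 : ‖F m‖ = 0 := by linarith [norm_nonneg (F m)]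
  have hF0 : F =ᶠ[𝓝 s0] fun _ => 0 := by
    filter_upwards [Metric.closedBall_mem_nhds s0 hr] with y hy
    have : ‖F y‖ ≤ ‖F m‖ := hmax hy
    rw [hm0] at this
    exact norm_le_zero_iff.1 this
  have := (hF.differentiableOn.analyticOnNhd isOpen_univ).eq_of_eventuallyEq (differentiable_const (0:ℂ) |>.differentiableOn.analyticOnNhd isOpen_univ) hF0
  exact fun s => congrFun this s

lemma punct_ne {F : ℂ → ℂ} (hF : Differentiable ℂ F) {s1 : ℂ} (h1 : F s1 ≠ 0) (s0 : ℂ) : ∀ᶠ s in 𝓝[≠] s0, F s ≠ 0 := by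
  have hA := hF.differentiableOn.analyticOnNhd isOpen_univ
  rcases (hA s0 (mem_univ _)).eventually_eq_zero_or_eventually_ne_zero with h | h
  · exfalso
    have := hA.eq_of_eventuallyEq (differentiable_const (0:ℂ) |>.differentiableOn.analyticOnNhd isOpen_univ) (z₀ := s0) h
    exact h1 (congrFun this s1)
  · exact h

lemma p7_local {d : ℕ} {c : Fin (d-1) → ℂ} {f g : ℂ → ℂ} (hf : Differentiable ℂ f) (hg : Differentiable ℂ g) (hgf : ∀ s, henonPoly d c (g s) = henonPoly d c (f s))
    {s1 s0 : ℂ} (h1 : g s1 ≠ f s1) {C : ℝ} (h0 : hpD d c (henonPoly d c (f s0)) = 0)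
    (hC : ∀ᶠ s in 𝓝 s0, ‖g s - f s‖ ≤ C * ‖hpD d c (henonPoly d c (f s))‖) : ∀ s, henonPoly d c (f s) = henonPoly d c (f s0) := by
  have hg0 : g s0 = f s0 := by
    have := hC.self_of_nhds
    rw [h0, norm_zero, mul_zero] at this
    exact sub_eq_zero.1 (norm_le_zero_iff.1 this)
  obtain ⟨K1, t1, ht1, hL1⟩ := (hpQ_contDiff d c).contDiffAt.exists_lipschitzOnWith (x := (f s0, f s0))
  obtain ⟨K2, t2, ht2, hL2⟩ := ((hpD_diff d c).contDiff (n := 1)).contDiffAt.exists_lipschitzOnWith (x := henonPoly d c (f s0))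
  obtain ⟨M, hM0, hM⟩ := bdd_of_cont ((hf.contDiff (n := 1)).continuous_deriv (by simp)) (‖s0‖ + 1)
  have hpf : Differentiable ℂ (fun s => henonPoly d c (f s)) := (hp_diff d c).comp hf
  have e1 : ∀ᶠ s in 𝓝 s0, ((g s, f s) : ℂ × ℂ) ∈ t1 := by
    have : Tendsto (fun s => (g s, f s)) (𝓝 s0) (𝓝 (f s0, f s0)) := by
      have := (hg.continuous.prodMk hf.continuous).tendsto s0
      rwa [hg0] at this
    exact this ht1
  have e2 : ∀ᶠ s in 𝓝 s0, ((f s, f s) : ℂ × ℂ) ∈ t1 := (hf.continuous.prodMk hf.continuous).tendsto s0 ht1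
  have e3 : ∀ᶠ s in 𝓝 s0, henonPoly d c (f s) ∈ t2 := hpf.continuous.tendsto s0 ht2
  have e4 : ∀ᶠ s in 𝓝 s0, ‖s‖ < ‖s0‖ + 1 := continuous_norm.continuousAt.eventually_lt_const (by linarith)
  set F : ℂ → ℂ := fun s => henonPoly d c (f s) - henonPoly d c (f s0) with hFd
  have hF : Differentiable ℂ F := hpf.sub_const _
  have hdF : ∀ s, deriv F s = hpD d c (f s) * deriv f s := fun s =>
    (((henonPoly_hasDerivAt d c (f s)).comp s (hf s).hasDerivAt).sub_const _).deriv
  have hbd : ∀ᶠ s in 𝓝[≠] s0, ‖deriv F s‖ ≤ K1 * (|C| * K2) * M * ‖F s‖ := by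
    have pn := punct_ne (F := fun s => g s - f s) (hg.sub hf) (sub_ne_zero.2 h1) s0
    filter_upwards [pn, nhdsWithin_le_nhds e1, nhdsWithin_le_nhds e2, nhdsWithin_le_nhds e3, nhdsWithin_le_nhds e4, nhdsWithin_le_nhds hC] with s p a1 a2 a3 a4 a5
    have q0 : hpQ d c (g s) (f s) = 0 := by
      have := hpQ_mul d c (g s) (f s)
      rw [hgf, sub_self] at this
      exact (mul_eq_zero.1 this.symm).resolve_left p
    have b1 : ‖hpD d c (f s)‖ ≤ K1 * ‖g s - f s‖ := by
      have := hL1.dist_le_mul _ a2 _ a1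
      simp only [dist_eq_norm, Prod.norm_def, hpQ_self, q0, sub_zero, Prod.fst_sub, Prod.snd_sub, sub_self, norm_zero] at this
      rwa [max_eq_left (norm_nonneg _), norm_sub_rev] at this
    have b2 : ‖hpD d c (henonPoly d c (f s))‖ ≤ K2 * ‖F s‖ := by
      have := hL2.dist_le_mul _ a3 _ (mem_of_mem_nhds ht2)
      simpa only [dist_eq_norm, h0, sub_zero] using this
    rw [hdF, norm_mul]
    have b3 := hM s a4.le
    calc ‖hpD d c (f s)‖ * ‖deriv f s‖ ≤ (K1 * (|C| * (K2 * ‖F s‖))) * M := by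
          gcongr
          refine b1.trans ?_
          gcongr
          refine a5.trans ?_
          gcongr
          exact le_abs_self C
      _ = _ := by ring
  have hcl : ∀ᶠ s in 𝓝 s0, ‖deriv F s‖ ≤ K1 * (|C| * K2) * M * ‖F s‖ := by
    rw [eventually_nhdsWithin_iff] at hbd
    have h00 : ‖deriv F s0‖ ≤ K1 * (|C| * K2) * M * ‖F s0‖ := by
      have c1 : Tendsto (fun s => ‖deriv F s‖) (𝓝[≠] s0) (𝓝 ‖deriv F s0‖) :=
        (((hF.contDiff (n := 1)).continuous_deriv (by simp)).norm.tendsto s0).mono_left nhdsWithin_le_nhds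
      have c2 : Tendsto (fun s => K1 * (|C| * K2) * M * ‖F s‖) (𝓝[≠] s0) (𝓝 (K1 * (|C| * K2) * M * ‖F s0‖)) :=
        ((hF.continuous.norm.const_mul _).tendsto s0).mono_left nhdsWithin_le_nhds
      exact le_of_tendsto_of_tendsto c1 c2 (eventually_nhdsWithin_iff.2 hbd)
    filter_upwards [hbd] with s hs
    by_cases e : s = s0
    · rw [e]; exact h00
    · exact hs e
  intro s
  exact sub_eq_zero.1 (eq_zero_of_deriv_le hF (by simp [F]) hcl s)

end HenonML
end

section
namespace HenonML
namespace UF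
variable {d : ℕ} {c0 : Fin (d-1) → ℂ} {N : ℕ} {ζ : ℂ} {lam : ℂ × (Fin (d-1) → ℂ) → ℂ} {Z : ℂ × (Fin (d-1) → ℂ) → ℕ → ℂ → ℂ}
variable {h : UF d c0 N ζ lam Z} {uB γ : ℂ} {Γ0 Γ1 : ℂ × (Fin (d-1) → ℂ) → ℂ}

lemma tendJ (h : UF d c0 N ζ lam Z) (n : ℕ) {ι : Type*} {F : Filter ι} {X : ι → ℂ × (Fin (d-1) → ℂ)} (hX : Tendsto X F (𝓝 (0, c0))) {g : ι → ℂ} {u : ℂ} (hg : Tendsto g F (𝓝 u)) :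
    Tendsto (fun x => Z (X x) n (g x)) F (𝓝 (Z (0, c0) n u)) :=
  (h.cont n u).tendsto.comp (f := fun x => (X x, g x)) (by rw [nhds_prod_eq]; exact hX.prodMk hg)

lemma AD.fstT (_ : AD h uB Γ0 Γ1 γ) (u : ℂ) : Tendsto (fun q : (ℂ × (Fin (d-1) → ℂ)) × ℂ => q.1) (FB d c0 ×ˢ 𝓝 u) (𝓝 (0, c0)) :=
  (tendsto_id'.2 FB_le).comp tendsto_fst

lemma AD.aT (A : AD h uB Γ0 Γ1 γ) (u : ℂ) : Tendsto (fun q : (ℂ × (Fin (d-1) → ℂ)) × ℂ => Γ0 q.1 + Γ1 q.1 * q.2) (FB d c0 ×ˢ 𝓝 u) (𝓝 (uB + γ * u)) :=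
  (A.t0.comp tendsto_fst).add ((A.t1.comp tendsto_fst).mul tendsto_snd)

lemma AD.zT (A : AD h uB Γ0 Γ1 γ) (n : ℕ) (u : ℂ) : Tendsto (fun q : (ℂ × (Fin (d-1) → ℂ)) × ℂ => Z q.1 n q.2) (FB d c0 ×ˢ 𝓝 u) (𝓝 (Z (0, c0) n u)) :=
  h.tendJ n (A.fstT u) tendsto_snd

lemma AD.zAT (A : AD h uB Γ0 Γ1 γ) (n : ℕ) (u : ℂ) : Tendsto (fun q : (ℂ × (Fin (d-1) → ℂ)) × ℂ => Z q.1 n (Γ0 q.1 + Γ1 q.1 * q.2)) (FB d c0 ×ˢ 𝓝 u) (𝓝 (Z (0, c0) n (uB + γ * u))) :=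
  h.tendJ n (A.fstT u) (A.aT u)

/-- uniform convergence of `Z n ∘ A - Z n` -/
lemma AD.eU (A : AD h uB Γ0 Γ1 γ) (n : ℕ) (K : ℝ) {ε : ℝ} (hε : 0 < ε) : ∀ᶠ x in FB d c0, ∀ s : ℂ, ‖s‖ ≤ K →
    ‖(Z x n (Γ0 x + Γ1 x * s) - Z x n s) - (Z (0, c0) n (uB + γ * s) - Z (0, c0) n s)‖ < ε :=
  unif_of_joint (G := fun x s => Z x n (Γ0 x + Γ1 x * s) - Z x n s) (g := fun s => Z (0, c0) n (uB + γ * s) - Z (0, c0) n s)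
    (by have := (h.diff0 n).continuous; fun_prop) (fun u => (A.zAT n u).sub (A.zT n u)) K hε

lemma AD.inv_n (A : AD h uB Γ0 Γ1 γ) (n : ℕ) (s : ℂ) : Z (0, c0) (n+1) (uB + γ * s) = Z (0, c0) (n+1) s := by
  rw [add_comm, h.iter0, h.iter0, A.inv]

/-- uniform convergence of the difference quotients -/
lemma AD.qU (A : AD h uB Γ0 Γ1 γ) (n : ℕ) (K : ℝ) {ε : ℝ} (hε : 0 < ε) : ∀ᶠ x in FB d c0, ∀ s : ℂ, ‖s‖ ≤ K →
    ‖hpQ d x.2 (Z x (n+1) (Γ0 x + Γ1 x * s)) (Z x (n+1) s) - hpD d c0 (Z (0, c0) (n+1) s)‖ < ε := by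
  refine unif_of_joint (G := fun x s => hpQ d x.2 (Z x (n+1) (Γ0 x + Γ1 x * s)) (Z x (n+1) s)) (g := fun s => hpD d c0 (Z (0, c0) (n+1) s))
    ((hpD_diff d c0).continuous.comp (h.diff0 (n+1)).continuous) (fun u => ?_) K hε
  have h1 : Tendsto (fun q : (ℂ × (Fin (d-1) → ℂ)) × ℂ => (q.1.2, Z q.1 (n+1) (Γ0 q.1 + Γ1 q.1 * q.2), Z q.1 (n+1) q.2)) (FB d c0 ×ˢ 𝓝 u) (𝓝 (c0, Z (0, c0) (n+1) u, Z (0, c0) (n+1) u)) := by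
    refine ((continuous_snd.tendsto _).comp (A.fstT u)).prodMk_nhds (Tendsto.prodMk_nhds ?_ (A.zT (n+1) u))
    have := A.zAT (n+1) u
    rwa [A.inv_n] at this
  have := ((hpQ_cont d).tendsto _).comp h1
  rw [hpQ_self] at this
  exact this

lemma AD.erec {x : ℂ × (Fin (d-1) → ℂ)} (hx : ∀ n s, Z x (n+2) s = x.1 * Z x n s + henonPoly d x.2 (Z x (n+1) s)) (n : ℕ) (t s : ℂ) :
    Z x (n+2) t - Z x (n+2) s = x.1 * (Z x n t - Z x n s) + (Z x (n+1) t - Z x (n+1) s) * hpQ d x.2 (Z x (n+1) t) (Z x (n+1) s) := by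
  rw [← hpQ_mul, hx, hx]; ring

lemma AD.bound [NeBot (FB d c0)] (A : AD h uB Γ0 Γ1 γ) (s0 : ℂ) : ∃ C, ∀ᶠ s in 𝓝 s0, ‖Z (0, c0) 0 (uB + γ * s) - Z (0, c0) 0 s‖ ≤ C * ‖hpD d c0 (Z (0, c0) 1 s)‖ := by
  have hfd : Differentiable ℂ (fun s => hpD d c0 (Z (0, c0) 1 s)) := (hpD_diff d c0).comp (h.diff0 1)
  have pn := punct_ne hfd (s1 := 0) (by
    have := h.der0 2
    rw [h.derRec0] at this
    exact left_ne_zero_of_mul this) s0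
  obtain ⟨ρ', hρ', hne⟩ := Metric.eventually_nhds_iff.1 (eventually_nhdsWithin_iff.1 pn)
  set ρ := ρ' / 2
  have hρ : 0 < ρ := by positivity
  have hs : (Metric.sphere s0 ρ).Nonempty := NormedSpace.sphere_nonempty.2 hρ.le
  obtain ⟨m, hm, hmin⟩ := (isCompact_sphere s0 ρ).exists_isMinOn hs hfd.continuous.norm.continuousOn
  set δ := ‖hpD d c0 (Z (0, c0) 1 m)‖
  have hδ : 0 < δ := norm_pos_iff.2 (hne (by rw [Metric.mem_sphere.1 hm]; simp only [ρ]; linarith) (by rintro rfl; simp at hm; linarith))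
  set K := ‖s0‖ + ρ
  have hK : ∀ s ∈ Metric.closedBall s0 ρ, ‖s‖ ≤ K := by
    intro s hs
    rw [mem_closedBall_iff_norm] at hs
    have := norm_le_norm_add_norm_sub' s s0
    simp only [K]; linarith
  set D : ℂ → ℂ := fun s => Z (0, c0) 0 (uB + γ * s) - Z (0, c0) 0 s with hD
  have hDc : Continuous D := by have := (h.diff0 0).continuous; fun_prop
  obtain ⟨M, hM0, hM⟩ := bdd_of_cont hDc K
  set C := (1 + (M + 1)) * 2 / δ
  have hC0 : 0 ≤ C := by positivity
  refine ⟨C, ?_⟩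
  filter_upwards [Metric.closedBall_mem_nhds s0 hρ] with s hs
  refine le_of_forall_pos_le_add fun ε hε => ?_
  have hev : ∀ᶠ x in FB d c0, ‖Z x 0 (Γ0 x + Γ1 x * s) - Z x 0 s‖ ≤ C * ‖hpQ d x.2 (Z x 1 (Γ0 x + Γ1 x * s)) (Z x 1 s)‖ + ε := by
    filter_upwards [A.small K (min ε 1) (by positivity), A.qU 0 K (half_pos hδ), A.eU 0 K one_pos, FB_le h.ev, FB_ne] with x e1 e2 e3 e4 e5
    have ha : 0 < ‖x.1‖ := norm_pos_iff.2 e5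
    have hdd : Differentiable ℂ (fun s => Z x 1 (Γ0 x + Γ1 x * s) - Z x 1 s) := by have := e4.1 1; fun_prop
    have hsph : ∀ t ∈ Metric.sphere s0 ρ, ‖Z x 1 (Γ0 x + Γ1 x * t) - Z x 1 t‖ ≤ C * ‖x.1‖ := by
      intro t ht
      have htK := hK t (Metric.sphere_subset_closedBall ht)
      have q1 : δ / 2 ≤ ‖hpQ d x.2 (Z x 1 (Γ0 x + Γ1 x * t)) (Z x 1 t)‖ := by
        have a1 : δ ≤ ‖hpD d c0 (Z (0, c0) 1 t)‖ := hmin ht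
        have a2 := norm_le_norm_add_norm_sub (hpQ d x.2 (Z x 1 (Γ0 x + Γ1 x * t)) (Z x 1 t)) (hpD d c0 (Z (0, c0) 1 t))
        have a3 := e2 t htK
        simp only [zero_add] at a3
        linarith
      have q2 : ‖Z x 0 (Γ0 x + Γ1 x * t) - Z x 0 t‖ ≤ M + 1 := by
        have := norm_le_norm_add_norm_sub' (Z x 0 (Γ0 x + Γ1 x * t) - Z x 0 t) (D t)
        linarith [e3 t htK, hM t htK]
      have q3 := AD.erec e4.2.1 0 (Γ0 x + Γ1 x * t) t
      simp only [zero_add] at q3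
      have q4 := (e1 t htK).trans (mul_le_mul_of_nonneg_right (min_le_right ε 1) ha.le)
      have q5 : ‖Z x 1 (Γ0 x + Γ1 x * t) - Z x 1 t‖ * (δ / 2) ≤ (1 + (M + 1)) * ‖x.1‖ := by
        calc _ ≤ ‖Z x 1 (Γ0 x + Γ1 x * t) - Z x 1 t‖ * ‖hpQ d x.2 (Z x 1 (Γ0 x + Γ1 x * t)) (Z x 1 t)‖ := by gcongr
          _ = ‖(Z x 2 (Γ0 x + Γ1 x * t) - Z x 2 t) - x.1 * (Z x 0 (Γ0 x + Γ1 x * t) - Z x 0 t)‖ := by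
              rw [← norm_mul]; congr 1; rw [q3]; ring
          _ ≤ 1 * ‖x.1‖ + ‖x.1‖ * (M + 1) := by
              refine (norm_sub_le _ _).trans (add_le_add q4 ?_)
              rw [norm_mul]; gcongr
          _ = _ := by ring
      rw [← le_div_iff₀ (by positivity)] at q5
      refine q5.trans (le_of_eq ?_)
      simp only [C]; field_simp
    have hin : ‖Z x 1 (Γ0 x + Γ1 x * s) - Z x 1 s‖ ≤ C * ‖x.1‖ := by
      have := Complex.norm_le_of_forall_mem_frontier_norm_le (U := Metric.ball s0 ρ) Metric.isBounded_ball hdd.diffContOnCl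
        (fun z hz => hsph z (by rwa [frontier_ball s0 hρ.ne'] at hz)) (z := s) (by rwa [closure_ball s0 hρ.ne'])
      exact this
    have q3 := AD.erec e4.2.1 0 (Γ0 x + Γ1 x * s) s
    simp only [zero_add] at q3
    have q4 := (e1 s (hK s hs)).trans (mul_le_mul_of_nonneg_right (min_le_left ε 1) ha.le)
    have q6 : ‖x.1‖ * ‖Z x 0 (Γ0 x + Γ1 x * s) - Z x 0 s‖ ≤ ‖x.1‖ * (C * ‖hpQ d x.2 (Z x 1 (Γ0 x + Γ1 x * s)) (Z x 1 s)‖ + ε) := by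
      calc _ = ‖(Z x 2 (Γ0 x + Γ1 x * s) - Z x 2 s) - (Z x 1 (Γ0 x + Γ1 x * s) - Z x 1 s) * hpQ d x.2 (Z x 1 (Γ0 x + Γ1 x * s)) (Z x 1 s)‖ := by
              rw [← norm_mul]; congr 1; rw [q3]; ring
        _ ≤ ε * ‖x.1‖ + C * ‖x.1‖ * ‖hpQ d x.2 (Z x 1 (Γ0 x + Γ1 x * s)) (Z x 1 s)‖ := by
              refine (norm_sub_le _ _).trans (add_le_add q4 ?_)
              rw [norm_mul]; gcongr
        _ = _ := by ring
    exact le_of_mul_le_mul_left q6 ha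
  have ps : Tendsto (fun x : ℂ × (Fin (d-1) → ℂ) => (x, s)) (FB d c0) (FB d c0 ×ˢ 𝓝 s) := tendsto_id.prodMk tendsto_const_nhds
  have l1 := (((A.zAT 0 s).sub (A.zT 0 s)).comp ps).norm
  have l2 : Tendsto (fun x : ℂ × (Fin (d-1) → ℂ) => hpQ d x.2 (Z x 1 (Γ0 x + Γ1 x * s)) (Z x 1 s)) (FB d c0) (𝓝 (hpD d c0 (Z (0, c0) 1 s))) := by
    rw [Metric.tendsto_nhds]
    intro e he
    filter_upwards [A.qU 0 K he] with x hx
    rw [dist_eq_norm]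
    exact hx s (hK s hs)
  exact le_of_tendsto_of_tendsto l1 ((l2.norm.const_mul C).add_const ε) hev

theorem AD.no_crit [NeBot (FB d c0)] (A : AD h uB Γ0 Γ1 γ) (h0 : Z (0, c0) 0 uB ≠ Z (0, c0) 0 0) (s : ℂ) : hpD d c0 (Z (0, c0) 1 s) ≠ 0 := by
  intro hz
  obtain ⟨C, hC⟩ := A.bound s
  have hr : ∀ s, Z (0, c0) 1 s = henonPoly d c0 (Z (0, c0) 0 s) := h.rec0 0
  have := p7_local (d := d) (c := c0) (f := Z (0, c0) 0) (g := fun s => Z (0, c0) 0 (uB + γ * s)) (h.diff0 0) (by have := h.diff0 0; fun_prop)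
    (fun s => by rw [← hr, ← hr, A.inv]) (s1 := 0) (s0 := s) (by simpa using h0) (C := C) (by rw [← hr]; exact hz)
    (by filter_upwards [hC] with t ht; rw [← hr]; exact ht)
  refine h.der ?_
  rw [show Z (0, c0) 1 = fun _ => Z (0, c0) 1 s from funext fun t => by rw [hr t, this t, hr s]]
  simp

end UF
end HenonML
end

section
namespace HenonML
open Polynomial in
/-- `henonPoly` as a formal polynomial. -/
def hpP (d : ℕ) (c : Fin (d-1) → ℂ) : Polynomial ℂ := X ^ d + ∑ j : Fin (d-1), C (c j) * X ^ (j:ℕ)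

lemma hpP_eval (d : ℕ) (c : Fin (d-1) → ℂ) (z : ℂ) : (hpP d c).eval z = henonPoly d c z := by
  simp [hpP, henonPoly, Polynomial.eval_finset_sum]

lemma hpP_deriv_eval (d : ℕ) (c : Fin (d-1) → ℂ) (z : ℂ) : (hpP d c).derivative.eval z = hpD d c z := by
  have h1 := (hpP d c).hasDerivAt z
  have h2 : (fun x => (hpP d c).eval x) = henonPoly d c := funext fun z => hpP_eval d c z
  rw [h2] at h1
  exact h1.unique (henonPoly_hasDerivAt d c z)

lemma hpP_tail {d : ℕ} (hd : 2 ≤ d) (c : Fin (d-1) → ℂ) : (∑ j : Fin (d-1), Polynomial.C (c j) * Polynomial.X ^ (j:ℕ)).degree < ((d - 1 : ℕ) : WithBot ℕ) := by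
  rw [Polynomial.degree_lt_iff_coeff_zero]
  intro m hm
  simp only [Polynomial.finset_sum_coeff, Polynomial.coeff_C_mul_X_pow]
  exact Finset.sum_eq_zero fun j _ => if_neg (by have := j.2; omega)

lemma hpP_monic {d : ℕ} (hd : 2 ≤ d) (c : Fin (d-1) → ℂ) : (hpP d c).Monic := by
  refine Polynomial.monic_X_pow_add ((hpP_tail hd c).trans_le ?_)
  exact_mod_cast Nat.sub_le d 1

lemma hpP_natDegree {d : ℕ} (hd : 2 ≤ d) (c : Fin (d-1) → ℂ) : (hpP d c).natDegree = d := by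
  unfold hpP
  rw [Polynomial.natDegree_add_eq_left_of_degree_lt, Polynomial.natDegree_X_pow]
  rw [Polynomial.degree_X_pow]
  refine (hpP_tail hd c).trans_le ?_
  exact_mod_cast Nat.sub_le d 1

lemma hpP_coeff {d : ℕ} (c : Fin (d-1) → ℂ) (j : Fin (d-1)) : (hpP d c).coeff j = c j := by
  have := j.2
  simp only [hpP, Polynomial.coeff_add, Polynomial.finset_sum_coeff, Polynomial.coeff_C_mul_X_pow, Polynomial.coeff_X_pow]
  rw [if_neg (by omega), zero_add, Finset.sum_eq_single j]
  · simp
  · intro b _ hb; rw [if_neg]; intro e; exact hb (Fin.ext e.symm)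
  · simp

lemma hpP_coeff_pred {d : ℕ} (hd : 2 ≤ d) (c : Fin (d-1) → ℂ) : (hpP d c).coeff (d-1) = 0 := by
  simp only [hpP, Polynomial.coeff_add, Polynomial.coeff_X_pow]
  rw [if_neg (by omega), zero_add]
  exact (Polynomial.degree_lt_iff_coeff_zero _ _).1 (hpP_tail hd c) _ le_rfl

variable {d : ℕ} {c0 : Fin (d-1) → ℂ} {N : ℕ} {ζ : ℂ} {lam : ℂ × (Fin (d-1) → ℂ) → ℂ}
    {Z : ℂ × (Fin (d-1) → ℂ) → ℕ → ℂ → ℂ}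

theorem UF.crit_false (hd : 2 ≤ d) (hc : c0 ≠ 0) (h : UF d c0 N ζ lam Z) (hcr : ∀ s, hpD d c0 (Z (0, c0) 1 s) ≠ 0) : False := by
  set P := hpP d c0 with hP
  have hdeg : P.derivative.natDegree = d - 1 := by
    rw [Polynomial.natDegree_derivative, hpP_natDegree hd]
  have hne : P.derivative ≠ 0 := by
    intro h0; rw [h0] at hdeg; simp at hdeg; omega
  have hlc : P.derivative.leadingCoeff = d := by
    rw [Polynomial.leadingCoeff, hdeg, Polynomial.coeff_derivative]
    have : P.coeff (d - 1 + 1) = 1 := by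
      have := (hpP_monic hd c0).coeff_natDegree
      rw [hpP_natDegree hd] at this
      rwa [Nat.sub_add_cancel (by omega)]
    rw [this, one_mul]
    exact_mod_cast Nat.sub_add_cancel (by omega : 1 ≤ d)
  have hs := IsAlgClosed.splits P.derivative
  obtain ⟨r, hr⟩ : ∃ r, P.derivative.IsRoot r := IsAlgClosed.exists_root _ (by
    rw [Polynomial.degree_eq_natDegree hne, hdeg]; exact_mod_cast (by omega : d - 1 ≠ 0))
  have huniq : ∀ r2, P.derivative.IsRoot r2 → r2 = r := by
    intro r2 h2
    by_contra hrr
    rw [Polynomial.IsRoot, hpP_deriv_eval] at hr h2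
    rcases h.picard 1 hrr with ⟨s, e⟩ | ⟨s, e⟩
    · exact hcr s (by rw [e]; exact h2)
    · exact hcr s (by rw [e]; exact hr)
  have hroots : P.derivative.roots = Multiset.replicate (d-1) r := by
    rw [Multiset.eq_replicate]
    refine ⟨by rw [← hdeg]; exact hs.natDegree_eq_card_roots.symm, fun b hb => huniq b (Polynomial.isRoot_of_mem_roots hb)⟩
  have hform : P.derivative = Polynomial.C (d:ℂ) * (Polynomial.X - Polynomial.C r) ^ (d-1) := by
    conv_lhs => rw [hs.eq_prod_roots, hroots, hlc]
    simp
  have hcoef : ∀ k, P.coeff (k+1) * ((k:ℂ)+1) = d * ((-r)^(d-1-k) * (d-1).choose k) := by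
    intro k
    rw [← Polynomial.coeff_derivative, hform, Polynomial.coeff_C_mul, sub_eq_add_neg, ← Polynomial.C_neg, Polynomial.coeff_X_add_C_pow]
  have hd0 : (d:ℂ) ≠ 0 := by exact_mod_cast (by omega : d ≠ 0)
  have hr0 : r = 0 := by
    have := hcoef (d-2)
    rw [show d - 2 + 1 = d - 1 by omega, hpP_coeff_pred hd, show d - 1 - (d-2) = 1 by omega, zero_mul] at this
    have h3 : ((d-1).choose (d-2) : ℂ) ≠ 0 := by
      exact_mod_cast (Nat.choose_pos (by omega)).ne'
    have h4 := this.symm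
    simp only [pow_one, mul_eq_zero, neg_eq_zero, hd0, h3, or_false, false_or] at h4
    exact h4
  have hcj : ∀ j : Fin (d-1), (j:ℕ) ≠ 0 → c0 j = 0 := by
    intro j hj
    obtain ⟨k, hk⟩ : ∃ k, (j:ℕ) = k + 1 := ⟨j - 1, by omega⟩
    have h1 := hcoef k
    rw [← hk, hpP_coeff, hr0, neg_zero, zero_pow (by have := j.2; omega)] at h1
    have : (k:ℂ) + 1 ≠ 0 := by exact_mod_cast Nat.succ_ne_zero k
    simpa [this] using h1
  let j0 : Fin (d-1) := ⟨0, by omega⟩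
  have hc00 : c0 j0 ≠ 0 := by
    intro h0
    apply hc
    ext j
    by_cases hj : (j:ℕ) = 0
    · rw [show j = j0 from Fin.ext hj, h0]; rfl
    · rw [hcj j hj]; rfl
  have hpoly : ∀ z, henonPoly d c0 z = z ^ d + c0 j0 := by
    intro z
    rw [henonPoly, Finset.sum_eq_single j0]
    · simp [j0]
    · intro b _ hb
      rw [hcj b (fun e => hb (Fin.ext e)), zero_mul]
    · simp
  obtain ⟨w, hw⟩ := IsAlgClosed.exists_pow_nat_eq (-c0 j0) (by omega : 0 < d)
  have hw0 : w ≠ 0 := by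
    intro e; rw [e, zero_pow (by omega)] at hw; exact hc00 (by simpa using hw.symm)
  have hω := Complex.isPrimitiveRoot_exp d (by omega)
  set ω := Complex.exp (2 * Real.pi * Complex.I / d)
  have hω1 : w * ω ≠ w := by
    intro e
    exact hω.ne_one (by omega) (mul_left_cancel₀ hw0 (by rw [e, mul_one]))
  have hz0 : hpD d c0 0 = 0 := by rw [← hpP_deriv_eval]; rw [hr0] at hr; exact hr
  have key : ∀ s v, Z (0, c0) 0 s = v → v ^ d = - c0 j0 → False := by
    intro s v e1 e2
    refine hcr s ?_
    rw [show Z (0, c0) 1 s = henonPoly d c0 (Z (0, c0) 0 s) from h.rec0 0 s, e1, hpoly, e2, neg_add_cancel, hz0]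
  rcases h.picard 0 hω1 with ⟨s, e⟩ | ⟨s, e⟩
  · exact key s _ e (by rw [mul_pow, hω.pow_eq_one, mul_one, hw])
  · exact key s _ e hw
end HenonML
end

section
namespace HenonML

lemma nonbad {f : ℂ → ℂ} (hf : Continuous f) (C : Finset ℂ) : ∃ η > 0, ∀ n0 : ℕ, ∃ n, n0 ≤ n ∧ 1 ≤ n ∧ ∀ c ∈ C, f c ≠ c → η ≤ ‖f^[n] c - c‖ := by
  classical
  have h1 : ∀ c : ℂ, ∃ m : ℕ, 1 ≤ m ∧ ((∃ k, 1 ≤ k ∧ f^[k] c = c) → f^[m] c = c) := by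
    intro c
    by_cases h : ∃ k, 1 ≤ k ∧ f^[k] c = c
    · obtain ⟨k, hk, e⟩ := h
      exact ⟨k, hk, fun _ => e⟩
    · exact ⟨1, le_rfl, fun h' => absurd h' h⟩
  choose m hm1 hm2 using h1
  set G := ∏ c ∈ C, m c with hG
  have hG1 : 1 ≤ G := Nat.succ_le_of_lt (Finset.prod_pos fun c _ => hm1 c)
  set K := C.card
  have e1 : ∀ᶠ η in 𝓝[>] (0:ℝ), ∀ c ∈ C, f c ≠ c → η ≤ ‖f c - c‖ := by
    rw [Filter.eventually_all_finset]
    intro c _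
    by_cases h : f c = c
    · simp [h]
    · filter_upwards [nhdsWithin_le_nhds (gt_mem_nhds (norm_pos_iff.2 (sub_ne_zero.2 h)))] with η hη _ using hη.le
  have e2 : ∀ᶠ η in 𝓝[>] (0:ℝ), ∀ c ∈ C, ∀ k ∈ Finset.range (K * G + 1), f^[k] c ≠ c → ∀ z, ‖z - c‖ < η → η ≤ ‖f^[k] z - c‖ := by
    rw [Filter.eventually_all_finset]
    intro c _
    rw [Filter.eventually_all_finset]
    intro k _
    by_cases h : f^[k] c = c
    · simp [h]
    have hpos := norm_pos_iff.2 (sub_ne_zero.2 h)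
    have hct : ∀ᶠ z in 𝓝 c, ‖f^[k] c - c‖ / 2 < ‖f^[k] z - c‖ := by
      have : Continuous fun z => ‖f^[k] z - c‖ := ((hf.iterate k).sub continuous_const).norm
      exact this.tendsto c |>.eventually (lt_mem_nhds (by linarith))
    obtain ⟨ε, hε, hz⟩ := Metric.eventually_nhds_iff.1 hct
    filter_upwards [nhdsWithin_le_nhds (gt_mem_nhds hε), nhdsWithin_le_nhds (gt_mem_nhds (half_pos hpos))] with η h1 h2 _ z hzc
    exact h2.le.trans (hz (by rw [dist_eq_norm]; linarith)).le
  obtain ⟨η, ⟨h1, h2⟩, h3⟩ := ((e1.and e2).and self_mem_nhdsWithin).exists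
  refine ⟨η, h3, fun n0 => ?_⟩
  by_contra hcon
  push Not at hcon
  have h4 : ∀ j : ℕ, ∃ c ∈ C, f c ≠ c ∧ ‖f^[1 + G * (n0 + j)] c - c‖ < η := fun j =>
    hcon _ (by nlinarith) (by omega)
  choose cc hc1 hc2 hc3 using h4
  obtain ⟨i, hi, j, hj, hij, hcij⟩ := Finset.exists_ne_map_eq_of_card_lt_of_maps_to (s := Finset.range (K+1)) (t := C) (f := cc) (by simp [K]) (fun j _ => hc1 j)
  have key : ∀ i j, i ∈ Finset.range (K+1) → j ∈ Finset.range (K+1) → i < j → cc i = cc j → False := by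
    intro i j hi hj hlt he
    rw [Finset.mem_range] at hi hj
    set c := cc i with hc
    have hper : ¬ ∃ k, 1 ≤ k ∧ f^[k] c = c := by
      intro hk
      have hmc := hm2 c hk
      have hGc : IsPeriodicPt f G c := (show IsPeriodicPt f (m c) c from hmc).trans_dvd (Finset.dvd_prod_of_mem m (hc1 i))
      have h5 : f^[1 + G * (n0 + i)] c = f c := by
        rw [iterate_add_apply, (hGc.mul_const (n0 + i)).eq]; rfl
      have h6 := hc3 i
      rw [← hc, h5] at h6
      exact absurd (h1 c (hc1 i) (hc2 i)) (not_le.2 h6)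
    have hk : 1 ≤ G * (j - i) := Nat.mul_pos hG1 (by omega)
    have h7 := h2 c (hc1 i) (G * (j - i)) (by
      rw [Finset.mem_range, mul_comm K G]
      exact Nat.lt_succ_of_le (Nat.mul_le_mul_left G (by omega))) (fun e => hper ⟨_, hk, e⟩) _ (hc3 i)
    rw [← hc, ← iterate_add_apply, show G * (j - i) + (1 + G * (n0 + i)) = 1 + G * (n0 + j) by
      obtain ⟨t, rfl⟩ := Nat.exists_eq_add_of_lt hlt
      rw [show i + t + 1 - i = t + 1 by omega]; ring, he] at h7
    exact absurd h7 (not_le.2 (hc3 j))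
  rcases lt_or_gt_of_ne hij with h | h
  · exact key i j hi hj h hcij
  · exact key j i hj hi h hcij.symm

open Polynomial

/-- the polynomial `p^n - X` -/
def Tp (p : ℂ[X]) (n : ℕ) : ℂ[X] := p.comp^[n] X - X

lemma Tp_eval (p : ℂ[X]) (n : ℕ) (z : ℂ) : (Tp p n).eval z = (fun x => p.eval x)^[n] z - z := by
  simp [Tp, iterate_comp_eval]

lemma iterP_monic {p : ℂ[X]} (hp : p.Monic) (hd : 2 ≤ p.natDegree) (n : ℕ) : (p.comp^[n] X).Monic := by
  induction n with
  | zero => exact monic_X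
  | succ n ih =>
    rw [iterate_succ_apply']
    refine hp.comp ih ?_
    rw [natDegree_iterate_comp, natDegree_X, mul_one]
    exact (pow_pos (by omega) n).ne'

lemma two_le_pow' {d n : ℕ} (hd : 2 ≤ d) (hn : 1 ≤ n) : 2 ≤ d ^ n :=
  hd.trans (Nat.le_self_pow (by omega) d)

lemma Tp_deg_lt {p : ℂ[X]} (hp : p.Monic) (hd : 2 ≤ p.natDegree) {n : ℕ} (hn : 1 ≤ n) : (X:ℂ[X]).degree < (p.comp^[n] X).degree := by
  rw [degree_eq_natDegree (iterP_monic hp hd n).ne_zero, natDegree_iterate_comp, natDegree_X, degree_X, mul_one]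
  exact_mod_cast two_le_pow' hd hn

lemma Tp_monic {p : ℂ[X]} (hp : p.Monic) (hd : 2 ≤ p.natDegree) {n : ℕ} (hn : 1 ≤ n) : (Tp p n).Monic :=
  (iterP_monic hp hd n).sub_of_left (Tp_deg_lt hp hd hn)

lemma Tp_natDegree {p : ℂ[X]} (hp : p.Monic) (hd : 2 ≤ p.natDegree) {n : ℕ} (hn : 1 ≤ n) : (Tp p n).natDegree = p.natDegree ^ n := by
  rw [Tp, natDegree_sub_eq_left_of_natDegree_lt, natDegree_iterate_comp, natDegree_X, mul_one]
  exact natDegree_lt_natDegree X_ne_zero (Tp_deg_lt hp hd hn)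

lemma iterP_deriv (p : ℂ[X]) (n : ℕ) (z : ℂ) : (derivative (p.comp^[n] X)).eval z = ∏ k ∈ Finset.range n, p.derivative.eval ((fun x => p.eval x)^[k] z) := by
  induction n with
  | zero => simp
  | succ n ih =>
    rw [iterate_succ_apply', derivative_comp, eval_mul, ih, eval_comp, Finset.prod_range_succ]
    simp [iterate_comp_eval]

lemma Tp_deriv (p : ℂ[X]) (n : ℕ) (z : ℂ) : (Tp p n).derivative.eval z = ∏ k ∈ Finset.range n, p.derivative.eval ((fun x => p.eval x)^[k] z) - 1 := by
  simp [Tp, iterP_deriv]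

lemma Tp_mult {p : ℂ[X]} (hp : p.Monic) (hd : 2 ≤ p.natDegree) {n : ℕ} (hn : 1 ≤ n) {y : ℂ} (hy : (fun x => p.eval x)^[n] y = y) (hy' : p.derivative.eval y ≠ 0) :
    (Tp p n).rootMultiplicity (p.eval y) ≤ (Tp p n).rootMultiplicity y := by
  have hT := (Tp_monic hp hd hn).ne_zero
  rw [le_rootMultiplicity_iff hT]
  have h1 : (X - C (p.eval y)) ^ (Tp p n).rootMultiplicity (p.eval y) ∣ Tp p n := pow_rootMultiplicity_dvd _ _
  set m := (Tp p n).rootMultiplicity (p.eval y)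
  obtain ⟨k, hk⟩ := binomExpansion (p.map C) X (Tp p n)
  simp only [derivative_map] at hk
  have hXT : (X + Tp p n) = p.comp^[n] X := by simp [Tp]
  have hev : ∀ (q r : ℂ[X]), eval r (q.map C) = q.comp r := fun q r => by rw [eval_map]; rfl
  rw [hXT, hev, hev, hev, comp_X, comp_X] at hk
  have hcm : (p.comp^[n] X).comp p = p.comp (p.comp^[n] X) := by
    apply Polynomial.funext
    intro z
    simp only [eval_comp, iterate_comp_eval, eval_X]
    exact ((iterate_succ_apply (fun x => p.eval x) n z).symm.trans (iterate_succ_apply' (fun x => p.eval x) n z))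
  have h2 : (Tp p n).comp p = Tp p n * (p.derivative + k * Tp p n) := by
    rw [Tp, sub_comp, X_comp, hcm, hk, ← Tp]; ring
  have h3 : (X - C y) ^ m ∣ (Tp p n).comp p := by
    have h4 : (X - C y) ∣ p - C (p.eval y) := X_sub_C_dvd_sub_C_eval
    obtain ⟨q, hq⟩ := h1
    refine (pow_dvd_pow_of_dvd h4 m).trans ⟨q.comp p, ?_⟩
    conv_lhs => rw [hq]
    simp
  rw [h2] at h3
  refine IsCoprime.dvd_of_dvd_mul_right (IsCoprime.pow_left ?_) h3
  rw [(irreducible_X_sub_C y).coprime_iff_not_dvd, dvd_iff_isRoot]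
  simp only [IsRoot, eval_add, eval_mul, Tp_eval, hy, sub_self, mul_zero, add_zero]
  exact hy'

/-- upper bound for the product of the derivatives -/
lemma Tp_upper {p : ℂ[X]} (hp : p.Monic) (hd : 2 ≤ p.natDegree) {n : ℕ} (hn : 1 ≤ n)
    (hgood : ∀ c, p.derivative.eval c = 0 → (fun x => p.eval x)^[n] c = c → p.eval c = c)
    {R : Finset ℂ} {M : ℝ} (hM : 1 ≤ M)
    (hR : ∀ y, (fun x => p.eval x)^[n] y = y → y ∉ R → ‖∏ k ∈ Finset.range n, p.derivative.eval ((fun x => p.eval x)^[k] y)‖ ≤ 1)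
    (hRM : ∀ y ∈ R, ∀ k, ‖p.derivative.eval ((fun x => p.eval x)^[k] y)‖ ≤ M)
    (hR1 : ∀ y ∈ R, (fun x => p.eval x)^[n] y = y → ∏ k ∈ Finset.range n, p.derivative.eval ((fun x => p.eval x)^[k] y) ≠ 1) :
    (((Tp p n).roots.filter (fun y => p.derivative.eval y ≠ 0)).map (fun y => ‖p.derivative.eval y‖)).prod ≤ M ^ R.card := by
  classical
  set f : ℂ → ℂ := fun x => p.eval x with hf
  set T := Tp p n with hTdef
  have hT : T ≠ 0 := (Tp_monic hp hd hn).ne_zero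
  set Y := T.roots.filter (fun y => p.derivative.eval y ≠ 0) with hY
  have hroot : ∀ y, y ∈ T.roots ↔ f^[n] y = y := by
    intro y
    rw [mem_roots hT, IsRoot, Tp_eval, sub_eq_zero]
  rw [Finset.prod_multiset_map_count]
  set S := Y.toFinset with hS
  have hmS : ∀ y, y ∈ S ↔ f^[n] y = y ∧ p.derivative.eval y ≠ 0 := by
    intro y; rw [hS, Multiset.mem_toFinset, hY, Multiset.mem_filter, hroot]
  have hcount : ∀ y ∈ S, Y.count y = T.rootMultiplicity y := by
    intro y hy
    rw [hY, Multiset.count_filter_of_pos (p := fun y => p.derivative.eval y ≠ 0) ((hmS y).1 hy).2, count_roots]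
  rw [Finset.prod_congr rfl (fun y hy => by rw [hcount y hy])]
  have hfS : ∀ y ∈ S, f y ∈ S := by
    intro y hy
    obtain ⟨h1, h2⟩ := (hmS y).1 hy
    have h3 : f^[n] (f y) = f y := by rw [← iterate_succ_apply, iterate_succ_apply', h1]
    refine (hmS _).2 ⟨h3, fun h4 => h2 ?_⟩
    have h5 : f (f y) = f y := hgood _ h4 h3
    have h6 : y = f y := by
      conv_lhs => rw [← h1]
      obtain ⟨k, rfl⟩ : ∃ k, n = k + 1 := ⟨n - 1, by omega⟩
      rw [iterate_succ_apply]
      exact iterate_fixed h5 k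
    rw [h6]; exact h4
  have hfSk : ∀ k, ∀ y ∈ S, f^[k] y ∈ S := by
    intro k
    induction k with
    | zero => intro y hy; exact hy
    | succ k ih => intro y hy; rw [iterate_succ_apply']; exact hfS _ (ih y hy)
  have hm1 : ∀ y ∈ S, T.rootMultiplicity (f y) ≤ T.rootMultiplicity y := fun y hy =>
    Tp_mult hp hd hn ((hmS y).1 hy).1 ((hmS y).1 hy).2
  have hmk : ∀ k, ∀ y ∈ S, T.rootMultiplicity (f^[k] y) ≤ T.rootMultiplicity y := by
    intro k
    induction k with
    | zero => intro y hy; exact le_rfl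
    | succ k ih => intro y hy; rw [iterate_succ_apply']; exact (hm1 _ (hfSk k y hy)).trans (ih y hy)
  have hm : ∀ y ∈ S, T.rootMultiplicity (f y) = T.rootMultiplicity y := by
    intro y hy
    refine le_antisymm (hm1 y hy) ?_
    have := hmk (n-1) (f y) (hfS y hy)
    rwa [← iterate_succ_apply, show (n-1).succ = n by omega, ((hmS y).1 hy).1] at this
  have hinv : ∀ g : ℂ → ℝ, ∏ y ∈ S, g (f y) ^ T.rootMultiplicity y = ∏ y ∈ S, g y ^ T.rootMultiplicity y := by
    intro g
    refine Finset.prod_nbij f hfS ?_ ?_ (fun y hy => by rw [hm y hy])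
    · intro y hy z hz e
      have h1 := ((hmS y).1 hy).1
      have h2 := ((hmS z).1 hz).1
      obtain ⟨k, rfl⟩ : ∃ k, n = k + 1 := ⟨n - 1, by omega⟩
      rw [iterate_succ_apply] at h1 h2
      rw [← h1, ← h2, e]
    · intro y hy
      refine ⟨f^[n-1] y, hfSk _ y hy, ?_⟩
      rw [← iterate_succ_apply' f, show (n-1).succ = n by omega, ((hmS y).1 hy).1]
  have hk : ∀ k, ∏ y ∈ S, ‖p.derivative.eval (f^[k] y)‖ ^ T.rootMultiplicity y = ∏ y ∈ S, ‖p.derivative.eval y‖ ^ T.rootMultiplicity y := by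
    intro k
    induction k with
    | zero => rfl
    | succ k ih =>
      rw [← ih, ← hinv (fun y => ‖p.derivative.eval (f^[k] y)‖)]
      rfl
  have hpow : (∏ y ∈ S, ‖p.derivative.eval y‖ ^ T.rootMultiplicity y) ^ n ≤ (M ^ R.card) ^ n := by
    calc _ = ∏ k ∈ Finset.range n, ∏ y ∈ S, ‖p.derivative.eval (f^[k] y)‖ ^ T.rootMultiplicity y := by
          rw [Finset.prod_congr rfl (fun k _ => hk k)]; simp
      _ = ∏ y ∈ S, ‖∏ k ∈ Finset.range n, p.derivative.eval (f^[k] y)‖ ^ T.rootMultiplicity y := by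
          rw [Finset.prod_comm]
          refine Finset.prod_congr rfl fun y _ => ?_
          rw [Finset.prod_pow, norm_prod]
      _ ≤ ∏ y ∈ S, if y ∈ R then M ^ n else 1 := by
          refine Finset.prod_le_prod (fun y _ => by positivity) fun y hy => ?_
          split_ifs with hyR
          · have : T.rootMultiplicity y = 1 := by
              refine le_antisymm ?_ ?_
              · by_contra hlt
                have := ((one_lt_rootMultiplicity_iff_isRoot hT).1 (not_le.1 hlt)).2
                rw [IsRoot, hTdef, Tp_deriv, sub_eq_zero] at this
                exact hR1 y hyR ((hmS y).1 hy).1 this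
              · rw [Nat.succ_le_iff, rootMultiplicity_pos hT, ← mem_roots hT, hroot]
                exact ((hmS y).1 hy).1
            rw [this, pow_one, norm_prod]
            refine (Finset.prod_le_prod (fun _ _ => norm_nonneg _) (fun k _ => hRM y hyR k)).trans ?_
            simp
          · exact pow_le_one₀ (norm_nonneg _) (hR y ((hmS y).1 hy).1 hyR)
      _ = (M ^ n) ^ (S.filter (· ∈ R)).card := by
          rw [← Finset.prod_filter, Finset.prod_const]
      _ ≤ (M ^ n) ^ R.card := by
          refine pow_le_pow_right₀ (one_le_pow₀ hM) (Finset.card_le_card fun y hy => (Finset.mem_filter.1 hy).2)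
      _ = _ := by rw [← pow_mul, ← pow_mul, mul_comm]
  exact le_of_pow_le_pow_left₀ (by omega) (by positivity) hpow
end HenonML
end

section
namespace HenonML
open Polynomial

lemma ms_prod_nonneg {s : Multiset ℂ} (g : ℂ → ℝ) (h : ∀ y ∈ s, 0 ≤ g y) : 0 ≤ (s.map g).prod :=
  Multiset.prod_nonneg (by intro a ha; obtain ⟨y, hy, rfl⟩ := Multiset.mem_map.1 ha; exact h y hy)

lemma ms_prod_le {s : Multiset ℂ} (g : ℂ → ℝ) {B : ℝ} (hB : 1 ≤ B) {k : ℕ} (hk : s.card ≤ k) (h0 : ∀ y ∈ s, 0 ≤ g y) (h : ∀ y ∈ s, g y ≤ B) : (s.map g).prod ≤ B ^ k := by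
  refine le_trans ?_ (pow_le_pow_right₀ hB hk)
  clear hk
  induction s using Multiset.induction with
  | empty => simp
  | cons a s ih =>
    rw [Multiset.map_cons, Multiset.prod_cons, Multiset.card_cons, pow_succ']
    have h0' : ∀ y ∈ s, 0 ≤ g y := fun y hy => h0 y (Multiset.mem_cons_of_mem hy)
    exact mul_le_mul (h a (Multiset.mem_cons_self a s)) (ih h0' (fun y hy => h y (Multiset.mem_cons_of_mem hy)))
      (ms_prod_nonneg g h0') (by linarith)

lemma ms_le_prod {s : Multiset ℂ} (g : ℂ → ℝ) {κ : ℝ} (hκ : 0 ≤ κ) (h : ∀ y ∈ s, κ ≤ g y) : κ ^ s.card ≤ (s.map g).prod := by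
  induction s using Multiset.induction with
  | empty => simp
  | cons a s ih =>
    rw [Multiset.map_cons, Multiset.prod_cons, Multiset.card_cons, pow_succ']
    exact mul_le_mul (h a (Multiset.mem_cons_self a s)) (ih (fun y hy => h y (Multiset.mem_cons_of_mem hy)))
      (by positivity) (hκ.trans (h a (Multiset.mem_cons_self a s)))

lemma ms_norm (s : Multiset ℂ) (g : ℂ → ℂ) : ‖(s.map g).prod‖ = (s.map fun y => ‖g y‖).prod := by
  induction s using Multiset.induction with
  | empty => simp
  | cons a s ih => simp [ih]

/-- lower bound for the product of the derivatives -/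
lemma Tp_lower {p : ℂ[X]} (hp : p.Monic) (hd : 2 ≤ p.natDegree) {n : ℕ} (hn : 1 ≤ n) {η B : ℝ} (hη : 0 < η) (hη1 : η ≤ 1) (hB : 1 ≤ B)
    (hgood : ∀ c, p.derivative.eval c = 0 → p.eval c ≠ c → η ≤ ‖(fun x => p.eval x)^[n] c - c‖)
    (hBc : ∀ c c', p.derivative.eval c = 0 → p.derivative.eval c' = 0 → ‖c - c'‖ ≤ B) :
    (2:ℝ) ^ (2 ^ n - p.natDegree) * (η / B ^ p.natDegree) ^ (p.natDegree - 1) ≤ (((Tp p n).roots.filter (fun y => p.derivative.eval y ≠ 0)).map (fun y => ‖p.derivative.eval y‖)).prod := by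
  classical
  set d := p.natDegree with hdd
  set f : ℂ → ℂ := fun x => p.eval x with hf
  set T := Tp p n with hTdef
  have hTm : T.Monic := Tp_monic hp hd hn
  have hT : T ≠ 0 := hTm.ne_zero
  have hTs := IsAlgClosed.splits T
  have hDs := IsAlgClosed.splits p.derivative
  have hdeg : p.derivative.natDegree = d - 1 := natDegree_derivative p
  have hlc : p.derivative.leadingCoeff = d := by
    rw [leadingCoeff, hdeg, coeff_derivative, Nat.sub_add_cancel (by omega), hdd, hp.coeff_natDegree, one_mul]
    exact_mod_cast Nat.sub_add_cancel (by omega : 1 ≤ d)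
  have hD0 : p.derivative ≠ 0 := by
    intro h0; rw [h0] at hdeg; simp at hdeg; omega
  have hroot : ∀ y, y ∈ T.roots ↔ f^[n] y = y := by
    intro y
    rw [mem_roots hT, IsRoot, Tp_eval, sub_eq_zero]
  set Y := T.roots.filter (fun y => p.derivative.eval y ≠ 0) with hY
  set F := T.roots.filter (fun y => ¬ (p.derivative.eval y ≠ 0)) with hF
  have hYF : Y + F = T.roots := Multiset.filter_add_not _ _
  have hTd : ∀ c, p.derivative.eval c = 0 → T.derivative.eval c = -1 := by
    intro c hc
    rw [hTdef, Tp_deriv, Finset.prod_eq_zero (Finset.mem_range.2 (show 0 < n by omega)) hc, zero_sub]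
  have hFc : ∀ y ∈ F, p.derivative.eval y = 0 := by
    intro y hy
    have := (Multiset.mem_filter.1 hy).2
    push Not at this
    exact this
  have hFcard : F.card ≤ d - 1 := by
    have hnd : F.Nodup := by
      rw [Multiset.nodup_iff_count_le_one]
      intro a
      by_cases ha : a ∈ F
      · refine (Multiset.count_le_of_le a (Multiset.filter_le _ _)).trans ?_
        rw [count_roots]
        by_contra hlt
        have := ((one_lt_rootMultiplicity_iff_isRoot hT).1 (not_le.1 hlt)).2
        rw [IsRoot, hTd a (hFc a ha)] at this
        norm_num at this
      · rw [Multiset.count_eq_zero_of_notMem ha]; omega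
    rw [← hdeg, hDs.natDegree_eq_card_roots]
    exact Multiset.card_le_card ((Multiset.le_iff_subset hnd).2 fun y hy => (mem_roots hD0).2 (hFc y hy))
  have hYcard : 2 ^ n - d ≤ Y.card := by
    have h1 : Y.card + F.card = d ^ n := by
      rw [← Multiset.card_add, hYF, ← hTs.natDegree_eq_card_roots, hTdef, Tp_natDegree hp hd hn]
    have h2 : 2 ^ n ≤ d ^ n := Nat.pow_le_pow_left hd n
    omega
  have hBp : 0 < B ^ d := by positivity
  have hin : ∀ c ∈ p.derivative.roots, η / B ^ d ≤ (Y.map fun y => ‖c - y‖).prod := by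
    intro c hc
    have hc' : p.derivative.eval c = 0 := (mem_roots hD0).1 hc
    have hYn : 0 ≤ (Y.map fun y => ‖c - y‖).prod := ms_prod_nonneg _ fun y _ => norm_nonneg _
    rw [div_le_iff₀ hBp]
    by_cases hfix : p.eval c = c
    · have hcT : c ∈ T.roots := (hroot c).2 (iterate_fixed hfix n)
      have hcF : c ∈ F := Multiset.mem_filter.2 ⟨hcT, by simpa using hc'⟩
      have h1 := hTs.eval_root_derivative hTm hcT
      rw [hTd c hc', ← hYF, Multiset.erase_add_right_pos _ hcF, Multiset.map_add, Multiset.prod_add] at h1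
      have h2 := congrArg norm h1
      rw [norm_neg, norm_one, norm_mul, ms_norm, ms_norm] at h2
      refine hη1.trans (h2.trans_le ?_)
      gcongr
      exact ms_prod_le _ hB ((Multiset.card_le_card (Multiset.erase_le c F)).trans (by omega)) (fun _ _ => norm_nonneg _)
        fun y hy => hBc _ _ hc' (hFc y (Multiset.mem_of_mem_erase hy))
    · have h1 := hTs.eval_eq_prod_roots c
      rw [hTm.leadingCoeff, one_mul, ← hYF, Multiset.map_add, Multiset.prod_add] at h1
      have h2 := congrArg norm h1
      rw [norm_mul, ms_norm, ms_norm, hTdef, Tp_eval] at h2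
      refine (hgood c hc' hfix).trans (h2.trans_le ?_)
      gcongr
      exact ms_prod_le _ hB (by omega) (fun _ _ => norm_nonneg _) fun y hy => hBc _ _ hc' (hFc y hy)
  have hev : ∀ y, ‖p.derivative.eval y‖ = d * (p.derivative.roots.map fun c => ‖c - y‖).prod := by
    intro y
    rw [hDs.eval_eq_prod_roots, hlc, norm_mul, ms_norm]
    simp [norm_sub_rev]
  have hE : (Y.map fun y => ‖p.derivative.eval y‖).prod = (d:ℝ) ^ Y.card * (p.derivative.roots.map fun c => (Y.map fun y => ‖c - y‖).prod).prod := by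
    simp_rw [hev]
    rw [Multiset.prod_map_mul, Multiset.prod_map_prod_map]
    simp
  rw [hE]
  have hd2 : (2:ℝ) ≤ d := by exact_mod_cast hd
  refine mul_le_mul ?_ ?_ (by positivity) (by positivity)
  · exact (pow_le_pow_right₀ (by norm_num) hYcard).trans (pow_le_pow_left₀ (by norm_num) hd2 _)
  · rw [← hdeg, hDs.natDegree_eq_card_roots]
    exact ms_le_prod _ (by positivity) hin

theorem rep_infinite {p : ℂ[X]} (hp : p.Monic) (hd : 2 ≤ p.natDegree) :
    {y : ℂ | ∃ n, 1 ≤ n ∧ (fun x => p.eval x)^[n] y = y ∧ 1 < ‖∏ k ∈ Finset.range n, p.derivative.eval ((fun x => p.eval x)^[k] y)‖}.Infinite := by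
  classical
  intro hfin
  set f : ℂ → ℂ := fun x => p.eval x with hf
  set R := hfin.toFinset with hR
  have hmR : ∀ y, y ∈ R ↔ ∃ n, 1 ≤ n ∧ f^[n] y = y ∧ 1 < ‖∏ k ∈ Finset.range n, p.derivative.eval (f^[k] y)‖ := by
    intro y; rw [hR, Set.Finite.mem_toFinset]; rfl
  have hM1 : ∀ y : R, ∃ M : ℝ, ∀ k, ‖p.derivative.eval (f^[k] (y:ℂ))‖ ≤ M := by
    rintro ⟨y, hy⟩
    obtain ⟨n, hn, hper, -⟩ := (hmR y).1 hy
    refine ⟨∑ k ∈ Finset.range n, ‖p.derivative.eval (f^[k] y)‖, fun k => ?_⟩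
    have h1 : f^[k] y = f^[k % n] y := ((show IsPeriodicPt f n y from hper).iterate_mod_apply k).symm
    simp only
    rw [h1]
    exact Finset.single_le_sum (f := fun k => ‖p.derivative.eval (f^[k] y)‖) (fun _ _ => norm_nonneg _) (Finset.mem_range.2 (Nat.mod_lt _ hn))
  choose Mf hMf using hM1
  obtain ⟨M, hM1, hM⟩ : ∃ M : ℝ, 1 ≤ M ∧ ∀ y : R, Mf y ≤ M := by
    refine ⟨1 + ∑ y : R, |Mf y|, by have : 0 ≤ ∑ y : R, |Mf y| := Finset.sum_nonneg fun _ _ => abs_nonneg _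
                                    linarith, fun y => ?_⟩
    have := Finset.single_le_sum (f := fun y : R => |Mf y|) (fun _ _ => abs_nonneg _) (Finset.mem_univ y)
    linarith [le_abs_self (Mf y)]
  set Cr := p.derivative.roots.toFinset with hCr
  have hdeg : p.derivative.natDegree = p.natDegree - 1 := natDegree_derivative p
  have hD0 : p.derivative ≠ 0 := by
    intro h0; rw [h0] at hdeg; simp at hdeg; omega
  have hmC : ∀ c, p.derivative.eval c = 0 → c ∈ Cr := fun c hc => by
    rw [hCr, Multiset.mem_toFinset, mem_roots hD0]; exact hc
  obtain ⟨B0, hB0⟩ : ∃ B : ℝ, ∀ c ∈ Cr, ‖c‖ ≤ B := ⟨∑ c ∈ Cr, ‖c‖, fun c hc => Finset.single_le_sum (f := fun c : ℂ => ‖c‖) (fun _ _ => norm_nonneg _) hc⟩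
  obtain ⟨η0, hη0, hnb⟩ := nonbad (f := f) p.continuous Cr
  set B := max 1 (2 * B0)
  set η := min η0 1
  have hη : 0 < η := lt_min hη0 one_pos
  set κ := (η / B ^ p.natDegree) ^ (p.natDegree - 1)
  have hκ : 0 < κ := by positivity
  obtain ⟨k, hk⟩ := pow_unbounded_of_one_lt (M ^ R.card / κ) (by norm_num : (1:ℝ) < 2)
  obtain ⟨n, hn0, hn1, hn⟩ := hnb (k + p.natDegree)
  have hlow := Tp_lower hp hd hn1 (η := η) (B := B) hη (min_le_right _ _) (le_max_left _ _)
    (fun c hc hcf => (min_le_left _ _).trans (hn c (hmC c hc) hcf))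
    (fun c c' hc hc' => by
      refine (norm_sub_le _ _).trans (le_trans ?_ (le_max_right _ _))
      linarith [hB0 c (hmC c hc), hB0 c' (hmC c' hc')])
  have hup := Tp_upper hp hd hn1 (R := R) (M := M)
    (fun c hc hper => by
      by_contra hne
      have := hn c (hmC c hc) hne
      rw [hper, sub_self, norm_zero] at this
      linarith) hM1
    (fun y hy hyR => by
      by_contra hlt
      exact hyR ((hmR y).2 ⟨n, hn1, hy, not_le.1 hlt⟩))
    (fun y hy k => (hMf ⟨y, hy⟩ k).trans (hM ⟨y, hy⟩))
    (fun y hy hyn h1 => by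
      obtain ⟨m, hm, hper, hgt⟩ := (hmR y).1 hy
      -- the product over `n * m` steps computed in two ways
      have hmul : ∀ a b : ℕ, f^[a] y = y → ∏ k ∈ Finset.range (a * b), p.derivative.eval (f^[k] y) = (∏ k ∈ Finset.range a, p.derivative.eval (f^[k] y)) ^ b := by
        intro a b ha
        induction b with
        | zero => simp
        | succ b ih =>
          rw [Nat.mul_succ, Finset.prod_range_add, ih, pow_succ]
          congr 1
          refine Finset.prod_congr rfl fun k _ => ?_
          rw [add_comm, iterate_add_apply, ((show IsPeriodicPt f a y from ha).mul_const b).eq]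
      have e1 := hmul n m hyn
      have e2 := hmul m n hper
      rw [mul_comm, e2, h1, one_pow] at e1
      have e3 := congrArg norm e1
      rw [norm_pow, norm_one] at e3
      exact absurd e3 (one_lt_pow₀ hgt (by omega)).ne')
  have h1 := hlow.trans hup
  have h2 : (2:ℝ) ^ k ≤ 2 ^ (2 ^ n - p.natDegree) := by
    refine pow_le_pow_right₀ (by norm_num) ?_
    have : n < 2 ^ n := Nat.lt_two_pow_self
    omega
  rw [div_lt_iff₀ hκ] at hk
  have h3 : (2:ℝ) ^ k * κ ≤ 2 ^ (2 ^ n - p.natDegree) * κ := by gcongr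
  linarith
end HenonML
end

section
namespace HenonML

lemma hp_iter_deriv (d : ℕ) (c : Fin (d-1) → ℂ) (n : ℕ) (z : ℂ) :
    deriv ((henonPoly d c)^[n]) z = ∏ k ∈ Finset.range n, hpD d c ((henonPoly d c)^[k] z) := by
  suffices h : HasDerivAt ((henonPoly d c)^[n]) (∏ k ∈ Finset.range n, hpD d c ((henonPoly d c)^[k] z)) z from h.deriv
  induction n with
  | zero => simpa using hasDerivAt_id z
  | succ n ih =>
    rw [iterate_succ', Finset.prod_range_succ, mul_comm]
    exact (henonPoly_hasDerivAt d c _).comp z ih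

lemma post_finite {f : ℂ → ℂ} (c : ℂ) : {y | (∃ n, 1 ≤ n ∧ f^[n] y = y) ∧ ∃ k, f^[k] c = y}.Finite := by
  by_cases h : ∃ k0 n, 1 ≤ n ∧ f^[n] (f^[k0] c) = f^[k0] c
  · obtain ⟨k0, n, hn, hper⟩ := h
    refine ((Finset.range (k0 + n)).image (fun j => f^[j] c)).finite_toSet.subset ?_
    rintro y ⟨-, k, rfl⟩
    simp only [Finset.coe_image, Finset.coe_range, Set.mem_image, Set.mem_Iio]
    by_cases hk : k < k0
    · exact ⟨k, by omega, rfl⟩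
    · obtain ⟨j, rfl⟩ := Nat.exists_eq_add_of_le (not_lt.1 hk)
      refine ⟨j % n + k0, by have := Nat.mod_lt j hn; omega, ?_⟩
      rw [add_comm k0 j, iterate_add_apply, iterate_add_apply]
      exact (show IsPeriodicPt f n (f^[k0] c) from hper).iterate_mod_apply j
  · convert Set.finite_empty
    rw [Set.eq_empty_iff_forall_notMem]
    rintro y ⟨⟨n, hn, hy⟩, k, rfl⟩
    exact h ⟨k, n, hn, hy⟩

lemma prod_per {f : ℂ → ℂ} {y : ℂ} {a : ℕ} (g : ℂ → ℂ) (ha : f^[a] y = y) (b : ℕ) : ∏ k ∈ Finset.range (a * b), g (f^[k] y) = (∏ k ∈ Finset.range a, g (f^[k] y)) ^ b := by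
  induction b with
  | zero => simp
  | succ b ih =>
    rw [Nat.mul_succ, Finset.prod_range_add, ih, pow_succ]
    congr 1
    refine Finset.prod_congr rfl fun k _ => ?_
    rw [add_comm, iterate_add_apply, ((show IsPeriodicPt f a y from ha).mul_const b).eq]

lemma exists_LD {d : ℕ} (hd : 2 ≤ d) (c0 : Fin (d-1) → ℂ) : ∃ N ζ, LD d c0 N ζ ∧ ∀ c k, hpD d c0 c = 0 → (henonPoly d c0)^[k] c ≠ ζ := by
  classical
  set f := henonPoly d c0 with hf
  have hfe : (fun x => (hpP d c0).eval x) = f := funext (hpP_eval d c0)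
  have hinf := rep_infinite (hpP_monic hd c0) (by rw [hpP_natDegree hd]; exact hd)
  rw [hfe] at hinf
  simp only [hpP_deriv_eval] at hinf
  have hdeg : (hpP d c0).derivative.natDegree = d - 1 := by
    rw [Polynomial.natDegree_derivative, hpP_natDegree hd]
  have hD0 : (hpP d c0).derivative ≠ 0 := by
    intro h0; rw [h0] at hdeg; simp at hdeg; omega
  have hfin : (⋃ c ∈ (hpP d c0).derivative.roots.toFinset, {y | (∃ n, 1 ≤ n ∧ f^[n] y = y) ∧ ∃ k, f^[k] c = y}).Finite :=
    Set.Finite.biUnion (Finset.finite_toSet _) fun c _ => post_finite c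
  obtain ⟨ζ, ⟨n, hn, hper, hrep⟩, hζ⟩ := (hinf.diff hfin).nonempty
  have hpost : ∀ c k, hpD d c0 c = 0 → f^[k] c ≠ ζ := by
    intro c k hc e
    refine hζ ?_
    simp only [Set.mem_iUnion]
    refine ⟨c, ?_, ⟨n, hn, hper⟩, k, e⟩
    rw [Multiset.mem_toFinset, Polynomial.mem_roots hD0, Polynomial.IsRoot, hpP_deriv_eval]
    exact hc
  set μ := ∏ k ∈ Finset.range n, hpD d c0 (f^[k] ζ) with hμ
  have hw : hpD d c0 (f^[n-1] ζ) ≠ 0 := by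
    intro h0
    refine hpost _ 1 h0 ?_
    rw [← iterate_add_apply, show 1 + (n-1) = n by omega, hper]
  set w := ‖hpD d c0 (f^[n-1] ζ)‖ with hwd
  have hw0 : 0 < w := norm_pos_iff.2 hw
  obtain ⟨t, ht⟩ := pow_unbounded_of_one_lt (1 / w) hrep
  have ht1 : 1 / w < ‖μ‖ ^ (2 * (t+1)) := ht.trans_le (pow_le_pow_right₀ hrep.le (by omega))
  have e1 : deriv (f^[2 * (n * (t+1))]) ζ = μ ^ (2 * (t+1)) := by
    rw [hp_iter_deriv, show 2 * (n * (t+1)) = n * (2 * (t+1)) by ring, prod_per _ hper]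
  have hn1 : 1 ≤ n * (t+1) := Nat.mul_pos hn (by omega)
  have e2 : deriv (f^[2 * (n * (t+1))]) ζ = deriv (f^[2 * (n * (t+1)) - 1]) ζ * hpD d c0 (f^[n-1] ζ) := by
    rw [hp_iter_deriv, hp_iter_deriv]
    obtain ⟨m, hm⟩ : ∃ m, 2 * (n * (t+1)) = m + 1 := ⟨2 * (n * (t+1)) - 1, by omega⟩
    rw [hm, Finset.prod_range_succ, Nat.add_sub_cancel]
    congr 2
    have : m = (n - 1) + n * (2 * t + 1) := by
      have : 2 * (n * (t+1)) = n + n * (2 * t + 1) := by ring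
      omega
    rw [this, iterate_add_apply, ((show IsPeriodicPt f n ζ from hper).mul_const _).eq]
  have hgt : 1 < ‖μ‖ ^ (2 * (t+1)) := one_lt_pow₀ hrep (by omega)
  refine ⟨n * (t+1), ζ, ⟨hn1, ?_, ?_, ?_⟩, hpost⟩
  · rw [← hf, show 2 * (n * (t+1)) = n * (2 * (t+1)) by ring]
    exact ((show IsPeriodicPt f n ζ from hper).mul_const _).eq
  · rw [← hf, e1, norm_pow]; exact hgt
  · have e3 := congrArg norm e2
    rw [norm_mul, e1, norm_pow, ← hwd] at e3
    rw [← hf, e1, norm_pow, pow_two]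
    have h4 : 1 < ‖μ‖ ^ (2 * (t+1)) * w := by rwa [div_lt_iff₀ hw0] at ht1
    refine lt_of_mul_lt_mul_right ?_ hw0.le
    rw [← e3]
    nlinarith

lemma hp_surj {d : ℕ} (hd : 2 ≤ d) (c : Fin (d-1) → ℂ) (k : ℕ) (y : ℂ) : ∃ x, (henonPoly d c)^[k] x = y := by
  have h1 : Function.Surjective (henonPoly d c) := by
    intro y
    have hnd : (hpP d c - Polynomial.C y).natDegree = d := by
      rw [Polynomial.natDegree_sub_C, hpP_natDegree hd]
    obtain ⟨x, hx⟩ := IsAlgClosed.exists_root (hpP d c - Polynomial.C y) (by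
      intro h0; rw [Polynomial.natDegree_eq_of_degree_eq_some (n := 0) h0] at hnd; omega)
    refine ⟨x, ?_⟩
    rw [Polynomial.IsRoot, Polynomial.eval_sub, hpP_eval, Polynomial.eval_C, sub_eq_zero] at hx
    exact hx
  exact h1.iterate k y

lemma hp_two {d : ℕ} (hd : 2 ≤ d) (c : Fin (d-1) → ℂ) {y : ℂ} (hy : ∀ x, hpD d c x = 0 → henonPoly d c x ≠ y) :
    ∃ x1 x2, x1 ≠ x2 ∧ henonPoly d c x1 = y ∧ henonPoly d c x2 = y := by
  obtain ⟨x, hx⟩ := hp_surj hd c 1 y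
  simp only [iterate_one] at hx
  by_contra hcon
  push Not at hcon
  have hu : ∀ x2, henonPoly d c x2 = y → x2 = x := by
    intro x2 h2
    by_contra hne
    exact hcon x2 x hne h2 hx
  set Q := hpP d c - Polynomial.C y with hQ
  have hnd : Q.natDegree = d := by
    rw [Polynomial.natDegree_sub_C, hpP_natDegree hd]
  have hs := IsAlgClosed.splits Q
  have hroots : Q.roots = Multiset.replicate d x := by
    rw [Multiset.eq_replicate]
    refine ⟨by rw [← hs.natDegree_eq_card_roots, hnd], fun b hb => hu b ?_⟩
    have := Polynomial.isRoot_of_mem_roots hb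
    rwa [Polynomial.IsRoot, hQ, Polynomial.eval_sub, hpP_eval, Polynomial.eval_C, sub_eq_zero] at this
  have hQ0 : Q ≠ 0 := by intro h0; rw [h0] at hnd; simp at hnd; omega
  have hm : 1 < Q.rootMultiplicity x := by
    rw [← Polynomial.count_roots, hroots, Multiset.count_replicate_self]; omega
  have h2 := ((Polynomial.one_lt_rootMultiplicity_iff_isRoot hQ0).1 hm).2
  rw [Polynomial.IsRoot, hQ, Polynomial.derivative_sub, Polynomial.derivative_C, sub_zero, hpP_deriv_eval] at h2
  exact hy x h2 hx

theorem case_ne {d : ℕ} (hd : 2 ≤ d) {c0 : Fin (d-1) → ℂ} (hc : c0 ≠ 0) : ¬ NeBot (FB d c0) := by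
  intro hne
  obtain ⟨N, ζ, hLD, hpost⟩ := exists_LD hd c0
  obtain ⟨lam, Z, h⟩ := p4 hLD
  have hN := h.hN
  obtain ⟨e1, _, e3, _⟩ := h.ev.self_of_nhds
  set f := henonPoly d c0 with hf
  obtain ⟨w, hw, hw0⟩ : ∃ w, f w = ζ ∧ w ≠ Z (0, c0) 0 0 := by
    obtain ⟨x1, x2, h12, h1, h2⟩ := hp_two hd c0 (y := ζ) (fun x hx => hpost x 1 hx)
    by_cases h3 : x1 = Z (0, c0) 0 0
    · exact ⟨x2, h2, fun h4 => h12 (h3.trans h4.symm)⟩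
    · exact ⟨x1, h1, h3⟩
  obtain ⟨y, hy⟩ := hp_surj hd c0 (2 * N - 2) w
  obtain ⟨x1, x2, h12, h1, h2⟩ := hp_two hd c0 (y := y) (fun x hx he => hpost x (2 * N) hx (by
    rw [show 2 * N = 1 + ((2 * N - 2) + 1) by omega, iterate_add_apply, iterate_add_apply, iterate_one, hf, he, hy, ← hf, hw]))
  obtain ⟨s, hs⟩ : ∃ s, f (Z (0, c0) 1 s) = y := by
    rcases h.picard 1 h12 with ⟨s, e⟩ | ⟨s, e⟩
    · exact ⟨s, by rw [e]; exact h1⟩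
    · exact ⟨s, by rw [e]; exact h2⟩
  have hz0 : Z (0, c0) 0 (lam (0, c0) * s) = w := by
    rw [← e3, show 0 + 2 * N = 1 + ((2 * N - 2) + 1) by omega, h.iter0, iterate_add_apply, iterate_one, ← hf, hs, hf, hy]
  have hz1 : Z (0, c0) 1 (lam (0, c0) * s) = ζ := by
    rw [h.rec0 0, hz0]; exact hw
  set u := lam (0, c0) * s with hu
  have hu0 : u ≠ 0 := by intro e; rw [e] at hz0; exact hw0 hz0.symm
  have hder : deriv (Z (0, c0) 1) u ≠ 0 := by
    have hlim : Tendsto (fun l : ℕ => (lam (0, c0))⁻¹ ^ l * u) atTop (𝓝 0) := by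
      have := tendsto_pow_atTop_nhds_zero_of_norm_lt_one (x := (lam (0, c0))⁻¹) (by
        rw [norm_inv]; exact inv_lt_one_of_one_lt₀ h.lam_gt)
      simpa using this.mul_const u
    have hct := ((h.contD0 1).tendsto 0).comp hlim
    obtain ⟨l, hl⟩ := (hct.eventually_ne h.der).exists
    simp only [Function.comp_apply] at hl
    set v := (lam (0, c0))⁻¹ ^ l * u with hv
    have hlv : lam (0, c0) ^ l * v = u := by
      rw [hv, inv_pow, mul_inv_cancel_left₀ (pow_ne_zero _ h.lam_ne)]
    have hper := UF.derPerX e1 e3 1 l v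
    rw [hlv] at hper
    have hzl : Z (0, c0) (1 + l * (2 * N)) v = ζ := by
      have : ∀ l v, Z (0, c0) (1 + l * (2 * N)) v = Z (0, c0) 1 (lam (0, c0) ^ l * v) := by
        intro l
        induction l with
        | zero => simp
        | succ l ih => intro v; rw [show 1 + (l+1) * (2 * N) = (1 + l * (2 * N)) + 2 * N by ring, e3, ih, pow_succ]; ring_nf
      rw [this, hlv, hz1]
    have hk : ∀ k, k ≤ l * (2 * N) → deriv (Z (0, c0) (1 + k)) v ≠ 0 := by
      intro k
      induction k with
      | zero => intro _; exact hl
      | succ k ih =>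
        intro hk
        rw [← add_assoc, h.derRec0]
        refine mul_ne_zero (fun h0 => ?_) (ih (by omega))
        refine hpost _ (l * (2 * N) - k) h0 ?_
        rw [← h.iter0, show 1 + k + (l * (2 * N) - k) = 1 + l * (2 * N) by omega, hzl]
    intro h0
    rw [h0, mul_zero] at hper
    exact hk _ le_rfl hper
  obtain ⟨Γ0, Γ1, γ, A⟩ := UF.ad hd h hu0 (by rw [hz1, h.zero]) hder
  exact h.crit_false hd hc (UF.AD.no_crit A (by rw [hz0]; exact hw0))
end HenonML
end

section
namespace HenonML

lemma hp_zero (d : ℕ) (z : ℂ) : henonPoly d 0 z = z ^ d := by simp [henonPoly]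

lemma pow_exp {φ : ℂ → ℂ} (hφ : Differentiable ℂ φ) {D : ℕ} (hD : 2 ≤ D) (h0 : φ 0 ≠ 0) (hf : ∀ s, φ (D * s) = φ s ^ D) :
    ∃ κ, ∀ s, φ s = φ 0 * Complex.exp (κ * s) := by
  have hDC : (D:ℂ) ≠ 0 := by exact_mod_cast (by omega : D ≠ 0)
  have hlim : ∀ s : ℂ, Tendsto (fun l : ℕ => ((D:ℂ))⁻¹ ^ l * s) atTop (𝓝 0) := by
    intro s
    have := tendsto_pow_atTop_nhds_zero_of_norm_lt_one (x := (D:ℂ)⁻¹) (by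
      rw [norm_inv, Complex.norm_natCast]; exact inv_lt_one_of_one_lt₀ (by exact_mod_cast (by omega : 1 < D)))
    simpa using this.mul_const s
  have hne : ∀ s, φ s ≠ 0 := by
    intro s
    obtain ⟨l, hl⟩ := (((hφ.continuous.tendsto 0).comp (hlim s)).eventually_ne h0).exists
    simp only [Function.comp_apply] at hl
    have : ∀ (l : ℕ) (s : ℂ), φ ((D:ℂ)⁻¹ ^ l * s) ≠ 0 → φ s ≠ 0 := by
      intro l
      induction l with
      | zero => intro s; simp
      | succ l ih =>
        intro s hs
        have h2 : φ ((D:ℂ)⁻¹ * s) ≠ 0 := ih _ (by rwa [pow_succ, mul_assoc] at hs)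
        have h3 := hf ((D:ℂ)⁻¹ * s)
        rw [mul_inv_cancel_left₀ hDC] at h3
        rw [h3]; exact pow_ne_zero _ h2
    exact this l s hl
  have hd' : Differentiable ℂ (deriv φ) := by
    exact fun s => ((hφ.differentiableOn (s := univ)).deriv isOpen_univ).differentiableAt univ_mem
  set g : ℂ → ℂ := fun s => deriv φ s / φ s with hg
  have hgc : Continuous g := hd'.continuous.div hφ.continuous hne
  have hgs : ∀ s, g (D * s) = g s := by
    intro s
    have e1 : HasDerivAt (fun s => φ (D * s)) (deriv φ (D * s) * D) s := by
      have := (hφ (D*s)).hasDerivAt.comp s ((hasDerivAt_id s).const_mul (D:ℂ))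
      rw [mul_one] at this
      exact this
    have e2 : HasDerivAt (fun s => φ s ^ D) (D * φ s ^ (D-1) * deriv φ s) s := (hφ s).hasDerivAt.pow D
    simp only [hf] at e1
    have e3 := e1.unique e2
    have e4 : deriv φ (D * s) = φ s ^ (D-1) * deriv φ s := by
      apply mul_right_cancel₀ hDC; rw [e3]; ring
    simp only [hg]
    rw [hf, e4]
    have : φ s ^ D = φ s ^ (D-1) * φ s := by rw [← pow_succ]; congr 1; omega
    rw [this]
    exact mul_div_mul_left _ _ (pow_ne_zero _ (hne s))
  have hgl : ∀ (l : ℕ) (s : ℂ), g ((D:ℂ)⁻¹ ^ l * s) = g s := by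
    intro l
    induction l with
    | zero => intro s; simp
    | succ l ih =>
      intro s
      rw [pow_succ, mul_assoc, ih, ← hgs, mul_inv_cancel_left₀ hDC]
  have hg0 : ∀ s, g s = g 0 := by
    intro s
    refine tendsto_nhds_unique (f := fun l : ℕ => g ((D:ℂ)⁻¹ ^ l * s)) (l := atTop) ?_ ((hgc.tendsto 0).comp (hlim s))
    simp only [hgl]; exact tendsto_const_nhds
  refine ⟨g 0, ?_⟩
  have hdz : ∀ s, HasDerivAt (fun s => φ s * Complex.exp (-(g 0 * s))) 0 s := by
    intro s
    have := (hφ s).hasDerivAt.mul ((((hasDerivAt_id s).const_mul (g 0)).neg).cexp)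
    refine this.congr_deriv ?_
    have h3 : deriv φ s = g 0 * φ s := by rw [← hg0 s]; simp only [hg]; rw [div_mul_cancel₀ _ (hne s)]
    simp only [id, h3]; ring
  intro s
  have := is_const_of_deriv_eq_zero (fun s => (hdz s).differentiableAt) (fun s => (hdz s).deriv) s 0
  simp only [mul_zero, neg_zero, Complex.exp_zero, mul_one, Complex.exp_neg] at this
  rw [← this]; field_simp

theorem UF.exp_form {d : ℕ} (hd : 2 ≤ d) {ζ : ℂ} {lam : ℂ × (Fin (d-1) → ℂ) → ℂ} {Z : ℂ × (Fin (d-1) → ℂ) → ℕ → ℂ → ℂ}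
    (h : UF d 0 1 ζ lam Z) (hz : ζ ≠ 0) (hl : lam (0, 0) = d ^ 2) :
    ∃ κ, κ ≠ 0 ∧ (∀ s, Z (0, 0) 1 s = ζ * Complex.exp (κ * s)) ∧ ∀ s, Z (0, 0) 0 s = ζ ^ d * Complex.exp (κ * s / d) := by
  obtain ⟨_, _, e3, _⟩ := h.ev.self_of_nhds
  have hdC : (d:ℂ) ≠ 0 := by exact_mod_cast (by omega : d ≠ 0)
  have r0 : ∀ n s, Z (0, 0) (n+1) s = Z (0, 0) n s ^ d := fun n s => by rw [h.rec0, hp_zero]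
  obtain ⟨κ, hκ⟩ := pow_exp (h.diff0 1) (D := d^2) (by nlinarith) (by rw [h.zero]; exact hz) (by
    intro s
    push_cast
    rw [← hl, ← e3, r0, r0, ← pow_mul, pow_two])
  rw [h.zero] at hκ
  refine ⟨κ, ?_, hκ, ?_⟩
  · rintro rfl
    apply h.der
    have : Z (0, 0) 1 = fun _ => ζ := by funext s; rw [hκ]; simp
    rw [this]; simp
  · intro s
    have := e3 0 (s / d^2)
    rw [hl, mul_div_cancel₀ _ (pow_ne_zero 2 hdC), show 0 + 2 * 1 = 1 + 1 from rfl, r0, hκ, mul_pow, ← Complex.exp_nat_mul] at this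
    rw [← this]; congr 2; field_simp
end HenonML
end

section
namespace HenonML
namespace UF
variable {d : ℕ} {c0 : Fin (d-1) → ℂ} {N : ℕ} {ζ : ℂ} {lam : ℂ × (Fin (d-1) → ℂ) → ℂ} {Z : ℂ × (Fin (d-1) → ℂ) → ℕ → ℂ → ℂ}
variable {h : UF d c0 N ζ lam Z} {uB γ : ℂ} {Γ0 Γ1 : ℂ × (Fin (d-1) → ℂ) → ℂ}

lemma bilip (h : UF d c0 N ζ lam Z) (n : ℕ) {u v : ℂ × (Fin (d-1) → ℂ) → ℂ} {w : ℂ} (hu : Tendsto u (FB d c0) (𝓝 w)) (hv : Tendsto v (FB d c0) (𝓝 w))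
    (hw : deriv (Z (0, c0) n) w ≠ 0) (hZ : Tendsto (fun x => (Z x n (u x) - Z x n (v x)) / x.1) (FB d c0) (𝓝 0)) :
    Tendsto (fun x => (u x - v x) / x.1) (FB d c0) (𝓝 0) := by
  set α := deriv (Z (0, c0) n) w with hα
  have hαp : 0 < ‖α‖ := norm_pos_iff.2 hw
  obtain ⟨δ, hδ, hδ2⟩ := Metric.eventually_nhds_iff_ball.1 (((h.contD0 n).tendsto w).eventually (Metric.ball_mem_nhds _ (show 0 < ‖α‖/4 by positivity)))
  have hb : ∀ᶠ x in FB d c0, ‖u x - v x‖ ≤ 2 / ‖α‖ * ‖Z x n (u x) - Z x n (v x)‖ := by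
    filter_upwards [FB_le (h.unifD n (‖w‖ + δ) (show 0 < ‖α‖/4 by positivity)), FB_le h.ev, hu.eventually (Metric.ball_mem_nhds _ hδ), hv.eventually (Metric.ball_mem_nhds _ hδ)] with x h1 h2 h3 h4
    have key := near_linear_bound (Ω := Metric.ball w δ) Metric.isOpen_ball (convex_ball _ _) (h2.1 n).differentiableOn (α := α) (k := ‖α‖/2) (by
      intro z hz
      have a1 := h1 z (by
        have := norm_le_norm_add_norm_sub' z w
        rw [Metric.mem_ball, dist_eq_norm] at hz; linarith)
      have a2 := hδ2 z hz
      rw [dist_eq_norm] at a2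
      have := norm_sub_le_norm_sub_add_norm_sub (deriv (Z x n) z) (deriv (Z (0, c0) n) z) α
      linarith) h3 h4
    have h5 : ‖α * (u x - v x)‖ ≤ ‖Z x n (u x) - Z x n (v x)‖ + ‖α‖/2 * ‖u x - v x‖ := by
      have := norm_sub_norm_le (α * (u x - v x)) (Z x n (u x) - Z x n (v x))
      rw [norm_sub_rev (α * (u x - v x))] at this; linarith
    rw [norm_mul] at h5
    rw [div_mul_eq_mul_div, le_div_iff₀ hαp]
    nlinarith
  refine squeeze_zero_norm' (a := fun x => 2 / ‖α‖ * ‖(Z x n (u x) - Z x n (v x)) / x.1‖) ?_ (by simpa using hZ.norm.const_mul (2 / ‖α‖))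
  filter_upwards [hb] with x hx
  rw [norm_div, norm_div, ← mul_div_assoc]
  gcongr

lemma AD.e2 (A : AD h uB Γ0 Γ1 γ) {s : ℂ × (Fin (d-1) → ℂ) → ℂ} {w : ℂ} (hs : Tendsto s (FB d c0) (𝓝 w)) :
    Tendsto (fun x => (Z x 2 (Γ0 x + Γ1 x * s x) - Z x 2 (s x)) / x.1) (FB d c0) (𝓝 0) := by
  rw [Metric.tendsto_nhds]
  intro ε hε
  filter_upwards [A.small (‖w‖ + 1) (ε/2) (by positivity), hs.eventually (Metric.ball_mem_nhds _ one_pos), FB_ne] with x h1 h2 h3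
  rw [dist_zero_right, norm_div, div_lt_iff₀ (norm_pos_iff.2 h3)]
  refine (h1 _ ?_).trans_lt ?_
  · have := norm_le_norm_add_norm_sub' (s x) w
    rw [dist_eq_norm] at h2; linarith
  · have := norm_pos_iff.2 h3; nlinarith

lemma AD.sA (A : AD h uB Γ0 Γ1 γ) {s : ℂ × (Fin (d-1) → ℂ) → ℂ} {w : ℂ} (hs : Tendsto s (FB d c0) (𝓝 w)) :
    Tendsto (fun x => Γ0 x + Γ1 x * s x) (FB d c0) (𝓝 (uB + γ * w)) := A.t0.add (A.t1.mul hs)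

lemma AD.eT (A : AD h uB Γ0 Γ1 γ) {s : ℂ × (Fin (d-1) → ℂ) → ℂ} {w : ℂ} (hs : Tendsto s (FB d c0) (𝓝 w)) (n : ℕ) :
    Tendsto (fun x => Z x n (Γ0 x + Γ1 x * s x) - Z x n (s x)) (FB d c0) (𝓝 (Z (0, c0) n (uB + γ * w) - Z (0, c0) n w)) :=
  (h.tend n FB_le (A.sA hs)).sub (h.tend n FB_le hs)

lemma AD.qT (A : AD h uB Γ0 Γ1 γ) {s : ℂ × (Fin (d-1) → ℂ) → ℂ} {w : ℂ} (hs : Tendsto s (FB d c0) (𝓝 w)) (n : ℕ) :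
    Tendsto (fun x => hpQ d x.2 (Z x (n+1) (Γ0 x + Γ1 x * s x)) (Z x (n+1) (s x))) (FB d c0) (𝓝 (hpD d c0 (Z (0, c0) (n+1) w))) := by
  have h2 : Tendsto (fun x : ℂ × (Fin (d-1) → ℂ) => x.2) (FB d c0) (𝓝 c0) := (continuous_snd.tendsto _).mono_left FB_le
  have h3 := h2.prodMk_nhds ((h.tend (n+1) FB_le (A.sA hs)).prodMk_nhds (h.tend (n+1) FB_le hs))
  have := ((hpQ_cont d).tendsto _).comp h3
  simp only [A.inv_n, hpQ_self] at this
  exact this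

lemma AD.e1 (A : AD h uB Γ0 Γ1 γ) {s : ℂ × (Fin (d-1) → ℂ) → ℂ} {w : ℂ} (hs : Tendsto s (FB d c0) (𝓝 w)) (hw : hpD d c0 (Z (0, c0) 1 w) ≠ 0) :
    Tendsto (fun x => (Z x 1 (Γ0 x + Γ1 x * s x) - Z x 1 (s x)) / x.1) (FB d c0) (𝓝 ((0 - (Z (0, c0) 0 (uB + γ * w) - Z (0, c0) 0 w)) / hpD d c0 (Z (0, c0) 1 w))) := by
  refine (((A.e2 hs).sub (A.eT hs 0)).div (A.qT hs 0) hw).congr' ?_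
  filter_upwards [FB_le h.ev, FB_ne, (A.qT hs 0).eventually_ne hw] with x h1 h2 h3
  have h4 := AD.erec h1.2.1 0 (Γ0 x + Γ1 x * s x) (s x)
  simp only [Pi.div_apply, zero_add] at h3 h4 ⊢
  rw [h4]
  field_simp
  ring

lemma AD.e3 (A : AD h uB Γ0 Γ1 γ) {s : ℂ × (Fin (d-1) → ℂ) → ℂ} {w : ℂ} (hs : Tendsto s (FB d c0) (𝓝 w)) :
    Tendsto (fun x => (Z x 3 (Γ0 x + Γ1 x * s x) - Z x 3 (s x)) / x.1) (FB d c0) (𝓝 0) := by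
  have := ((A.eT hs 1).add ((A.e2 hs).mul (A.qT hs 1)))
  rw [A.inv_n 0, sub_self, zero_mul, add_zero] at this
  refine this.congr' ?_
  filter_upwards [FB_le h.ev, FB_ne] with x h1 h2
  rw [AD.erec h1.2.1 1]
  simp only [Nat.reduceAdd]
  field_simp

end UF
end HenonML
end

section
namespace HenonML

theorem UF.lam_small {d : ℕ} (hd : 2 ≤ d) [NeBot (FB d 0)] {ζ : ℂ} {lam : ℂ × (Fin (d-1) → ℂ) → ℂ} {Z : ℂ × (Fin (d-1) → ℂ) → ℕ → ℂ → ℂ}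
    (h : UF d 0 1 ζ lam Z) (hz : ζ ≠ 0) (hl : lam (0, 0) = d ^ 2) : Tendsto (fun x => (lam x - d ^ 2) / x.1) (FB d 0) (𝓝 0) := by
  obtain ⟨κ, hκ, f1, f0⟩ := h.exp_form hd hz hl
  have hdC : (d:ℂ) ≠ 0 := by exact_mod_cast (by omega : d ≠ 0)
  set uB : ℂ := 2 * Real.pi * Complex.I / κ with huB
  have hku : κ * uB = 2 * Real.pi * Complex.I := by rw [huB]; field_simp
  have huB0 : uB ≠ 0 := div_ne_zero Complex.two_pi_I_ne_zero hκ
  have fp : ∀ s, Z (0, 0) 1 (uB + s) = Z (0, 0) 1 s := by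
    intro s; rw [f1, f1, mul_add, hku, Complex.exp_add, Complex.exp_two_pi_mul_I, one_mul]
  have fd : ∀ s, HasDerivAt (Z (0, 0) 1) (ζ * (Complex.exp (κ * s) * κ)) s := by
    intro s
    rw [show Z (0, 0) 1 = fun s => ζ * Complex.exp (κ * s) from funext f1]
    have := (((hasDerivAt_id s).const_mul κ).cexp).const_mul ζ
    simpa using this
  have fd0 : ∀ s, deriv (Z (0, 0) 1) s ≠ 0 := by
    intro s; rw [(fd s).deriv]; exact mul_ne_zero hz (mul_ne_zero (Complex.exp_ne_zero _) hκ)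
  obtain ⟨Γ0, Γ1, γ, A⟩ := UF.ad hd h huB0 (by simpa using fp 0) (fd0 _)
  have hγ : γ = 1 := by
    have e1 : HasDerivAt (fun s => Z (0, 0) 1 (uB + γ * s)) (deriv (Z (0, 0) 1) (uB + γ * 0) * (γ * 1)) 0 :=
      ((h.diff0 1) (uB + γ * 0)).hasDerivAt.comp (0:ℂ) (((hasDerivAt_id (0:ℂ)).const_mul γ).const_add uB)
    simp only [A.inv] at e1
    have := e1.unique (fd 0)
    rw [(fd _).deriv] at this
    simp only [mul_zero, add_zero, hku, Complex.exp_two_pi_mul_I, Complex.exp_zero, one_mul, mul_one] at this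
    exact mul_left_cancel₀ (mul_ne_zero hz hκ) (by rw [this, mul_one])
  subst hγ
  set ω := Complex.exp (2 * Real.pi * Complex.I / d) with hω
  have f0p : ∀ s, Z (0, 0) 0 (uB + s) = ω * Z (0, 0) 0 s := by
    intro s; rw [f0, f0, mul_add, hku, add_div, Complex.exp_add]; ring
  have hprim : IsPrimitiveRoot ω d := Complex.isPrimitiveRoot_exp d (by omega)
  have hD : ∀ s, hpD d 0 (Z (0, 0) 1 s) ≠ 0 := by
    intro s
    simp only [hpD, Pi.zero_apply, zero_mul, Finset.sum_const_zero, add_zero]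
    refine mul_ne_zero hdC (pow_ne_zero _ ?_)
    rw [f1]; exact mul_ne_zero hz (Complex.exp_ne_zero _)
  set R : ℂ → ℂ := fun w => (0 - (Z (0, 0) 0 (uB + 1 * w) - Z (0, 0) 0 w)) / hpD d 0 (Z (0, 0) 1 w) with hR
  have hRp : ∀ w, R (uB + w) = ω * R w := by
    intro w
    simp only [hR, one_mul]
    rw [fp, f0p, f0p]; ring
  have hRj : ∀ (w : ℂ) (j : ℕ), R (w + j * uB) = ω ^ j * R w := by
    intro w j
    induction j with
    | zero => simp
    | succ j ih => rw [show w + ((j+1 : ℕ):ℂ) * uB = uB + (w + j * uB) by push_cast; ring, hRp, ih]; ring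
  have hRs : ∀ w : ℂ, ∑ j ∈ Finset.range (d^2), R (w + j * uB) = 0 := by
    intro w
    simp only [hRj]
    rw [← Finset.sum_mul]
    have : (∑ j ∈ Finset.range (d^2), ω ^ j) * (ω - 1) = 0 := by
      rw [geom_sum_mul, pow_two, pow_mul, hprim.pow_eq_one, one_pow, sub_self]
    rw [(mul_eq_zero.1 this).resolve_right (sub_ne_zero.2 (hprim.ne_one (by omega))), zero_mul]
  -- iterates
  have hlam : Tendsto lam (FB d 0) (𝓝 (d^2)) := by
    rw [← hl]; exact h.lamc.tendsto.mono_left FB_le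
  have main : ∀ t : ℂ, Tendsto (fun x => ((Γ0 x * ∑ i ∈ Finset.range (d^2), Γ1 x ^ i + Γ1 x ^ (d^2) * t) - (lam x * Γ0 x + Γ1 x * t)) / x.1) (FB d 0) (𝓝 0) := by
    intro t
    set T : ℕ → ℂ × (Fin (d-1) → ℂ) → ℂ := fun j x => Γ0 x * ∑ i ∈ Finset.range j, Γ1 x ^ i + Γ1 x ^ j * t with hT
    have hTs : ∀ j x, T (j+1) x = Γ0 x + Γ1 x * T j x := by
      intro j x
      simp only [hT, Finset.sum_range_succ', pow_succ, ← Finset.sum_mul, pow_zero]; ring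
    have hTt : ∀ j : ℕ, Tendsto (T j) (FB d 0) (𝓝 (t + j * uB)) := by
      intro j
      induction j with
      | zero => simp [hT]
      | succ j ih =>
        have := A.sA ih
        rw [show uB + 1 * (t + j * uB) = t + ((j+1 : ℕ):ℂ) * uB by push_cast; ring] at this
        exact this.congr fun x => (hTs j x).symm
    have hE : Tendsto (fun x => (Z x 1 (T (d^2) x) - Z x 1 t) / x.1) (FB d 0) (𝓝 0) := by
      rw [← hRs t]
      refine (tendsto_finsetSum (Finset.range (d^2)) fun j _ => A.e1 (hTt j) (hD _)).congr fun x => ?_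
      simp only [← hTs]
      rw [← Finset.sum_div, Finset.sum_range_sub (fun j => Z x 1 (T j x))]
      simp [hT]
    have hS : Tendsto (fun x => t / lam x) (FB d 0) (𝓝 (t / d^2)) := tendsto_const_nhds.div hlam (pow_ne_zero 2 hdC)
    have hE3 := A.e3 hS
    have hE4 : Tendsto (fun x => (Z x 1 (lam x * Γ0 x + Γ1 x * t) - Z x 1 t) / x.1) (FB d 0) (𝓝 0) := by
      refine hE3.congr' ?_
      filter_upwards [FB_le h.ev] with x hx
      have hx0 : lam x ≠ 0 := norm_pos_iff.1 (one_pos.trans hx.2.2.2)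
      have := hx.2.2.1 1
      norm_num at this
      rw [this, this, mul_div_cancel₀ _ hx0]
      congr 3
      field_simp
    have h5 : Tendsto (fun x => lam x * Γ0 x + Γ1 x * t) (FB d 0) (𝓝 (t + ((d^2 : ℕ):ℂ) * uB)) := by
      have := (hlam.mul A.t0).add (A.t1.mul_const t)
      rwa [show (d:ℂ)^2 * uB + 1 * t = t + ((d^2 : ℕ):ℂ) * uB by push_cast; ring] at this
    refine h.bilip 1 (hTt (d^2)) h5 (fd0 _) ?_
    have := hE.sub hE4
    rw [sub_zero] at this
    exact this.congr fun x => by ring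
  have m0 := main 0
  have m1 := (main 1).sub m0
  rw [sub_zero] at m1
  have hd2 : 2 ≤ d^2 := by nlinarith
  have hgs : ∀ j : ℕ, Tendsto (fun x => ∑ i ∈ Finset.range j, Γ1 x ^ i) (FB d 0) (𝓝 j) := by
    intro j
    have := tendsto_finsetSum (Finset.range j) fun i _ => A.t1.pow i
    simpa using this
  have g1 : Tendsto (fun x => (Γ1 x - 1) / x.1) (FB d 0) (𝓝 0) := by
    have hq := A.t1.mul (hgs (d^2 - 1))
    have hq0 : (1:ℂ) * ((d^2 - 1 : ℕ):ℂ) ≠ 0 := by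
      rw [one_mul]; exact_mod_cast (by omega : d^2 - 1 ≠ 0)
    have := m1.div hq hq0
    rw [zero_div] at this
    refine this.congr' ?_
    filter_upwards [hq.eventually_ne hq0] with x hx
    simp only [Pi.div_apply]
    rw [div_eq_iff hx]
    have h6 := geom_sum_mul (Γ1 x) (d^2 - 1)
    have h7 : Γ1 x ^ (d^2) = Γ1 x ^ (d^2-1) * Γ1 x := by rw [← pow_succ]; congr 1; omega
    rw [h7, show Γ1 x ^ (d^2-1) = (∑ i ∈ Finset.range (d^2 - 1), Γ1 x ^ i) * (Γ1 x - 1) + 1 by rw [h6]; ring]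
    ring
  have g2 : Tendsto (fun x => (∑ i ∈ Finset.range (d^2), Γ1 x ^ i - lam x) / x.1) (FB d 0) (𝓝 0) := by
    have := m0.div A.t0 huB0
    rw [zero_div] at this
    refine this.congr' ?_
    filter_upwards [A.t0.eventually_ne huB0] with x hx
    simp only [Pi.div_apply]
    rw [div_eq_iff hx]; ring
  have g3 : Tendsto (fun x => (∑ i ∈ Finset.range (d^2), Γ1 x ^ i - d^2) / x.1) (FB d 0) (𝓝 0) := by
    have := g1.mul (tendsto_finsetSum (Finset.range (d^2)) fun i _ => hgs i)
    rw [zero_mul] at this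
    refine this.congr fun x => ?_
    have h8 : ∑ i ∈ Finset.range (d^2), Γ1 x ^ i - (d:ℂ)^2 = (Γ1 x - 1) * ∑ j ∈ Finset.range (d^2), ∑ i ∈ Finset.range j, Γ1 x ^ i := by
      rw [Finset.mul_sum]
      simp only [mul_geom_sum]
      rw [Finset.sum_sub_distrib]; simp
    rw [h8]; ring
  have := g3.sub g2
  rw [sub_zero] at this
  exact this.congr fun x => by ring
end HenonML
end

section
namespace HenonML

lemma powT {ι : Type*} {F : Filter ι} {z r : ι → ℂ} {ζ Δ : ℂ} (hz : Tendsto z F (𝓝 ζ)) (n : ℕ) (hΔ : Tendsto (fun x => (z x - ζ) / r x) F (𝓝 Δ)) :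
    Tendsto (fun x => (z x ^ n - ζ ^ n) / r x) F (𝓝 (n * ζ ^ (n-1) * Δ)) := by
  have h1 : Tendsto (fun x => ∑ i ∈ Finset.range n, z x ^ i * ζ ^ (n - 1 - i)) F (𝓝 (n * ζ ^ (n-1))) := by
    rw [← geom_sum₂_self]
    exact tendsto_finsetSum _ fun i _ => (hz.pow i).mul_const _
  refine (h1.mul hΔ).congr fun x => ?_
  rw [← geom_sum₂_mul]; ring

lemma ld_one {d : ℕ} (hd : 2 ≤ d) {ζ : ℂ} (hζ : ζ ^ (d^2 - 1) = 1) : LD d 0 1 ζ ∧ deriv ((henonPoly d 0)^[2 * 1]) ζ = d ^ 2 := by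
  have hd2 : 4 ≤ d^2 := by nlinarith
  have hn : ‖ζ‖ = 1 := Complex.norm_eq_one_of_pow_eq_one hζ (by omega)
  have hD : ∀ z, hpD d 0 z = d * z ^ (d-1) := by intro z; simp [hpD]
  have hdR : (2:ℝ) ≤ d := by exact_mod_cast hd
  have e2 : deriv ((henonPoly d 0)^[2 * 1]) ζ = d ^ 2 := by
    rw [hp_iter_deriv]
    simp only [mul_one, Finset.prod_range_succ, Finset.prod_range_zero, one_mul, iterate_zero, iterate_one, id, hD, hp_zero]
    have : ζ ^ (d-1) * (ζ^d)^(d-1) = 1 := by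
      rw [← pow_mul, ← pow_add, ← hζ]; congr 1
      obtain ⟨e, rfl⟩ : ∃ e, d = e + 1 := ⟨d-1, by omega⟩
      have : (e+1)^2 = e + (e+1)*e + 1 := by ring
      simp only [Nat.add_sub_cancel]; omega
    linear_combination (d:ℂ)^2 * this
  refine ⟨⟨le_rfl, ?_, ?_, ?_⟩, e2⟩
  · simp only [mul_one, iterate_succ, iterate_zero, Function.comp, id, hp_zero]
    rw [← pow_mul, show d * d = (d^2 - 1) + 1 by rw [← pow_two]; omega, pow_succ, hζ, one_mul]
  · rw [e2, norm_pow, Complex.norm_natCast]; nlinarith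
  · rw [e2, hp_iter_deriv]
    simp only [mul_one, Nat.add_one_sub_one, Finset.prod_range_succ, Finset.prod_range_zero, one_mul, iterate_zero, id, hD]
    simp only [norm_mul, norm_pow, hn, one_pow, mul_one, Complex.norm_natCast]
    calc (d:ℝ) < d ^ 2 := by nlinarith
      _ ≤ (d ^ 2) ^ 2 := by nlinarith [sq_nonneg ((d:ℝ)^2 - 1)]

/-- the linearised identity -/
theorem lin_id {d : ℕ} (hd : 2 ≤ d) [NeBot (FB d 0)] {F : Filter (ℂ × (Fin (d-1) → ℂ))} [NeBot F] (hF : F ≤ FB d 0) {as : ℂ} {cs : Fin (d-1) → ℂ}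
    (ha : Tendsto (fun x : ℂ × (Fin (d-1) → ℂ) => x.1 / (‖x‖ : ℂ)) F (𝓝 as)) (hc : ∀ j, Tendsto (fun x : ℂ × (Fin (d-1) → ℂ) => x.2 j / (‖x‖ : ℂ)) F (𝓝 (cs j)))
    {ζ : ℂ} (hζ : ζ ^ (d^2 - 1) = 1) :
    2 * as * (d^2 - 1) * ζ ^ (d+1) + ∑ j : Fin (d-1), (d^2 - d * (j:ℕ)) * cs j * (ζ ^ ((j:ℕ)+1) + ζ ^ (d * ((j:ℕ)+1))) = 0 := by
  have hd2 : 4 ≤ d^2 := by nlinarith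
  have hz : ζ ≠ 0 := by rintro rfl; rw [zero_pow (by omega)] at hζ; exact zero_ne_one hζ
  have hdC : (d:ℂ) ≠ 0 := by exact_mod_cast (by omega : d ≠ 0)
  obtain ⟨hLD, hder⟩ := ld_one hd hζ
  obtain ⟨lam, Z, h⟩ := p4 hLD
  have hl : lam (0, 0) = d^2 := by rw [h.lam0, hder]
  have hls := h.lam_small hd hz hl
  have hF0 : F ≤ 𝓝 ((0:ℂ), 0) := hF.trans FB_le
  have hdD : (d:ℂ)^2 - 1 ≠ 0 := by
    rw [sub_ne_zero]; exact_mod_cast (by omega : d^2 ≠ 1)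
  have hd1 : (d:ℂ) - 1 ≠ 0 := by
    rw [sub_ne_zero]; exact_mod_cast (by omega : d ≠ 1)
  set η := ζ ^ d with hη
  have hη0 : η ≠ 0 := pow_ne_zero _ hz
  have hηd : η ^ d = ζ := by
    rw [hη, ← pow_mul, show d * d = (d^2 - 1) + 1 by rw [← pow_two]; omega, pow_succ, hζ, one_mul]
  have z00 : Z (0, 0) 0 0 = η := by
    have := h.ev.self_of_nhds.2.2.1 0 0
    rw [mul_zero] at this
    rw [← this, show 0 + 2 * 1 = 1 + 1 from rfl, h.rec0, h.zero, hp_zero]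
  set r : ℂ × (Fin (d-1) → ℂ) → ℂ := fun x => (‖x‖ : ℂ) with hr
  have hr0 : ∀ᶠ x in F, r x ≠ 0 := by
    filter_upwards [hF FB_ne] with x hx
    simp only [hr, ne_eq, Complex.ofReal_eq_zero, norm_eq_zero]
    intro h0; rw [h0] at hx; exact hx rfl
  have t0 : Tendsto (fun x => Z x 0 0) F (𝓝 η) := by rw [← z00]; exact h.tend 0 hF0 tendsto_const_nhds
  have t1 : Tendsto (fun x => Z x 1 0) F (𝓝 ζ) := by
    have := h.tend 1 hF0 (g := fun _ => 0) tendsto_const_nhds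
    rwa [h.zero] at this
  have ta : Tendsto (fun x : ℂ × (Fin (d-1) → ℂ) => x.1) F (𝓝 0) := (continuous_fst.tendsto _).mono_left hF0
  have tl : Tendsto lam F (𝓝 (d^2)) := by rw [← hl]; exact h.lamc.tendsto.mono_left hF0
  have tlr : Tendsto (fun x => (lam x - d^2) / r x) F (𝓝 0) := by
    have := (hls.mono_left hF).mul ha
    rw [zero_mul] at this
    refine this.congr' ?_
    filter_upwards [hF FB_ne, hr0] with x h1 h2
    simp only [hr] at h2 ⊢
    field_simp
  -- first order variation of the orbit
  set S0 : ℂ × (Fin (d-1) → ℂ) → ℂ := fun x => ∑ i ∈ Finset.range d, Z x 0 0 ^ i * η ^ (d - 1 - i) with hS0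
  set S1 : ℂ × (Fin (d-1) → ℂ) → ℂ := fun x => ∑ i ∈ Finset.range d, Z x 1 0 ^ i * ζ ^ (d - 1 - i) with hS1
  have tS0 : Tendsto S0 F (𝓝 (d * η ^ (d-1))) := by
    rw [← geom_sum₂_self]
    exact tendsto_finsetSum _ fun i _ => (t0.pow i).mul_const _
  have tS1 : Tendsto S1 F (𝓝 (d * ζ ^ (d-1))) := by
    rw [← geom_sum₂_self]
    exact tendsto_finsetSum _ fun i _ => (t1.pow i).mul_const _
  have eη : η ^ (d-1) = ζ / η := by
    rw [eq_div_iff hη0, ← pow_succ, show d - 1 + 1 = d by omega, hηd]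
  have eζ : ζ ^ (d-1) = η / ζ := by
    rw [eq_div_iff hz, ← pow_succ, show d - 1 + 1 = d by omega]
  rw [eη] at tS0
  rw [eζ] at tS1
  set B0 : ℂ × (Fin (d-1) → ℂ) → ℂ := fun x => x.1 / r x * Z x 0 0 + ∑ j : Fin (d-1), x.2 j / r x * Z x 1 0 ^ (j:ℕ) with hB0
  set B1 : ℂ × (Fin (d-1) → ℂ) → ℂ := fun x => x.1 / r x * Z x 1 0 + ∑ j : Fin (d-1), x.2 j / r x * Z x 0 0 ^ (j:ℕ) with hB1
  set P0 := ∑ j : Fin (d-1), cs j * ζ ^ (j:ℕ) with hP0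
  set P1 := ∑ j : Fin (d-1), cs j * η ^ (j:ℕ) with hP1
  have tB0 : Tendsto B0 F (𝓝 (as * η + P0)) := (ha.mul t0).add (tendsto_finsetSum _ fun j _ => (hc j).mul (t1.pow _))
  have tB1 : Tendsto B1 F (𝓝 (as * ζ + P1)) := (ha.mul t1).add (tendsto_finsetSum _ fun j _ => (hc j).mul (t0.pow _))
  have orb : ∀ᶠ x in F, (Z x 0 0 - η) / r x = S1 x * ((Z x 1 0 - ζ) / r x) + B0 x ∧ (Z x 1 0 - ζ) / r x = S0 x * ((Z x 0 0 - η) / r x) + B1 x := by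
    filter_upwards [hF0 h.ev, hr0] with x hx hrx
    obtain ⟨_, e2, e3, _⟩ := hx
    have p0 := e3 0 0
    have p1 := e3 1 0
    rw [mul_zero] at p0 p1
    have q0 := e2 0 0
    have q1 := e2 1 0
    simp only [Nat.reduceAdd, Nat.reduceMul] at p0 p1 q0 q1
    rw [p0] at q0 q1
    rw [p1] at q1
    simp only [henonPoly] at q0 q1
    have g1 : S1 x * (Z x 1 0 - ζ) = Z x 1 0 ^ d - η := geom_sum₂_mul _ _ _
    have g0 : S0 x * (Z x 0 0 - η) = Z x 0 0 ^ d - ζ := by rw [← hηd]; exact geom_sum₂_mul _ _ _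
    have b0 : B0 x = (x.1 * Z x 0 0 + ∑ j : Fin (d-1), x.2 j * Z x 1 0 ^ (j:ℕ)) / r x := by
      simp only [hB0, add_div, Finset.sum_div, div_mul_eq_mul_div]
    have b1 : B1 x = (x.1 * Z x 1 0 + ∑ j : Fin (d-1), x.2 j * Z x 0 0 ^ (j:ℕ)) / r x := by
      simp only [hB1, add_div, Finset.sum_div, div_mul_eq_mul_div]
    rw [b0, b1, ← mul_div_assoc, g1, ← mul_div_assoc, g0, ← add_div, ← add_div]
    constructor
    · congr 1; linear_combination q0
    · congr 1; linear_combination q1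
  obtain ⟨X, tX⟩ : ∃ X, Tendsto (fun x => (Z x 0 0 - η) / r x) F (𝓝 X) := by
    have hden : (1:ℂ) - d * (η / ζ) * (d * (ζ / η)) ≠ 0 := by
      rw [show (1:ℂ) - d * (η / ζ) * (d * (ζ / η)) = -((d:ℂ)^2 - 1) by field_simp; ring]
      exact neg_ne_zero.2 hdD
    have hde := (tendsto_const_nhds (x := (1:ℂ))).sub (tS1.mul tS0)
    refine ⟨_, (((tS1.mul tB1).add tB0).div hde hden).congr' ?_⟩
    filter_upwards [orb, hde.eventually_ne hden] with x h1 h2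
    simp only [Pi.div_apply]
    rw [div_eq_iff h2]
    linear_combination (-1:ℂ) * h1.1 - S1 x * h1.2
  obtain ⟨Y, tY⟩ : ∃ Y, Tendsto (fun x => (Z x 1 0 - ζ) / r x) F (𝓝 Y) :=
    ⟨_, ((tS0.mul tX).add tB1).congr' (orb.mono fun x hx => hx.2.symm)⟩
  have eX : X = d * (η / ζ) * Y + (as * η + P0) :=
    tendsto_nhds_unique tX (((tS1.mul tY).add tB0).congr' (orb.mono fun x hx => hx.1.symm))
  have eY : Y = d * (ζ / η) * X + (as * ζ + P1) :=
    tendsto_nhds_unique tY (((tS0.mul tX).add tB1).congr' (orb.mono fun x hx => hx.2.symm))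
  -- derivatives
  have tD : ∀ {z : ℂ × (Fin (d-1) → ℂ) → ℂ} {ζ Δ : ℂ}, Tendsto z F (𝓝 ζ) → Tendsto (fun x => (z x - ζ) / r x) F (𝓝 Δ) →
      Tendsto (fun x => (hpD d x.2 (z x) - d * ζ ^ (d-1)) / r x) F (𝓝 (d * (((d - 1 : ℕ):ℂ) * ζ ^ (d - 1 - 1) * Δ) + ∑ j : Fin (d-1), cs j * (((j:ℕ):ℂ) * ζ ^ ((j:ℕ)-1)))) := by
    intro z ζ Δ hz hΔ
    have := ((powT hz (d-1) hΔ).const_mul (d:ℂ)).add (tendsto_finsetSum Finset.univ fun (j : Fin (d-1)) _ => (hc j).mul ((hz.pow ((j:ℕ)-1)).const_mul ((j:ℕ):ℂ)))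
    refine this.congr fun x => ?_
    simp only [hpD, div_mul_eq_mul_div, ← Finset.sum_div]
    ring
  have d0 := tD t0 tX
  have d1 := tD t1 tY
  have tr : Tendsto r F (𝓝 0) := by
    have h1 : Tendsto (fun x : ℂ × (Fin (d-1) → ℂ) => x) F (𝓝 0) := hF0
    have h2 := (Complex.continuous_ofReal.tendsto _).comp h1.norm
    rw [norm_zero, Complex.ofReal_zero] at h2
    exact h2
  have tD0 : Tendsto (fun x => hpD d x.2 (Z x 0 0)) F (𝓝 (d * η ^ (d-1))) := by
    have := (d0.mul tr).add_const (d * η ^ (d-1))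
    rw [mul_zero, zero_add] at this
    refine this.congr' ?_
    filter_upwards [hr0] with x hx
    rw [div_mul_cancel₀ _ hx]; ring
  have tw : ∀ n, ∀ᶠ x in F, deriv (Z x n) 0 ≠ 0 := by
    intro n
    have hp : 0 < ‖deriv (Z (0, 0) n) 0‖ := norm_pos_iff.2 (h.der0 n)
    filter_upwards [hF0 (h.unifD n 0 hp)] with x hx h0
    have := hx 0 (by simp)
    rw [h0, zero_sub, norm_neg] at this
    exact lt_irrefl _ this
  have mult : ∀ᶠ x in F, (lam x - x.1)^2 = lam x * (hpD d x.2 (Z x 0 0) * hpD d x.2 (Z x 1 0)) := by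
    filter_upwards [hF0 h.ev, tw 0, tw 1] with x hx w0 w1
    obtain ⟨e1, e2, e3, _⟩ := hx
    have p0 := UF.derPerX e1 e3 0 1 0
    have p1 := UF.derPerX e1 e3 1 1 0
    have z2 := e3 0 0
    simp only [pow_one, mul_zero, mul_one, zero_add, one_mul, Nat.reduceAdd] at p0 p1 z2
    have dr : ∀ n, deriv (Z x (n+2)) 0 = x.1 * deriv (Z x n) 0 + hpD d x.2 (Z x (n+1) 0) * deriv (Z x (n+1)) 0 := by
      intro n
      rw [show Z x (n+2) = fun s => x.1 * Z x n s + henonPoly d x.2 (Z x (n+1) s) from funext (e2 n)]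
      exact (((e1 n 0).hasDerivAt.const_mul x.1).add ((henonPoly_hasDerivAt d x.2 _).comp 0 (e1 (n+1) 0).hasDerivAt)).deriv
    have q0 := dr 0
    have q1 := dr 1
    simp only [zero_add, Nat.reduceAdd] at q0 q1
    rw [p0] at q0 q1
    rw [p1, z2] at q1
    have hw := mul_ne_zero w0 w1
    apply mul_right_cancel₀ hw
    linear_combination (lam x - x.1) * deriv (Z x 0) 0 * q1 + lam x * hpD d x.2 (Z x 0 0) * deriv (Z x 0) 0 * q0
  set D0 := d * (((d - 1 : ℕ):ℂ) * η ^ (d - 1 - 1) * X) + ∑ j : Fin (d-1), cs j * (((j:ℕ):ℂ) * η ^ ((j:ℕ)-1)) with hD0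
  set D1 := d * (((d - 1 : ℕ):ℂ) * ζ ^ (d - 1 - 1) * Y) + ∑ j : Fin (d-1), cs j * (((j:ℕ):ℂ) * ζ ^ ((j:ℕ)-1)) with hD1
  have fin : (d:ℂ)^2 * 0 - 2 * d^2 * as + 0 * as = d^2 * (d * η ^ (d-1) * D1 + d * ζ ^ (d-1) * D0) := by
    refine tendsto_nhds_unique (((tl.mul tlr).sub ((tl.const_mul 2).mul ha)).add (ta.mul ha)) ((tl.mul ((tD0.mul d1).add (d0.const_mul (d * ζ ^ (d-1))))).congr' ?_)
    filter_upwards [mult, hr0] with x hx hrx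
    have e5 : (d * η ^ (d-1)) * (d * ζ ^ (d-1)) = (d:ℂ)^2 := by rw [eη, eζ]; field_simp
    simp only [hr] at hrx ⊢
    field_simp
    linear_combination (-1:ℂ) * hx - lam x * e5
  have fin2 : -2 * as = d * η ^ (d-1) * D1 + d * ζ ^ (d-1) * D0 := by
    apply mul_left_cancel₀ (pow_ne_zero 2 hdC); rw [← fin]; ring
  have eη2 : η ^ (d-1-1) = ζ / η^2 := by
    rw [eq_div_iff (pow_ne_zero 2 hη0), ← pow_add, show d - 1 - 1 + 2 = d by omega, hηd]
  have eζ2 : ζ ^ (d-1-1) = η / ζ^2 := by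
    rw [eq_div_iff (pow_ne_zero 2 hz), ← pow_add, show d - 1 - 1 + 2 = d by omega]
  set Q0 := ∑ j : Fin (d-1), cs j * (((j:ℕ):ℂ) * η ^ ((j:ℕ)-1)) with hQ0
  set Q1 := ∑ j : Fin (d-1), cs j * (((j:ℕ):ℂ) * ζ ^ ((j:ℕ)-1)) with hQ1
  have hjp : ∀ (j : ℕ) (w : ℂ), (j:ℂ) * w ^ (j-1) * w = j * w ^ j := by
    intro j w
    rcases j with _ | j
    · simp
    · rw [Nat.add_sub_cancel, mul_assoc, ← pow_succ]
  have hsum : ∑ j : Fin (d-1), ((d:ℂ)^2 - d * (j:ℕ)) * cs j * (ζ ^ ((j:ℕ)+1) + ζ ^ (d * ((j:ℕ)+1))) = ζ * (d^2 * P0 - d * Q1 * ζ) + η * (d^2 * P1 - d * Q0 * η) := by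
    simp only [hP0, hP1, hQ0, hQ1, Finset.mul_sum, Finset.sum_mul, ← Finset.sum_sub_distrib, ← Finset.sum_add_distrib]
    refine Finset.sum_congr rfl fun j _ => ?_
    rw [pow_mul, ← hη]
    linear_combination (-(d:ℂ)) * cs j * ζ * hjp j ζ * (-1) + (d:ℂ) * cs j * η * hjp j η
  rw [hsum]
  rw [hD0, hD1, eη2, eζ2, eη, eζ, Nat.cast_sub (by omega : 1 ≤ d), Nat.cast_one] at fin2
  have k1 : -2 * as * (ζ * η) = d^2 * (d-1) * (Y * η + X * ζ) + d * ζ^2 * Q1 + d * η^2 * Q0 := by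
    rw [fin2]; field_simp; ring
  have k2 : X * ζ = d * η * Y + (as * η + P0) * ζ := by
    conv_lhs => rw [eX]
    field_simp
  have k3 : Y * η = d * ζ * X + (as * ζ + P1) * η := by
    conv_lhs => rw [eY]
    field_simp
  rw [pow_succ ζ d, ← hη]
  linear_combination k1 - (d:ℂ)^2 * k2 - (d:ℂ)^2 * k3
end HenonML
end

namespace HenonML

theorem coeff_zero {d : ℕ} (hd : 2 ≤ d) {as : ℂ} {cs : Fin (d-1) → ℂ}
    (H : ∀ ζ : ℂ, ζ ^ (d^2 - 1) = 1 → 2 * as * (d^2 - 1) * ζ ^ (d+1) + ∑ j : Fin (d-1), (d^2 - d * (j:ℕ)) * cs j * (ζ ^ ((j:ℕ)+1) + ζ ^ (d * ((j:ℕ)+1))) = 0) :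
    as = 0 ∧ cs = 0 := by
  have hd2 : 4 ≤ d^2 := by nlinarith
  have hdC : (d:ℂ) ≠ 0 := by exact_mod_cast (by omega : d ≠ 0)
  have hcs : cs = 0 := by
    set e := if d = 2 then 0 else d + 1 with he
    have helt : e < d^2 - 1 := by
      rw [he]; split_ifs with h2
      · omega
      · have : 3 ≤ d := by omega
        have : 3 * d ≤ d^2 := by nlinarith
        omega
    have hepow : ∀ ζ : ℂ, ζ ^ (d^2 - 1) = 1 → ζ ^ e = ζ ^ (d+1) := by
      intro ζ hζ
      rw [he]; split_ifs with h2
      · subst h2; norm_num at hζ; rw [pow_zero]; exact hζ.symm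
      · rfl
    set P : Polynomial ℂ := Polynomial.C (2 * as * (d^2 - 1)) * Polynomial.X ^ e +
      ∑ j : Fin (d-1), Polynomial.C ((d^2 - d * (j:ℕ)) * cs j) * (Polynomial.X ^ ((j:ℕ)+1) + Polynomial.X ^ (d * ((j:ℕ)+1))) with hP
    have hdeg : P.natDegree < d^2 - 1 := by
      have hle : P.natDegree ≤ d^2 - 2 := by
        refine Polynomial.natDegree_add_le_of_degree_le ((Polynomial.natDegree_C_mul_X_pow_le _ _).trans (by omega)) ?_
        refine Polynomial.natDegree_sum_le_of_forall_le _ _ fun j _ => (Polynomial.natDegree_C_mul_le _ _).trans ?_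
        have hj := j.2
        have h1 : d * ((j:ℕ)+1) ≤ d^2 - 2 := by
          have : d * ((j:ℕ)+1) ≤ d * (d-1) := Nat.mul_le_mul_left _ (by omega)
          have h3 : d * (d-1) + d = d^2 := by
            obtain ⟨e, rfl⟩ : ∃ e, d = e + 1 := ⟨d-1, by omega⟩
            simp only [Nat.add_sub_cancel]; ring
          omega
        have h2 : (j:ℕ)+1 ≤ d * ((j:ℕ)+1) := Nat.le_mul_of_pos_left _ (by omega)
        refine Polynomial.natDegree_add_le_of_degree_le ?_ ?_ <;> rw [Polynomial.natDegree_X_pow]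
        · omega
        · exact h1
      omega
    have hP0 : P = 0 := by
      have hprim := Complex.isPrimitiveRoot_exp (d^2-1) (by omega)
      refine Polynomial.eq_zero_of_natDegree_lt_card_of_eval_eq_zero' P (Polynomial.nthRootsFinset (d^2-1) (1:ℂ)) ?_ (by rw [hprim.card_nthRootsFinset]; exact hdeg)
      intro ζ hζ
      rw [Polynomial.mem_nthRootsFinset (by omega)] at hζ
      rw [← H ζ hζ, hP]
      simp [Polynomial.eval_finset_sum, hepow ζ hζ]
    funext k
    have hk := k.2
    have hc := congrArg (fun Q => Polynomial.coeff Q ((k:ℕ)+1)) hP0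
    simp only [hP, Polynomial.coeff_add, Polynomial.finset_sum_coeff, Polynomial.coeff_C_mul, Polynomial.coeff_X_pow, Polynomial.coeff_zero] at hc
    have hke : (k:ℕ)+1 ≠ e := by
      rw [he]; split_ifs <;> omega
    rw [if_neg hke, mul_zero, zero_add, Finset.sum_eq_single k] at hc
    · have h2 : (k:ℕ)+1 ≠ d * ((k:ℕ)+1) := by nlinarith
      rw [if_pos rfl, if_neg h2, add_zero, mul_one] at hc
      refine (mul_eq_zero.1 hc).resolve_left ?_
      rw [show (d:ℂ)^2 - d * (k:ℕ) = d * (d - (k:ℕ)) by ring]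
      refine mul_ne_zero hdC (sub_ne_zero.2 ?_)
      exact_mod_cast (by omega : d ≠ k)
    · intro j _ hj
      have h1 : (k:ℕ)+1 ≠ (j:ℕ)+1 := fun h => hj (Fin.ext (by omega))
      have h2 : (k:ℕ)+1 ≠ d * ((j:ℕ)+1) := by
        have : d ≤ d * ((j:ℕ)+1) := Nat.le_mul_of_pos_right _ (by omega)
        omega
      rw [if_neg h1, if_neg h2]; ring
    · intro h; exact absurd (Finset.mem_univ _) h
  refine ⟨?_, hcs⟩
  have := H 1 (one_pow _)
  simp only [hcs, Pi.zero_apply, mul_zero, zero_mul, Finset.sum_const_zero, add_zero, one_pow, mul_one] at this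
  have hdD : (d:ℂ)^2 - 1 ≠ 0 := by
    rw [sub_ne_zero]; exact_mod_cast (by omega : d^2 ≠ 1)
  simpa using (mul_eq_zero.1 this).resolve_right hdD

theorem case_zero {d : ℕ} (hd : 2 ≤ d) : ¬ NeBot (FB d 0) := by
  intro hne
  set U := Ultrafilter.of (FB d 0) with hU
  have hF : (U : Filter _) ≤ FB d 0 := Ultrafilter.of_le _
  set g : ℂ × (Fin (d-1) → ℂ) → ℂ × (Fin (d-1) → ℂ) := fun x => ((‖x‖ : ℂ)⁻¹) • x with hg
  have hgs : ∀ᶠ x in (U : Filter _), g x ∈ Metric.sphere (0 : ℂ × (Fin (d-1) → ℂ)) 1 := by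
    filter_upwards [hF FB_ne] with x hx
    have hx0 : x ≠ 0 := fun h => hx (by rw [h]; rfl)
    rw [mem_sphere_zero_iff_norm, hg]
    simp only [norm_smul, norm_inv, Complex.norm_real, norm_norm]
    exact inv_mul_cancel₀ (norm_ne_zero_iff.2 hx0)
  obtain ⟨y, hy, hyl⟩ := (isCompact_sphere (0 : ℂ × (Fin (d-1) → ℂ)) 1).ultrafilter_le_nhds (U.map g) (by
    rw [Ultrafilter.coe_map, le_principal_iff]; exact hgs)
  have ht : Tendsto g U (𝓝 y) := hyl
  have ha := (continuous_fst.tendsto y).comp ht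
  have hc := fun j => ((continuous_apply j).tendsto y.2).comp ((continuous_snd.tendsto y).comp ht)
  obtain ⟨h1, h2⟩ := coeff_zero hd (as := y.1) (cs := y.2) (fun ζ hζ => lin_id hd hF
    (ha.congr fun x => by simp [hg, div_eq_inv_mul]) (fun j => (hc j).congr fun x => by simp [hg, div_eq_inv_mul]) hζ)
  have : y = 0 := Prod.ext h1 h2
  rw [this] at hy
  simp at hy

theorem main_ev {d : ℕ} (hd : 2 ≤ d) (c0 : Fin (d-1) → ℂ) : ∀ᶠ x in 𝓝 ((0:ℂ), c0), x.1 ≠ 0 → ¬ Bad d x.1 x.2 := by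
  have h : FB d c0 = ⊥ := by
    rw [← not_neBot]
    by_cases hc : c0 = 0
    · subst hc; exact case_zero hd
    · exact case_ne hd hc
  rw [FB, ← disjoint_iff, disjoint_principal_right] at h
  filter_upwards [h] with x hx h1 h2
  exact hx ⟨h1, h2⟩
end HenonML

/-- near the degenerate locus `{a = 0}` of the extended Hénon parameter
space, the stable and unstable multipliers of the saddle periodic points of `f_{a,c}`
are not contained in any fixed number field. -/
theorem henon_small_jacobian_multipliers_not_in_number_field
    (d : ℕ) (hd : 2 ≤ d) :
    ∃ U : Set (ℂ × (Fin (d - 1) → ℂ)), IsOpen U ∧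
      (∀ c : Fin (d - 1) → ℂ, ((0 : ℂ), c) ∈ U) ∧
      ∀ (a : ℂ) (c : Fin (d - 1) → ℂ), (a, c) ∈ U → a ≠ 0 →
        ∀ L : Subfield ℂ, FiniteDimensional ℚ L →
          (∃ (p : ℂ × ℂ) (n : ℕ) (ls lu : ℂ),
            IsSaddle (henonMap d a c) p n ls lu ∧ lu ∉ L) ∧
          (∃ (p : ℂ × ℂ) (n : ℕ) (ls lu : ℂ),
            IsSaddle (henonMap d a c) p n ls lu ∧ ls ∉ L) := by
  refine ⟨interior {x | x.1 ≠ 0 → ¬ HenonML.Bad d x.1 x.2}, isOpen_interior, fun c => mem_interior_iff_mem_nhds.2 (HenonML.main_ev hd c), ?_⟩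
  intro a c hac ha L hL
  have hb := interior_subset hac ha
  constructor
  · by_contra hcon
    push Not at hcon
    exact hb ⟨L, hL, Or.inl fun p n ls lu h => hcon p n ls lu h⟩
  · by_contra hcon
    push Not at hcon
    exact hb ⟨L, hL, Or.inr fun p n ls lu h => hcon p n ls lu h⟩
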